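/- For every ε > 0 there is a constant C_ε such that for every positive integer n, the number of isomorphism classes of cubic fields K with |Disc(K)| = n is at most C_ε·n^{1/3+ε}. -/

import Mathlib

/-- A cubic field: a number field of degree 3 over `ℚ`. -/
structure CubicField where
  carrier : Type
  [field : Field carrier]
  [nf : NumberField carrier]
  deg : Module.finrank ℚ carrier = 3

attribute [instance] CubicField.field CubicField.nf

/-- Two cubic fields are identified if they are isomorphic. -/
instance CubicField.setoid : Setoid CubicField where
  r A B := Nonempty (A.carrier ≃+* B.carrier)
  iseqv := ⟨fun _ => ⟨RingEquiv.refl _⟩, fun ⟨e⟩ => ⟨e.symm⟩, fun ⟨e⟩ ⟨f⟩ => ⟨e.trans f⟩⟩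

/-- The number of isomorphism classes of cubic fields whose discriminant satisfies `P`. -/
noncomputable def countCubic (P : ℤ → Prop) : ℕ :=
  Nat.card {C : Quotient CubicField.setoid //
    ∃ K : CubicField, ⟦K⟧ = C ∧ P (NumberField.discr K.carrier)}

/-- The ring of Eisenstein integers `ℤ[ω]`, with `ω² + ω + 1 = 0`. -/
abbrev Eis := QuadraticAlgebra ℤ (-1) (-1)

namespace CubicSymbol

section Log

variable {R : Type*} [CommRing R] {w x y : R}

open Classical in
/-- The logarithm of a cube root of unity to the base `w`, as an element of `ℤ/3`. -/
noncomputable def lg (w x : R) : ZMod 3 := if x = 1 then 0 else if x = w then 1 else 2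

lemma lg_one (w : R) : lg w 1 = 0 := if_pos rfl

lemma lg_eq_zero : lg w x = 0 ↔ x = 1 := by
  refine ⟨fun h => ?_, fun h => h ▸ lg_one w⟩
  by_contra hx
  rw [lg, if_neg hx] at h
  split_ifs at h
  · exact absurd h (by decide)
  · exact absurd h (by decide)

lemma eq_of_cube_eq_one [IsDomain R] (hw : w * w + w + 1 = 0) (hx : x ^ 3 = 1) :
    x = 1 ∨ x = w ∨ x = w * w := by
  have h : (x - 1) * ((x - w) * (x - w * w)) = 0 := by
    linear_combination hx + (-x ^ 2 + (1 : R) * x + x * (w - 1) + 1 - w + 0 * x ^ 3) * hw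
  simpa [sub_eq_zero] using h

lemma lg_mul [IsDomain R] (hw : w * w + w + 1 = 0) (hw1 : w ≠ 1) (hx : x ^ 3 = 1) (hy : y ^ 3 = 1) :
    lg w (x * y) = lg w x + lg w y := by
  have h3 : w * (w * w) = 1 := by linear_combination (w - 1) * hw
  have hww1 : w * w ≠ 1 := fun h => hw1 (by linear_combination h3 - w * h)
  have hwww : w * w ≠ w := fun h => hw1 (by linear_combination h3 - (w + 1) * h)
  have e4 : w * w * (w * w) = w := by linear_combination w * h3
  have e0 : lg w 1 = 0 := lg_one w
  have e1 : lg w w = 1 := by rw [lg, if_neg hw1, if_pos rfl]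
  have e2 : lg w (w * w) = 2 := by rw [lg, if_neg hww1, if_neg hwww]
  have h3' : w * w * w = 1 := by rw [mul_assoc]; exact h3
  rcases eq_of_cube_eq_one hw hx with rfl | rfl | rfl <;>
  rcases eq_of_cube_eq_one hw hy with h | h | h <;> subst h <;>
  simp only [one_mul, mul_one, e0, e1, e2, h3, h3', e4] <;> decide

lemma lg_pow_two [IsDomain R] (hw : w * w + w + 1 = 0) (hw1 : w ≠ 1) (hx : x ^ 3 = 1) :
    lg w (x ^ 2) = 2 * lg w x := by
  rw [pow_two, lg_mul hw hw1 hx hx, two_mul]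

lemma lg_map [IsDomain R] {S : Type*} [CommRing S] (f : R →+* S) (hw : w * w + w + 1 = 0)
    (hw1 : f w ≠ 1) (hx : x ^ 3 = 1) : lg (f w) (f x) = lg w x := by
  have h3 : w * (w * w) = 1 := by linear_combination (w - 1) * hw
  have hw1' : w ≠ 1 := fun h => hw1 (by rw [h, map_one])
  have hww1 : f (w * w) ≠ 1 := fun h => hw1 (by
    have := congrArg f h3
    rw [map_mul, h, map_one, mul_one] at this; exact this)
  have hwww : f (w * w) ≠ f w := fun h => by
    have h4 := congrArg f h3
    rw [map_mul, h, ← map_mul, map_one] at h4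
    exact hww1 h4
  have hww1' : w * w ≠ 1 := fun h => hww1 (by rw [h, map_one])
  have hwww' : w * w ≠ w := fun h => hwww (by rw [h])
  rcases eq_of_cube_eq_one hw hx with rfl | rfl | rfl
  · rw [map_one, lg_one, lg_one]
  · rw [lg, lg, if_neg hw1, if_neg hw1', if_pos rfl, if_pos rfl]
  · rw [lg, lg, if_neg hww1, if_neg hwww, if_neg hww1', if_neg hwww']

end Log

section Symbol

variable (p : ℕ) [Fact p.Prime]

lemma exists_omega : ∃ w : AlgebraicClosure (ZMod p), w * w + w + 1 = 0 := by
  obtain ⟨w, hw⟩ := IsAlgClosed.exists_root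
    (Polynomial.C (1 : AlgebraicClosure (ZMod p)) * Polynomial.X ^ 2 +
      Polynomial.C 1 * Polynomial.X + Polynomial.C 1)
    (by rw [Polynomial.degree_quadratic one_ne_zero]; decide)
  refine ⟨w, ?_⟩
  simpa [Polynomial.IsRoot, pow_two] using hw

/-- A root of `x² + x + 1` in an algebraic closure of `𝔽_p`. -/
noncomputable def om : AlgebraicClosure (ZMod p) := (exists_omega p).choose

lemma om_spec : om p * om p + om p + 1 = 0 := (exists_omega p).choose_spec

/-- The reduction map from `ℤ[ω]` to an algebraic closure of `𝔽_p`. -/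
noncomputable def ev : Eis →+* AlgebraicClosure (ZMod p) :=
  (QuadraticAlgebra.lift (R := ℤ) (a := -1) (b := -1) ⟨om p, by
    have := om_spec p
    simp only [neg_smul, one_smul]
    linear_combination this⟩).toRingHom

lemma ev_apply (z : Eis) : ev p z = z.re + z.im * om p := by
  simp [ev, QuadraticAlgebra.lift, Algebra.smul_def]

lemma ev_star (z : Eis) : ev p (star z) = z.re + z.im * om p ^ 2 := by
  rw [ev_apply]
  simp only [QuadraticAlgebra.re_star, QuadraticAlgebra.im_star]
  push_cast
  linear_combination (-z.im : AlgebraicClosure (ZMod p)) * om_spec p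

variable {p}

lemma om_ne_one (hp : p ≠ 3) : om p ≠ 1 := fun h => by
  have := om_spec p
  rw [h] at this
  have h3 : ((3 : ℕ) : AlgebraicClosure (ZMod p)) = 0 := by push_cast; linear_combination this
  rw [CharP.cast_eq_zero_iff _ p] at h3
  exact hp ((Nat.prime_dvd_prime_iff_eq Fact.out Nat.prime_three).mp h3)

lemma om_cube : om p ^ 3 = 1 := by linear_combination (om p - 1) * om_spec p

lemma sq_mod_three (hp : p ≠ 3) : p ^ 2 % 3 = 1 := by
  have h : ¬ 3 ∣ p := fun h => hp ((Nat.prime_dvd_prime_iff_eq Nat.prime_three Fact.out).mp h).symm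
  have : p % 3 = 1 ∨ p % 3 = 2 := by omega
  rcases this with h | h <;> simp [Nat.pow_mod, h]

lemma ev_frob (hp : p ≠ 3) (z : Eis) : ev p z ^ p ^ 2 = ev p z := by
  have h := iterateFrobenius_def p 2 (ev p z)
  rw [← h, ev_apply, map_add, map_mul, map_intCast, map_intCast, iterateFrobenius_def]
  have : p ^ 2 = 3 * (p ^ 2 / 3) + 1 := by have := sq_mod_three hp; omega
  rw [this, pow_succ, pow_mul, om_cube, one_pow, one_mul]

lemma ev_norm (z : Eis) : ev p z * ev p (star z) = (z.norm : ℤ) := by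
  rw [← map_mul, ← QuadraticAlgebra.algebraMap_norm_eq_mul_star]
  simp

lemma ev_ne_zero {z : Eis} (hz : ¬ (p : ℤ) ∣ z.norm) : ev p z ≠ 0 := fun h => by
  have := ev_norm (p := p) z
  rw [h, zero_mul, eq_comm, CharP.intCast_eq_zero_iff _ p] at this
  exact hz this

lemma ev_star_ne_zero {z : Eis} (hz : ¬ (p : ℤ) ∣ z.norm) : ev p (star z) ≠ 0 :=
  ev_ne_zero (by rwa [QuadraticAlgebra.norm_star])

variable (p) in
/-- The cubic residue of `z / z̄` at `p`. -/
noncomputable def res (z : Eis) : AlgebraicClosure (ZMod p) :=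
  (ev p z / ev p (star z)) ^ ((p ^ 2 - 1) / 3)

lemma exp_mul_three (hp : p ≠ 3) : (p ^ 2 - 1) / 3 * 3 = p ^ 2 - 1 := by
  have := sq_mod_three hp; omega

lemma res_cube (hp : p ≠ 3) {z : Eis} (hz : ¬ (p : ℤ) ∣ z.norm) : res p z ^ 3 = 1 := by
  rw [res, ← pow_mul, exp_mul_three hp, div_pow]
  have h (z : Eis) (h0 : ev p z ≠ 0) : ev p z ^ (p ^ 2 - 1) = 1 := by
    have h1 : 0 < p ^ 2 := pow_pos (Fact.out : p.Prime).pos 2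
    apply mul_right_cancel₀ h0
    rw [← pow_succ, Nat.sub_add_cancel h1, ev_frob hp, one_mul]
  rw [h z (ev_ne_zero hz), h _ (ev_star_ne_zero hz), div_one]

lemma res_mul (z v : Eis) : res p (z * v) = res p z * res p v := by
  rw [res, res, res, star_mul', map_mul, map_mul, mul_div_mul_comm, mul_pow]

lemma res_star (z : Eis) : res p (star z) = (res p z)⁻¹ := by
  rw [res, res, star_star, ← inv_pow, inv_div]

end Symbol

open Classical in
/-- The cubic symbol of `z / z̄` at a prime `p`, with values in `ℤ/3` (zero if `p` is not prime). -/
noncomputable def sym (p : ℕ) (z : Eis) : ZMod 3 :=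
  if h : p.Prime then haveI := Fact.mk h; lg (om p) (res p z) else 0

section

variable {p : ℕ}

lemma sym_def [hp : Fact p.Prime] (z : Eis) : sym p z = lg (om p) (res p z) := by
  rw [sym, dif_pos hp.out]

lemma sym_mul [hp : Fact p.Prime] (hp3 : p ≠ 3) {z v : Eis} (hz : ¬ (p : ℤ) ∣ z.norm)
    (hv : ¬ (p : ℤ) ∣ v.norm) : sym p (z * v) = sym p z + sym p v := by
  rw [sym_def, sym_def, sym_def, res_mul,
    lg_mul (om_spec p) (om_ne_one hp3) (res_cube hp3 hz) (res_cube hp3 hv)]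

lemma sym_star [hp : Fact p.Prime] (hp3 : p ≠ 3) {z : Eis} (hz : ¬ (p : ℤ) ∣ z.norm) :
    sym p (star z) = - sym p z := by
  have h1 : res p (star z * z) = 1 := by
    rw [res_mul, res_star, inv_mul_cancel₀]
    intro h
    have := res_cube hp3 hz
    rw [h] at this
    simp at this
  have h2 := sym_mul hp3 (z := star z) (v := z) (by rwa [QuadraticAlgebra.norm_star]) hz
  rw [sym_def (star z * z), h1, lg_one] at h2
  exact eq_neg_of_add_eq_zero_left h2.symm

lemma sym_congr [hp : Fact p.Prime] {z v : Eis} (h1 : (p : ℤ) ∣ z.re - v.re)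
    (h2 : (p : ℤ) ∣ z.im - v.im) : sym p z = sym p v := by
  rw [← CharP.intCast_eq_zero_iff (AlgebraicClosure (ZMod p)) p] at h1 h2
  push_cast at h1 h2
  rw [sub_eq_zero] at h1 h2
  rw [sym_def, sym_def, res, res, ev_apply, ev_star, ev_apply, ev_star, h1, h2]

lemma sym_intCast_mul [hp : Fact p.Prime] {n : ℤ} (hn : ¬ (p : ℤ) ∣ n) (z : Eis) :
    sym p (n * z) = sym p z := by
  have h0 : ((n : ℤ) : AlgebraicClosure (ZMod p)) ≠ 0 := by
    rwa [Ne, CharP.intCast_eq_zero_iff _ p]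
  have h1 : ev p (star (n : Eis)) = n := by
    rw [ev_star]; simp
  rw [sym_def, sym_def, res, res, star_mul', map_mul, map_mul, map_intCast, h1,
    mul_div_mul_left _ _ h0]

lemma sym_of_im [hp : Fact p.Prime] {z : Eis} (hz : ¬ (p : ℤ) ∣ z.norm)
    (h : (p : ℤ) ∣ z.im) : sym p z = 0 := by
  have e : ev p z = ev p (star z) := by
    rw [← CharP.intCast_eq_zero_iff (AlgebraicClosure (ZMod p)) p] at h
    rw [ev_apply, ev_star, h, zero_mul, zero_mul]
  rw [sym_def, res, ← e, div_self (ev_ne_zero hz), one_pow, lg_one]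

end

end CubicSymbol

namespace Eis

@[simp] lemma re_one : (1 : Eis).re = 1 := rfl

@[simp] lemma im_one : (1 : Eis).im = 0 := rfl

@[simp] lemma re_three : (3 : Eis).re = 3 := rfl

@[simp] lemma im_three : (3 : Eis).im = 0 := rfl

lemma norm_eq (z : Eis) : z.norm = z.re ^ 2 - z.re * z.im + z.im ^ 2 := by
  rw [QuadraticAlgebra.norm_def]; ring

lemma four_norm (z : Eis) : 4 * z.norm = (2 * z.re - z.im) ^ 2 + 3 * z.im ^ 2 := by
  rw [norm_eq]; ring

lemma norm_nonneg (z : Eis) : 0 ≤ z.norm := by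
  have := four_norm z; nlinarith [sq_nonneg (2 * z.re - z.im), sq_nonneg z.im]

lemma norm_eq_zero {z : Eis} : z.norm = 0 ↔ z = 0 := by
  refine ⟨fun h => ?_, fun h => by rw [h, QuadraticAlgebra.norm_zero]⟩
  have h4 := four_norm z
  rw [h] at h4
  have h1 : z.im = 0 := by nlinarith [sq_nonneg (2 * z.re - z.im), sq_nonneg z.im]
  have h2 : z.re = 0 := by rw [h1] at h4; nlinarith [sq_nonneg z.re]
  ext <;> simp [h1, h2]

instance : NoZeroDivisors Eis where
  eq_zero_or_eq_zero_of_mul_eq_zero {a b} h := by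
    have := congrArg QuadraticAlgebra.norm h
    rw [map_mul, QuadraticAlgebra.norm_zero, mul_eq_zero, norm_eq_zero, norm_eq_zero] at this
    exact this

instance : Nontrivial Eis := ⟨0, 1, fun h => by simpa using congrArg QuadraticAlgebra.re h⟩

instance : IsDomain Eis := NoZeroDivisors.to_isDomain _

/-- The primitive cube root of unity `ω`. -/
def w : Eis := ⟨0, 1⟩

lemma w_spec : w * w + w + 1 = 0 := by
  ext <;> simp [w]

lemma w_ne_one : w ≠ 1 := fun h => by simpa [w] using congrArg QuadraticAlgebra.im h

lemma w_primitive : IsPrimitiveRoot w 3 := by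
  rw [IsPrimitiveRoot.iff_orderOf]
  apply orderOf_eq_prime _ w_ne_one
  linear_combination (w - 1) * w_spec

lemma cube_mul_star {x : Eis} (hx : x ^ 3 = 1) : x * star x = 1 := by
  have h : x.norm ^ 3 = 1 := by rw [← map_pow, hx, map_one]
  have h1 : x.norm = 1 := by
    have := norm_nonneg x
    exact (pow_eq_one_iff_of_nonneg this (by norm_num)).mp h
  rw [← QuadraticAlgebra.algebraMap_norm_eq_mul_star, h1, map_one]

end Eis

namespace CubicSymbol

lemma ev_w (p : ℕ) [Fact p.Prime] : ev p Eis.w = om p := by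
  rw [ev_apply]; simp [Eis.w]

section Gauss

variable {p q : ℕ} [Fact p.Prime] [Fact q.Prime]

lemma gaussSum_frob_two {χ : MulChar (ZMod q) (AlgebraicClosure (ZMod p))}
    (hχ : χ ^ 3 = 1) (hpq : p ≠ q) (hp : p ≠ 3) (ψ : AddChar (ZMod q) (AlgebraicClosure (ZMod p))) :
    gaussSum χ ψ ^ p ^ 2 = χ p * gaussSum χ ψ := by
  have hcop : Nat.Coprime p q := (Nat.coprime_primes Fact.out Fact.out).mpr hpq
  rw [pow_two, pow_mul, gaussSum_frob, gaussSum_frob, ← pow_mul, ← pow_mul]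
  have e : p * p = 3 * (p ^ 2 / 3) + 1 := by have := sq_mod_three hp; rw [← pow_two]; omega
  have h1 : χ ^ (p * p) = χ := by rw [e, pow_succ, pow_mul, hχ, one_pow, one_mul]
  have h2 : ψ ^ (p * p) = ψ.mulShift ((ZMod.unitOfCoprime p hcop) ^ 2 : (ZMod q)ˣ) := by
    rw [AddChar.pow_mulShift]; simp [pow_two]
  have h3 : (χ⁻¹) ^ 2 = χ := by
    rw [inv_pow, inv_eq_iff_mul_eq_one, ← pow_succ, hχ]
  rw [h1, h2, gaussSum_mulShift_eq]
  congr 1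
  rw [Units.val_pow_eq_pow_val, map_pow, ZMod.coe_unitOfCoprime,
    ← MulChar.pow_apply' _ two_ne_zero, h3]

lemma jacobi_res {χ : MulChar (ZMod q) (AlgebraicClosure (ZMod p))}
    (hχ : χ ^ 3 = 1) (hχ1 : χ ≠ 1) (hpq : p ≠ q) (hp : p ≠ 3) :
    (jacobiSum χ χ / jacobiSum χ⁻¹ χ⁻¹) ^ ((p ^ 2 - 1) / 3) = χ p ^ 2 := by
  have hq0 : ((q : ℕ) : AlgebraicClosure (ZMod p)) ≠ 0 := by
    rw [Ne, CharP.cast_eq_zero_iff _ p]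
    exact fun h => hpq ((Nat.prime_dvd_prime_iff_eq Fact.out Fact.out).mp h)
  have : NeZero ((q : ℕ) : AlgebraicClosure (ZMod p)) := ⟨hq0⟩
  obtain ⟨ζ, hζ⟩ := HasEnoughRootsOfUnity.exists_primitiveRoot (AlgebraicClosure (ZMod p)) q
  obtain ⟨ψ, hψ⟩ : ∃ ψ : AddChar (ZMod q) (AlgebraicClosure (ZMod p)), ψ.IsPrimitive :=
    ⟨_, AddChar.zmodChar_primitive_of_primitive_root q hζ⟩
  have hcard : ((Fintype.card (ZMod q) : ℕ) : AlgebraicClosure (ZMod p)) ≠ 0 := by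
    rwa [ZMod.card]
  have hinv1 : χ⁻¹ ≠ 1 := inv_ne_one.mpr hχ1
  have hsq : χ * χ = χ⁻¹ := by rw [eq_inv_iff_mul_eq_one, ← pow_two, ← pow_succ, hχ]
  have hsq' : χ⁻¹ * χ⁻¹ = χ := by rw [← mul_inv, hsq, inv_inv]
  have hg := gaussSum_ne_zero_of_nontrivial hcard hχ1 hψ
  have hg' := gaussSum_ne_zero_of_nontrivial hcard hinv1 hψ
  have j1 := jacobiSum_mul_nontrivial (χ := χ) (φ := χ) (by rwa [hsq]) ψ
  have j2 := jacobiSum_mul_nontrivial (χ := χ⁻¹) (φ := χ⁻¹) (by rwa [hsq']) ψ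
  rw [hsq] at j1
  rw [hsq'] at j2
  set g := gaussSum χ ψ
  set g' := gaussSum χ⁻¹ ψ
  have e1 : jacobiSum χ χ = g * g / g' := by rw [← j1]; field_simp
  have e2 : jacobiSum χ⁻¹ χ⁻¹ = g' * g' / g := by rw [← j2]; field_simp
  have e3 : jacobiSum χ χ / jacobiSum χ⁻¹ χ⁻¹ = (g / g') ^ 3 := by
    rw [e1, e2]; field_simp
  have f1 : g ^ p ^ 2 = χ p * g := gaussSum_frob_two hχ hpq hp ψ
  have f2 : g' ^ p ^ 2 = χ⁻¹ p * g' :=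
    gaussSum_frob_two (by rw [inv_pow, hχ, inv_one]) hpq hp ψ
  have hu : χ p * χ⁻¹ p = 1 := by
    have hpu : IsUnit ((p : ℕ) : ZMod q) := by
      rw [ZMod.isUnit_iff_coprime]; exact (Nat.coprime_primes Fact.out Fact.out).mpr hpq
    rw [← MulChar.mul_apply, mul_inv_cancel, MulChar.one_apply hpu]
  have hp0 : 0 < p ^ 2 := pow_pos (Fact.out : p.Prime).pos 2
  rw [e3, ← pow_mul, mul_comm 3, exp_mul_three hp]
  have hgg : g / g' ≠ 0 := div_ne_zero hg hg'
  apply mul_right_cancel₀ hgg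
  rw [← pow_succ, Nat.sub_add_cancel hp0, div_pow, f1, f2]
  have hne : χ⁻¹ p ≠ 0 := right_ne_zero_of_mul_eq_one hu
  field_simp
  linear_combination (-(χ p : AlgebraicClosure (ZMod p))) * hu

end Gauss

/-- For a prime `q ≡ 1 mod 3` there is a primary element of norm `q` in `ℤ[ω]` whose cubic
symbol is given by a Dirichlet character modulo `q`. -/
lemma exists_jacobi {q : ℕ} [hq : Fact q.Prime] (hq1 : q % 3 = 1) :
    ∃ (χ : MulChar (ZMod q) Eis) (J : Eis), χ ^ 3 = 1 ∧ J.norm = q ∧ (3 : ℤ) ∣ J.im ∧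
      (3 : ℤ) ∣ J.re + 1 ∧
      ∀ p : ℕ, p.Prime → p ≠ 3 → p ≠ q → sym p J = 2 * lg Eis.w (χ p) := by
  obtain ⟨χ, hχ⟩ := MulChar.exists_mulChar_orderOf (ZMod q) (n := 3) (R := Eis)
    (by rw [ZMod.card]; omega) Eis.w_primitive
  have h3 : χ ^ 3 = 1 := by rw [← hχ]; exact pow_orderOf_eq_one χ
  have h1 : χ ≠ 1 := fun h => by rw [h, orderOf_one] at hχ; omega
  have hsq : χ * χ = χ⁻¹ := by rw [eq_inv_iff_mul_eq_one, ← pow_two, ← pow_succ, h3]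
  have hval (u : (ZMod q)ˣ) : χ u ^ 3 = 1 := by
    rw [← MulChar.pow_apply_coe, h3, MulChar.one_apply_coe]
  have hstar : χ.ringHomComp (starRingEnd Eis) = χ⁻¹ := by
    ext u : 1
    rw [MulChar.ringHomComp_apply, starRingEnd_apply]
    have e1 : χ u * star (χ u) = 1 := Eis.cube_mul_star (hval u)
    have e2 : χ u * χ⁻¹ u = 1 := by rw [← MulChar.mul_apply, mul_inv_cancel, MulChar.one_apply_coe]
    exact mul_left_cancel₀ (left_ne_zero_of_mul_eq_one e1) (e1.trans e2.symm)
  have hJstar : star (jacobiSum χ χ) = jacobiSum χ⁻¹ χ⁻¹ := by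
    rw [← hstar, jacobiSum_ringHomComp, starRingEnd_apply]
  refine ⟨χ, jacobiSum χ χ, h3, ?_, ?_⟩
  · have hinj : Function.Injective (algebraMap Eis (FractionRing Eis)) :=
      IsFractionRing.injective _ _
    have : CharZero (FractionRing Eis) := charZero_of_injective_algebraMap hinj
    have h1' := (MulChar.ringHomComp_ne_one_iff hinj).mpr h1
    have key := jacobiSum_mul_jacobiSum_inv (F := ZMod q) (F' := FractionRing Eis)
      (by rw [ringChar.eq_zero, ZMod.ringChar_zmod_n]; exact hq.out.ne_zero.symm)
      h1' h1' (by rw [← MulChar.ringHomComp_mul, MulChar.ringHomComp_ne_one_iff hinj, hsq]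
                  exact inv_ne_one.mpr h1)
    rw [MulChar.ringHomComp_inv, jacobiSum_ringHomComp, jacobiSum_ringHomComp, ← map_mul,
      ZMod.card, ← hJstar, ← QuadraticAlgebra.algebraMap_norm_eq_mul_star,
      ← map_natCast (algebraMap Eis (FractionRing Eis))] at key
    have := congrArg QuadraticAlgebra.re (hinj key)
    simpa using this
  · obtain ⟨z, -, hz⟩ := exists_jacobiSum_eq_neg_one_add (n := 3) (by norm_num) h3 h3
      (by rw [ZMod.card]; omega) Eis.w_primitive
    have hz' : jacobiSum χ χ = -1 + 3 * (-z * Eis.w) := by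
      rw [hz]; linear_combination z * Eis.w_spec
    refine ⟨?_, ?_, ?_⟩
    · rw [hz']; refine ⟨(-z * Eis.w).im, ?_⟩; simp; ring
    · rw [hz']; refine ⟨(-z * Eis.w).re, ?_⟩; simp; ring
    · intro p hp hp3 hpq
      have := Fact.mk hp
      have hpu : IsUnit ((p : ℕ) : ZMod q) := by
        rw [ZMod.isUnit_iff_coprime]; exact (Nat.coprime_primes hp hq.out).mpr hpq
      have hv : χ p ^ 3 = 1 := by obtain ⟨u, hu⟩ := hpu; rw [← hu]; exact hval u
      have hw1 : ev p Eis.w ≠ 1 := by rw [ev_w]; exact om_ne_one hp3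
      have hnt : χ.ringHomComp (ev p) ≠ 1 := by
        intro h
        apply h1
        ext u : 1
        have e := DFunLike.congr_fun h (u : ZMod q)
        simp only [MulChar.ringHomComp_apply, MulChar.one_apply_coe] at e
        have e2 := lg_map (ev p) Eis.w_spec hw1 (hval u)
        rw [e, lg_one, eq_comm, lg_eq_zero] at e2
        rw [e2, MulChar.one_apply_coe]
      have key := jacobi_res (p := p) (χ := χ.ringHomComp (ev p))
        (by rw [MulChar.ringHomComp_pow, h3, MulChar.ringHomComp_one]) hnt hpq hp3
      rw [MulChar.ringHomComp_inv, jacobiSum_ringHomComp, jacobiSum_ringHomComp, ← hJstar,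
        MulChar.ringHomComp_apply, ← map_pow] at key
      rw [sym_def, res, key, ← ev_w, lg_map (ev p) Eis.w_spec hw1
        (by rw [← pow_mul, mul_comm, pow_mul, hv, one_pow]),
        lg_pow_two Eis.w_spec Eis.w_ne_one hv]

end CubicSymbol

namespace Eis

/-- An Eisenstein integer is primary if it is congruent to `±1` modulo `3`. -/
def Primary (z : Eis) : Prop := (3 : ℤ) ∣ z.im ∧ ¬ (3 : ℤ) ∣ z.re

lemma eq_mul_of_dvd {q : ℕ} (hq : q.Prime) {J z : Eis} (hJ : J.norm = q)
    (hz : (q : ℤ) ∣ z.norm) (h : (q : ℤ) ∣ (z * star J).im) : ∃ v, z = J * v := by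
  have hqi : Prime (q : ℤ) := Nat.prime_iff_prime_int.mp hq
  have h1 : (q : ℤ) ∣ (z * star J).norm := by rw [map_mul]; exact hz.mul_right _
  have h2 : (q : ℤ) ∣ (z * star J).re := by
    rw [norm_eq] at h1
    apply hqi.dvd_of_dvd_pow (n := 2)
    have : (z * star J).re ^ 2 = ((z * star J).re ^ 2 - (z * star J).re * (z * star J).im +
      (z * star J).im ^ 2) + (z * star J).im * ((z * star J).re - (z * star J).im) := by ring
    rw [this]
    exact dvd_add h1 (h.mul_right _)
  obtain ⟨r, hr⟩ := h2
  obtain ⟨s, hs⟩ := h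
  have h3 : z * star J = (q : Eis) * ⟨r, s⟩ := by
    ext
    · rw [hr]; simp
    · rw [hs]; simp
  have h4 : J * star J = (q : Eis) := by
    rw [← QuadraticAlgebra.algebraMap_norm_eq_mul_star, hJ]; simp
  have hq0 : (q : Eis) ≠ 0 := Nat.cast_ne_zero.mpr hq.ne_zero
  refine ⟨⟨r, s⟩, mul_left_cancel₀ hq0 ?_⟩
  linear_combination (-z) * h4 + J * h3

lemma exists_factor {q : ℕ} (hq : q.Prime) {J z : Eis} (hJ : J.norm = q)
    (hz : (q : ℤ) ∣ z.norm) : ∃ v, z = J * v ∨ z = star J * v := by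
  have hqi : Prime (q : ℤ) := Nat.prime_iff_prime_int.mp hq
  have key : (q : ℤ) ∣ (z * star J).im * (z * J).im := by
    have : (z * star J).im * (z * J).im = J.norm * z.im ^ 2 - z.norm * J.im ^ 2 := by
      simp only [QuadraticAlgebra.im_mul, QuadraticAlgebra.re_star, QuadraticAlgebra.im_star,
        norm_eq]
      ring
    rw [this, hJ]
    exact dvd_sub (dvd_mul_right _ _) (hz.mul_right _)
  rcases hqi.dvd_or_dvd key with h | h
  · obtain ⟨v, hv⟩ := eq_mul_of_dvd hq hJ hz h
    exact ⟨v, Or.inl hv⟩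
  · obtain ⟨v, hv⟩ := eq_mul_of_dvd hq (J := star J) (by rwa [QuadraticAlgebra.norm_star]) hz
      (by rwa [star_star])
    exact ⟨v, Or.inr hv⟩

lemma dvd_of_mod_three_eq_two {q : ℕ} (hq : q.Prime) (hq2 : q % 3 = 2) {z : Eis}
    (hz : (q : ℤ) ∣ z.norm) : ∃ v : Eis, z = ((q : ℤ) : Eis) * v := by
  have hqi : Prime (q : ℤ) := Nat.prime_iff_prime_int.mp hq
  have := Fact.mk hq
  have him : (q : ℤ) ∣ z.im := by
    by_contra h
    have e : ((z.re : ZMod q)) ^ 2 - z.re * z.im + (z.im : ZMod q) ^ 2 = 0 := by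
      have := (ZMod.intCast_zmod_eq_zero_iff_dvd z.norm q).mpr hz
      rw [norm_eq] at this
      push_cast at this
      exact this
    have h0 : (z.im : ZMod q) ≠ 0 := by rwa [Ne, ZMod.intCast_zmod_eq_zero_iff_dvd]
    set x : ZMod q := -(z.re / z.im) with hx
    have hx1 : x ^ 2 + x + 1 = 0 := by
      rw [hx]; field_simp; linear_combination e
    have hx3 : x ^ 3 = 1 := by linear_combination (x - 1) * hx1
    have hne : x ≠ 1 := by
      intro h
      rw [h] at hx1
      have h3 : ((3 : ℕ) : ZMod q) = 0 := by push_cast; linear_combination hx1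
      rw [ZMod.natCast_eq_zero_iff] at h3
      have := (Nat.prime_dvd_prime_iff_eq hq Nat.prime_three).mp h3
      omega
    have ho := orderOf_eq_prime hx3 hne
    have hx0 : x ≠ 0 := by rintro h; rw [h] at hx3; simp at hx3
    have h4 := ZMod.orderOf_dvd_card_sub_one hx0
    rw [ho] at h4
    have := hq.two_le
    omega
  have hre : (q : ℤ) ∣ z.re := by
    apply hqi.dvd_of_dvd_pow (n := 2)
    have : z.re ^ 2 = z.norm + z.im * (z.re - z.im) := by rw [norm_eq]; ring
    rw [this]
    exact dvd_add hz (him.mul_right _)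
  obtain ⟨r, hr⟩ := hre
  obtain ⟨s, hs⟩ := him
  refine ⟨⟨r, s⟩, ?_⟩
  ext
  · rw [hr]; simp
  · rw [hs]; simp

lemma Primary.norm_mod {z : Eis} (hz : z.Primary) : ¬ (3 : ℤ) ∣ z.norm := by
  obtain ⟨⟨b, hb⟩, h⟩ := hz
  intro h3
  apply h
  apply Int.prime_three.dvd_of_dvd_pow (n := 2)
  have : z.re ^ 2 = z.norm + 3 * (b * (z.re - z.im)) := by
    rw [norm_eq]; linear_combination (z.re - z.im) * hb
  rw [this]
  exact dvd_add h3 (dvd_mul_right _ _)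

lemma Primary.of_mul {J v : Eis} (hJ : J.Primary) (h : (J * v).Primary) : v.Primary := by
  obtain ⟨⟨b, hb⟩, hr⟩ := hJ
  obtain ⟨h1, h2⟩ := h
  simp only [QuadraticAlgebra.im_mul, QuadraticAlgebra.re_mul, hb] at h1 h2
  have h3 : (3 : ℤ) ∣ v.im := by
    have h4 : (3 : ℤ) ∣ J.re * v.im := by
      have e : J.re * v.im = (J.re * v.im + 3 * b * v.re + -1 * (3 * b) * v.im) -
        3 * (b * v.re - b * v.im) := by ring
      rw [e]
      exact dvd_sub h1 (dvd_mul_right _ _)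
    exact (Int.prime_three.dvd_or_dvd h4).resolve_left hr
  refine ⟨h3, fun h5 => h2 ?_⟩
  obtain ⟨c, hc⟩ := h5
  exact ⟨J.re * c - b * v.im, by rw [hc]; ring⟩

lemma Primary.star {z : Eis} (hz : z.Primary) : (star z).Primary := by
  obtain ⟨⟨b, hb⟩, h⟩ := hz
  refine ⟨?_, fun h' => h ?_⟩
  · rw [QuadraticAlgebra.im_star, hb, dvd_neg]; exact dvd_mul_right _ _
  · rw [QuadraticAlgebra.re_star, hb] at h'
    obtain ⟨c, hc⟩ := h'
    exact ⟨c + b, by linear_combination hc⟩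

end Eis

namespace CubicSymbol

/-- The cubic symbol extended multiplicatively to composite natural numbers. -/
noncomputable def psi (z : Eis) (n : ℕ) : ZMod 3 := (n.primeFactorsList.map (sym · z)).sum

lemma psi_one (z : Eis) : psi z 1 = 0 := by simp [psi]

lemma psi_prime (z : Eis) {p : ℕ} (hp : p.Prime) : psi z p = sym p z := by
  simp [psi, Nat.primeFactorsList_prime hp]

lemma psi_mul (z : Eis) {m n : ℕ} (hm : m ≠ 0) (hn : n ≠ 0) :
    psi z (m * n) = psi z m + psi z n := by
  rw [psi, ((Nat.perm_primeFactorsList_mul hm hn).map _).sum_eq, List.map_append, List.sum_append]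
  rfl

lemma psi_pow (z : Eis) {m : ℕ} (hm : m ≠ 0) (k : ℕ) : psi z (m ^ k) = k * psi z m := by
  induction k with
  | zero => simp [psi_one]
  | succ k ih => rw [pow_succ, psi_mul z (pow_ne_zero _ hm) hm, ih]; push_cast; ring

lemma psi_congr {z v : Eis} {n : ℕ} (h : ∀ p, p.Prime → p ∣ n → sym p z = sym p v) :
    psi z n = psi v n := by
  rw [psi, psi]
  congr 1
  exact List.map_congr_left fun p hp =>
    h p (Nat.prime_of_mem_primeFactorsList hp) (Nat.dvd_of_mem_primeFactorsList hp)

lemma psi_eq_zero {z : Eis} {n : ℕ} (h : ∀ p, p.Prime → p ∣ n → sym p z = 0) :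
    psi z n = 0 := by
  rw [psi]
  apply List.sum_eq_zero
  intro x hx
  obtain ⟨p, hp, rfl⟩ := List.mem_map.mp hx
  exact h p (Nat.prime_of_mem_primeFactorsList hp) (Nat.dvd_of_mem_primeFactorsList hp)

/-- `n` is prime to `3` and to the norm of `z`. -/
def Good (z : Eis) (n : ℕ) : Prop := ∀ p : ℕ, p.Prime → p ∣ n → p ≠ 3 ∧ ¬ (p : ℤ) ∣ z.norm

lemma Good.left {z v : Eis} {n : ℕ} (h : Good (z * v) n) : Good z n := fun p hp hpn =>
  ⟨(h p hp hpn).1, fun hd => (h p hp hpn).2 (by rw [map_mul]; exact hd.mul_right _)⟩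

lemma Good.right {z v : Eis} {n : ℕ} (h : Good (z * v) n) : Good v n := fun p hp hpn =>
  ⟨(h p hp hpn).1, fun hd => (h p hp hpn).2 (by rw [map_mul]; exact hd.mul_left _)⟩

lemma Good.star {z : Eis} {n : ℕ} (h : Good (star z) n) : Good z n := fun p hp hpn =>
  ⟨(h p hp hpn).1, by rw [← QuadraticAlgebra.norm_star]; exact (h p hp hpn).2⟩

lemma psi_mul_left {z v : Eis} {n : ℕ} (h : Good (z * v) n) :
    psi (z * v) n = psi z n + psi v n := by
  rw [psi, psi, psi, ← List.sum_map_add]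
  congr 1
  apply List.map_congr_left
  intro p hp
  have hpp := Nat.prime_of_mem_primeFactorsList hp
  have hpn := Nat.dvd_of_mem_primeFactorsList hp
  have := Fact.mk hpp
  exact sym_mul (h p hpp hpn).1 (h.left p hpp hpn).2 (h.right p hpp hpn).2

lemma psi_star {z : Eis} {n : ℕ} (h : Good z n) : psi (star z) n = - psi z n := by
  rw [eq_neg_iff_add_eq_zero, psi, psi, ← List.sum_map_add]
  apply List.sum_eq_zero
  intro x hx
  obtain ⟨p, hp, rfl⟩ := List.mem_map.mp hx
  have hpp := Nat.prime_of_mem_primeFactorsList hp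
  have hpn := Nat.dvd_of_mem_primeFactorsList hp
  have := Fact.mk hpp
  rw [sym_star (h p hpp hpn).1 (h p hpp hpn).2, neg_add_cancel]

lemma psi_eq_of_character {q : ℕ} [hq : Fact q.Prime] {χ : MulChar (ZMod q) Eis} {J : Eis}
    (h3 : χ ^ 3 = 1) (hJ : J.norm = q)
    (h : ∀ p : ℕ, p.Prime → p ≠ 3 → p ≠ q → sym p J = 2 * lg Eis.w (χ p)) {n : ℕ} (hn : n ≠ 0)
    (hg : Good J n) : psi J n = 2 * lg Eis.w (χ n) ∧ χ n ^ 3 = 1 := by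
  induction n using induction_on_primes with
  | zero => exact absurd rfl hn
  | one => simp [psi_one, lg_one]
  | prime_mul p n hp ih =>
    have hn0 : n ≠ 0 := right_ne_zero_of_mul hn
    obtain ⟨ih1, ih2⟩ := ih hn0 fun r hr hrn => hg r hr (hrn.mul_left _)
    obtain ⟨hp3, hpq⟩ := hg p hp (dvd_mul_right _ _)
    have hpq' : p ≠ q := by rintro rfl; exact hpq (by rw [hJ])
    have hpu : IsUnit ((p : ℕ) : ZMod q) := by
      rw [ZMod.isUnit_iff_coprime]; exact (Nat.coprime_primes hp hq.out).mpr hpq'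
    have hv : χ p ^ 3 = 1 := by
      rw [← MulChar.pow_apply' _ three_ne_zero, h3, MulChar.one_apply hpu]
    refine ⟨?_, ?_⟩
    · rw [psi_mul _ hp.ne_zero hn0, psi_prime _ hp, h p hp hp3 hpq', ih1, Nat.cast_mul, map_mul,
        lg_mul Eis.w_spec Eis.w_ne_one hv ih2]
      ring
    · rw [Nat.cast_mul, map_mul, mul_pow, hv, ih2, one_mul]

lemma exists_primary_prime {q : ℕ} (hq : q.Prime) (hq1 : q % 3 = 1) :
    ∃ J : Eis, J.norm = q ∧ J.Primary ∧ ∀ n₁ n₂ : ℕ, n₁ ≠ 0 → n₂ ≠ 0 → Good J n₁ → Good J n₂ →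
      ((q : ℤ) ∣ n₁ - n₂ ∨ (q : ℤ) ∣ n₁ + n₂) → psi J n₁ = psi J n₂ := by
  have := Fact.mk hq
  obtain ⟨χ, J, h3, hJ, him, hre, h⟩ := exists_jacobi hq1
  refine ⟨J, hJ, ⟨him, by omega⟩, fun n₁ n₂ h1 h2 hg1 hg2 hc => ?_⟩
  obtain ⟨e1, -⟩ := psi_eq_of_character h3 hJ h h1 hg1
  obtain ⟨e2, -⟩ := psi_eq_of_character h3 hJ h h2 hg2
  rw [e1, e2]
  congr 2
  rcases hc with hc | hc
  · rw [← ZMod.intCast_zmod_eq_zero_iff_dvd] at hc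
    push_cast at hc
    rw [sub_eq_zero.mp hc]
  · rw [← ZMod.intCast_zmod_eq_zero_iff_dvd] at hc
    push_cast at hc
    have hm : χ (-1) = 1 := by
      have a1 : χ (-1) ^ 2 = 1 := by rw [← map_pow]; simp
      have a2 : χ (-1) ^ 3 = 1 := by
        rw [← MulChar.pow_apply' _ three_ne_zero, h3, MulChar.one_apply isUnit_one.neg]
      rw [pow_succ, a1, one_mul] at a2
      exact a2
    rw [eq_neg_of_add_eq_zero_left hc, neg_eq_neg_one_mul (n₂ : ZMod q), map_mul, hm, one_mul]

/-- Cubic reciprocity for rational arguments: the cubic symbol of a primary `z` at natural numbers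
only depends on the residue class, up to sign, modulo the norm of `z`. -/
theorem psi_eq_of_congr (z : Eis) (hz : z.Primary) (n₁ n₂ : ℕ) (h1 : n₁ ≠ 0) (h2 : n₂ ≠ 0)
    (hg1 : Good z n₁) (hg2 : Good z n₂) (hc : z.norm ∣ n₁ - n₂ ∨ z.norm ∣ n₁ + n₂) :
    psi z n₁ = psi z n₂ := by
  induction hN : z.norm.natAbs using Nat.strong_induction_on generalizing z with
  | _ N ih =>
  have hz0 : z.norm ≠ 0 := fun h => hz.norm_mod (by rw [h]; exact dvd_zero _)
  have hdesc (J v : Eis) (hJv : z = J * v) (hJ : J.Primary) (hJ1 : 1 < J.norm) :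
      psi v n₁ = psi v n₂ := by
    have hv0 : v.norm ≠ 0 := by rw [hJv, map_mul] at hz0; exact right_ne_zero_of_mul hz0
    have hdv : v.norm ∣ z.norm := by rw [hJv, map_mul]; exact dvd_mul_left _ _
    refine ih v.norm.natAbs ?_ v (hJ.of_mul (hJv ▸ hz)) ?_ ?_
      (hc.imp hdv.trans hdv.trans) rfl
    · rw [← hN, hJv, map_mul, Int.natAbs_mul]
      have : 0 < v.norm.natAbs := Int.natAbs_pos.mpr hv0
      have : 1 < J.norm.natAbs := by omega
      nlinarith
    · exact (hJv ▸ hg1 : Good (J * v) n₁).right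
    · exact (hJv ▸ hg2 : Good (J * v) n₂).right
  by_cases h1N : N = 1
  · have hn1 : z.norm = 1 := by have := Eis.norm_nonneg z; omega
    have him : z.im = 0 := by
      obtain ⟨⟨b, hb⟩, -⟩ := hz
      have h4 := Eis.four_norm z
      rw [hn1, hb] at h4
      have : b = 0 := by nlinarith [sq_nonneg (2 * z.re - 3 * b), sq_nonneg b]
      rw [hb, this, mul_zero]
    have h0 (n : ℕ) (hg : Good z n) : psi z n = 0 := psi_eq_zero fun p hp hpn => by
      have := Fact.mk hp
      exact sym_of_im (hg p hp hpn).2 (by rw [him]; exact dvd_zero _)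
    rw [h0 n₁ hg1, h0 n₂ hg2]
  · obtain ⟨q, hq, hqN⟩ := Nat.exists_prime_and_dvd h1N
    have hqz : (q : ℤ) ∣ z.norm := by rw [← hN] at hqN; exact Int.natCast_dvd.mpr hqN
    have hq3 : ¬ 3 ∣ q := fun h => by
      have := (Nat.prime_dvd_prime_iff_eq Nat.prime_three hq).mp h
      rw [← this] at hqz
      exact hz.norm_mod hqz
    have hq1 : (1 : ℤ) < q := by exact_mod_cast hq.one_lt
    rcases (by omega : q % 3 = 1 ∨ q % 3 = 2) with hqm | hqm
    · obtain ⟨J, hJ, hJp, hJc⟩ := exists_primary_prime hq hqm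
      have hc' : (q : ℤ) ∣ n₁ - n₂ ∨ (q : ℤ) ∣ n₁ + n₂ := hc.imp hqz.trans hqz.trans
      obtain ⟨v, hv | hv⟩ := Eis.exists_factor hq hJ hqz
      · rw [hv] at hg1 hg2 ⊢
        rw [psi_mul_left hg1, psi_mul_left hg2, hdesc J v hv hJp (by rwa [hJ]),
          hJc n₁ n₂ h1 h2 hg1.left hg2.left hc']
      · rw [hv] at hg1 hg2 ⊢
        have g1 : Good J n₁ := hg1.left.star
        have g2 : Good J n₂ := hg2.left.star
        rw [psi_mul_left hg1, psi_mul_left hg2, psi_star g1, psi_star g2,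
          hdesc (star J) v hv hJp.star (by rwa [QuadraticAlgebra.norm_star, hJ]),
          hJc n₁ n₂ h1 h2 g1 g2 hc']
    · obtain ⟨v, hv⟩ := Eis.dvd_of_mod_three_eq_two hq hqm hqz
      have hqn : ((q : ℤ) : Eis).norm = (q : ℤ) ^ 2 := by rw [QuadraticAlgebra.norm_intCast]; rfl
      have e (n : ℕ) (hg : Good z n) : psi z n = psi v n := psi_congr fun p hp hpn => by
        have := Fact.mk hp
        rw [hv]
        refine sym_intCast_mul (fun hd => (hg p hp hpn).2 ?_) v
        rw [hv, map_mul, hqn]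
        exact (hd.trans (dvd_pow_self _ two_ne_zero)).mul_right _
      rw [e n₁ hg1, e n₂ hg2]
      refine hdesc _ v hv ⟨?_, ?_⟩ ?_
      · simp
      · simp only [QuadraticAlgebra.re_intCast]
        intro h; apply hq3; rw [Int.cast_id] at h; omega
      · rw [hqn]; nlinarith

end CubicSymbol

namespace CubicSymbol

/-- The element `x + t√-3` of `ℤ[ω]`. -/
def el (x t : ℤ) : Eis := ⟨x + t, 2 * t⟩

lemma norm_el (x t : ℤ) : (el x t).norm = x ^ 2 + 3 * t ^ 2 := by
  rw [Eis.norm_eq, el]; ring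

lemma star_el (x t : ℤ) : star (el x t) = el x (-t) := by
  rw [el, el, QuadraticAlgebra.star_mk]; ext <;> simp; ring

lemma intCast_mul_el (n x t : ℤ) : (n : Eis) * el x t = el (n * x) (n * t) := by
  ext <;> simp [el]; ring
  ring

lemma el_mul_el (x t x' t' : ℤ) :
    el x t * el x' t' = el (x * x' - 3 * t * t') (x * t' + t * x') := by
  ext <;> simp [el] <;> ring

section

variable {p : ℕ} [hp : Fact p.Prime]

lemma sym_el_congr {x t x' t' : ℤ} (h1 : (p : ℤ) ∣ x - x') (h2 : (p : ℤ) ∣ t - t') :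
    sym p (el x t) = sym p (el x' t') := by
  apply sym_congr
  · have : (el x t).re - (el x' t').re = (x - x') + (t - t') := by simp [el]; ring
    rw [this]; exact dvd_add h1 h2
  · have : (el x t).im - (el x' t').im = 2 * (t - t') := by simp [el]; ring
    rw [this]; exact h2.mul_left _

lemma sym_el_eq_zero_of_right {x t : ℤ} (h : ¬ (p : ℤ) ∣ (el x t).norm) (ht : (p : ℤ) ∣ 2 * t) :
    sym p (el x t) = 0 := sym_of_im h ht

lemma sym_el_eq_zero_of_left (hp3 : p ≠ 3) {x t : ℤ} (h : ¬ (p : ℤ) ∣ (el x t).norm)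
    (hx : (p : ℤ) ∣ x) : sym p (el x t) = 0 := by
  have hpi : Prime (p : ℤ) := Nat.prime_iff_prime_int.mp hp.out
  have h2 : sym p (el x t * el x t) = 0 := by
    apply sym_of_im
    · rw [map_mul]; exact fun h' => (hpi.dvd_or_dvd h').elim h h
    · have : (el x t * el x t).im = x * (4 * t) := by simp [el]; ring
      rw [this]; exact hx.mul_right _
  rw [sym_mul hp3 h h] at h2
  generalize sym p (el x t) = c at h2
  revert c; decide

end

/-- Triviality of the symbol attached to `x + y√(-3 * D)` on principal ideals, in terms of rational
integers. -/
theorem psi_el_eq_zero {D x y m : ℤ} {M : ℕ} (hxy : IsCoprime x y) (hx2 : ¬ (2 : ℤ) ∣ x)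
    (hx3 : ¬ (3 : ℤ) ∣ x) (hy : (972 : ℤ) ∣ y) (hm : x ^ 2 + 3 * D * y ^ 2 = m ^ 3)
    (hD : Squarefree D) (hM : 6 * D * m ∣ M) {u v : ℤ} (huv : IsCoprime u v)
    (hu : ¬ (3 : ℤ) ∣ u) (hv : ¬ (27 : ℤ) ∣ v) {a j : ℕ} (ha : |u ^ 2 - D * v ^ 2| = 2 ^ j * a)
    (hj : j = 0 ∨ ¬ (2 : ℤ) ∣ v) (haM : Nat.Coprime a M) :
    psi (el (v * x) (-(u * y))) a = 0 := by
  -- elementary consequences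
  have hcop (p : ℕ) (hp : p.Prime) {s t : ℤ} (h : IsCoprime s t) (h1 : (p : ℤ) ∣ s)
      (h2 : (p : ℤ) ∣ t) : False :=
    (Nat.prime_iff_prime_int.mp hp).not_isUnit (h.isUnit_of_dvd' h1 h2)
  have hx0 : x ≠ 0 := by rintro rfl; exact hx3 (dvd_zero _)
  have hu0 : u ≠ 0 := by rintro rfl; exact hu (dvd_zero _)
  have hM6 : 6 ∣ M := by
    have : ((6 : ℕ) : ℤ) ∣ M := Dvd.dvd.trans ⟨D * m, by push_cast; ring⟩ hM
    exact_mod_cast this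
  have hDM : D ∣ M := (Dvd.intro_left (6 * m) (by ring)).trans hM
  have hmM : m ∣ M := (Dvd.intro_left (6 * D) (by ring)).trans hM
  have haM' (p : ℕ) (hp : p.Prime) (hpa : p ∣ a) : ¬ (p : ℤ) ∣ M := fun h =>
    Nat.Prime.not_coprime_iff_dvd.mpr ⟨p, hp, hpa, by exact_mod_cast h⟩ haM
  have ha0 : a ≠ 0 := by
    rintro rfl
    rw [Nat.coprime_zero_left] at haM
    omega
  obtain ⟨k, v₁, hk, hv₁, rfl⟩ : ∃ (k : ℕ) (v₁ : ℤ), k ≤ 2 ∧ ¬ (3 : ℤ) ∣ v₁ ∧ v = 3 ^ k * v₁ := by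
    by_cases h1 : (3 : ℤ) ∣ v
    · by_cases h2 : (9 : ℤ) ∣ v
      · exact ⟨2, v / 9, le_rfl, by omega, by norm_num; omega⟩
      · exact ⟨1, v / 3, by omega, by omega, by norm_num; omega⟩
    · exact ⟨0, v, by omega, h1, by ring⟩
  obtain ⟨yk, hyk, hyk3, hyk2⟩ : ∃ yk : ℤ, y = 3 ^ k * yk ∧ (3 : ℤ) ∣ yk ∧ (2 : ℤ) ∣ yk := by
    interval_cases k
    · exact ⟨y, by ring, by omega, by omega⟩
    · exact ⟨y / 3, by norm_num; omega, by omega, by omega⟩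
    · exact ⟨y / 9, by norm_num; omega, by omega, by omega⟩
  obtain ⟨g, x', u', hg0, hx'u', hgx, hgu⟩ : ∃ g x' u' : ℤ, g ≠ 0 ∧ IsCoprime x' u' ∧ x = g * x' ∧
      u = g * u' := by
    obtain ⟨x', u', h1, h2, h3⟩ := extract_gcd x u
    refine ⟨gcd x u, x', u', ?_, (gcd_isUnit_iff _ _).mp h3, h1, h2⟩
    intro h
    rw [h, zero_mul] at h1
    exact hx0 h1
  have hx'0 : x' ≠ 0 := by rintro rfl; exact hx0 (by rw [hgx, mul_zero])
  have hu'0 : u' ≠ 0 := by rintro rfl; exact hu0 (by rw [hgu, mul_zero])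
  have hx'x : x' ∣ x := hgx ▸ dvd_mul_left _ _
  have hu'u : u' ∣ u := hgu ▸ dvd_mul_left _ _
  have hyky : yk ∣ y := hyk ▸ dvd_mul_left _ _
  have hm0 : m ≠ 0 := by
    rintro rfl
    obtain ⟨c, hc⟩ := hy
    apply hx3
    apply Int.prime_three.dvd_of_dvd_pow (n := 2)
    exact ⟨-(D * y ^ 2), by linear_combination hm⟩
  set z₁ := el (v₁ * x') (-(u' * yk)) with hz₁
  have hzz : el (3 ^ k * v₁ * x) (-(u * y)) = ((g * 3 ^ k : ℤ) : Eis) * z₁ := by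
    rw [hz₁, intCast_mul_el, hgx, hgu, hyk]; congr 1 <;> ring
  have hN : z₁.norm = v₁ ^ 2 * x' ^ 2 + 3 * (u' ^ 2 * yk ^ 2) := by rw [hz₁, norm_el]; ring
  have hid : (u ^ 2 - D * (3 ^ k * v₁) ^ 2) * x' ^ 2 =
      u' ^ 2 * m ^ 3 - D * 9 ^ k * z₁.norm := by
    have hg2 : g ^ 2 ≠ 0 := pow_ne_zero _ hg0
    apply mul_left_cancel₀ hg2
    have e : (9 : ℤ) ^ k = 3 ^ k * 3 ^ k := by rw [← mul_pow]; norm_num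
    rw [← hm, hN, hgu, hyk, e, hgx]; ring
  have hprim : z₁.Primary := by
    constructor
    · rw [hz₁]; simp only [el]; exact ((hyk3.mul_left u').neg_right).mul_left 2
    · rw [hz₁]; simp only [el]
      intro h
      have h' : (3 : ℤ) ∣ v₁ * x' := (dvd_add_left ((hyk3.mul_left u').neg_right)).mp h
      rcases Int.prime_three.dvd_or_dvd h' with h' | h'
      · exact hv₁ h'
      · exact hx3 (h'.trans hx'x)
  have hp3 (p : ℕ) (hpz : (p : ℤ) ∣ z₁.norm) : p ≠ 3 := by
    rintro rfl; exact hprim.norm_mod hpz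
  have hne3 {n : ℤ} (hn : ¬ (3 : ℤ) ∣ n) (p : ℕ) (hpn : (p : ℤ) ∣ n) : p ≠ 3 := by
    rintro rfl; exact hn hpn
  have haid : (a : ℤ) ∣ u ^ 2 - D * (3 ^ k * v₁) ^ 2 := by
    rw [← dvd_abs, ha]; exact dvd_mul_left _ _
  -- the relevant integers are prime to the norm of `z₁`
  have gx : ∀ p : ℕ, p.Prime → p ∣ x'.natAbs → p ≠ 3 ∧ ¬ (p : ℤ) ∣ z₁.norm := by
    intro p hp hpx
    have hpi := Nat.prime_iff_prime_int.mp hp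
    have hpx : (p : ℤ) ∣ x' := Int.natCast_dvd.mpr hpx
    have h3 := hne3 hx3 p (hpx.trans hx'x)
    refine ⟨h3, fun h => ?_⟩
    have h1 : (p : ℤ) ∣ 3 * (u' ^ 2 * yk ^ 2) :=
      (dvd_add_right ((dvd_pow hpx two_ne_zero).mul_left _)).mp (hN ▸ h)
    rcases hpi.dvd_or_dvd h1 with h1 | h1
    · exact h3 ((Nat.prime_dvd_prime_iff_eq hp Nat.prime_three).mp (by exact_mod_cast h1))
    rcases hpi.dvd_or_dvd h1 with h1 | h1
    · exact hcop p hp hx'u' hpx (hpi.dvd_of_dvd_pow h1)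
    · exact hcop p hp hxy (hpx.trans hx'x) ((hpi.dvd_of_dvd_pow h1).trans hyky)
  have gu : ∀ p : ℕ, p.Prime → p ∣ u'.natAbs → p ≠ 3 ∧ ¬ (p : ℤ) ∣ z₁.norm := by
    intro p hp hpu
    have hpi := Nat.prime_iff_prime_int.mp hp
    have hpu : (p : ℤ) ∣ u' := Int.natCast_dvd.mpr hpu
    refine ⟨hne3 hu p (hpu.trans hu'u), fun h => ?_⟩
    have h1 : (p : ℤ) ∣ v₁ ^ 2 * x' ^ 2 :=
      (dvd_add_left (((dvd_pow hpu two_ne_zero).mul_right _).mul_left _)).mp (hN ▸ h)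
    rcases hpi.dvd_or_dvd h1 with h1 | h1
    · exact hcop p hp huv (hpu.trans hu'u) ((hpi.dvd_of_dvd_pow h1).mul_left _)
    · exact hcop p hp hx'u' (hpi.dvd_of_dvd_pow h1) hpu
  have ga : ∀ p : ℕ, p.Prime → p ∣ a → p ≠ 3 ∧ ¬ (p : ℤ) ∣ z₁.norm := by
    intro p hp hpa
    have hpi := Nat.prime_iff_prime_int.mp hp
    have hpM := haM' p hp hpa
    refine ⟨?_, fun h => ?_⟩
    · rintro rfl
      apply hpM
      exact_mod_cast (by norm_num : 3 ∣ 6).trans hM6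
    · have hpa' : (p : ℤ) ∣ u ^ 2 - D * (3 ^ k * v₁) ^ 2 :=
        (Int.natCast_dvd_natCast.mpr hpa).trans haid
      have h1 : (p : ℤ) ∣ u' ^ 2 * m ^ 3 := by
        have : u' ^ 2 * m ^ 3 = (u ^ 2 - D * (3 ^ k * v₁) ^ 2) * x' ^ 2 + D * 9 ^ k * z₁.norm := by
          rw [hid]; ring
        rw [this]
        exact dvd_add (hpa'.mul_right _) (h.mul_left _)
      rcases hpi.dvd_or_dvd h1 with h1 | h1
      · have h2 := (hpi.dvd_of_dvd_pow h1).trans hu'u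
        have h3 : (p : ℤ) ∣ D * (3 ^ k * v₁) ^ 2 :=
          (dvd_sub_right (dvd_pow h2 two_ne_zero)).mp hpa'
        rcases hpi.dvd_or_dvd h3 with h3 | h3
        · exact hpM (h3.trans hDM)
        · exact hcop p hp huv h2 (hpi.dvd_of_dvd_pow h3)
      · exact hpM ((hpi.dvd_of_dvd_pow h1).trans hmM)
  have gm : ∀ p : ℕ, p.Prime → p ∣ m.natAbs → p ≠ 3 ∧ ¬ (p : ℤ) ∣ z₁.norm := by
    intro p hp hpm
    have hpi := Nat.prime_iff_prime_int.mp hp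
    have hpm : (p : ℤ) ∣ m := Int.natCast_dvd.mpr hpm
    have hpm3 : (p : ℤ) ∣ m ^ 3 := dvd_pow hpm three_ne_zero
    have h3 : p ≠ 3 := by
      rintro rfl
      apply hx3
      apply Int.prime_three.dvd_of_dvd_pow (n := 2)
      have : x ^ 2 = m ^ 3 - 3 * (D * y ^ 2) := by rw [← hm]; ring
      rw [this]
      exact dvd_sub hpm3 (dvd_mul_right _ _)
    refine ⟨h3, fun h => ?_⟩
    have hpx : ¬ (p : ℤ) ∣ x := by
      intro hpx
      have h1 : (p : ℤ) ^ 2 ∣ 3 * D * y ^ 2 := by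
        have : 3 * D * y ^ 2 = m ^ 3 - x ^ 2 := by rw [← hm]; ring
        rw [this]
        exact dvd_sub ((pow_dvd_pow_of_dvd hpm 2).trans (pow_dvd_pow _ (by norm_num)))
          (pow_dvd_pow_of_dvd hpx 2)
      have hpy : ¬ (p : ℤ) ∣ y := fun hpy => hcop p hp hxy hpx hpy
      have hc3 : IsCoprime ((p : ℤ) ^ 2) 3 := by
        apply IsCoprime.pow_left
        exact_mod_cast Nat.isCoprime_iff_coprime.mpr
          ((Nat.coprime_primes hp Nat.prime_three).mpr h3)
      have hcy : IsCoprime ((p : ℤ) ^ 2) (y ^ 2) :=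
        ((Nat.prime_iff_prime_int.mp hp).coprime_iff_not_dvd.mpr hpy).pow
      have h2 : (p : ℤ) ^ 2 ∣ D := hc3.dvd_of_dvd_mul_left (hcy.dvd_of_dvd_mul_right h1)
      rw [pow_two] at h2
      exact hpi.not_isUnit (hD _ h2)
    have h1 : (p : ℤ) ∣ (u ^ 2 - D * (3 ^ k * v₁) ^ 2) * x' ^ 2 := by
      rw [hid]
      exact dvd_sub (hpm3.mul_left _) (h.mul_left _)
    rcases hpi.dvd_or_dvd h1 with h1 | h1
    · rw [← dvd_abs, ha] at h1
      rcases hpi.dvd_or_dvd h1 with h1 | h1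
      · have h2 : p = 2 := by
          have := hpi.dvd_of_dvd_pow h1
          exact (Nat.prime_dvd_prime_iff_eq hp Nat.prime_two).mp (by exact_mod_cast this)
        subst h2
        apply hx2
        apply Int.prime_two.dvd_of_dvd_pow (n := 2)
        have : x ^ 2 = m ^ 3 - 3 * D * y ^ 2 := by rw [← hm]; ring
        rw [this]
        obtain ⟨c, hc⟩ := hy
        exact dvd_sub hpm3 ⟨3 * D * y * (486 * c), by rw [hc]; ring⟩
      · exact haM' p hp (by exact_mod_cast h1) (hpm.trans hmM)
    · exact hpx ((hpi.dvd_of_dvd_pow h1).trans hx'x)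
  have g2 : j ≠ 0 → ¬ (2 : ℤ) ∣ z₁.norm := by
    intro hj0 h
    have hv2 := hj.resolve_left hj0
    obtain ⟨c, hc⟩ := hyk2
    have h1 : (2 : ℤ) ∣ v₁ ^ 2 * x' ^ 2 :=
      (dvd_add_left ⟨3 * (u' ^ 2 * (yk * c)), by rw [hc]; ring⟩).mp (hN ▸ h)
    rcases Int.prime_two.dvd_or_dvd h1 with h1 | h1
    · exact hv2 ((Int.prime_two.dvd_of_dvd_pow h1).mul_left _)
    · exact hx2 ((Int.prime_two.dvd_of_dvd_pow h1).trans hx'x)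
  have gprime {m n : ℕ} (hm : Good z₁ m) (hn : Good z₁ n) : Good z₁ (m * n) := fun p hp hd =>
    (hp.dvd_mul.mp hd).elim (hm p hp) (hn p hp)
  have gpow {m : ℕ} (hm : Good z₁ m) (k : ℕ) : Good z₁ (m ^ k) := fun p hp hd =>
    hm p hp (hp.dvd_of_dvd_pow hd)
  have g2j : Good z₁ (2 ^ j) := by
    intro p hp hd
    have hj0 : j ≠ 0 := by rintro rfl; exact hp.one_lt.ne' (by simpa using hd)
    have h2 := (Nat.prime_dvd_prime_iff_eq hp Nat.prime_two).mp (hp.dvd_of_dvd_pow hd)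
    subst h2
    exact ⟨by norm_num, g2 hj0⟩
  have p2j : psi z₁ (2 ^ j) = 0 := by
    apply psi_eq_zero
    intro p hp hd
    have := Fact.mk hp
    have h2 := (Nat.prime_dvd_prime_iff_eq hp Nat.prime_two).mp (hp.dvd_of_dvd_pow hd)
    exact sym_el_eq_zero_of_right (g2j p hp hd).2 (by subst h2; exact dvd_mul_right _ _)
  have px : psi z₁ x'.natAbs = 0 := by
    apply psi_eq_zero
    intro p hp hd
    have := Fact.mk hp
    exact sym_el_eq_zero_of_left (gx p hp hd).1 (gx p hp hd).2
      ((Int.natCast_dvd.mpr hd).mul_left _)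
  have pu : psi z₁ u'.natAbs = 0 := by
    apply psi_eq_zero
    intro p hp hd
    have := Fact.mk hp
    exact sym_el_eq_zero_of_right (gu p hp hd).2
      ((((Int.natCast_dvd.mpr hd).mul_right _).neg_right).mul_left _)
  have hx'a : x'.natAbs ≠ 0 := Int.natAbs_ne_zero.mpr hx'0
  have hu'a : u'.natAbs ≠ 0 := Int.natAbs_ne_zero.mpr hu'0
  have hma : m.natAbs ≠ 0 := Int.natAbs_ne_zero.mpr hm0
  have h2j0 : (2 ^ j : ℕ) ≠ 0 := pow_ne_zero _ two_ne_zero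
  have key := psi_eq_of_congr z₁ hprim (2 ^ j * a * x'.natAbs ^ 2) (u'.natAbs ^ 2 * m.natAbs ^ 3)
    (by positivity) (by positivity) (gprime (gprime g2j ga) (gpow gx 2))
    (gprime (gpow gu 2) (gpow gm 3)) (by
      push_cast
      rw [← ha, sq_abs, sq_abs]
      have hd : z₁.norm ∣ (u ^ 2 - D * (3 ^ k * v₁) ^ 2) * x' ^ 2 - u' ^ 2 * m ^ 3 :=
        ⟨-(D * 9 ^ k), by rw [hid]; ring⟩
      rcases abs_choice (u ^ 2 - D * (3 ^ k * v₁) ^ 2) with h1 | h1 <;>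
      rcases abs_choice m with h2 | h2 <;> rw [h1, h2]
      · exact Or.inl hd
      · right; rwa [Odd.neg_pow (by decide), mul_neg, ← sub_eq_add_neg]
      · right; rwa [← dvd_neg, neg_add, neg_mul, neg_neg, ← sub_eq_add_neg]
      · left
        rwa [Odd.neg_pow (by decide), mul_neg, ← dvd_neg, neg_mul, neg_sub_neg, neg_sub])
  rw [psi_mul _ (by positivity) (by positivity), psi_mul _ h2j0 ha0, p2j, psi_pow _ hx'a, px,
    psi_mul _ (by positivity) (by positivity), psi_pow _ hu'a, pu, psi_pow _ hma] at key
  have h30 : ((3 : ℕ) : ZMod 3) = 0 := by decide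
  rw [h30] at key
  have key' : psi z₁ a = 0 := by simpa using key
  rw [← key', hzz]
  apply psi_congr
  intro p hp hpa
  have := Fact.mk hp
  have hpi := Nat.prime_iff_prime_int.mp hp
  apply sym_intCast_mul
  intro hd
  rcases hpi.dvd_or_dvd hd with hd | hd
  · have hpa' : (p : ℤ) ∣ u ^ 2 - D * (3 ^ k * v₁) ^ 2 :=
      (Int.natCast_dvd_natCast.mpr hpa).trans haid
    have h2 : (p : ℤ) ∣ u := hgu ▸ hd.mul_right _
    have h3 : (p : ℤ) ∣ D * (3 ^ k * v₁) ^ 2 :=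
      (dvd_sub_right (dvd_pow h2 two_ne_zero)).mp hpa'
    rcases hpi.dvd_or_dvd h3 with h3 | h3
    · exact haM' p hp hpa (h3.trans hDM)
    · exact hcop p hp huv h2 (hpi.dvd_of_dvd_pow h3)
  · have := hpi.dvd_of_dvd_pow hd
    exact (ga p hp hpa).1 ((Nat.prime_dvd_prime_iff_eq hp Nat.prime_three).mp
      (by exact_mod_cast this))

end CubicSymbol

section

open NumberField

/-- `K` is the quadratic field `ℚ(√D)` with `D` squarefree, and `s` is a square root of `D`. -/
structure QuadData {K : Type*} [Field K] [NumberField K] (s : 𝓞 K) (D : ℤ) : Prop where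
  sq : s ^ 2 = (D : 𝓞 K)
  sqf : Squarefree D
  nsq : ¬ IsSquare D
  finrank : Module.finrank ℚ K = 2
  repr : ∀ x : 𝓞 K, ∃ a b : ℤ, 2 * x = a + b * s
  conj : ∃ σ : 𝓞 K →+* 𝓞 K, σ s = -s ∧ ∀ x, σ (σ x) = x

section Ideals

variable {K : Type*} [Field K] [NumberField K]

lemma Ideal.exists_prime_mem {P : Ideal (𝓞 K)} (hP : P.IsPrime) (hP0 : P ≠ ⊥) :
    ∃ p : ℕ, p.Prime ∧ (p : 𝓞 K) ∈ P ∧ p ∣ Ideal.absNorm P := by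
  have h := Ideal.absNorm_mem P
  have h0 : Ideal.absNorm P ≠ 0 := by rwa [Ne, Ideal.absNorm_eq_zero_iff]
  have key : ∀ n : ℕ, n ≠ 0 → (n : 𝓞 K) ∈ P → ∃ p : ℕ, p.Prime ∧ (p : 𝓞 K) ∈ P ∧ p ∣ n := by
    intro n
    induction n using Nat.recOnMul with
    | zero => intro h; exact absurd rfl h
    | one => intro _ h; exact absurd ((Ideal.eq_top_iff_one P).mpr (by simpa using h)) hP.ne_top
    | prime p hp => intro _ h; exact ⟨p, hp, h, dvd_rfl⟩
    | mul a b ha hb =>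
      intro h0 h
      rw [Nat.cast_mul] at h
      rcases hP.mem_or_mem h with h | h
      · obtain ⟨p, h1, h2, h3⟩ := ha (left_ne_zero_of_mul h0) h
        exact ⟨p, h1, h2, h3.mul_right _⟩
      · obtain ⟨p, h1, h2, h3⟩ := hb (right_ne_zero_of_mul h0) h
        exact ⟨p, h1, h2, h3.mul_left _⟩
  exact key _ h0 h

omit [NumberField K] in
lemma Ideal.intCast_mem_iff_dvd {P : Ideal (𝓞 K)} (hP : P ≠ ⊤) {p : ℕ} (hp : p.Prime)
    (hpP : (p : 𝓞 K) ∈ P) (n : ℤ) : (n : 𝓞 K) ∈ P ↔ (p : ℤ) ∣ n := by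
  constructor
  · intro h
    by_contra hd
    obtain ⟨a, b, hab⟩ := (Nat.prime_iff_prime_int.mp hp).coprime_iff_not_dvd.mpr hd
    apply hP
    rw [Ideal.eq_top_iff_one]
    have : (1 : 𝓞 K) = a * p + b * n := by
      rw [← Int.cast_one, ← hab]; push_cast; rfl
    rw [this]
    exact P.add_mem (P.mul_mem_left _ hpP) (P.mul_mem_left _ h)
  · rintro ⟨c, rfl⟩
    push_cast
    exact P.mul_mem_right _ hpP

omit [NumberField K] in
lemma Ideal.prime_unique {P : Ideal (𝓞 K)} (hP : P ≠ ⊤) {p q : ℕ} (hp : p.Prime) (hq : q.Prime)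
    (hpP : (p : 𝓞 K) ∈ P) (hqP : (q : 𝓞 K) ∈ P) : p = q := by
  have := (Ideal.intCast_mem_iff_dvd hP hp hpP q).mp (by exact_mod_cast hqP)
  exact (Nat.prime_dvd_prime_iff_eq hp hq).mp (by exact_mod_cast this)

end Ideals

namespace QuadData

variable {K : Type*} [Field K] [NumberField K] {s : 𝓞 K} {D : ℤ} (H : QuadData s D)
include H

lemma ne_zero : D ≠ 0 := H.sqf.ne_zero

lemma absNorm_intCast (n : ℤ) : Ideal.absNorm (Ideal.span {(n : 𝓞 K)}) = n.natAbs ^ 2 := by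
  rw [Ideal.absNorm_span_singleton]
  have : (n : 𝓞 K) = algebraMap ℤ (𝓞 K) n := rfl
  rw [this, Algebra.norm_algebraMap_of_basis (RingOfIntegers.basis K), Int.natAbs_pow]
  congr 1
  rw [← Module.finrank_eq_card_basis (RingOfIntegers.basis K), RingOfIntegers.rank, H.finrank]

lemma absNorm_natCast (n : ℕ) : Ideal.absNorm (Ideal.span {(n : 𝓞 K)}) = n ^ 2 := by
  have := H.absNorm_intCast n
  simpa using this

omit H in
lemma absNorm_conj {σ : 𝓞 K →+* 𝓞 K} (hσ : ∀ x, σ (σ x) = x) (x : 𝓞 K) :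
    Ideal.absNorm (Ideal.span {σ x}) = Ideal.absNorm (Ideal.span {x}) := by
  let e : 𝓞 K ≃ₐ[ℤ] 𝓞 K := AlgEquiv.ofRingEquiv (f := RingEquiv.ofRingHom σ σ
    (RingHom.ext hσ) (RingHom.ext hσ)) (fun n => by simp)
  rw [Ideal.absNorm_span_singleton, Ideal.absNorm_span_singleton,
    ← Algebra.norm_eq_of_algEquiv e x]
  rfl

/-- The norm of `u + v√D`. -/
lemma absNorm_add (u v : ℤ) :
    (Ideal.absNorm (Ideal.span {(u + v * s : 𝓞 K)}) : ℤ) = |u ^ 2 - D * v ^ 2| := by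
  obtain ⟨σ, hσ, hσσ⟩ := H.conj
  have h1 := absNorm_conj hσσ (u + v * s : 𝓞 K)
  have h2 : Ideal.span {(u + v * s : 𝓞 K)} * Ideal.span {σ (u + v * s)} =
      Ideal.span {((u ^ 2 - D * v ^ 2 : ℤ) : 𝓞 K)} := by
    rw [Ideal.span_singleton_mul_span_singleton]
    congr 2
    rw [map_add, map_mul, map_intCast, map_intCast, hσ]
    push_cast
    linear_combination (-v ^ 2 : 𝓞 K) * H.sq
  have h3 := congrArg Ideal.absNorm h2
  rw [map_mul, h1, H.absNorm_intCast, ← pow_two] at h3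
  have h4 := (Nat.pow_left_injective two_ne_zero) h3
  rw [h4, Int.natCast_natAbs]

lemma four_mul_absNorm {x : 𝓞 K} {u v : ℤ} (h : 2 * x = u + v * s) :
    4 * (Ideal.absNorm (Ideal.span {x}) : ℤ) = |u ^ 2 - D * v ^ 2| := by
  rw [← H.absNorm_add, ← h, ← Ideal.span_singleton_mul_span_singleton, map_mul]
  have := H.absNorm_natCast 2
  push_cast at this ⊢
  rw [this]
  norm_num

lemma eq_zero_of_add_eq_zero {u v : ℤ} (h : (u + v * s : 𝓞 K) = 0) : u = 0 ∧ v = 0 := by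
  have h1 := H.absNorm_add u v
  rw [h] at h1
  have h2 : u ^ 2 = D * v ^ 2 := by
    have : |u ^ 2 - D * v ^ 2| = 0 := by rw [← h1]; simp
    rw [abs_eq_zero] at this
    linarith
  have hv : v = 0 := by
    by_contra hv
    apply H.nsq
    have : (v ^ 2 : ℤ) ∣ u ^ 2 := ⟨D, by rw [h2]; ring⟩
    obtain ⟨c, rfl⟩ := (Int.pow_dvd_pow_iff two_ne_zero).mp this
    refine ⟨c, mul_left_cancel₀ (pow_ne_zero 2 hv) ?_⟩
    rw [mul_comm, ← h2]; ring
  refine ⟨?_, hv⟩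
  subst hv
  simpa using h2

/-- A prime ideal modulo which `√D` is congruent to a rational integer has prime norm. -/
lemma absNorm_eq {P : Ideal (𝓞 K)} (hP : P ≠ ⊤) {p : ℕ} (hp : p.Prime) (hp2 : p ≠ 2)
    (hpP : (p : 𝓞 K) ∈ P) {δ : ℤ} (hδ : s - δ ∈ P) : Ideal.absNorm P = p := by
  have hsurj : Function.Surjective (algebraMap ℤ (𝓞 K ⧸ P)) := by
    intro t
    obtain ⟨t, rfl⟩ := Ideal.Quotient.mk_surjective t
    obtain ⟨a, b, hab⟩ := H.repr t
    obtain ⟨c, hc⟩ := hp.odd_of_ne_two hp2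
    refine ⟨(c + 1) * (a + b * δ), ?_⟩
    have h1 : algebraMap ℤ (𝓞 K ⧸ P) ((c + 1) * (a + b * δ)) =
        Ideal.Quotient.mk P (((c + 1) * (a + b * δ) : ℤ) : 𝓞 K) := by simp
    rw [h1, Ideal.Quotient.eq]
    have h2 : (((c + 1) * (a + b * δ) : ℤ) : 𝓞 K) - t = p * t + (-((c + 1) * b)) * (s - δ) := by
      rw [hc]; push_cast
      linear_combination (-(c + 1) : 𝓞 K) * hab
    rw [h2]
    exact P.add_mem (P.mul_mem_right _ hpP) (P.mul_mem_left _ hδ)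
  have hker : RingHom.ker (algebraMap ℤ (𝓞 K ⧸ P)) = Ideal.span {(p : ℤ)} := by
    ext n
    rw [RingHom.mem_ker, Ideal.mem_span_singleton, ← Ideal.intCast_mem_iff_dvd hP hp hpP,
      ← Ideal.Quotient.eq_zero_iff_mem]
    simp
  have e := ((RingHom.quotientKerEquivOfSurjective hsurj).symm.trans
    (Ideal.quotEquivOfEq hker)).trans (Int.quotientSpanEquivZMod p)
  rw [Ideal.absNorm_apply, Submodule.cardQuot_apply, Nat.card_congr e.toEquiv, Nat.card_zmod,
    Int.natAbs_natCast]

lemma absNorm_dvd_sq {P : Ideal (𝓞 K)} {p : ℕ} (hpP : (p : 𝓞 K) ∈ P) :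
    Ideal.absNorm P ∣ p ^ 2 := by
  rw [← H.absNorm_natCast]
  exact map_dvd Ideal.absNorm (Ideal.dvd_span_singleton.mpr hpP)

lemma dvd_of_mem {P : Ideal (𝓞 K)} (hP : P ≠ ⊤) {p : ℕ}
    (hp : p.Prime) (hpP : (p : 𝓞 K) ∈ P) {δ : ℤ} (hδ : s - δ ∈ P) : (p : ℤ) ∣ δ ^ 2 - D := by
  rw [← Ideal.intCast_mem_iff_dvd hP hp hpP]
  have : ((δ ^ 2 - D : ℤ) : 𝓞 K) = -(s + δ) * (s - δ) := by
    push_cast; linear_combination H.sq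
  rw [this]
  exact P.mul_mem_left _ hδ

/-- A prime `p` modulo which `D` is a nonzero square splits into two primes. -/
lemma exists_split {P : Ideal (𝓞 K)} (hP : P.IsPrime) {p : ℕ} (hp : p.Prime) (hp2 : p ≠ 2)
    (hpD : ¬ (p : ℤ) ∣ D) (hpP : (p : 𝓞 K) ∈ P) {δ : ℤ} (hδ : s - δ ∈ P) :
    ∃ Q : Ideal (𝓞 K), Q.IsPrime ∧ (p : 𝓞 K) ∈ Q ∧ s - (-δ : ℤ) ∈ Q ∧
      Ideal.span {(p : 𝓞 K)} = P * Q := by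
  obtain ⟨σ, hσ, hσσ⟩ := H.conj
  have hpi := Nat.prime_iff_prime_int.mp hp
  set Q := P.comap σ with hQ
  have hQP : Q.IsPrime := Ideal.comap_isPrime σ P
  have hpQ : (p : 𝓞 K) ∈ Q := by rw [hQ, Ideal.mem_comap, map_natCast]; exact hpP
  have hδQ : s - (-δ : ℤ) ∈ Q := by
    rw [hQ, Ideal.mem_comap, map_sub, hσ, map_intCast]
    have : -s - ((-δ : ℤ) : 𝓞 K) = -(s - δ) := by push_cast; ring
    rw [this]; exact P.neg_mem hδ
  refine ⟨Q, hQP, hpQ, hδQ, ?_⟩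
  have hp0 : (p : 𝓞 K) ≠ 0 := by exact_mod_cast hp.ne_zero
  have hP0 : P ≠ ⊥ := by rintro rfl; exact hp0 (by simpa using hpP)
  have hQ0 : Q ≠ ⊥ := by intro h; rw [h] at hpQ; exact hp0 (by simpa using hpQ)
  have hne : P ≠ Q := by
    intro h
    rw [← h] at hδQ
    have h1 : ((2 * δ : ℤ) : 𝓞 K) ∈ P := by
      have : ((2 * δ : ℤ) : 𝓞 K) = (s - (-δ : ℤ)) - (s - δ) := by push_cast; ring
      rw [this]; exact P.sub_mem hδQ hδ
    rw [Ideal.intCast_mem_iff_dvd hP.ne_top hp hpP] at h1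
    rcases hpi.dvd_or_dvd h1 with h1 | h1
    · exact hp2 ((Nat.prime_dvd_prime_iff_eq hp Nat.prime_two).mp (by exact_mod_cast h1))
    · apply hpD
      have h2 := H.dvd_of_mem hP.ne_top hp hpP hδ
      have h3 : D = δ ^ 2 - (δ ^ 2 - D) := by ring
      rw [h3]
      exact dvd_sub (dvd_pow h1 two_ne_zero) h2
  have hPm : P.IsMaximal := hP.isMaximal hP0
  have hQm : Q.IsMaximal := hQP.isMaximal hQ0
  have hcop : IsCoprime P Q := Ideal.isCoprime_of_isMaximal hne
  obtain ⟨R, hR⟩ := hcop.mul_dvd (Ideal.dvd_span_singleton.mpr hpP)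
    (Ideal.dvd_span_singleton.mpr hpQ)
  have h1 := congrArg Ideal.absNorm hR
  rw [map_mul, map_mul, H.absNorm_natCast, H.absNorm_eq hP.ne_top hp hp2 hpP hδ,
    H.absNorm_eq hQP.ne_top hp hp2 hpQ hδQ, ← pow_two] at h1
  have h2 : Ideal.absNorm R = 1 := by
    have : p ^ 2 ≠ 0 := pow_ne_zero _ hp.ne_zero
    exact (mul_eq_left₀ this).mp h1.symm
  rw [Ideal.absNorm_eq_one_iff] at h2
  rw [hR, h2, Ideal.mul_top]

end QuadData

end

section

open NumberField UniqueFactorizationMonoid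

namespace CubicSymbol

/-- The conditions on `x + y√(-3 * D)` ensuring that it gives rise to a cubic character of the class
group of `ℚ(√D)`. -/
structure SymbolData (D x y m : ℤ) (M : ℕ) : Prop where
  coprime : IsCoprime x y
  two : ¬ (2 : ℤ) ∣ x
  three : ¬ (3 : ℤ) ∣ x
  dvd : (972 : ℤ) ∣ y
  cube : x ^ 2 + 3 * D * y ^ 2 = m ^ 3
  dvd_mod : 6 * D * m ∣ M
  ne_zero : M ≠ 0

variable {K : Type*} [Field K] [NumberField K]

open Classical in
/-- The cubic symbol of `x + yδ√-3` at the prime below `P`, where `s ≡ δ` modulo `P`. -/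
noncomputable def symI (s : 𝓞 K) (x y : ℤ) (M : ℕ) (P : Ideal (𝓞 K)) : ZMod 3 :=
  if h : ∃ q : ℕ × ℤ, q.1.Prime ∧ ¬ q.1 ∣ M ∧ (q.1 : 𝓞 K) ∈ P ∧ s - q.2 ∈ P then
    sym h.choose.1 (el x (y * h.choose.2)) else 0

/-- The additive extension of `symI` to all ideals. -/
noncomputable def chi (s : 𝓞 K) (x y : ℤ) (M : ℕ) (I : Ideal (𝓞 K)) : ZMod 3 :=
  ((normalizedFactors I).map (symI s x y M)).sum

variable {s : 𝓞 K} {D x y m : ℤ} {M : ℕ}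

omit [NumberField K] in
lemma symI_eq {P : Ideal (𝓞 K)} (hP : P ≠ ⊤) {p : ℕ} (hp : p.Prime) (hpM : ¬ p ∣ M)
    (hpP : (p : 𝓞 K) ∈ P) {δ : ℤ} (hδ : s - δ ∈ P) : symI s x y M P = sym p (el x (y * δ)) := by
  have h : ∃ q : ℕ × ℤ, q.1.Prime ∧ ¬ q.1 ∣ M ∧ (q.1 : 𝓞 K) ∈ P ∧ s - q.2 ∈ P :=
    ⟨(p, δ), hp, hpM, hpP, hδ⟩
  rw [symI, dif_pos h]
  obtain ⟨h1, h2, h3, h4⟩ := h.choose_spec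
  have hpq := Ideal.prime_unique hP h1 hp h3 hpP
  have := Fact.mk hp
  rw [hpq]
  apply sym_el_congr
  · simp
  · rw [← mul_sub]
    apply Dvd.dvd.mul_left
    rw [← Ideal.intCast_mem_iff_dvd hP hp hpP]
    have : ((h.choose.2 - δ : ℤ) : 𝓞 K) = (s - δ) - (s - h.choose.2) := by push_cast; ring
    rw [this]
    exact P.sub_mem hδ h4

omit [NumberField K] in
lemma symI_eq_zero {P : Ideal (𝓞 K)} (hP : P ≠ ⊤) {p : ℕ} (hp : p.Prime) (hpM : p ∣ M)
    (hpP : (p : 𝓞 K) ∈ P) : symI s x y M P = 0 := by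
  rw [symI, dif_neg]
  rintro ⟨q, h1, h2, h3, -⟩
  exact h2 (Ideal.prime_unique hP h1 hp h3 hpP ▸ hpM)

lemma chi_mul {I J : Ideal (𝓞 K)} (hI : I ≠ ⊥) (hJ : J ≠ ⊥) :
    chi s x y M (I * J) = chi s x y M I + chi s x y M J := by
  rw [chi, normalizedFactors_mul hI hJ, Multiset.map_add, Multiset.sum_add, chi, chi]

lemma chi_top : chi s x y M ⊤ = 0 := by
  rw [chi, ← Ideal.one_eq_top, normalizedFactors_one]; simp

lemma chi_pow {I : Ideal (𝓞 K)} (hI : I ≠ ⊥) (n : ℕ) :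
    chi s x y M (I ^ n) = n * chi s x y M I := by
  induction n with
  | zero => simp [Ideal.one_eq_top, chi_top]
  | succ n ih => rw [pow_succ, chi_mul (pow_ne_zero n hI) hI, ih]; push_cast; ring

lemma chi_prime {P : Ideal (𝓞 K)} (hP : P.IsPrime) (hP0 : P ≠ ⊥) :
    chi s x y M P = symI s x y M P := by
  rw [chi, normalizedFactors_irreducible (Ideal.prime_of_isPrime hP0 hP).irreducible]
  simp

lemma isPrime_of_mem_factors {I P : Ideal (𝓞 K)} (h : P ∈ normalizedFactors I) :
    P.IsPrime ∧ P ≠ ⊥ :=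
  ⟨Ideal.isPrime_of_prime (prime_of_normalized_factor P h), (prime_of_normalized_factor P h).ne_zero⟩

lemma SymbolData.dvd_of_prime_dvd (h : SymbolData D x y m M) {p : ℕ} :
    ((p : ℤ) ∣ D → p ∣ M) ∧ ((p : ℤ) ∣ m → p ∣ M) ∧ 6 ∣ M := by
  refine ⟨fun hp => ?_, fun hp => ?_, ?_⟩
  · exact_mod_cast hp.trans ((Dvd.intro_left (6 * m) (by ring)).trans h.dvd_mod)
  · exact_mod_cast hp.trans ((Dvd.intro_left (6 * D) (by ring)).trans h.dvd_mod)
  · have : ((6 : ℕ) : ℤ) ∣ M := Dvd.dvd.trans ⟨D * m, by push_cast; ring⟩ h.dvd_mod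
    exact_mod_cast this

/-- The norm of `x + yδ√-3` is prime to the primes not dividing the modulus. -/
lemma SymbolData.not_dvd_norm (h : SymbolData D x y m M) {p : ℕ} (hp : p.Prime) (hpM : ¬ p ∣ M)
    {δ : ℤ} (hδ : (p : ℤ) ∣ δ ^ 2 - D) : ¬ (p : ℤ) ∣ (el x (y * δ)).norm := by
  have hpi := Nat.prime_iff_prime_int.mp hp
  intro hd
  apply hpM
  apply h.dvd_of_prime_dvd.2.1
  apply hpi.dvd_of_dvd_pow (n := 3)
  have : m ^ 3 = (el x (y * δ)).norm - 3 * y ^ 2 * (δ ^ 2 - D) := by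
    rw [norm_el, ← h.cube]; ring
  rw [this]
  exact dvd_sub hd (hδ.mul_left _)

section

variable (H : QuadData s D) (h : SymbolData D x y m M)
include H h

lemma chi_natCast_prime {p : ℕ} (hp : p.Prime) : chi s x y M (Ideal.span {(p : 𝓞 K)}) = 0 := by
  by_cases hpM : p ∣ M
  · rw [chi]
    apply Multiset.sum_eq_zero
    intro a ha
    obtain ⟨P, hP, rfl⟩ := Multiset.mem_map.mp ha
    exact symI_eq_zero (isPrime_of_mem_factors hP).1.ne_top hp hpM
      (Ideal.dvd_span_singleton.mp (dvd_of_mem_normalizedFactors hP))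
  by_cases hex : ∃ (P : Ideal (𝓞 K)) (δ : ℤ), P.IsPrime ∧ (p : 𝓞 K) ∈ P ∧ s - δ ∈ P
  · obtain ⟨P, δ, hP, hpP, hδ⟩ := hex
    have := Fact.mk hp
    have hp2 : p ≠ 2 := by
      rintro rfl; exact hpM ((by norm_num : 2 ∣ 6).trans (h.dvd_of_prime_dvd (p := 2)).2.2)
    obtain ⟨Q, hQ, hpQ, hδQ, hPQ⟩ := H.exists_split hP hp hp2
      (fun hd => hpM (h.dvd_of_prime_dvd.1 hd)) hpP hδ
    have hd := H.dvd_of_mem hP.ne_top hp hpP hδ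
    have hp0 : (p : 𝓞 K) ≠ 0 := by exact_mod_cast hp.ne_zero
    have hP0 : P ≠ ⊥ := by rintro rfl; exact hp0 (by simpa using hpP)
    have hQ0 : Q ≠ ⊥ := by intro h; rw [h] at hpQ; exact hp0 (by simpa using hpQ)
    rw [hPQ, chi_mul hP0 hQ0, chi_prime hP hP0, chi_prime hQ hQ0,
      symI_eq hP.ne_top hp hpM hpP hδ, symI_eq hQ.ne_top hp hpM hpQ hδQ, mul_neg, ← star_el,
      sym_star, add_neg_cancel]
    · rintro rfl
      exact hpM ((by norm_num : 3 ∣ 6).trans (h.dvd_of_prime_dvd (p := 3)).2.2)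
    · exact h.not_dvd_norm hp hpM hd
  · rw [chi]
    apply Multiset.sum_eq_zero
    intro a ha
    obtain ⟨P, hP, rfl⟩ := Multiset.mem_map.mp ha
    rw [symI, dif_neg]
    rintro ⟨q, h1, h2, h3, h4⟩
    have hP' := (isPrime_of_mem_factors hP).1
    have hpP := (Ideal.dvd_span_singleton.mp (dvd_of_mem_normalizedFactors hP))
    exact hex ⟨P, q.2, hP', hpP, h4⟩

lemma chi_natCast {n : ℕ} (hn : n ≠ 0) : chi s x y M (Ideal.span {(n : 𝓞 K)}) = 0 := by
  induction n using Nat.recOnMul with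
  | zero => exact absurd rfl hn
  | one => simp [chi_top]
  | prime p hp => exact chi_natCast_prime H h hp
  | mul a b ha hb =>
    have ha0 := left_ne_zero_of_mul hn
    have hb0 := right_ne_zero_of_mul hn
    rw [Nat.cast_mul, ← Ideal.span_singleton_mul_span_singleton, chi_mul, ha ha0, hb hb0, add_zero]
    · simpa using ha0
    · simpa using hb0

lemma chi_intCast {n : ℤ} (hn : n ≠ 0) : chi s x y M (Ideal.span {(n : 𝓞 K)}) = 0 := by
  have h1 : Ideal.span {(n : 𝓞 K)} = Ideal.span {(n.natAbs : 𝓞 K)} := by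
    rcases Int.natAbs_eq n with h | h
    · conv_lhs => rw [h]
      simp
    · conv_lhs => rw [h]
      rw [Int.cast_neg, Ideal.span_singleton_neg]; simp
  rw [h1]
  exact chi_natCast H h (Int.natAbs_ne_zero.mpr hn)

omit [Field K] [NumberField K] H h in
lemma sum_eq_psi {α : Type*} (z : Eis) (f : α → ZMod 3) (N : α → ℕ) (S : Multiset α)
    (hN : ∀ P ∈ S, N P ≠ 0)
    (hS : ∀ P ∈ S, (f P = 0 ∧ ∀ q : ℕ, q.Prime → q ∣ N P → q ∣ M) ∨
      (Nat.Coprime (N P) M ∧ f P = psi z (N P))) :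
    ∃ A B : ℕ, (S.map N).prod = A * B ∧ A ≠ 0 ∧ Nat.Coprime A M ∧
      (∀ q : ℕ, q.Prime → q ∣ B → q ∣ M) ∧ (S.map f).sum = psi z A := by
  induction S using Multiset.induction_on with
  | empty => exact ⟨1, 1, by simp, one_ne_zero, by simp, fun q hq h =>
      absurd (Nat.dvd_one.mp h) hq.ne_one, by simp [psi_one]⟩
  | cons P S ih =>
    obtain ⟨A, B, h1, h2, h3, h4, h5⟩ := ih (fun P hP => hN P (Multiset.mem_cons_of_mem hP))
      (fun P hP => hS P (Multiset.mem_cons_of_mem hP))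
    rw [Multiset.map_cons, Multiset.prod_cons, Multiset.map_cons, Multiset.sum_cons, h1, h5]
    rcases hS P (Multiset.mem_cons_self _ _) with ⟨h6, h7⟩ | ⟨h6, h7⟩
    · refine ⟨A, N P * B, by ring, h2, h3, fun q hq hd => ?_, by rw [h6, zero_add]⟩
      exact (hq.dvd_mul.mp hd).elim (h7 q hq) (h4 q hq)
    · have hP0 := hN P (Multiset.mem_cons_self _ _)
      exact ⟨N P * A, B, by ring, mul_ne_zero hP0 h2, Nat.Coprime.mul_left h6 h3, h4,
        by rw [h7, psi_mul z hP0 h2]⟩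

lemma chi_primitive {u v : ℤ} (huv : IsCoprime u v) (hu : ¬ (3 : ℤ) ∣ u) (hv : ¬ (27 : ℤ) ∣ v)
    {a j : ℕ} (ha : |u ^ 2 - D * v ^ 2| = 2 ^ j * a) (hj : j = 0 ∨ ¬ (2 : ℤ) ∣ v)
    (haM : Nat.Coprime a M) : chi s x y M (Ideal.span {(u + v * s : 𝓞 K)}) = 0 := by
  have h6 := (h.dvd_of_prime_dvd (p := 2)).2.2
  have h2M : 2 ∣ M := (by norm_num : 2 ∣ 6).trans h6
  have ha0 : a ≠ 0 := by
    rintro rfl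
    rw [Nat.coprime_zero_left] at haM
    omega
  set η : 𝓞 K := u + v * s with hη
  have hNη : Ideal.absNorm (Ideal.span {η}) = 2 ^ j * a := by
    have := H.absNorm_add u v
    rw [ha] at this
    exact_mod_cast this
  have hη0 : Ideal.span {η} ≠ ⊥ := by
    rw [Ne, ← Ideal.absNorm_eq_zero_iff, hNη]; positivity
  set z := el (v * x) (-(u * y)) with hz
  obtain ⟨A, B, h1, h2, h3, h4, h5⟩ := sum_eq_psi (M := M) z (symI s x y M) Ideal.absNorm
    (normalizedFactors (Ideal.span {η})) (fun P hP => by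
      rw [Ne, Ideal.absNorm_eq_zero_iff]; exact (isPrime_of_mem_factors hP).2) (by
    intro P hP
    obtain ⟨hPp, hP0⟩ := isPrime_of_mem_factors hP
    have hηP : η ∈ P := Ideal.dvd_span_singleton.mp (dvd_of_mem_normalizedFactors hP)
    obtain ⟨p, hp, hpP, hpN⟩ := Ideal.exists_prime_mem hPp hP0
    have hpi := Nat.prime_iff_prime_int.mp hp
    by_cases hpM : p ∣ M
    · left
      refine ⟨symI_eq_zero hPp.ne_top hp hpM hpP, fun q hq hd => ?_⟩
      have := hq.dvd_of_dvd_pow (hd.trans (H.absNorm_dvd_sq hpP))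
      rwa [(Nat.prime_dvd_prime_iff_eq hq hp).mp this]
    · right
      have hp2 : p ≠ 2 := by rintro rfl; exact hpM h2M
      have hpv : ¬ (p : ℤ) ∣ v := by
        intro hd
        have h1 : (u : 𝓞 K) ∈ P := by
          have : (u : 𝓞 K) = η - v * s := by rw [hη]; ring
          rw [this]
          exact P.sub_mem hηP (P.mul_mem_right _
            ((Ideal.intCast_mem_iff_dvd hPp.ne_top hp hpP v).mpr hd))
        rw [Ideal.intCast_mem_iff_dvd hPp.ne_top hp hpP] at h1
        exact hpi.not_isUnit (huv.isUnit_of_dvd' h1 hd)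
      obtain ⟨e, w, hew⟩ := hpi.coprime_iff_not_dvd.mpr hpv
      have hewK : (e * p + w * v : 𝓞 K) = 1 := by exact_mod_cast congrArg (Int.cast (R := 𝓞 K)) hew
      have hδ : s - ((-(u * w) : ℤ) : 𝓞 K) ∈ P := by
        have : s - ((-(u * w) : ℤ) : 𝓞 K) = w * η + e * s * p := by
          rw [hη]; push_cast; linear_combination (-s) * hewK
        rw [this]
        exact P.add_mem (P.mul_mem_left _ hηP) (P.mul_mem_left _ hpP)
      have hN := H.absNorm_eq hPp.ne_top hp hp2 hpP hδ
      have := Fact.mk hp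
      rw [hN]
      refine ⟨(hp.coprime_iff_not_dvd).mpr hpM, ?_⟩
      rw [symI_eq hPp.ne_top hp hpM hpP hδ, psi_prime z hp, ← sym_intCast_mul (n := v) hpv,
        intCast_mul_el, hz]
      apply sym_el_congr
      · simp
      · refine ⟨e * (u * y), ?_⟩
        linear_combination (-(u * y)) * hew)
  rw [chi, h5]
  have hprod : ((normalizedFactors (Ideal.span {η})).map Ideal.absNorm).prod = 2 ^ j * a := by
    rw [← map_multiset_prod, (Ideal.prod_normalizedFactors_eq_self hη0), hNη]
  rw [hprod] at h1
  have hAa : A = a := by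
    apply Nat.dvd_antisymm
    · have : Nat.Coprime A (2 ^ j) := (h3.coprime_dvd_right h2M).pow_right _
      exact this.dvd_of_dvd_mul_left (h1 ▸ dvd_mul_right _ _)
    · have : Nat.Coprime a B := by
        by_contra hnc
        obtain ⟨q, hq, hqa, hqB⟩ := Nat.Prime.not_coprime_iff_dvd.mp hnc
        exact Nat.Prime.not_coprime_iff_dvd.mpr ⟨q, hq, hqa, h4 q hq hqB⟩ haM
      exact this.dvd_of_dvd_mul_right (h1 ▸ dvd_mul_left _ _)
  rw [hAa]
  exact psi_el_eq_zero h.coprime h.two h.three h.dvd h.cube H.sqf h.dvd_mod huv hu hv ha hj haM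

end

end CubicSymbol

namespace CubicSymbol

variable {K : Type*} [Field K] [NumberField K] {s : 𝓞 K} {D x y m : ℤ} {M : ℕ}

section

variable (H : QuadData s D) (h : SymbolData D x y m M)
include H h

lemma chi_eq_zero_of_not_dvd {γ : 𝓞 K} {u₀ v₀ : ℤ} (hγ : 2 * γ = u₀ + v₀ * s)
    (hN : Nat.Coprime (Ideal.absNorm (Ideal.span {γ})) M) (hu : ¬ (3 : ℤ) ∣ u₀)
    (hv : ¬ (27 : ℤ) ∣ v₀) : chi s x y M (Ideal.span {γ}) = 0 := by
  have h6 := (h.dvd_of_prime_dvd (p := 2)).2.2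
  have h2M : 2 ∣ M := (by norm_num : 2 ∣ 6).trans h6
  have h4N := H.four_mul_absNorm hγ
  set N := Ideal.absNorm (Ideal.span {γ}) with hNdef
  have hN2 : ¬ 2 ∣ N := fun hd => Nat.Prime.not_coprime_iff_dvd.mpr ⟨2, Nat.prime_two, hd, h2M⟩ hN
  have hγ0 : γ ≠ 0 := by
    rintro rfl
    apply hN2
    rw [hNdef]; simp
  obtain ⟨u, v, h1, h2, h3⟩ := extract_gcd u₀ v₀
  have huv : IsCoprime u v := (gcd_isUnit_iff _ _).mp h3
  set g := gcd u₀ v₀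
  have hg0 : g ≠ 0 := by intro hg; rw [hg, zero_mul] at h1; exact hu (h1 ▸ dvd_zero _)
  have hu' : ¬ (3 : ℤ) ∣ u := fun hd => hu (h1 ▸ hd.mul_left _)
  have hv' : ¬ (27 : ℤ) ∣ v := fun hd => hv (h2 ▸ hd.mul_left _)
  have hw : 4 * (N : ℤ) = g ^ 2 * |u ^ 2 - D * v ^ 2| := by
    rw [h4N, h1, h2, ← abs_sq g, ← abs_mul]; congr 1; ring
  have key : ∃ a j : ℕ, |u ^ 2 - D * v ^ 2| = 2 ^ j * a ∧ (j = 0 ∨ ¬ (2 : ℤ) ∣ v) ∧ a ∣ N := by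
    by_cases hg2 : (2 : ℤ) ∣ g
    · obtain ⟨c, hc⟩ := hg2
      refine ⟨(u ^ 2 - D * v ^ 2).natAbs, 0, by simp, Or.inl rfl, ?_⟩
      rw [← Int.natCast_dvd_natCast, Int.natCast_natAbs]
      refine ⟨c ^ 2, ?_⟩
      rw [hc] at hw
      linarith
    · have hcop : IsCoprime (4 : ℤ) (g ^ 2) := by
        have : IsCoprime ((2 : ℤ) ^ 2) (g ^ 2) :=
          (Int.prime_two.coprime_iff_not_dvd.mpr hg2).pow
        norm_num at this; exact this
      obtain ⟨a, ha⟩ := hcop.dvd_of_dvd_mul_left (hw ▸ dvd_mul_right _ _)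
      have ha0 : 0 ≤ a := by
        have := abs_nonneg (u ^ 2 - D * v ^ 2)
        rw [ha] at this; linarith
      lift a to ℕ using ha0
      refine ⟨a, 2, by rw [ha]; norm_num, Or.inr fun hd => ?_, ?_⟩
      · have h4 : (2 : ℤ) ∣ |u ^ 2 - D * v ^ 2| := ha ▸ (by norm_num : (2 : ℤ) ∣ 4).mul_right _
        rw [dvd_abs] at h4
        have h5 : (2 : ℤ) ∣ u ^ 2 := by
          have : u ^ 2 = (u ^ 2 - D * v ^ 2) + v * (D * v) := by ring
          rw [this]; exact dvd_add h4 (hd.mul_right _)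
        exact Int.prime_two.not_isUnit
          (huv.isUnit_of_dvd' (Int.prime_two.dvd_of_dvd_pow h5) hd)
      · rw [ha] at hw
        rw [← Int.natCast_dvd_natCast]
        exact ⟨g ^ 2, by linarith⟩
  obtain ⟨a, j, ha, hj, haN⟩ := key
  have h5 := chi_primitive H h huv hu' hv' ha hj (hN.coprime_dvd_left haN)
  have h6 : Ideal.span {((2 : ℤ) : 𝓞 K)} * Ideal.span {γ} =
      Ideal.span {(g : 𝓞 K)} * Ideal.span {(u + v * s : 𝓞 K)} := by
    rw [Ideal.span_singleton_mul_span_singleton, Ideal.span_singleton_mul_span_singleton]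
    congr 2
    push_cast
    rw [hγ, h1, h2]; push_cast; ring
  have h7 := congrArg (chi s x y M) h6
  have hη0 : (u + v * s : 𝓞 K) ≠ 0 := by
    intro h0
    have := (H.eq_zero_of_add_eq_zero h0).1
    exact hu' (this ▸ dvd_zero _)
  rw [chi_mul, chi_mul, chi_intCast H h two_ne_zero, chi_intCast H h hg0, h5] at h7
  · simpa using h7
  · simpa using hg0
  · simpa using hη0
  · simp
  · simpa using hγ0

omit h in
lemma absNorm_coprime_of {r t : ℤ} (hrt : ∀ p : ℕ, p.Prime → p ∣ M → ¬ (p : ℤ) ∣ r ^ 2 - D * t ^ 2) :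
    Nat.Coprime (Ideal.absNorm (Ideal.span {(r + t * s : 𝓞 K)})) M := by
  by_contra hc
  obtain ⟨p, hp, h1, h2⟩ := Nat.Prime.not_coprime_iff_dvd.mp hc
  apply hrt p hp h2
  rw [← dvd_abs, ← H.absNorm_add]
  exact_mod_cast h1

omit H in
lemma chi_mul_cube {γ τ : 𝓞 K} (hN : Nat.Coprime (Ideal.absNorm (Ideal.span {γ})) M)
    (hτ : Nat.Coprime (Ideal.absNorm (Ideal.span {τ})) M) :
    Nat.Coprime (Ideal.absNorm (Ideal.span {γ * τ ^ 3})) M ∧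
    chi s x y M (Ideal.span {γ * τ ^ 3}) = chi s x y M (Ideal.span {γ}) := by
  have h6 := (h.dvd_of_prime_dvd (p := 2)).2.2
  have hM1 : M ≠ 1 := by rintro rfl; norm_num at h6
  have hne {γ : 𝓞 K} (hN : Nat.Coprime (Ideal.absNorm (Ideal.span {γ})) M) :
      Ideal.span {γ} ≠ ⊥ := by
    intro h0
    rw [h0] at hN
    simp [hM1] at hN
  rw [← Ideal.span_singleton_mul_span_singleton, ← Ideal.span_singleton_pow, map_mul, map_pow]
  refine ⟨hN.mul_left (hτ.pow_left 3), ?_⟩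
  rw [chi_mul (hne hN) (pow_ne_zero _ (hne hτ)), chi_pow (hne hτ)]
  have : ((3 : ℕ) : ZMod 3) = 0 := by decide
  rw [this]; simp

/-- The character is trivial on principal ideals prime to the modulus. -/
theorem chi_span_eq_zero {γ : 𝓞 K} (hN : Nat.Coprime (Ideal.absNorm (Ideal.span {γ})) M) :
    chi s x y M (Ideal.span {γ}) = 0 := by
  have h3M : 3 ∣ M := (by norm_num : 3 ∣ 6).trans (h.dvd_of_prime_dvd (p := 2)).2.2
  obtain ⟨e, M', hM'3, hM'⟩ := Nat.exists_eq_pow_mul_and_not_dvd h.ne_zero 3 (by norm_num)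
  have hM'3' : ¬ (3 : ℤ) ∣ M' := by exact_mod_cast hM'3
  have hpM' {p : ℕ} (hp : p.Prime) (hpM : p ∣ M) : p = 3 ∨ (p : ℤ) ∣ M' := by
    rw [hM'] at hpM
    rcases hp.dvd_mul.mp hpM with h1 | h1
    · exact Or.inl ((Nat.prime_dvd_prime_iff_eq hp Nat.prime_three).mp (hp.dvd_of_dvd_pow h1))
    · exact Or.inr (by exact_mod_cast h1)
  have step1 {γ : 𝓞 K} {u v : ℤ} (hγ : 2 * γ = u + v * s) (hu : ¬ (3 : ℤ) ∣ u)
      (hN : Nat.Coprime (Ideal.absNorm (Ideal.span {γ})) M) :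
      chi s x y M (Ideal.span {γ}) = 0 := by
    by_cases hv : (27 : ℤ) ∣ v
    · have hτ : Nat.Coprime (Ideal.absNorm (Ideal.span {((1 : ℤ) + (3 * M' : ℤ) * s : 𝓞 K)})) M := by
        apply absNorm_coprime_of H
        intro p hp hpM hd
        have h1 : (p : ℤ) ∣ 3 * M' := by
          rcases hpM' hp hpM with rfl | h1
          · exact dvd_mul_right _ _
          · exact h1.mul_left _
        have h2 : (p : ℤ) ∣ 1 := by
          have : (1 : ℤ) = (1 ^ 2 - D * (3 * M') ^ 2) + 3 * M' * (D * (3 * M')) := by ring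
          rw [this]; exact dvd_add hd (h1.mul_right _)
        exact (Nat.prime_iff_prime_int.mp hp).not_isUnit (isUnit_of_dvd_one h2)
      obtain ⟨h1, h2⟩ := chi_mul_cube h hN hτ
      rw [← h2]
      obtain ⟨c, rfl⟩ := hv
      refine chi_eq_zero_of_not_dvd H h (u₀ := u * (1 + 27 * D * M' ^ 2) +
        27 * c * D * (9 * M' + 27 * D * M' ^ 3)) (v₀ := u * (9 * M' + 27 * D * M' ^ 3) +
        27 * c * (1 + 27 * D * M' ^ 2)) ?_ h1 ?_ ?_
      · push_cast at hγ ⊢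
        have e1 : (1 + 3 * M' * s : 𝓞 K) ^ 3 = (1 + 27 * D * M' ^ 2) +
            (9 * M' + 27 * D * M' ^ 3) * s := by
          linear_combination (27 * M' ^ 2 + 27 * M' ^ 3 * s : 𝓞 K) * H.sq
        rw [e1, ← mul_assoc, hγ]
        linear_combination ((27 * c) * (9 * M' + 27 * D * M' ^ 3) : 𝓞 K) * H.sq
      · intro hd
        apply hu
        have : u = (u * (1 + 27 * D * M' ^ 2) + 27 * c * D * (9 * M' + 27 * D * M' ^ 3)) -
          3 * (9 * u * D * M' ^ 2 + 9 * c * D * (9 * M' + 27 * D * M' ^ 3)) := by ring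
        rw [this]; exact dvd_sub hd (dvd_mul_right _ _)
      · intro hd
        have h3 : (3 : ℤ) ∣ u * M' := by
          have h4 : (27 : ℤ) ∣ 9 * (u * M') := by
            have : 9 * (u * M') = (u * (9 * M' + 27 * D * M' ^ 3) +
              27 * c * (1 + 27 * D * M' ^ 2)) - 27 * (u * D * M' ^ 3 +
              c * (1 + 27 * D * M' ^ 2)) := by ring
            rw [this]; exact dvd_sub hd (dvd_mul_right _ _)
          omega
        exact (Int.prime_three.dvd_or_dvd h3).elim hu hM'3'
    · exact chi_eq_zero_of_not_dvd H h hγ hN hu hv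
  obtain ⟨u, v, hγ⟩ := H.repr γ
  by_cases hu : (3 : ℤ) ∣ u
  · have h4N := H.four_mul_absNorm hγ
    have h3N : ¬ (3 : ℤ) ∣ D * v ^ 2 := by
      intro hd
      have h3 : (3 : ℤ) ∣ 4 * (Ideal.absNorm (Ideal.span {γ}) : ℤ) := by
        rw [h4N, dvd_abs]
        exact dvd_sub (dvd_pow hu two_ne_zero) hd
      refine Nat.Prime.not_coprime_iff_dvd.mpr ⟨3, Nat.prime_three, ?_, h3M⟩ hN
      omega
    have hD3 : ¬ (3 : ℤ) ∣ D := fun hd => h3N (hd.mul_right _)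
    have hv3 : ¬ (3 : ℤ) ∣ v := fun hd => h3N ((dvd_pow hd two_ne_zero).mul_left _)
    have hτ : Nat.Coprime (Ideal.absNorm (Ideal.span {((3 : ℤ) + (M' : ℤ) * s : 𝓞 K)})) M := by
      apply absNorm_coprime_of H
      intro p hp hpM hd
      have hpi := Nat.prime_iff_prime_int.mp hp
      rcases hpM' hp hpM with rfl | h1
      · have h3 : ((3 : ℕ) : ℤ) ∣ D * M' ^ 2 := by
          have : D * M' ^ 2 = 3 * 3 - (3 ^ 2 - D * M' ^ 2) := by ring
          rw [this]; exact dvd_sub (dvd_mul_right _ _) hd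
        rcases hpi.dvd_or_dvd h3 with h3 | h3
        · exact hD3 h3
        · exact hM'3' (hpi.dvd_of_dvd_pow h3)
      · have h3 : (p : ℤ) ∣ 3 ^ 2 := by
          have : (3 : ℤ) ^ 2 = (3 ^ 2 - D * M' ^ 2) + M' * (D * M') := by ring
          rw [this]; exact dvd_add hd (h1.mul_right _)
        have h3 := (Nat.prime_dvd_prime_iff_eq hp Nat.prime_three).mp
          (by exact_mod_cast hpi.dvd_of_dvd_pow h3)
        subst h3
        exact hM'3' h1
    obtain ⟨h1, h2⟩ := chi_mul_cube h hN hτ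
    rw [← h2]
    refine step1 (u := u * (27 + 9 * D * M' ^ 2) + v * D * (27 * M' + D * M' ^ 3))
      (v := u * (27 * M' + D * M' ^ 3) + v * (27 + 9 * D * M' ^ 2)) ?_ ?_ h1
    · push_cast at hγ ⊢
      have e1 : (3 + M' * s : 𝓞 K) ^ 3 = (27 + 9 * D * M' ^ 2) +
          (27 * M' + D * M' ^ 3) * s := by
        linear_combination (9 * M' ^ 2 + M' ^ 3 * s : 𝓞 K) * H.sq
      rw [e1, ← mul_assoc, hγ]
      linear_combination (v * (27 * M' + D * M' ^ 3) : 𝓞 K) * H.sq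
    · intro hd
      have h3 : (3 : ℤ) ∣ v * D * (D * M' ^ 3) := by
        have : v * D * (D * M' ^ 3) = (u * (27 + 9 * D * M' ^ 2) +
          v * D * (27 * M' + D * M' ^ 3)) - 3 * (u * (9 + 3 * D * M' ^ 2) +
          v * D * (9 * M')) := by ring
        rw [this]; exact dvd_sub hd (dvd_mul_right _ _)
      have p3 := Int.prime_three
      rcases p3.dvd_or_dvd h3 with h3 | h3
      · exact (p3.dvd_or_dvd h3).elim hv3 hD3
      · exact (p3.dvd_or_dvd h3).elim hD3 fun h => hM'3' (p3.dvd_of_dvd_pow h)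
  · exact step1 hγ hu hN

omit h in
/-- Every ideal class contains an ideal prime to `M`. -/
lemma exists_coprime_ideal (hM : M ≠ 0) (hM1 : M ≠ 1) (c : ClassGroup (𝓞 K)) :
    ∃ I : nonZeroDivisors (Ideal (𝓞 K)), ClassGroup.mk0 I = c ∧
      Nat.Coprime (Ideal.absNorm (I : Ideal (𝓞 K))) M := by
  obtain ⟨B, hB⟩ := ClassGroup.mk0_surjective c⁻¹
  have hB0 : (B : Ideal (𝓞 K)) ≠ 0 := nonZeroDivisors.coe_ne_zero B
  have hM0 : Ideal.span {(M : 𝓞 K)} ≠ 0 := by simpa using hM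
  obtain ⟨a, ha⟩ := IsDedekindDomain.exists_sup_span_eq (I := (B : Ideal (𝓞 K)) * Ideal.span {(M : 𝓞 K)})
    (J := (B : Ideal (𝓞 K))) Ideal.mul_le_left (mul_ne_zero hB0 hM0)
  have haB : Ideal.span {a} ≤ (B : Ideal (𝓞 K)) := le_sup_right.trans ha.le
  obtain ⟨A, hA⟩ := Ideal.dvd_iff_le.mpr haB
  have hAM : Ideal.span {(M : 𝓞 K)} ⊔ A = ⊤ := by
    rw [hA, ← Ideal.mul_sup] at ha
    conv_rhs at ha => rw [← Ideal.mul_top (B : Ideal (𝓞 K))]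
    exact mul_left_cancel₀ hB0 ha
  have hA0 : A ≠ ⊥ := by
    rintro rfl
    rw [sup_bot_eq] at hAM
    have := congrArg Ideal.absNorm hAM
    rw [H.absNorm_natCast, Ideal.absNorm_top] at this
    exact hM1 (by simpa using this)
  refine ⟨⟨A, mem_nonZeroDivisors_of_ne_zero hA0⟩, ?_, ?_⟩
  · have h1 : ClassGroup.mk0 (B * ⟨A, mem_nonZeroDivisors_of_ne_zero hA0⟩) = 1 := by
      exact (ClassGroup.mk0_eq_one_iff (mem_nonZeroDivisors_of_ne_zero
        (mul_ne_zero hB0 hA0))).mpr ⟨a, hA.symm⟩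
    rw [map_mul, hB] at h1
    exact (inv_mul_eq_one.mp h1).symm
  · by_contra hc
    obtain ⟨p, hp, h1, h2⟩ := Nat.Prime.not_coprime_iff_dvd.mp hc
    change p ∣ Ideal.absNorm A at h1
    rw [← Ideal.prod_normalizedFactors_eq_self hA0, map_multiset_prod] at h1
    obtain ⟨P, hP, hpP⟩ := Prime.exists_mem_multiset_map_dvd hp.prime h1
    obtain ⟨hPp, hP0⟩ := isPrime_of_mem_factors hP
    obtain ⟨q, hq, hqP, -⟩ := Ideal.exists_prime_mem hPp hP0
    have hpq := (Nat.prime_dvd_prime_iff_eq hp hq).mp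
      (hp.dvd_of_dvd_pow (hpP.trans (H.absNorm_dvd_sq hqP)))
    subst hpq
    apply hPp.ne_top
    rw [eq_top_iff, ← hAM, sup_le_iff]
    refine ⟨?_, Ideal.dvd_iff_le.mp (dvd_of_mem_normalizedFactors hP)⟩
    rw [Ideal.span_singleton_le_iff_mem]
    obtain ⟨c, rfl⟩ := h2
    rw [Nat.cast_mul]
    exact P.mul_mem_right _ hqP

/-- The character takes equal values on equivalent ideals prime to the modulus. -/
lemma chi_eq_of_mk0_eq {I J : nonZeroDivisors (Ideal (𝓞 K))}
    (hIJ : ClassGroup.mk0 I = ClassGroup.mk0 J) (hI : Nat.Coprime (Ideal.absNorm I.1) M)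
    (hJ : Nat.Coprime (Ideal.absNorm J.1) M) : chi s x y M I = chi s x y M J := by
  have hM1 : M ≠ 1 := by
    have h6 := (h.dvd_of_prime_dvd (p := 2)).2.2
    rintro rfl; norm_num at h6
  obtain ⟨A, hA, hAM⟩ := exists_coprime_ideal H h.ne_zero hM1 (ClassGroup.mk0 I)⁻¹
  have key (J : nonZeroDivisors (Ideal (𝓞 K))) (hJI : ClassGroup.mk0 J = ClassGroup.mk0 I)
      (hJ : Nat.Coprime (Ideal.absNorm J.1) M) : chi s x y M J + chi s x y M A = 0 := by
    have h1 : ClassGroup.mk0 (J * A) = 1 := by rw [map_mul, hA, hJI, mul_inv_cancel]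
    have hJ0 := nonZeroDivisors.coe_ne_zero J
    have hA0 := nonZeroDivisors.coe_ne_zero A
    obtain ⟨a, ha⟩ := (ClassGroup.mk0_eq_one_iff (mem_nonZeroDivisors_of_ne_zero
      (mul_ne_zero hJ0 hA0))).mp h1
    rw [← chi_mul hJ0 hA0]
    have ha' : (J : Ideal (𝓞 K)) * A = Ideal.span {a} := ha
    rw [ha']
    apply chi_span_eq_zero H h
    rw [← ha', map_mul]
    exact hJ.mul_left hAM
  have h1 := key I rfl hI
  rw [← key J hIJ.symm hJ] at h1
  exact add_right_cancel h1

/-- The character of the class group attached to `x + y√(-3 * D)`. -/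
lemma exists_hom : ∃ f : ClassGroup (𝓞 K) →* Multiplicative (ZMod 3),
    ∀ I : nonZeroDivisors (Ideal (𝓞 K)), Nat.Coprime (Ideal.absNorm I.1) M →
      f (ClassGroup.mk0 I) = Multiplicative.ofAdd (chi s x y M I) := by
  have hM1 : M ≠ 1 := by
    have h6 := (h.dvd_of_prime_dvd (p := 2)).2.2
    rintro rfl; norm_num at h6
  choose A hA hAM using exists_coprime_ideal H h.ne_zero hM1
  refine ⟨MonoidHom.mk' (fun c => Multiplicative.ofAdd (chi s x y M (A c))) ?_, ?_⟩
  · intro c d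
    rw [← ofAdd_add, ← chi_mul (nonZeroDivisors.coe_ne_zero _) (nonZeroDivisors.coe_ne_zero _)]
    have : chi s x y M (A (c * d)) = chi s x y M (A c * A d : nonZeroDivisors (Ideal (𝓞 K))) := by
      apply chi_eq_of_mk0_eq H h
      · rw [map_mul, hA, hA, hA]
      · exact hAM _
      · change Nat.Coprime (Ideal.absNorm ((A c).1 * (A d).1)) M
        rw [map_mul]; exact (hAM c).mul_left (hAM d)
    rw [this]; rfl
  · intro I hI
    change Multiplicative.ofAdd (chi s x y M (A (ClassGroup.mk0 I))) = _
    rw [chi_eq_of_mk0_eq H h (hA _) (hAM _) hI]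

end

end CubicSymbol

end

namespace CubicSymbol

/-- The cubic resolvent of `X + Y √(-3 * D)`. -/
def resolvent {R : Type*} [CommRing R] (m X : ℤ) (t : R) : R := t ^ 3 - 3 * m * t - 2 * X

section

variable {F : Type*} [Field F] {m X : ℤ} {w c e g : F}

lemma resolvent_eq_prod (hw : w * w + w + 1 = 0) (hce : c * e = m)
    (hc : c ^ 3 = X + g) (he : e ^ 3 = X - g) (t : F) :
    resolvent m X t = (t - (c + e)) * (t - (c * w + e * w ^ 2)) * (t - (c * w ^ 2 + e * w)) := by
  have hw2 : w ^ 2 = -1 - w := by linear_combination hw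
  have h1 : (t - (c * w + e * w ^ 2)) * (t - (c * w ^ 2 + e * w))
      = t ^ 2 + t * (c + e) + c ^ 2 + e ^ 2 - c * e := by
    rw [hw2]
    linear_combination -(c - e) ^ 2 * hw
  have h2 : (t - (c + e)) * (t - (c * w + e * w ^ 2)) * (t - (c * w ^ 2 + e * w))
      = t ^ 3 - 3 * (c * e) * t - (c ^ 3 + e ^ 3) := by
    rw [mul_assoc, h1]; ring
  rw [h2, resolvent, hce, hc, he]; ring

lemma disc_eq (hw : w * w + w + 1 = 0) (hc : c ^ 3 = X + g) (he : e ^ 3 = X - g) :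
    ((c + e) - (c * w + e * w ^ 2)) * ((c * w + e * w ^ 2) - (c * w ^ 2 + e * w)) *
      ((c * w ^ 2 + e * w) - (c + e)) = -6 * (2 * w + 1) * g := by
  have hw2 : w ^ 2 = -1 - w := by linear_combination hw
  have h1 : ((c + e) - (c * w + e * w ^ 2)) * ((c * w ^ 2 + e * w) - (c + e))
      = -3 * (c ^ 2 + e ^ 2 + c * e) := by
    rw [hw2]; linear_combination (c - e) ^ 2 * hw
  have h2 : (c * w + e * w ^ 2) - (c * w ^ 2 + e * w) = (2 * w + 1) * (c - e) := by
    rw [hw2]; ring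
  have h3 : c ^ 3 - e ^ 3 = 2 * g := by rw [hc, he]; ring
  rw [mul_right_comm, h1, h2]
  linear_combination -3 * (2 * w + 1) * h3

lemma map_resolvent (φ : F →+* F) (t : F) : φ (resolvent m X t) = resolvent m X (φ t) := by
  simp only [resolvent, map_sub, map_mul, map_pow, map_ofNat, map_intCast]

/-- A root-permuting map negating the square root of the discriminant has a fixed root. -/
lemma exists_fixed {t₀ t₁ t₂ : F} (φ : F →+* F)
    (h₀ : φ t₀ = t₀ ∨ φ t₀ = t₁ ∨ φ t₀ = t₂) (h₁ : φ t₁ = t₀ ∨ φ t₁ = t₁ ∨ φ t₁ = t₂)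
    (h₂ : φ t₂ = t₀ ∨ φ t₂ = t₁ ∨ φ t₂ = t₂) (h : (2 : F) ≠ 0)
    (hP : (t₀ - t₁) * (t₁ - t₂) * (t₂ - t₀) ≠ 0)
    (hφ : φ ((t₀ - t₁) * (t₁ - t₂) * (t₂ - t₀)) = -((t₀ - t₁) * (t₁ - t₂) * (t₂ - t₀))) :
    φ t₀ = t₀ ∨ φ t₁ = t₁ ∨ φ t₂ = t₂ := by
  have h01 : t₀ ≠ t₁ := fun h => hP (by rw [h]; ring)
  have h12 : t₁ ≠ t₂ := fun h => hP (by rw [h]; ring)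
  have h20 : t₂ ≠ t₀ := fun h => hP (by rw [h]; ring)
  have i01 := φ.injective.ne h01
  have i12 := φ.injective.ne h12
  have i20 := φ.injective.ne h20
  by_contra! hn
  have key : φ ((t₀ - t₁) * (t₁ - t₂) * (t₂ - t₀)) = (t₀ - t₁) * (t₁ - t₂) * (t₂ - t₀) := by
    simp only [map_mul, map_sub]
    rcases h₀ with h₀ | h₀ | h₀ <;> rcases h₁ with h₁ | h₁ | h₁ <;> rcases h₂ with h₂ | h₂ | h₂ <;>
      first
        | exact absurd h₀ hn.1
        | exact absurd h₁ hn.2.1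
        | exact absurd h₂ hn.2.2
        | exact absurd (h₀.trans h₁.symm) i01
        | exact absurd (h₁.trans h₂.symm) i12
        | exact absurd (h₂.trans h₀.symm) i20
        | (rw [h₀, h₁, h₂]; ring)
  rw [key] at hφ
  exact hP ((mul_eq_zero.mp (show (2 : F) * _ = 0 by linear_combination hφ)).resolve_left h)

/-- A map of order two on the roots fixing the square root of the discriminant fixes the roots. -/
lemma forall_fixed {t₀ t₁ t₂ : F} (φ : F →+* F)
    (h₀ : φ t₀ = t₀ ∨ φ t₀ = t₁ ∨ φ t₀ = t₂) (h₁ : φ t₁ = t₀ ∨ φ t₁ = t₁ ∨ φ t₁ = t₂)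
    (h₂ : φ t₂ = t₀ ∨ φ t₂ = t₁ ∨ φ t₂ = t₂) (h : (2 : F) ≠ 0)
    (hP : (t₀ - t₁) * (t₁ - t₂) * (t₂ - t₀) ≠ 0)
    (hφ : φ ((t₀ - t₁) * (t₁ - t₂) * (t₂ - t₀)) = (t₀ - t₁) * (t₁ - t₂) * (t₂ - t₀))
    (hφφ₀ : φ (φ t₀) = t₀) :
    φ t₀ = t₀ ∧ φ t₁ = t₁ := by
  have h01 : t₀ ≠ t₁ := fun h => hP (by rw [h]; ring)
  have h12 : t₁ ≠ t₂ := fun h => hP (by rw [h]; ring)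
  have h20 : t₂ ≠ t₀ := fun h => hP (by rw [h]; ring)
  have i01 := φ.injective.ne h01
  have i12 := φ.injective.ne h12
  have i20 := φ.injective.ne h20
  by_contra! hn
  have key : φ ((t₀ - t₁) * (t₁ - t₂) * (t₂ - t₀)) = -((t₀ - t₁) * (t₁ - t₂) * (t₂ - t₀)) := by
    simp only [map_mul, map_sub]
    rcases h₀ with h₀ | h₀ | h₀ <;> rcases h₁ with h₁ | h₁ | h₁ <;> rcases h₂ with h₂ | h₂ | h₂ <;>
      first
        | exact absurd h₁ (hn h₀)
        | exact absurd (h₀.trans h₁.symm) i01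
        | exact absurd (h₁.trans h₂.symm) i12
        | exact absurd (h₂.trans h₀.symm) i20
        | (rw [h₀, h₁, h₂]; ring1)
        | (rw [h₀, h₁] at hφφ₀; exact absurd hφφ₀ h20)
        | (rw [h₀, h₂] at hφφ₀; exact absurd hφφ₀ h01.symm)
  rw [key] at hφ
  exact hP ((mul_eq_zero.mp (show (2 : F) * _ = 0 by linear_combination -hφ)).resolve_left h)

end

section

variable {p : ℕ} [hp : Fact p.Prime]

lemma exists_intCast_of_pow_eq {x : AlgebraicClosure (ZMod p)} (h : x ^ p = x) :
    ∃ a : ℤ, x = a := by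
  have h1 := (Subfield.mem_bot_iff_pow_eq_self (AlgebraicClosure (ZMod p)) p).mpr h
  obtain ⟨a, ha⟩ := (mem_bot_iff_intCast p _).mp h1
  exact ⟨a, ha.symm⟩

lemma resolvent_intCast {R : Type*} [CommRing R] (m X a : ℤ) :
    resolvent m X (a : R) = ((resolvent m X a : ℤ) : R) := by
  simp [resolvent]

lemma exists_resolvent_root {D X Y m : ℤ} (hcube : X ^ 2 + 3 * D * Y ^ 2 = m ^ 3)
    (hpn : ¬ (p : ℤ) ∣ 6 * m * D * Y)
    (hsym : ∀ δ : ℤ, (p : ℤ) ∣ δ ^ 2 - D → sym p (el X (Y * δ)) = 0) :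
    (∃ a : ℤ, (p : ℤ) ∣ resolvent m X a) ∧
    ∀ δ : ℤ, (p : ℤ) ∣ δ ^ 2 - D →
      ∃ a b : ℤ, (p : ℤ) ∣ resolvent m X a ∧ (p : ℤ) ∣ resolvent m X b ∧ ¬ (p : ℤ) ∣ a - b := by
  have cast0 : ∀ a : ℤ, (a : (AlgebraicClosure (ZMod p))) = 0 ↔ (p : ℤ) ∣ a := fun a => CharP.intCast_eq_zero_iff (AlgebraicClosure (ZMod p)) p a
  have hne : (6 * m * D * Y : (AlgebraicClosure (ZMod p))) ≠ 0 := by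
    have := (cast0 (6 * m * D * Y)).not.mpr hpn
    simpa only [Int.cast_mul, Int.cast_ofNat] using this
  have h6 : (6 : (AlgebraicClosure (ZMod p))) ≠ 0 := fun h => hne (by rw [h]; ring)
  have h2 : (2 : (AlgebraicClosure (ZMod p))) ≠ 0 := fun h => h6 (by linear_combination 3 * h)
  have h3 : (3 : (AlgebraicClosure (ZMod p))) ≠ 0 := fun h => h6 (by linear_combination 2 * h)
  have hm : (m : (AlgebraicClosure (ZMod p))) ≠ 0 := fun h => hne (by rw [h]; ring)
  have hD : (D : (AlgebraicClosure (ZMod p))) ≠ 0 := fun h => hne (by rw [h]; ring)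
  have hY : (Y : (AlgebraicClosure (ZMod p))) ≠ 0 := fun h => hne (by rw [h]; ring)
  have hp3 : p ≠ 3 := fun h => h3 (by
    have := (cast0 3).mpr (by rw [h]; rfl)
    exact_mod_cast this)
  obtain ⟨δ, hδ⟩ := IsAlgClosed.exists_pow_nat_eq (D : (AlgebraicClosure (ZMod p))) (n := 2) (by norm_num)
  have hδ0 : δ ≠ 0 := fun h => hD (by rw [← hδ, h]; ring)
  have hw := om_spec p
  set w := om p
  have hρ : (2 * w + 1) ^ 2 = -3 := by linear_combination 4 * hw
  have hρ0 : 2 * w + 1 ≠ 0 := fun h => h3 (by linear_combination hρ - (2 * w + 1) * h)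
  set g : (AlgebraicClosure (ZMod p)) := (2 * w + 1) * δ * Y with hg
  have hg2 : g ^ 2 = -3 * D * Y ^ 2 := by rw [hg, mul_pow, mul_pow, hρ, hδ]
  have hcube' : (X : (AlgebraicClosure (ZMod p))) ^ 2 + 3 * D * Y ^ 2 = m ^ 3 := by
    simpa using congrArg (Int.cast : ℤ → AlgebraicClosure (ZMod p)) hcube
  obtain ⟨c, hc⟩ := IsAlgClosed.exists_pow_nat_eq (X + g : (AlgebraicClosure (ZMod p))) (n := 3) (by norm_num)
  have hXg : (X + g) * (X - g) = (m : (AlgebraicClosure (ZMod p))) ^ 3 := by linear_combination hcube' - hg2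
  have hc0 : c ≠ 0 := fun h => by
    have : (X + g) = 0 := by rw [← hc, h]; ring
    rw [this, zero_mul] at hXg
    exact hm (pow_eq_zero_iff (by norm_num) |>.mp hXg.symm)
  set e : (AlgebraicClosure (ZMod p)) := m / c with he'
  have hce : c * e = m := mul_div_cancel₀ _ hc0
  have he : e ^ 3 = X - g := by
    have : c ^ 3 * e ^ 3 = c ^ 3 * (X - g) := by
      rw [← mul_pow, hce, hc, hXg]
    exact mul_left_cancel₀ (pow_ne_zero 3 hc0) this
  set t₀ := c + e with ht₀
  set t₁ := c * w + e * w ^ 2 with ht₁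
  set t₂ := c * w ^ 2 + e * w with ht₂
  have hprod : ∀ t, resolvent m X t = (t - t₀) * (t - t₁) * (t - t₂) :=
    resolvent_eq_prod hw hce hc he
  have hdisc : (t₀ - t₁) * (t₁ - t₂) * (t₂ - t₀) = -6 * (2 * w + 1) * g := disc_eq hw hc he
  have hdisc' : (t₀ - t₁) * (t₁ - t₂) * (t₂ - t₀) = 18 * Y * δ := by
    rw [hdisc, hg]; linear_combination (-6 * δ * Y) * hρ
  have hP : (t₀ - t₁) * (t₁ - t₂) * (t₂ - t₀) ≠ 0 := by
    rw [hdisc']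
    have : (18 : (AlgebraicClosure (ZMod p))) ≠ 0 := by
      have : (18 : (AlgebraicClosure (ZMod p))) = 3 * 6 := by norm_num
      rw [this]; exact mul_ne_zero h3 h6
    exact mul_ne_zero (mul_ne_zero this hY) hδ0
  have r₀ : resolvent m X t₀ = 0 := by rw [hprod]; ring
  have r₁ : resolvent m X t₁ = 0 := by rw [hprod]; ring
  have r₂ : resolvent m X t₂ = 0 := by rw [hprod]; ring
  set φ := frobenius (AlgebraicClosure (ZMod p)) p with hφ
  have perm : ∀ t, resolvent m X t = 0 → φ t = t₀ ∨ φ t = t₁ ∨ φ t = t₂ := fun t ht => by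
    have := map_resolvent (m := m) (X := X) φ t
    rw [ht, map_zero, hprod] at this
    rcases mul_eq_zero.mp this.symm with h | h
    · rcases mul_eq_zero.mp h with h | h
      · exact Or.inl (sub_eq_zero.mp h)
      · exact Or.inr (Or.inl (sub_eq_zero.mp h))
    · exact Or.inr (Or.inr (sub_eq_zero.mp h))
  have root_of : ∀ t, resolvent m X t = 0 → φ t = t → ∃ a : ℤ, t = a ∧ (p : ℤ) ∣ resolvent m X a :=
    fun t ht h => by
      obtain ⟨a, ha⟩ := exists_intCast_of_pow_eq (p := p) (x := t) h
      refine ⟨a, ha, ?_⟩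
      rw [← cast0, ← resolvent_intCast, ← ha, ht]
  have split : ∀ d : ℤ, (p : ℤ) ∣ d ^ 2 - D →
      ∃ a b : ℤ, (p : ℤ) ∣ resolvent m X a ∧ (p : ℤ) ∣ resolvent m X b ∧ ¬ (p : ℤ) ∣ a - b := by
    intro d₁ hd₁
    obtain ⟨d, hd, hdδ⟩ : ∃ d : ℤ, (p : ℤ) ∣ d ^ 2 - D ∧ δ = d := by
      have h1 : (d₁ : (AlgebraicClosure (ZMod p))) ^ 2 = D := by
        have := (cast0 _).mpr hd₁
        push_cast at this; exact sub_eq_zero.mp this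
      rcases sq_eq_sq_iff_eq_or_eq_neg.mp (hδ.trans h1.symm) with h | h
      · exact ⟨d₁, hd₁, h⟩
      · exact ⟨-d₁, by rwa [neg_sq], by rw [h]; push_cast; ring⟩
    have hz : ev p (el X (Y * d)) = c ^ 3 := by
      rw [ev_apply, hc, hg, hdδ, el]; push_cast; ring
    have hzs : ev p (star (el X (Y * d))) = e ^ 3 := by
      rw [star_el, ev_apply, he, hg, hdδ, el]; push_cast; ring
    have e1 := exp_mul_three hp3
    have hs := hsym d hd
    rw [sym_def, lg_eq_zero, res, hz, hzs, ← div_pow, ← pow_mul, mul_comm 3, e1] at hs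
    have e0 : e ≠ 0 := div_ne_zero hm hc0
    have hpp : 1 ≤ p ^ 2 := Nat.one_le_pow _ _ hp.out.pos
    have e2 : (c ^ 3) ^ (p ^ 2 - 1) = 1 := by
      have := ev_frob hp3 (el X (Y * d))
      rw [hz, ← Nat.sub_add_cancel hpp, pow_succ] at this
      exact mul_right_cancel₀ (pow_ne_zero 3 hc0) (this.trans (one_mul _).symm)
    have e3 : (m : (AlgebraicClosure (ZMod p))) ^ (p ^ 2 - 1) = 1 := by
      have h := ev_frob hp3 (m : Eis)
      rw [map_intCast, ← Nat.sub_add_cancel hpp, pow_succ] at h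
      exact mul_right_cancel₀ hm (h.trans (one_mul _).symm)
    have e4 : (c ^ 2) ^ (p ^ 2 - 1) = 1 := by
      have : c ^ 2 = c / e * m := by
        rw [← hce, sq, div_mul_eq_mul_div, eq_div_iff e0, mul_assoc]
      rw [this, mul_pow, hs, e3, one_mul]
    have e5 : c ^ (p ^ 2 - 1) = 1 := by
      have : c ^ 3 = c * c ^ 2 := by ring
      rwa [this, mul_pow, e4, mul_one] at e2
    have φφ : ∀ x, φ (φ x) = x ^ p ^ 2 := fun x => by
      simp only [hφ, frobenius_def]; rw [← pow_mul, sq]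
    have φc : φ (φ c) = c := by
      rw [φφ, ← Nat.sub_add_cancel hpp, pow_succ, e5, one_mul]
    have φm : ∀ n : ℤ, φ (n : (AlgebraicClosure (ZMod p))) = n := fun n => map_intCast φ n
    have φe : φ (φ e) = e := by rw [he', map_div₀, map_div₀, φc, φm, φm]
    have φt₀ : φ (φ t₀) = t₀ := by simp only [ht₀, map_add, φc, φe]
    have hφP : φ ((t₀ - t₁) * (t₁ - t₂) * (t₂ - t₀)) = (t₀ - t₁) * (t₁ - t₂) * (t₂ - t₀) := by
      rw [hdisc', hdδ, map_mul, map_mul, φm, φm, map_ofNat]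
    obtain ⟨f₀, f₁⟩ := forall_fixed φ (perm _ r₀) (perm _ r₁) (perm _ r₂) h2 hP hφP φt₀
    obtain ⟨a, ha, ha'⟩ := root_of _ r₀ f₀
    obtain ⟨b, hb, hb'⟩ := root_of _ r₁ f₁
    refine ⟨a, b, ha', hb', fun h => hP ?_⟩
    have := (cast0 _).mpr h
    push_cast at this
    rw [← ha, ← hb] at this
    rw [this]; ring
  refine ⟨?_, split⟩
  by_cases hsq : ∃ d : ℤ, (p : ℤ) ∣ d ^ 2 - D
  · obtain ⟨d, hd⟩ := hsq
    obtain ⟨a, -, ha, -⟩ := split d hd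
    exact ⟨a, ha⟩
  · have hφδ : φ δ = -δ := by
      have : (φ δ) ^ 2 = δ ^ 2 := by rw [← map_pow, hδ]; exact map_intCast φ D
      refine (sq_eq_sq_iff_eq_or_eq_neg.mp this).resolve_left fun h => hsq ?_
      obtain ⟨d, hd⟩ := exists_intCast_of_pow_eq (p := p) (x := δ) h
      refine ⟨d, (cast0 _).mp ?_⟩
      push_cast; rw [← hd, hδ, sub_self]
    have hφP : φ ((t₀ - t₁) * (t₁ - t₂) * (t₂ - t₀)) = -((t₀ - t₁) * (t₁ - t₂) * (t₂ - t₀)) := by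
      rw [hdisc', map_mul, map_mul, hφδ, map_intCast, map_ofNat]; ring
    rcases exists_fixed φ (perm _ r₀) (perm _ r₁) (perm _ r₂) h2 hP hφP with h | h | h
    · obtain ⟨a, -, ha⟩ := root_of _ r₀ h; exact ⟨a, ha⟩
    · obtain ⟨a, -, ha⟩ := root_of _ r₁ h; exact ⟨a, ha⟩
    · obtain ⟨a, -, ha⟩ := root_of _ r₂ h; exact ⟨a, ha⟩

end

end CubicSymbol

section

open Filter Topology

section

variable {q : ℕ} [NeZero q] {a : ZMod q}

open ArithmeticFunction vonMangoldt in
/-- The sum of the reciprocals of the primes in an arithmetic progression diverges. -/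
theorem not_summable_prime_residue (ha : IsUnit a) :
    ¬ Summable fun n : ℕ => if n.Prime ∧ (n : ZMod q) = a then (n : ℝ)⁻¹ else 0 := by
  intro hS
  set S : ℕ → ℝ := fun n => if n.Prime ∧ (n : ZMod q) = a then (n : ℝ)⁻¹ else 0 with hSdef
  have hS0 : ∀ n, 0 ≤ S n := fun n => by simp only [hSdef]; split_ifs <;> positivity
  obtain ⟨C, hC⟩ := LSeries_residueClass_lower_bound ha
  set φ : ℝ := (q.totient : ℝ)⁻¹ with hφ
  have hφ0 : 0 < φ := inv_pos.mpr (Nat.cast_pos.mpr (Nat.totient_pos.mpr q.pos_of_neZero))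
  obtain ⟨N, hN⟩ : ∃ N, ∑' n, S (n + N) < φ / 2 :=
    ((tendsto_sum_nat_add S).eventually_lt_const (half_pos hφ0)).exists
  set G : ℕ → ℝ := fun n => (if n.Prime then 0 else residueClass a n) / n with hG
  have hGs : Summable G := summable_residueClass_non_primes_div a
  set Kf : ℕ → ℝ := fun n => if n < N then Real.log n else 0 with hKf
  have hKs : Summable Kf := summable_of_hasFiniteSupport <| (Set.finite_lt_nat N).subset fun n hn => by
    by_contra h
    exact hn (if_neg h)
  set H : ℕ → ℝ := fun n => if N ≤ n then S n else 0 with hH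
  have hHs : Summable H := Summable.of_nonneg_of_le
    (fun n => by simp only [hH]; split_ifs; exacts [hS0 n, le_rfl])
    (fun n => by simp only [hH]; split_ifs; exacts [le_rfl, hS0 n]) hS
  have hHt : ∑' n, H n < φ / 2 := by
    rw [← hHs.sum_add_tsum_nat_add N, Finset.sum_eq_zero, zero_add]
    · simpa [hH] using hN
    · exact fun i hi => if_neg (not_le.mpr (Finset.mem_range.mp hi))
  have bound : ∀ η : ℝ, 0 < η → ∀ n : ℕ,
      residueClass a n / (n : ℝ) ^ (1 + η) ≤ G n + Kf n + η⁻¹ * H n := by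
    intro η hη n
    have hK0 : 0 ≤ Kf n := by
      simp only [hKf]; split_ifs
      exacts [Real.log_natCast_nonneg n, le_rfl]
    have hG0 : 0 ≤ G n := by
      simp only [hG]; split_ifs
      exacts [by simp, div_nonneg (residueClass_nonneg a n) n.cast_nonneg]
    have hH0 : 0 ≤ η⁻¹ * H n := by
      simp only [hH]; split_ifs
      exacts [mul_nonneg (inv_nonneg.mpr hη.le) (hS0 n), by simp]
    rcases Nat.eq_zero_or_pos n with rfl | hn
    · rw [residueClass_apply_zero, zero_div]; positivity
    have hn1 : (1 : ℝ) ≤ n := by exact_mod_cast hn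
    have hle : (n : ℝ) ≤ (n : ℝ) ^ (1 + η) := by
      conv_lhs => rw [← Real.rpow_one (n : ℝ)]
      exact Real.rpow_le_rpow_of_exponent_le hn1 (by linarith)
    by_cases hp : n.Prime
    · by_cases hna : (n : ZMod q) = a
      · have hr : residueClass a n = Real.log n := by
          rw [residueClass, Set.indicator_of_mem (by exact hna), vonMangoldt_apply_prime hp]
        rw [hr]
        by_cases hlt : n < N
        · have : Real.log n / (n : ℝ) ^ (1 + η) ≤ Kf n := by
            simp only [hKf, if_pos hlt]
            exact div_le_self (Real.log_natCast_nonneg n) (hn1.trans hle)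
          linarith
        · have : Real.log n / (n : ℝ) ^ (1 + η) ≤ η⁻¹ * H n := by
            simp only [hH, if_pos (not_lt.mp hlt), hSdef, if_pos (And.intro hp hna)]
            rw [Real.rpow_add (by positivity), Real.rpow_one, div_le_iff₀ (by positivity)]
            have h := Real.log_natCast_le_rpow_div n hη
            calc Real.log n ≤ (n : ℝ) ^ η / η := h
              _ = η⁻¹ * (n : ℝ)⁻¹ * (n * (n : ℝ) ^ η) := by field_simp
          linarith
      · have hr : residueClass a n = 0 := by
          rw [residueClass, Set.indicator_of_notMem (by exact hna)]
        rw [hr, zero_div]; positivity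
    · have : residueClass a n / (n : ℝ) ^ (1 + η) ≤ G n := by
        simp only [hG, if_neg hp]
        exact div_le_div_of_nonneg_left (residueClass_nonneg a n) (by positivity) hle
      linarith
  have main : ∀ η : ℝ, 0 < η → η ≤ 1 → φ / η - C ≤ ∑' n, G n + ∑' n, Kf n + η⁻¹ * (φ / 2) := by
    intro η hη hη1
    have h1 := hC (x := 1 + η) ⟨by linarith, by linarith⟩
    rw [add_sub_cancel_left] at h1
    have hs : Summable fun n => G n + Kf n + η⁻¹ * H n := (hGs.add hKs).add (hHs.mul_left _)
    have h2 : ∑' n, residueClass a n / (n : ℝ) ^ (1 + η) ≤ ∑' n, (G n + Kf n + η⁻¹ * H n) :=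
      (hs.of_nonneg_of_le (fun n => div_nonneg (residueClass_nonneg a n) (by positivity))
        (bound η hη)).tsum_le_tsum (bound η hη) hs
    rw [(hGs.add hKs).tsum_add (hHs.mul_left _), hGs.tsum_add hKs, tsum_mul_left] at h2
    have h3 : η⁻¹ * ∑' n, H n ≤ η⁻¹ * (φ / 2) :=
      mul_le_mul_of_nonneg_left hHt.le (inv_nonneg.mpr hη.le)
    linarith
  set E := C + ∑' n, G n + ∑' n, Kf n
  have h4 : ∀ η : ℝ, 0 < η → η ≤ 1 → φ / 2 ≤ η * E := fun η hη hη1 => by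
    have := main η hη hη1
    have h5 : φ / η - η⁻¹ * (φ / 2) ≤ E := by simp only [E]; linarith
    have h6 : φ / η - η⁻¹ * (φ / 2) = (φ / 2) / η := by field_simp; ring
    rw [h6, div_le_iff₀ hη] at h5
    linarith
  have hE : 0 < E := by have := h4 1 one_pos le_rfl; linarith
  have h7 := h4 (min 1 (φ / (4 * E))) (lt_min one_pos (by positivity)) (min_le_left _ _)
  have h8 : min 1 (φ / (4 * E)) * E ≤ φ / (4 * E) * E :=
    mul_le_mul_of_nonneg_right (min_le_right _ _) hE.le
  have h9 : φ / (4 * E) * E = φ / 4 := by field_simp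
  linarith

end

end

section

open Filter Topology NumberField

section

variable {K : Type*} [Field K] [NumberField K]

lemma Ideal.prod_injOn (T : Finset (Ideal (𝓞 K))) (hT : ∀ P ∈ T, P.IsPrime ∧ P ≠ ⊥) :
    Set.InjOn (fun U : Finset (Ideal (𝓞 K)) => ∏ P ∈ U, P) (T.powerset : Set _) := by
  have key : ∀ U V : Finset (Ideal (𝓞 K)), U ⊆ T → V ⊆ T → ∏ P ∈ U, P = ∏ P ∈ V, P → U ⊆ V := by
    intro U V hU hV h P hP
    have hPp := hT P (hU hP)
    have hd : P ∣ ∏ P ∈ V, P := h ▸ Finset.dvd_prod_of_mem _ hP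
    obtain ⟨Q, hQ, hPQ⟩ := ((Ideal.prime_iff_isPrime hPp.2).mpr hPp.1).exists_mem_finset_dvd hd
    have hQp := hT Q (hV hQ)
    have hm := hQp.1.isMaximal hQp.2
    rwa [← hm.eq_of_le hPp.1.ne_top (Ideal.dvd_iff_le.mp hPQ)]
  intro U hU V hV h
  rw [Finset.mem_coe, Finset.mem_powerset] at hU hV
  exact (key U V hU hV h).antisymm (key V U hV hU h.symm)

variable (K)

/-- Partial products of `∏ (1 + N(P)⁻ˢ)` are bounded by the Dedekind zeta function. -/
theorem exists_prod_one_add_absNorm_le : ∃ C : ℝ, ∀ᶠ s : ℝ in 𝓝[>] 1, ∀ T : Finset (Ideal (𝓞 K)),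
    (∀ P ∈ T, P.IsPrime ∧ P ≠ ⊥) →
      (s - 1) * ∏ P ∈ T, (1 + (Ideal.absNorm P : ℝ) ^ (-s)) ≤ C := by
  classical
  have ht := (Complex.continuous_re.tendsto _).comp (tendsto_sub_one_mul_dedekindZeta_nhdsGT K)
  have hpos := dedekindZeta_residue_pos K
  have h1 := ht.eventually (lt_mem_nhds (show 0 < _ by rwa [Complex.ofReal_re]))
  have h2 := ht.eventually (gt_mem_nhds (show _ < dedekindZeta_residue K * 2 by
    rw [Complex.ofReal_re]; linarith))
  refine ⟨dedekindZeta_residue K * 2, ?_⟩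
  filter_upwards [h1, h2, self_mem_nhdsWithin] with s hs1 hs2 hs T hT
  replace hs : 1 < s := hs
  set a : ℕ → ℕ := fun n => Nat.card {I : Ideal (𝓞 K) // Ideal.absNorm I = n} with ha
  set g : ℕ → ℝ := fun n => a n * (n : ℝ) ^ (-s) with hg
  have hg0 : ∀ n, 0 ≤ g n := fun n => by positivity
  have hterm : ∀ n, LSeries.term (fun n => (a n : ℂ)) s n = (g n : ℂ) := by
    intro n
    rw [LSeries.term_def]
    split_ifs with hn
    · rw [hg, hn]; simp [Real.zero_rpow (show -s ≠ 0 by linarith)]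
    · simp only [hg]
      push_cast
      rw [Complex.ofReal_cpow n.cast_nonneg, Complex.ofReal_neg, Complex.cpow_neg, div_eq_mul_inv,
        Complex.ofReal_natCast]
  have hz : dedekindZeta K s = ∑' n, (g n : ℂ) := by
    rw [dedekindZeta, LSeries]; exact tsum_congr hterm
  have hsum : Summable g := by
    by_contra hns
    have : ¬ Summable fun n => (g n : ℂ) := fun h => hns (Complex.summable_ofReal.mp h)
    simp only [Function.comp_apply, hz, tsum_eq_zero_of_not_summable this, mul_zero,
      Complex.zero_re, lt_irrefl] at hs1
  have hre : ((s - 1 : ℂ) * dedekindZeta K s).re = (s - 1) * ∑' n, g n := by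
    rw [hz, ← Complex.ofReal_tsum]
    norm_cast
  simp only [Function.comp_apply, hre] at hs2
  refine le_trans (mul_le_mul_of_nonneg_left ?_ (by linarith)) hs2.le
  have e1 : ∀ U ∈ T.powerset, ∏ P ∈ U, (Ideal.absNorm P : ℝ) ^ (-s) =
      ((Ideal.absNorm (∏ P ∈ U, P) : ℕ) : ℝ) ^ (-s) := fun U _ => by
    rw [Real.finsetProd_rpow _ _ fun _ _ => Nat.cast_nonneg _, map_prod, Nat.cast_prod]
  rw [Finset.prod_one_add, Finset.sum_congr rfl e1,
    ← Finset.sum_image (f := fun I : Ideal (𝓞 K) => ((Ideal.absNorm I : ℕ) : ℝ) ^ (-s))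
      (Ideal.prod_injOn T hT),
    Finset.sum_comp (fun n : ℕ => (n : ℝ) ^ (-s)) (fun I : Ideal (𝓞 K) => Ideal.absNorm I)]
  refine le_trans (Finset.sum_le_sum fun n _ => ?_) (hsum.sum_le_tsum _ fun n _ => hg0 n)
  rw [nsmul_eq_mul]
  refine mul_le_mul_of_nonneg_right ?_ (by positivity)
  rw [Nat.cast_le, ← Set.ncard_coe_finset]
  exact Set.ncard_le_ncard (fun I hI => (Finset.mem_filter.mp hI).2)
    (Ideal.finite_setOfPred_absNorm_eq n)

end

/-- Partial products of `∏ (1 + p⁻ˢ)` over the primes approximate the zeta function from below. -/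
theorem exists_le_prod_one_add_rpow : ∃ c : ℝ, 0 < c ∧ ∀ᶠ s : ℝ in 𝓝[>] 1, ∃ N : ℕ,
    c ≤ (s - 1) * ∏ p ∈ N.primesBelow, (1 + (p : ℝ) ^ (-s)) := by
  have E : ∀ s : ℝ, 1 < s → Tendsto (fun n : ℕ => ∏ p ∈ n.primesBelow, (1 - (p : ℝ) ^ (-s))⁻¹) atTop
      (𝓝 (riemannZeta s).re) := by
    intro s hs
    have := (Complex.continuous_re.tendsto _).comp
      (riemannZeta_eulerProduct (s := s) (by rwa [Complex.ofReal_re]))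
    refine this.congr fun n => ?_
    have : ∏ p ∈ n.primesBelow, (1 - (p : ℂ) ^ (-(s : ℂ)))⁻¹ =
        ((∏ p ∈ n.primesBelow, (1 - (p : ℝ) ^ (-s))⁻¹ : ℝ) : ℂ) := by
      push_cast
      refine Finset.prod_congr rfl fun p _ => ?_
      rw [Complex.ofReal_cpow p.cast_nonneg, Complex.ofReal_neg, Complex.ofReal_natCast]
    rw [Function.comp_apply, this, Complex.ofReal_re]
  have hlt : ∀ s : ℝ, 1 < s → ∀ {n p : ℕ}, p ∈ n.primesBelow → (p : ℝ) ^ (-s) < 1 :=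
    fun s hs n p hp => Real.rpow_lt_one_of_one_lt_of_neg
      (by exact_mod_cast (Nat.prime_of_mem_primesBelow hp).one_lt) (by linarith)
  obtain ⟨M, hM⟩ := (E 2 (by norm_num)).bddAbove_range
  have hM1 : 1 ≤ M := by
    have := hM ⟨0, rfl⟩; simpa using this
  have hres : Tendsto (fun s : ℝ => (s - 1) * (riemannZeta s).re) (𝓝[>] 1) (𝓝 1) := by
    have h := riemannZeta_residue_one
    have h2 : Tendsto (fun s : ℝ => (s : ℂ)) (𝓝[>] 1) (𝓝[≠] 1) := by
      refine tendsto_nhdsWithin_iff.mpr ⟨?_, ?_⟩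
      · exact (Complex.continuous_ofReal.tendsto' 1 1 Complex.ofReal_one).mono_left nhdsWithin_le_nhds
      · filter_upwards [self_mem_nhdsWithin] with s hs
        have : (s : ℝ) ≠ 1 := ne_of_gt hs
        exact fun h => this (Complex.ofReal_eq_one.mp h)
    have h3 := (Complex.continuous_re.tendsto _).comp (h.comp h2)
    refine h3.congr fun s => ?_
    simp only [Function.comp_apply]
    rw [← Complex.ofReal_one, ← Complex.ofReal_sub, Complex.re_ofReal_mul]
  refine ⟨1 / (2 * M), by positivity, ?_⟩
  filter_upwards [hres.eventually (lt_mem_nhds (show (1 / 2 : ℝ) < 1 by norm_num)),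
    self_mem_nhdsWithin] with s hs hs1
  replace hs1 : 1 < s := hs1
  obtain ⟨N, hN⟩ := (((E s hs1).const_mul (s - 1)).eventually (lt_mem_nhds hs)).exists
  refine ⟨N, ?_⟩
  have h4 : ∏ p ∈ N.primesBelow, (1 - (p : ℝ) ^ (-s))⁻¹ ≤
      (∏ p ∈ N.primesBelow, (1 + (p : ℝ) ^ (-s))) * M := by
    refine le_trans ?_ (mul_le_mul_of_nonneg_left (hM ⟨N, rfl⟩)
      (Finset.prod_nonneg fun p _ => by positivity))
    simp only
    rw [← Finset.prod_mul_distrib]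
    refine Finset.prod_le_prod (fun p hp => ?_) fun p hp => ?_
    · have := hlt s hs1 hp; exact inv_nonneg.mpr (by linarith)
    · have h5 := hlt s hs1 hp
      have h6 := hlt 2 (by norm_num) hp
      have hp1 : (1 : ℝ) < p := by exact_mod_cast (Nat.prime_of_mem_primesBelow hp).one_lt
      have h7 : (p : ℝ) ^ (-s) * (p : ℝ) ^ (-s) ≤ (p : ℝ) ^ (-2 : ℝ) := by
        rw [← Real.rpow_add (by positivity)]
        exact Real.rpow_le_rpow_of_exponent_le hp1.le (by linarith)
      rw [inv_eq_one_div, ← div_eq_mul_inv, div_le_div_iff₀ (by linarith) (by linarith)]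
      nlinarith
  have h8 : 1 / 2 ≤ (s - 1) * ((∏ p ∈ N.primesBelow, (1 + (p : ℝ) ^ (-s))) * M) :=
    hN.le.trans (mul_le_mul_of_nonneg_left h4 (by linarith))
  rw [div_le_iff₀ (by positivity)]
  linarith

/-- A number field cannot have a prime of norm `p` for almost all `p`, and two of them for almost
all `p` in an arithmetic progression. -/
theorem false_of_primes_of_prime_norm (K : Type*) [Field K] [NumberField K] {q : ℕ} [NeZero q]
    {a : ZMod q} (ha : IsUnit a) (bad : Finset ℕ)
    (h₁ : ∀ p : ℕ, p.Prime → p ∉ bad → ∃ P : Ideal (𝓞 K), P.IsPrime ∧ Ideal.absNorm P = p)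
    (h₂ : ∀ p : ℕ, p.Prime → p ∉ bad → (p : ZMod q) = a → ∃ P Q : Ideal (𝓞 K), P ≠ Q ∧
      P.IsPrime ∧ Q.IsPrime ∧ Ideal.absNorm P = p ∧ Ideal.absNorm Q = p) : False := by
  classical
  obtain ⟨C, hC⟩ := exists_prod_one_add_absNorm_le K
  obtain ⟨c, hc, hc'⟩ := exists_le_prod_one_add_rpow
  have h₁' : ∀ p : ℕ, ∃ P : Ideal (𝓞 K), p.Prime → p ∉ bad → P.IsPrime ∧ Ideal.absNorm P = p := by
    intro p
    by_cases h : p.Prime ∧ p ∉ bad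
    · obtain ⟨P, hP⟩ := h₁ p h.1 h.2; exact ⟨P, fun _ _ => hP⟩
    · exact ⟨⊥, fun ha hb => absurd ⟨ha, hb⟩ h⟩
  choose P hP using h₁'
  have h₂' : ∀ p : ℕ, ∃ Q : Ideal (𝓞 K), p.Prime → p ∉ bad → (p : ZMod q) = a →
      Q ≠ P p ∧ Q.IsPrime ∧ Ideal.absNorm Q = p := by
    intro p
    by_cases h : p.Prime ∧ p ∉ bad ∧ (p : ZMod q) = a
    · obtain ⟨A, B, hAB, hA, hB, hA', hB'⟩ := h₂ p h.1 h.2.1 h.2.2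
      by_cases hAP : A = P p
      · exact ⟨B, fun _ _ _ => ⟨fun hBP => hAB (hAP.trans hBP.symm), hB, hB'⟩⟩
      · exact ⟨A, fun _ _ _ => ⟨hAP, hA, hA'⟩⟩
    · exact ⟨⊥, fun ha hb hc => absurd ⟨ha, hb, hc⟩ h⟩
  choose Q hQ using h₂'
  have ne_bot : ∀ {I : Ideal (𝓞 K)} {p : ℕ}, p.Prime → Ideal.absNorm I = p → I ≠ ⊥ := by
    rintro I p hp hI rfl
    rw [Ideal.absNorm_bot] at hI
    exact hp.ne_zero hI.symm
  refine not_summable_prime_residue ha (summable_of_sum_le (c := 2 ^ bad.card * C / c +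
    ∑ p ∈ bad, (p : ℝ)⁻¹) (fun n => ?_) fun U => ?_)
  · split_ifs <;> positivity
  set V : Finset ℕ := U.filter fun p : ℕ => p.Prime ∧ (p : ZMod q) = a ∧ p ∉ bad with hV
  have hVp : ∀ {p}, p ∈ V → p.Prime := fun hp => (Finset.mem_filter.mp hp).2.1
  have hVa : ∀ {p}, p ∈ V → (p : ZMod q) = a := fun hp => (Finset.mem_filter.mp hp).2.2.1
  have hVb : ∀ {p}, p ∈ V → p ∉ bad := fun hp => (Finset.mem_filter.mp hp).2.2.2
  have hUV : ∑ p ∈ U, (if p.Prime ∧ (p : ZMod q) = a then (p : ℝ)⁻¹ else 0) ≤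
      ∑ p ∈ V, (p : ℝ)⁻¹ + ∑ p ∈ bad, (p : ℝ)⁻¹ := by
    rw [← Finset.sum_filter]
    refine le_trans (Finset.sum_le_sum_of_subset_of_nonneg (t := V ∪ bad) (fun p hp => ?_)
      fun _ _ _ => by positivity) ?_
    · rw [Finset.mem_filter] at hp
      by_cases hb : p ∈ bad
      · exact Finset.mem_union_right _ hb
      · exact Finset.mem_union_left _ (Finset.mem_filter.mpr ⟨hp.1, hp.2.1, hp.2.2, hb⟩)
    · rw [← Finset.sum_union_inter]
      exact le_add_of_nonneg_right (Finset.sum_nonneg fun _ _ => by positivity)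
  refine hUV.trans (add_le_add_left ?_ _)
  have hev : ∀ᶠ s : ℝ in 𝓝[>] 1, ∏ p ∈ V, (1 + (p : ℝ) ^ (-s)) ≤ 2 ^ bad.card * C / c := by
    filter_upwards [hC, hc', self_mem_nhdsWithin] with s hs ⟨N, hN⟩ hs1
    replace hs1 : 1 < s := hs1
    set B := N.primesBelow \ bad with hB
    have hBp : ∀ {p}, p ∈ B → p.Prime :=
      fun hp => Nat.prime_of_mem_primesBelow (Finset.mem_sdiff.mp hp).1
    have hBb : ∀ {p}, p ∈ B → p ∉ bad := fun hp => (Finset.mem_sdiff.mp hp).2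
    have iP : Set.InjOn P B := fun x hx y hy hxy => by
      rw [← (hP x (hBp hx) (hBb hx)).2, hxy, (hP y (hBp hy) (hBb hy)).2]
    have iQ : Set.InjOn Q V := fun x hx y hy hxy => by
      rw [← (hQ x (hVp hx) (hVb hx) (hVa hx)).2.2, hxy, (hQ y (hVp hy) (hVb hy) (hVa hy)).2.2]
    have hd : Disjoint (B.image P) (V.image Q) := by
      rw [Finset.disjoint_left]
      rintro I hI hI'
      obtain ⟨x, hx, rfl⟩ := Finset.mem_image.mp hI
      obtain ⟨y, hy, hxy⟩ := Finset.mem_image.mp hI'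
      have := hQ y (hVp hy) (hVb hy) (hVa hy)
      have e : y = x := by rw [← this.2.2, hxy, (hP x (hBp hx) (hBb hx)).2]
      subst e
      exact this.1 hxy
    have h := hs (B.image P ∪ V.image Q) (by
      intro I hI
      rcases Finset.mem_union.mp hI with hI | hI <;> obtain ⟨x, hx, rfl⟩ := Finset.mem_image.mp hI
      · have := hP x (hBp hx) (hBb hx)
        exact ⟨this.1, ne_bot (hBp hx) this.2⟩
      · have := hQ x (hVp hx) (hVb hx) (hVa hx)
        exact ⟨this.2.1, ne_bot (hVp hx) this.2.2⟩)
    have eP : ∀ x ∈ B, 1 + (Ideal.absNorm (P x) : ℝ) ^ (-s) = 1 + (x : ℝ) ^ (-s) := fun x hx => by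
      rw [(hP x (hBp hx) (hBb hx)).2]
    have eQ : ∀ x ∈ V, 1 + (Ideal.absNorm (Q x) : ℝ) ^ (-s) = 1 + (x : ℝ) ^ (-s) := fun x hx => by
      rw [(hQ x (hVp hx) (hVb hx) (hVa hx)).2.2]
    rw [Finset.prod_union hd, Finset.prod_image iP, Finset.prod_image iQ,
      Finset.prod_congr rfl eP, Finset.prod_congr rfl eQ] at h
    have hNB : ∏ p ∈ N.primesBelow, (1 + (p : ℝ) ^ (-s)) ≤
        2 ^ bad.card * ∏ p ∈ B, (1 + (p : ℝ) ^ (-s)) := by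
      rw [← Finset.prod_inter_mul_prod_sdiff N.primesBelow bad]
      refine mul_le_mul_of_nonneg_right ?_ (Finset.prod_nonneg fun _ _ => by positivity)
      calc ∏ p ∈ N.primesBelow ∩ bad, (1 + (p : ℝ) ^ (-s))
          ≤ ∏ p ∈ N.primesBelow ∩ bad, (2 : ℝ) := by
            refine Finset.prod_le_prod (fun _ _ => by positivity) fun p hp => ?_
            have hp1 : (1 : ℝ) ≤ p := by
              exact_mod_cast (Nat.prime_of_mem_primesBelow (Finset.mem_inter.mp hp).1).one_le
            have := Real.rpow_le_one_of_one_le_of_nonpos hp1 (show -s ≤ 0 by linarith)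
            linarith
        _ ≤ 2 ^ bad.card := by
            rw [Finset.prod_const]
            exact pow_le_pow_right₀ (by norm_num) (Finset.card_le_card Finset.inter_subset_right)
    have hV0 : 0 ≤ ∏ p ∈ V, (1 + (p : ℝ) ^ (-s)) := Finset.prod_nonneg fun _ _ => by positivity
    rw [le_div_iff₀ hc]
    calc (∏ p ∈ V, (1 + (p : ℝ) ^ (-s))) * c
        ≤ (∏ p ∈ V, (1 + (p : ℝ) ^ (-s))) *
          ((s - 1) * (2 ^ bad.card * ∏ p ∈ B, (1 + (p : ℝ) ^ (-s)))) :=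
          mul_le_mul_of_nonneg_left (hN.trans (mul_le_mul_of_nonneg_left hNB (by linarith))) hV0
      _ = 2 ^ bad.card * ((s - 1) * ((∏ p ∈ B, (1 + (p : ℝ) ^ (-s))) *
            ∏ p ∈ V, (1 + (p : ℝ) ^ (-s)))) := by ring
      _ ≤ 2 ^ bad.card * C := mul_le_mul_of_nonneg_left h (by positivity)
  have hlim : Tendsto (fun s : ℝ => ∏ p ∈ V, (1 + (p : ℝ) ^ (-s))) (𝓝[>] 1)
      (𝓝 (∏ p ∈ V, (1 + (p : ℝ) ^ (-1 : ℝ)))) := by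
    refine Tendsto.mono_left (tendsto_finsetProd _ fun p hp => ?_) nhdsWithin_le_nhds
    have hp0 : (p : ℝ) ≠ 0 := Nat.cast_ne_zero.mpr (hVp hp).ne_zero
    exact tendsto_const_nhds.add (tendsto_const_nhds.rpow tendsto_id.neg (Or.inl hp0))
  refine le_trans ?_ (le_of_tendsto hlim hev)
  simp only [Real.rpow_neg_one]
  have hle : ∀ V : Finset ℕ, 1 + ∑ p ∈ V, (p : ℝ)⁻¹ ≤ ∏ p ∈ V, (1 + (p : ℝ)⁻¹) := by
    intro V
    induction V using Finset.induction_on with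
    | empty => simp
    | insert p V hp ih =>
      rw [Finset.sum_insert hp, Finset.prod_insert hp]
      have h0 : (0 : ℝ) ≤ (p : ℝ)⁻¹ := by positivity
      have h1 : 0 ≤ ∑ p ∈ V, (p : ℝ)⁻¹ := Finset.sum_nonneg fun _ _ => by positivity
      nlinarith
  linarith [hle V]

end

section

open Polynomial NumberField

section

variable {K : Type*} [Field K] [NumberField K]

lemma NumberField.exponent_ne_zero (θ : 𝓞 K) (hθ : IntermediateField.adjoin ℚ {(θ : K)} = ⊤) :
    RingOfIntegers.exponent θ ≠ 0 := by
  classical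
  let B : PowerBasis ℚ K := PowerBasis.ofAdjoinEqTop' (IsIntegral.of_finite ℚ (θ : K)) <| by
    rw [← IntermediateField.adjoin_simple_toSubalgebra_of_isAlgebraic, hθ]
    · rfl
    · exact Algebra.IsAlgebraic.isAlgebraic (θ : K)
  have hB : B.gen = (θ : K) := PowerBasis.ofAdjoinEqTop'_gen ..
  have hint : IsIntegral ℤ B.gen := hB ▸ RingOfIntegers.isIntegral_coe θ
  obtain ⟨n, hn⟩ : ∃ n : ℤ, (n : ℚ) = Algebra.discr ℚ B.basis := by
    have := Algebra.discr_isIntegral ℚ (R := ℤ) (b := B.basis) fun i => by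
      rw [PowerBasis.coe_basis]; exact hint.pow _
    obtain ⟨n, hn⟩ := IsIntegrallyClosed.isIntegral_iff.mp this
    exact ⟨n, by simpa using hn⟩
  have hn0 : n ≠ 0 := by
    rintro rfl
    exact Algebra.discr_not_zero_of_basis ℚ B.basis (by rw [← hn]; simp)
  have hmem : (n.natAbs : 𝓞 K) ∈ conductor ℤ θ := by
    rw [mem_conductor_iff]
    intro b
    have h := Algebra.discr_mul_isIntegral_mem_adjoin ℚ hint (RingOfIntegers.isIntegral_coe b)
    have h' : (n : 𝓞 K) * b ∈ Algebra.adjoin ℤ {θ} := by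
      rw [← hn, hB] at h
      have hmap : Algebra.adjoin ℤ {(θ : K)} =
          (Algebra.adjoin ℤ {θ}).map (IsScalarTower.toAlgHom ℤ (𝓞 K) K) := by
        rw [AlgHom.map_adjoin, Set.image_singleton]; rfl
      rw [hmap] at h
      obtain ⟨z, hz, hz'⟩ := h
      have : z = n * b := by
        apply RingOfIntegers.ext
        have h2 : ((z : 𝓞 K) : K) = ((n : ℚ) • (b : K)) := hz'
        rw [h2, Algebra.smul_def]; simp
      rw [← this]; exact hz
    rcases Int.natAbs_eq n with hc | hc
    · rwa [show (n : 𝓞 K) = n.natAbs by rw [← Int.cast_natCast, ← hc]] at h'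
    · rw [show (n : 𝓞 K) = -n.natAbs by rw [← Int.cast_natCast, ← Int.cast_neg, ← hc]] at h'
      simpa using neg_mem h'
  rw [RingOfIntegers.exponent_eq_sInf]
  exact (Nat.sInf_mem (s := {d : ℕ | 0 < d ∧ (d : 𝓞 K) ∈ conductor ℤ θ})
    ⟨n.natAbs, Int.natAbs_pos.mpr hn0, hmem⟩).1.ne'

lemma Ideal.exists_absNorm_eq_prime {θ : 𝓞 K} {p : ℕ} [Fact p.Prime]
    (hp : ¬ p ∣ RingOfIntegers.exponent θ) {a : ℤ} (ha : (p : ℤ) ∣ (minpoly ℤ θ).eval a) :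
    ∃ P : Ideal (𝓞 K), P.IsPrime ∧ Ideal.absNorm P = p ∧ θ - a ∈ P := by
  classical
  set Q : ℤ[X] := X - C a with hQ
  have hmonic : (minpoly ℤ θ).Monic := minpoly.monic θ.isIntegral
  have hQ' : Q.map (Int.castRingHom (ZMod p)) ∈ RingOfIntegers.monicFactorsMod θ p := by
    rw [RingOfIntegers.monicFactorsMod, Multiset.mem_toFinset,
      Polynomial.mem_normalizedFactors_iff (hmonic.map _).ne_zero]
    have : Q.map (Int.castRingHom (ZMod p)) = X - C (a : ZMod p) := by simp [hQ]
    rw [this]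
    refine ⟨irreducible_X_sub_C _, monic_X_sub_C _, ?_⟩
    rw [dvd_iff_isRoot, IsRoot, eval_intCast_map, eq_intCast, ZMod.intCast_zmod_eq_zero_iff_dvd]
    simpa using ha
  have hspan := Ideal.primesOverSpanEquivMonicFactorsMod_symm_apply_eq_span hp hQ'
  have hdeg := Ideal.inertiaDeg_primesOverSpanEquivMonicFactorsMod_symm_apply hp hQ'
  set P := (Ideal.primesOverSpanEquivMonicFactorsMod hp).symm ⟨Q.map (Int.castRingHom (ZMod p)), hQ'⟩
  have hprime : P.1.IsPrime := P.2.1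
  have hlies : P.1.LiesOver (Ideal.span {(p : ℤ)}) := P.2.2
  refine ⟨P.1, hprime, ?_, ?_⟩
  · have := Ideal.natAbs_pow_inertiaDeg (p : ℤ) P.1
    rw [hdeg] at this
    have hd : (Q.map (Int.castRingHom (ZMod p))).natDegree = 1 := by
      rw [(monic_X_sub_C a).natDegree_map, natDegree_X_sub_C]
    rw [hd] at this
    simpa using this.symm
  · rw [hspan]
    apply Ideal.subset_span
    right
    simp [hQ]

end

namespace CubicSymbol

lemma exists_sq_sub_dvd {p : ℕ} [Fact p.Prime] {D : ℤ} (hD : D ≠ 0) (hp2 : p ≠ 2)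
    (hp : (p : ZMod (4 * D.natAbs)) = 1) : ∃ δ : ℤ, (p : ℤ) ∣ δ ^ 2 - D := by
  have hpp : p.Prime := Fact.out
  have hodd : Odd p := hpp.odd_of_ne_two hp2
  have hpos : 1 < 4 * D.natAbs := by have := Int.natAbs_pos.mpr hD; omega
  have hmod : p % (4 * D.natAbs) = 1 := by
    have : (p : ZMod (4 * D.natAbs)) = ((1 : ℕ) : ZMod (4 * D.natAbs)) := by simpa using hp
    rw [ZMod.natCast_eq_natCast_iff'] at this
    rwa [Nat.mod_eq_of_lt hpos] at this
  have hJ : jacobiSym D p = 1 := by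
    rw [jacobiSym.mod_right _ hodd, hmod, jacobiSym.one_right]
  rw [← jacobiSym.legendreSym.to_jacobiSym] at hJ
  have h0 : (D : ZMod p) ≠ 0 := by
    intro h
    rw [(legendreSym.eq_zero_iff p D).mpr h] at hJ
    exact zero_ne_one hJ
  obtain ⟨r, hr⟩ := (legendreSym.eq_one_iff p h0).mp hJ
  obtain ⟨δ, rfl⟩ := ZMod.intCast_surjective r
  refine ⟨δ, (ZMod.intCast_zmod_eq_zero_iff_dvd _ p).mp ?_⟩
  push_cast
  rw [hr]; ring

/-- The cubic resolvent as a polynomial. -/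
noncomputable def resolventPoly (m x : ℤ) : ℤ[X] := X ^ 3 - C (3 * m) * X - C (2 * x)

lemma resolventPoly_monic (m x : ℤ) : (resolventPoly m x).Monic := by
  unfold resolventPoly; monicity!

lemma resolventPoly_natDegree (m x : ℤ) : (resolventPoly m x).natDegree = 3 := by
  unfold resolventPoly; compute_degree!

lemma eval_resolventPoly (m x a : ℤ) : (resolventPoly m x).eval a = resolvent m x a := by
  simp [resolventPoly, resolvent]

variable {D x y m : ℤ}

lemma false_of_minpoly_eq_resolventPoly {K : Type*} [Field K] [NumberField K] {θ : 𝓞 K}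
    (hθ : IntermediateField.adjoin ℚ {(θ : K)} = ⊤) (hmin : minpoly ℤ θ = resolventPoly m x)
    (hcube : x ^ 2 + 3 * D * y ^ 2 = m ^ 3) (hm : m ≠ 0) (hD : D ≠ 0) (hy : y ≠ 0)
    (bad : Finset ℕ) (hsym : ∀ p : ℕ, p.Prime → p ∉ bad → ∀ δ : ℤ, (p : ℤ) ∣ δ ^ 2 - D →
      sym p (el x (y * δ)) = 0) : False := by
  have hD4 : NeZero (4 * D.natAbs) := ⟨by have := Int.natAbs_pos.mpr hD; omega⟩
  have hn : 6 * m * D * y ≠ 0 := by positivity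
  have he := NumberField.exponent_ne_zero θ hθ
  have key : ∀ p : ℕ, p.Prime → p ∉ bad ∪ (6 * m * D * y).natAbs.primeFactors ∪
      (RingOfIntegers.exponent θ).primeFactors → (∀ δ : ℤ, (p : ℤ) ∣ δ ^ 2 - D →
        sym p (el x (y * δ)) = 0) ∧ ¬ (p : ℤ) ∣ 6 * m * D * y ∧
        ¬ p ∣ RingOfIntegers.exponent θ := by
    intro p hp hpb
    simp only [Finset.mem_union, Nat.mem_primeFactors, not_or, not_and, not_not] at hpb
    refine ⟨hsym p hp hpb.1.1, fun h => ?_, fun h => he (hpb.2 hp h)⟩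
    exact hn (Int.natAbs_eq_zero.mp (hpb.1.2 hp (Int.natCast_dvd.mp h)))
  refine false_of_primes_of_prime_norm K (q := 4 * D.natAbs) (a := 1) isUnit_one
    (bad ∪ (6 * m * D * y).natAbs.primeFactors ∪ (RingOfIntegers.exponent θ).primeFactors)
    (fun p hp hpb => ?_) (fun p hp hpb hp1 => ?_)
  · have := Fact.mk hp
    obtain ⟨h1, h2, h3⟩ := key p hp hpb
    obtain ⟨a, ha⟩ := (exists_resolvent_root hcube h2 h1).1
    obtain ⟨P, hP, hP', -⟩ := Ideal.exists_absNorm_eq_prime h3 (a := a)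
      (by rwa [hmin, eval_resolventPoly])
    exact ⟨P, hP, hP'⟩
  · have := Fact.mk hp
    obtain ⟨h1, h2, h3⟩ := key p hp hpb
    have hp2 : p ≠ 2 := by
      rintro rfl
      exact h2 ⟨3 * m * D * y, by push_cast; ring⟩
    obtain ⟨δ, hδ⟩ := exists_sq_sub_dvd hD hp2 hp1
    obtain ⟨a, b, ha, hb, hab⟩ := (exists_resolvent_root hcube h2 h1).2 δ hδ
    obtain ⟨P, hP, hP', hPa⟩ := Ideal.exists_absNorm_eq_prime h3 (a := a)
      (by rwa [hmin, eval_resolventPoly])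
    obtain ⟨Q, hQ, hQ', hQb⟩ := Ideal.exists_absNorm_eq_prime h3 (a := b)
      (by rwa [hmin, eval_resolventPoly])
    refine ⟨P, Q, ?_, hP, hQ, hP', hQ'⟩
    rintro rfl
    have hmem : ((a - b : ℤ) : 𝓞 K) ∈ P := by
      have := sub_mem hQb hPa
      push_cast
      convert this using 1; ring
    exact hab ((Ideal.intCast_mem_iff_dvd hP.ne_top hp (hP' ▸ Ideal.absNorm_mem P) _).mp hmem)

/-- If the cubic symbols attached to `x + y √(-3 * D)` are almost all trivial, then this number is a
cube in `ℚ(√(-3 * D))`. -/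
theorem exists_cube_of_sym_eq_zero (hcube : x ^ 2 + 3 * D * y ^ 2 = m ^ 3) (hm : m ≠ 0)
    (hD : D ≠ 0) (bad : Finset ℕ) (hsym : ∀ p : ℕ, p.Prime → p ∉ bad →
      ∀ δ : ℤ, (p : ℤ) ∣ δ ^ 2 - D → sym p (el x (y * δ)) = 0) :
    ∃ a b : ℚ, a ^ 3 - 9 * D * a * b ^ 2 = x ∧ 3 * a ^ 2 * b - 3 * D * b ^ 3 = y := by
  have hm' : (m : ℚ) ≠ 0 := by exact_mod_cast hm
  have hD' : (D : ℚ) ≠ 0 := by exact_mod_cast hD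
  have hc : (x : ℚ) ^ 2 + 3 * D * (y : ℚ) ^ 2 = (m : ℚ) ^ 3 := by exact_mod_cast hcube
  by_cases hy : y = 0
  · subst hy
    refine ⟨x / m, 0, ?_, by simp⟩
    have : (x : ℚ) ^ 2 = (m : ℚ) ^ 3 := by simpa using hc
    field_simp
    rw [← this]; ring
  by_cases hroot : ∃ t : ℚ, t ^ 3 - 3 * m * t - 2 * x = 0
  · obtain ⟨t, ht⟩ := hroot
    have hx : (x : ℚ) = (t ^ 3 - 3 * m * t) / 2 := by linarith
    have hprod : (3 : ℚ) * D * y ^ 2 = (4 * m - t ^ 2) * (t ^ 2 - m) ^ 2 / 4 := by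
      rw [hx] at hc; linear_combination hc
    have hne : t ^ 2 - m ≠ 0 := by
      intro h
      rw [h] at hprod
      have : (y : ℚ) ≠ 0 := by exact_mod_cast hy
      have : (3 : ℚ) * D * y ^ 2 ≠ 0 := by positivity
      apply this; rw [hprod]; ring
    have hb : 3 * D * ((y : ℚ) / (t ^ 2 - m)) ^ 2 = (4 * m - t ^ 2) / 4 := by
      field_simp
      linear_combination 4 * hprod
    have hb' : (y : ℚ) / (t ^ 2 - m) * (t ^ 2 - m) = y := div_mul_cancel₀ _ hne
    refine ⟨t / 2, y / (t ^ 2 - m), ?_, ?_⟩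
    · rw [hx]; linear_combination (-3 * (t / 2)) * hb
    · linear_combination hb' - (y : ℚ) / (t ^ 2 - m) * hb
  exfalso
  set f : ℚ[X] := (resolventPoly m x).map (Int.castRingHom ℚ) with hf
  have hfm : f.Monic := (resolventPoly_monic m x).map _
  have hfd : f.natDegree = 3 := by
    rw [hf, (resolventPoly_monic m x).natDegree_map, resolventPoly_natDegree]
  have hirr : Irreducible f := by
    rw [irreducible_iff_roots_eq_zero_of_degree_le_three (by omega) (by omega)]
    rw [Multiset.eq_zero_iff_forall_notMem]
    intro t ht
    apply hroot ⟨t, ?_⟩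
    have := (mem_roots'.mp ht).2
    simpa [hf, resolventPoly] using this
  have : Fact (Irreducible f) := ⟨hirr⟩
  have hnf : NumberField (AdjoinRoot f) :=
    { to_charZero := charZero_of_injective_algebraMap (algebraMap ℚ (AdjoinRoot f)).injective
      to_finiteDimensional := (AdjoinRoot.powerBasis hirr.ne_zero).finite }
  have hint : IsIntegral ℤ (AdjoinRoot.root f) := by
    refine ⟨resolventPoly m x, resolventPoly_monic m x, ?_⟩
    have := AdjoinRoot.eval₂_root f
    rw [hf, eval₂_map] at this
    rwa [RingHom.ext_int ((AdjoinRoot.of f).comp (Int.castRingHom ℚ))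
      (algebraMap ℤ (AdjoinRoot f))] at this
  let θ : 𝓞 (AdjoinRoot f) := ⟨AdjoinRoot.root f, hint⟩
  have hmin : minpoly ℤ θ = resolventPoly m x := by
    rw [← RingOfIntegers.minpoly_coe]
    apply map_injective (Int.castRingHom ℚ) (RingHom.injective_int _)
    have h1 := minpoly.isIntegrallyClosed_eq_field_fractions' ℚ hint
    have h2 := AdjoinRoot.minpoly_root hirr.ne_zero
    rw [hfm.leadingCoeff, inv_one, map_one, mul_one] at h2
    exact h1.symm.trans (by convert h2; exact Subsingleton.elim _ _)
  refine false_of_minpoly_eq_resolventPoly (θ := θ) ?_ hmin hcube hm hD hy bad hsym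
  apply IntermediateField.toSubalgebra_injective
  rw [IntermediateField.adjoin_simple_toSubalgebra_of_isAlgebraic
    (Algebra.IsAlgebraic.isAlgebraic (θ : AdjoinRoot f))]
  have hr : AdjoinRoot.root f ∈ Algebra.adjoin ℚ {(θ : AdjoinRoot f)} :=
    Algebra.self_mem_adjoin_singleton ℚ (θ : AdjoinRoot f)
  refine le_antisymm (fun _ _ => trivial) fun z _ => ?_
  obtain ⟨g, rfl⟩ := AdjoinRoot.mk_surjective z
  induction g using Polynomial.induction_on' with
  | add p q hp hq => rw [map_add]; exact add_mem (hp trivial) (hq trivial)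
  | monomial n r =>
    rw [← C_mul_X_pow_eq_monomial, map_mul, map_pow, AdjoinRoot.mk_X, AdjoinRoot.mk_C]
    refine mul_mem ?_ (pow_mem hr _)
    rw [show AdjoinRoot.of f r = algebraMap ℚ (AdjoinRoot f) r from
      RingHom.congr_fun (Subsingleton.elim _ _) r]
    exact Subalgebra.algebraMap_mem _ _

end CubicSymbol

end

section

open NumberField

namespace CubicSymbol

variable {K : Type*} [Field K] [NumberField K] {s : 𝓞 K} {D : ℤ}

lemma QuadData.exists_prime_of_dvd (H : QuadData s D) {p : ℕ} (hp : p.Prime) (hp2 : p ≠ 2) {δ : ℤ}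
    (hδ : (p : ℤ) ∣ δ ^ 2 - D) :
    ∃ P : Ideal (𝓞 K), P.IsPrime ∧ P ≠ ⊥ ∧ (p : 𝓞 K) ∈ P ∧ s - δ ∈ P := by
  have htop : Ideal.span {(p : 𝓞 K), s - δ} ≠ ⊤ := by
    intro h
    obtain ⟨a, b, hab⟩ := Ideal.mem_span_pair.mp ((Ideal.eq_top_iff_one _).mp h)
    obtain ⟨c, hc⟩ := hδ
    obtain ⟨u, v, huv⟩ := H.repr (a * (s + δ) - b * c)
    have h0 : ((p * u - 2 * δ : ℤ) + (p * v - 2 : ℤ) * s : 𝓞 K) = 0 := by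
      have hc' : (δ ^ 2 - D : 𝓞 K) = p * c := by exact_mod_cast hc
      push_cast
      linear_combination (-p : 𝓞 K) * huv + 2 * (s + δ) * hab + 2 * b * hc' - 2 * b * H.sq
    have := (H.eq_zero_of_add_eq_zero h0).2
    have hd : (p : ℤ) ∣ 2 := ⟨v, by linarith⟩
    exact hp2 ((Nat.prime_dvd_prime_iff_eq hp Nat.prime_two).mp (by exact_mod_cast hd))
  obtain ⟨P, hP, hle⟩ := Ideal.exists_le_maximal _ htop
  have h1 : (p : 𝓞 K) ∈ P := hle (Ideal.subset_span (by simp))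
  refine ⟨P, hP.isPrime, ?_, h1, hle (Ideal.subset_span (by simp))⟩
  rintro rfl
  exact hp.ne_zero (by simpa using h1)

variable {x₁ y₁ m₁ x₂ y₂ m₂ : ℤ} {M₁ M₂ : ℕ}

lemma SymbolData.m_ne_zero (h : SymbolData D x₁ y₁ m₁ M₁) : m₁ ≠ 0 := by
  rintro rfl
  have := h.dvd_mod
  simp only [mul_zero, zero_dvd_iff] at this
  exact h.ne_zero (by exact_mod_cast this)

/-- Two numbers with the same cubic character differ by a cube. -/
theorem exists_cube_of_hom_eq (H : QuadData s D) (h₁ : SymbolData D x₁ y₁ m₁ M₁)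
    (h₂ : SymbolData D x₂ y₂ m₂ M₂) {f : ClassGroup (𝓞 K) →* Multiplicative (ZMod 3)}
    (hf₁ : ∀ I : nonZeroDivisors (Ideal (𝓞 K)), Nat.Coprime (Ideal.absNorm I.1) M₁ →
      f (ClassGroup.mk0 I) = Multiplicative.ofAdd (chi s x₁ y₁ M₁ I))
    (hf₂ : ∀ I : nonZeroDivisors (Ideal (𝓞 K)), Nat.Coprime (Ideal.absNorm I.1) M₂ →
      f (ClassGroup.mk0 I) = Multiplicative.ofAdd (chi s x₂ y₂ M₂ I)) :
    ∃ a b : ℚ, a ^ 3 - 9 * D * a * b ^ 2 = x₁ * x₂ + 3 * D * y₁ * y₂ ∧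
      3 * a ^ 2 * b - 3 * D * b ^ 3 = y₁ * x₂ - x₁ * y₂ := by
  have := exists_cube_of_sym_eq_zero (D := D) (x := x₁ * x₂ + 3 * D * y₁ * y₂)
    (y := y₁ * x₂ - x₁ * y₂) (m := m₁ * m₂) (by
      linear_combination (x₂ ^ 2 + 3 * D * y₂ ^ 2) * h₁.cube + m₁ ^ 3 * h₂.cube)
    (mul_ne_zero h₁.m_ne_zero h₂.m_ne_zero) H.ne_zero
    (M₁.primeFactors ∪ M₂.primeFactors) ?_
  · simpa using this
  intro p hp hpb δ hδ
  simp only [Finset.mem_union, Nat.mem_primeFactors, not_or, not_and, not_not] at hpb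
  have hM₁ : ¬ p ∣ M₁ := fun h => h₁.ne_zero (hpb.1 hp h)
  have hM₂ : ¬ p ∣ M₂ := fun h => h₂.ne_zero (hpb.2 hp h)
  have h6 := h₁.dvd_of_prime_dvd (p := 2) |>.2.2
  have hp2 : p ≠ 2 := by rintro rfl; exact hM₁ ((by norm_num : 2 ∣ 6).trans h6)
  have hp3 : p ≠ 3 := by rintro rfl; exact hM₁ ((by norm_num : 3 ∣ 6).trans h6)
  obtain ⟨P, hP, hP0, hpP, hδP⟩ := QuadData.exists_prime_of_dvd H hp hp2 hδ
  have hn := H.absNorm_eq hP.ne_top hp hp2 hpP hδP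
  have e₁ := hf₁ ⟨P, mem_nonZeroDivisors_of_ne_zero hP0⟩
    (by rw [hn]; exact (hp.coprime_iff_not_dvd).mpr hM₁)
  have e₂ := hf₂ ⟨P, mem_nonZeroDivisors_of_ne_zero hP0⟩
    (by rw [hn]; exact (hp.coprime_iff_not_dvd).mpr hM₂)
  have e : chi s x₁ y₁ M₁ P = chi s x₂ y₂ M₂ P := Multiplicative.ofAdd.injective (e₁.symm.trans e₂)
  rw [chi_prime hP hP0, chi_prime hP hP0, symI_eq hP.ne_top hp hM₁ hpP hδP,
    symI_eq hP.ne_top hp hM₂ hpP hδP] at e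
  have := Fact.mk hp
  have n₁ := h₁.not_dvd_norm hp hM₁ hδ
  have n₂ := h₂.not_dvd_norm hp hM₂ hδ
  have n₂' : ¬ (p : ℤ) ∣ (el x₂ (-(y₂ * δ))).norm := by
    rwa [← star_el, QuadraticAlgebra.norm_star]
  have hmul := sym_mul hp3 n₁ n₂'
  rw [el_mul_el, ← star_el, sym_star hp3 n₂, e, add_neg_cancel] at hmul
  rw [← hmul]
  apply sym_el_congr
  · obtain ⟨c, hc⟩ := hδ
    exact ⟨-3 * y₁ * y₂ * c, by linear_combination (-3 * y₁ * y₂) * hc⟩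
  · exact ⟨0, by ring⟩

end CubicSymbol

/-- Two elements are related if their quotient is a cube of the fraction field. -/
def CubeRel {R : Type*} [CommRing R] (x y : R) : Prop :=
  ∃ a b : R, a ≠ 0 ∧ b ≠ 0 ∧ a ^ 3 * x = b ^ 3 * y

namespace CubeRel

variable {R : Type*} [CommRing R] [IsDomain R] {x y z : R}

omit [IsDomain R] in
lemma symm (h : CubeRel x y) : CubeRel y x := by
  obtain ⟨a, b, ha, hb, h⟩ := h
  exact ⟨b, a, hb, ha, h.symm⟩

lemma trans (h : CubeRel x y) (h' : CubeRel y z) : CubeRel x z := by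
  obtain ⟨a, b, ha, hb, h⟩ := h
  obtain ⟨c, d, hc, hd, h'⟩ := h'
  exact ⟨c * a, d * b, mul_ne_zero hc ha, mul_ne_zero hd hb, by
    linear_combination c ^ 3 * h + b ^ 3 * h'⟩

lemma of_mul_right (hz : z ≠ 0) (h : CubeRel (x * z) (y * z)) : CubeRel x y := by
  obtain ⟨a, b, ha, hb, h⟩ := h
  exact ⟨a, b, ha, hb, mul_right_cancel₀ hz (by linear_combination h)⟩

lemma cube_mul (hz : z ≠ 0) : CubeRel (z ^ 3 * x) x :=
  ⟨1, z, one_ne_zero, hz, by ring⟩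

end CubeRel

namespace QuadData

variable {K : Type*} [Field K] [NumberField K] {s : 𝓞 K} {D : ℤ} (H : QuadData s D)
include H

lemma eq_of_add_eq_add {u v u' v' : ℤ} (h : (u + v * s : 𝓞 K) = u' + v' * s) :
    u = u' ∧ v = v' := by
  have := H.eq_zero_of_add_eq_zero (u := u - u') (v := v - v')
    (by push_cast; linear_combination h)
  exact ⟨by linarith, by linarith⟩

lemma natCast_dvd_of_dvd_sq {q : ℕ} (hq : q.Prime) (hq2 : q ≠ 2) (hqD : ¬ (q : ℤ) ∣ D) {α : 𝓞 K}
    (h : (q : 𝓞 K) ∣ α ^ 2) : (q : 𝓞 K) ∣ α := by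
  have hqi := Nat.prime_iff_prime_int.mp hq
  have hq2' : ¬ (q : ℤ) ∣ 2 := by
    intro h
    exact hq2 ((Nat.prime_dvd_prime_iff_eq hq Nat.prime_two).mp (by exact_mod_cast h))
  obtain ⟨γ, hγ⟩ := h
  obtain ⟨a, b, hab⟩ := H.repr α
  obtain ⟨c, d, hcd⟩ := H.repr γ
  have := H.eq_of_add_eq_add (u := a ^ 2 + D * b ^ 2) (v := 2 * a * b) (u' := q * (2 * c))
    (v' := q * (2 * d)) (by
      push_cast
      linear_combination (-(2 * α + a + b * s)) * hab + 4 * hγ + 2 * (q : 𝓞 K) * hcd - b ^ 2 * H.sq)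
  obtain ⟨h1, h2⟩ := this
  have hdvd : (q : ℤ) ∣ a ∧ (q : ℤ) ∣ b := by
    have h1' : (q : ℤ) ∣ a ^ 2 + D * b ^ 2 := ⟨_, h1⟩
    have h2' : (q : ℤ) ∣ 2 * a * b := ⟨_, h2⟩
    rcases hqi.dvd_or_dvd h2' with h | h
    · have ha : (q : ℤ) ∣ a := (hqi.dvd_or_dvd h).resolve_left hq2'
      refine ⟨ha, ?_⟩
      rw [dvd_add_right (ha.pow two_ne_zero)] at h1'
      exact hqi.dvd_of_dvd_pow ((hqi.dvd_or_dvd h1').resolve_left hqD)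
    · refine ⟨?_, h⟩
      rw [dvd_add_left ((h.pow two_ne_zero).mul_left _)] at h1'
      exact hqi.dvd_of_dvd_pow h1'
  obtain ⟨⟨a', rfl⟩, ⟨b', rfl⟩⟩ := hdvd
  obtain ⟨r, hr⟩ := hq.odd_of_ne_two hq2
  have hr' : (q : 𝓞 K) = 2 * r + 1 := by exact_mod_cast hr
  refine ⟨α - r * (a' + b' * s), ?_⟩
  push_cast at hab
  linear_combination (-r : 𝓞 K) * hab - α * hr'

lemma natCast_dvd_of_dvd_cube {q : ℕ} (hq : q.Prime) (hq2 : q ≠ 2) (hqD : ¬ (q : ℤ) ∣ D) {α : 𝓞 K}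
    (h : (q : 𝓞 K) ∣ α ^ 3) : (q : 𝓞 K) ∣ α := by
  apply H.natCast_dvd_of_dvd_sq hq hq2 hqD
  apply H.natCast_dvd_of_dvd_sq hq hq2 hqD
  exact h.trans ⟨α, by ring⟩

end QuadData

namespace CubicSymbol

variable {L : Type*} [Field L] [NumberField L] {r : 𝓞 L} {D D' e : ℤ}

lemma exists_symbolData (H : QuadData r D') (hD : D ≠ 0) (he : e ∣ 3) (hD' : e ^ 2 * D' = -3 * D)
    {𝔠 : Ideal (𝓞 L)} (h𝔠 : Nat.Coprime (Ideal.absNorm 𝔠) (6 * D.natAbs)) {x y : ℤ}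
    (hx2 : ¬ 2 ∣ x) (hx3 : ¬ 3 ∣ x) (hy : 972 ∣ y)
    (hspan : Ideal.span {(x + (y * e : ℤ) * r : 𝓞 L)} = 𝔠 ^ 3) :
    ∃ (x' y' m g : ℤ) (M : ℕ), SymbolData D x' y' m M ∧ g ≠ 0 ∧ x = g ^ 3 * x' ∧ y = g ^ 3 * y' := by
  induction hn : x.natAbs using Nat.strong_induction_on generalizing x y 𝔠 with
  | _ n ih =>
  have hx0 : x ≠ 0 := by rintro rfl; exact hx2 (dvd_zero _)
  have hnorm := H.absNorm_add x (y * e)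
  rw [hspan, map_pow, show x ^ 2 - D' * (y * e) ^ 2 = x ^ 2 + 3 * D * y ^ 2 by
    linear_combination (-y ^ 2) * hD'] at hnorm
  have hβ0 : (x + (y * e : ℤ) * r : 𝓞 L) ≠ 0 := fun h => hx0 (H.eq_zero_of_add_eq_zero h).1
  have h𝔠0 : 𝔠 ≠ ⊥ := by
    rintro rfl
    rw [← Ideal.zero_eq_bot, zero_pow three_ne_zero, Ideal.zero_eq_bot, Ideal.span_singleton_eq_bot] at hspan
    exact hβ0 hspan
  by_cases hcop : IsCoprime x y
  · obtain ⟨m, hm, hm0⟩ : ∃ m : ℤ, x ^ 2 + 3 * D * y ^ 2 = m ^ 3 ∧ m ≠ 0 := by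
      have hN0 : (Ideal.absNorm 𝔠 : ℤ) ≠ 0 := by
        rw [Ne, Int.natCast_eq_zero, Ideal.absNorm_eq_zero_iff]; exact h𝔠0
      push_cast at hnorm
      rcases abs_choice (x ^ 2 + 3 * D * y ^ 2) with h | h
      · exact ⟨Ideal.absNorm 𝔠, by rw [hnorm, h], hN0⟩
      · exact ⟨-Ideal.absNorm 𝔠, by rw [Odd.neg_pow (by decide), hnorm, h, neg_neg],
          neg_ne_zero.mpr hN0⟩
    refine ⟨x, y, m, 1, (6 * D * m).natAbs, ⟨hcop, hx2, hx3, hy, hm, ?_, ?_⟩, one_ne_zero,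
      by ring, by ring⟩
    · exact Int.dvd_natAbs.mpr dvd_rfl
    · rw [Int.natAbs_ne_zero]; positivity
  obtain ⟨q, hq, hqx, hqy⟩ : ∃ q : ℕ, q.Prime ∧ (q : ℤ) ∣ x ∧ (q : ℤ) ∣ y := by
    rw [Int.isCoprime_iff_gcd_eq_one] at hcop
    obtain ⟨q, hq, hqd⟩ := Nat.exists_prime_and_dvd hcop
    exact ⟨q, hq, (Int.natCast_dvd_natCast.mpr hqd).trans (Int.gcd_dvd_left ..),
      (Int.natCast_dvd_natCast.mpr hqd).trans (Int.gcd_dvd_right ..)⟩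
  have hqi := Nat.prime_iff_prime_int.mp hq
  have hq𝔠 : q ∣ Ideal.absNorm 𝔠 := by
    have : (q : ℤ) ∣ ((Ideal.absNorm 𝔠 ^ 3 : ℕ) : ℤ) := by
      rw [hnorm, dvd_abs]
      exact dvd_add (hqx.pow two_ne_zero) ((hqy.pow two_ne_zero).mul_left _)
    exact hq.dvd_of_dvd_pow (by exact_mod_cast this)
  have hq6D : ¬ q ∣ 6 * D.natAbs := fun h =>
    hq.one_lt.ne' (Nat.dvd_one.mp (h𝔠 ▸ Nat.dvd_gcd hq𝔠 h))
  have hq2 : q ≠ 2 := by rintro rfl; exact hq6D ((by norm_num : 2 ∣ 6).mul_right _)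
  have hq3 : q ≠ 3 := by rintro rfl; exact hq6D ((by norm_num : 3 ∣ 6).mul_right _)
  have hq3' : ¬ (q : ℤ) ∣ 3 := by
    intro h
    exact hq3 ((Nat.prime_dvd_prime_iff_eq hq Nat.prime_three).mp (by exact_mod_cast h))
  have hqD' : ¬ (q : ℤ) ∣ D' := by
    intro h
    have h1 : (q : ℤ) ∣ 3 * D := by
      have := (h.mul_left (e ^ 2))
      rw [hD', neg_mul] at this
      exact (dvd_neg.mp this)
    have h2 := (hqi.dvd_or_dvd h1).resolve_left hq3'
    exact hq6D ((Int.natCast_dvd.mp h2).mul_left _)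
  have hle : 𝔠 ≤ Ideal.span {(q : 𝓞 L)} := by
    intro α hα
    rw [Ideal.mem_span_singleton]
    apply H.natCast_dvd_of_dvd_cube hq hq2 hqD'
    have h1 : α ^ 3 ∈ 𝔠 ^ 3 := Ideal.pow_mem_pow hα 3
    rw [← hspan, Ideal.mem_span_singleton] at h1
    refine Dvd.dvd.trans ?_ h1
    obtain ⟨x', rfl⟩ := hqx
    obtain ⟨y', rfl⟩ := hqy
    exact ⟨x' + (y' * e : ℤ) * r, by push_cast; ring⟩
  obtain ⟨𝔡, rfl⟩ := Ideal.dvd_iff_le.mpr hle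
  have hmem := hspan ▸ Ideal.mem_span_singleton_self (x + (y * e : ℤ) * r : 𝓞 L)
  rw [mul_pow] at hmem
  have hmem' := Ideal.mul_le_left hmem
  rw [Ideal.span_singleton_pow] at hmem'
  obtain ⟨γ, hγ⟩ := Ideal.mem_span_singleton.mp hmem'
  obtain ⟨a, b, hab⟩ := H.repr γ
  have hxy := H.eq_of_add_eq_add (u := 2 * x) (v := 2 * (y * e)) (u' := q ^ 3 * a)
    (v' := q ^ 3 * b) (by
      push_cast at hγ ⊢; linear_combination 2 * hγ + (q : 𝓞 L) ^ 3 * hab)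
  have hcop2 : IsCoprime ((q : ℤ) ^ 3) 2 := by
    apply IsCoprime.pow_left
    rw [hqi.coprime_iff_not_dvd]
    intro h
    exact hq2 ((Nat.prime_dvd_prime_iff_eq hq Nat.prime_two).mp (by exact_mod_cast h))
  have hcope : IsCoprime ((q : ℤ) ^ 3) e := by
    apply IsCoprime.pow_left
    rw [Prime.coprime_iff_not_dvd hqi]
    exact fun h => hq3' (h.trans he)
  obtain ⟨x', rfl⟩ : (q : ℤ) ^ 3 ∣ x := hcop2.dvd_of_dvd_mul_left ⟨a, hxy.1⟩
  obtain ⟨y', rfl⟩ : (q : ℤ) ^ 3 ∣ y :=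
    hcope.dvd_of_dvd_mul_right (hcop2.dvd_of_dvd_mul_left ⟨b, hxy.2⟩)
  have hq0 : (q : 𝓞 L) ≠ 0 := by exact_mod_cast hq.ne_zero
  have hlt : x'.natAbs < n := by
    rw [← hn, Int.natAbs_mul, Int.natAbs_pow, Int.natAbs_natCast]
    have : 0 < x'.natAbs := Int.natAbs_pos.mpr (right_ne_zero_of_mul hx0)
    exact lt_mul_of_one_lt_left this (Nat.one_lt_pow three_ne_zero hq.one_lt)
  have h𝔡 : Nat.Coprime (Ideal.absNorm 𝔡) (6 * D.natAbs) := by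
    rw [map_mul] at h𝔠
    exact Nat.Coprime.coprime_mul_left h𝔠
  have hy' : 972 ∣ y' := by
    refine IsCoprime.dvd_of_dvd_mul_left ?_ hy
    apply IsCoprime.pow_right
    rw [isCoprime_comm, hqi.coprime_iff_not_dvd]
    intro h
    have h' : q ∣ 2 ^ 2 * 3 ^ 5 := by exact_mod_cast h
    rcases (Nat.Prime.dvd_mul hq).mp h' with h | h
    · exact hq2 ((Nat.prime_dvd_prime_iff_eq hq Nat.prime_two).mp (hq.dvd_of_dvd_pow h))
    · exact hq3 ((Nat.prime_dvd_prime_iff_eq hq Nat.prime_three).mp (hq.dvd_of_dvd_pow h))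
  have hspan' : Ideal.span {(x' + (y' * e : ℤ) * r : 𝓞 L)} = 𝔡 ^ 3 := by
    have h0 : Ideal.span {(q : 𝓞 L) ^ 3} ≠ 0 := by
      rw [Ne, Ideal.zero_eq_bot, Ideal.span_singleton_eq_bot]
      exact pow_ne_zero 3 hq0
    apply mul_left_cancel₀ h0
    rw [Ideal.span_singleton_mul_span_singleton, ← Ideal.span_singleton_pow, ← mul_pow, ← hspan]
    congr 2
    push_cast; ring
  obtain ⟨X, Y, m, g, M, h1, h2, h3, h4⟩ := ih x'.natAbs hlt h𝔡 (fun h => hx2 (h.mul_left _))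
    (fun h => hx3 (h.mul_left _)) hy' hspan' rfl
  refine ⟨X, Y, m, q * g, M, h1, mul_ne_zero (by exact_mod_cast hq.ne_zero) h2, ?_, ?_⟩
  · rw [h3]; ring
  · rw [h4]; ring

end CubicSymbol

namespace CubicSymbol

section

variable {L : Type*} [Field L] [NumberField L]

lemma exists_coprime_rep {M : ℕ} (hM : M ≠ 0) (hM1 : M ≠ 1) {r : 𝓞 L} {D' : ℤ}
    (H : QuadData r D') {κ : 𝓞 L} {𝔠 : Ideal (𝓞 L)} (hκ : κ ≠ 0)
    (h : Ideal.span {κ} = 𝔠 ^ 3) : ∃ (κ' : 𝓞 L) (𝔠' : Ideal (𝓞 L)), CubeRel κ κ' ∧ κ' ≠ 0 ∧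
      Ideal.span {κ'} = 𝔠' ^ 3 ∧ Nat.Coprime (Ideal.absNorm 𝔠') M := by
  have h𝔠 : 𝔠 ≠ ⊥ := by
    rintro rfl
    rw [← Ideal.zero_eq_bot, zero_pow three_ne_zero, Ideal.zero_eq_bot,
      Ideal.span_singleton_eq_bot] at h
    exact hκ h
  obtain ⟨I, hI, hIM⟩ := exists_coprime_ideal H hM hM1
    (ClassGroup.mk0 ⟨𝔠, mem_nonZeroDivisors_of_ne_zero h𝔠⟩)
  obtain ⟨y, x, hy, hx, hxy⟩ := ClassGroup.mk0_eq_mk0_iff.mp hI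
  have h3 : Ideal.span {x ^ 3 * κ} = Ideal.span {y ^ 3} * (I : Ideal (𝓞 L)) ^ 3 := by
    rw [← Ideal.span_singleton_mul_span_singleton, h, ← Ideal.span_singleton_pow,
      ← Ideal.span_singleton_pow, ← mul_pow, ← mul_pow]
    exact congrArg (· ^ 3) hxy.symm
  have hmem : x ^ 3 * κ ∈ Ideal.span {y ^ 3} * (I : Ideal (𝓞 L)) ^ 3 :=
    h3 ▸ Ideal.mem_span_singleton_self _
  obtain ⟨κ', hκ'⟩ := Ideal.mem_span_singleton.mp (Ideal.mul_le_left hmem)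
  refine ⟨κ', I, ⟨x, y, hx, hy, hκ'⟩, ?_, ?_, hIM⟩
  · rintro rfl
    rw [mul_zero] at hκ'
    exact mul_ne_zero (pow_ne_zero 3 hx) hκ hκ'
  · have h0 : Ideal.span {y ^ 3} ≠ 0 := by
      rw [Ne, Ideal.zero_eq_bot, Ideal.span_singleton_eq_bot]
      exact pow_ne_zero 3 hy
    apply mul_left_cancel₀ h0
    rw [← h3, Ideal.span_singleton_mul_span_singleton, hκ']

lemma exists_dvd_pow_sub_one {κ : 𝓞 L} {N : ℕ} (hN : N ≠ 0)
    (h : Nat.Coprime (Ideal.absNorm (Ideal.span {κ})) N) :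
    ∃ n : ℕ, 0 < n ∧ (N : 𝓞 L) ∣ κ ^ n - 1 := by
  have hfin : Finite (𝓞 L ⧸ Ideal.span {(N : 𝓞 L)}) := by
    apply Ideal.finiteQuotientOfFreeOfNeBot
    simpa using hN
  obtain ⟨w, hw⟩ := Ideal.mem_span_singleton.mp (Ideal.absNorm_mem (Ideal.span {κ}))
  obtain ⟨u, v, huv⟩ := Nat.isCoprime_iff_coprime.mpr h
  have huv' : (u : 𝓞 L) * (κ * w) + v * N = 1 := by
    rw [← hw]; exact_mod_cast congrArg (Int.cast : ℤ → 𝓞 L) huv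
  have hunit : IsUnit (Ideal.Quotient.mk (Ideal.span {(N : 𝓞 L)}) κ) := by
    apply IsUnit.of_mul_eq_one (Ideal.Quotient.mk _ (u * w))
    rw [← map_mul, ← map_one (Ideal.Quotient.mk _), Ideal.Quotient.eq, Ideal.mem_span_singleton]
    exact ⟨-v, by linear_combination huv'⟩
  obtain ⟨z, hz⟩ := hunit
  obtain ⟨n, hn, hzn⟩ := (isOfFinOrder_of_finite z).exists_pow_eq_one
  refine ⟨n, hn, ?_⟩
  rw [← Ideal.mem_span_singleton, ← Ideal.Quotient.eq, map_pow, ← hz, map_one,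
    ← Units.val_pow_eq_pow_val, hzn, Units.val_one]

variable {r : 𝓞 L} {D D' e : ℤ}

lemma exists_symbolData_mul (H : QuadData r D') (hD : D ≠ 0) (he : e ∣ 3)
    (hD' : e ^ 2 * D' = -3 * D) {κ κ₀ : 𝓞 L} {𝔠 𝔠₀ : Ideal (𝓞 L)}
    (h : Ideal.span {κ} = 𝔠 ^ 3) (h₀ : Ideal.span {κ₀} = 𝔠₀ ^ 3)
    (h𝔠 : Nat.Coprime (Ideal.absNorm 𝔠) (6 * D.natAbs))
    (h𝔠₀ : Nat.Coprime (Ideal.absNorm 𝔠₀) (6 * D.natAbs)) {n : ℕ} (hn : 0 < n)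
    (hκ₀ : (5832 : 𝓞 L) ∣ κ₀ ^ n - 1) (hκ : (5832 : 𝓞 L) ∣ κ - κ₀) :
    ∃ (x y m g : ℤ) (M : ℕ), SymbolData D x y m M ∧ g ≠ 0 ∧
      κ * κ₀ ^ (3 * n - 1) = g ^ 3 * (x + (y * e : ℤ) * r) := by
  obtain ⟨k, hk⟩ : ∃ k, 3 * n - 1 = 3 * k + 2 := ⟨n - 1, by omega⟩
  obtain ⟨e', he'⟩ := he
  have hmod : (5832 : 𝓞 L) ∣ κ * κ₀ ^ (3 * n - 1) - 1 := by
    have h1 : (5832 : 𝓞 L) ∣ (κ - κ₀) * κ₀ ^ (3 * n - 1) := hκ.mul_right _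
    have h2 : (5832 : 𝓞 L) ∣ (κ₀ ^ n) ^ 3 - 1 := hκ₀.trans ⟨(κ₀ ^ n) ^ 2 + κ₀ ^ n + 1, by ring⟩
    have h3 : κ * κ₀ ^ (3 * n - 1) - 1 = (κ - κ₀) * κ₀ ^ (3 * n - 1) + ((κ₀ ^ n) ^ 3 - 1) := by
      rw [← pow_mul, show n * 3 = (3 * n - 1) + 1 by omega, pow_succ]; ring
    rw [h3]
    exact dvd_add h1 h2
  obtain ⟨η, hη⟩ := hmod
  obtain ⟨a, b, hab⟩ := H.repr η
  have hβ : κ * κ₀ ^ (3 * n - 1) = ((1 + 2916 * a : ℤ) + (972 * e' * b * e : ℤ) * r : 𝓞 L) := by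
    have he'' : (3 : 𝓞 L) = e * e' := by exact_mod_cast he'
    push_cast
    linear_combination hη + 2916 * hab + 972 * b * r * he''
  have hcop : Nat.Coprime (Ideal.absNorm (𝔠 * 𝔠₀ ^ (3 * n - 1))) (6 * D.natAbs) := by
    rw [map_mul, map_pow]
    exact Nat.Coprime.mul_left h𝔠 (h𝔠₀.pow_left _)
  obtain ⟨x, y, m, g, M, h1, h2, h3, h4⟩ := exists_symbolData H hD ⟨e', he'⟩ hD' hcop
    (x := 1 + 2916 * a) (y := 972 * e' * b) (by omega) (by omega) ⟨e' * b, by ring⟩ (by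
      rw [← hβ, ← Ideal.span_singleton_mul_span_singleton, ← Ideal.span_singleton_pow, h, h₀]
      ring)
  refine ⟨x, y, m, g, M, h1, h2, ?_⟩
  rw [hβ, h3, h4]
  push_cast; ring

lemma cubeRel_of_cube (H : QuadData r D') (hD' : e ^ 2 * D' = -3 * D) {x₁ y₁ m₁ x₂ y₂ m₂ : ℤ}
    {M₁ M₂ : ℕ} (h₁ : SymbolData D x₁ y₁ m₁ M₁) (h₂ : SymbolData D x₂ y₂ m₂ M₂)
    (h : ∃ a b : ℚ, a ^ 3 - 9 * D * a * b ^ 2 = x₁ * x₂ + 3 * D * y₁ * y₂ ∧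
      3 * a ^ 2 * b - 3 * D * b ^ 3 = y₁ * x₂ - x₁ * y₂) :
    CubeRel (x₁ + (y₁ * e : ℤ) * r : 𝓞 L) (x₂ + (y₂ * e : ℤ) * r) := by
  obtain ⟨a, b, h1, h2⟩ := h
  obtain ⟨c, A, B, hc, rfl, rfl⟩ : ∃ c A B : ℤ, c ≠ 0 ∧ a = A / c ∧ b = B / c := by
    refine ⟨a.den * b.den, a.num * b.den, b.num * a.den, by positivity, ?_, ?_⟩
    · push_cast
      rw [mul_div_mul_right _ _ (by positivity), Rat.num_div_den]
    · push_cast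
      rw [mul_comm (a.den : ℚ), mul_div_mul_right _ _ (by positivity), Rat.num_div_den]
  have hc' : (c : ℚ) ≠ 0 := by exact_mod_cast hc
  have e1 : A ^ 3 - 9 * D * A * B ^ 2 = c ^ 3 * (x₁ * x₂ + 3 * D * y₁ * y₂) := by
    field_simp at h1
    have : (A : ℚ) ^ 3 - 9 * D * A * B ^ 2 = c ^ 3 * (x₁ * x₂ + 3 * D * y₁ * y₂) := by
      linear_combination h1
    exact_mod_cast this
  have e2 : 3 * A ^ 2 * B - 3 * D * B ^ 3 = c ^ 3 * (y₁ * x₂ - x₁ * y₂) := by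
    field_simp at h2
    have : 3 * (A : ℚ) ^ 2 * B - 3 * D * B ^ 3 = c ^ 3 * (y₁ * x₂ - x₁ * y₂) := by
      linear_combination h2
    exact_mod_cast this
  have e1' : (A ^ 3 - 9 * D * A * B ^ 2 : 𝓞 L) = c ^ 3 * (x₁ * x₂ + 3 * D * y₁ * y₂) := by
    exact_mod_cast congrArg (Int.cast : ℤ → 𝓞 L) e1
  have e2' : (3 * A ^ 2 * B - 3 * D * B ^ 3 : 𝓞 L) = c ^ 3 * (y₁ * x₂ - x₁ * y₂) := by
    exact_mod_cast congrArg (Int.cast : ℤ → 𝓞 L) e2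
  have hcube : (x₂ ^ 2 + 3 * D * y₂ ^ 2 : 𝓞 L) = m₂ ^ 3 := by
    exact_mod_cast congrArg (Int.cast : ℤ → 𝓞 L) h₂.cube
  have hr : (e ^ 2 * r ^ 2 : 𝓞 L) = -3 * D := by
    rw [H.sq]; exact_mod_cast congrArg (Int.cast : ℤ → 𝓞 L) hD'
  have hx₁ : x₁ ≠ 0 := by rintro rfl; exact h₁.two (dvd_zero _)
  have hβ₁ : (x₁ + (y₁ * e : ℤ) * r : 𝓞 L) ≠ 0 := fun h => hx₁ (H.eq_zero_of_add_eq_zero h).1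
  have hcm : (c * m₂ : 𝓞 L) ≠ 0 := by
    exact_mod_cast mul_ne_zero hc h₂.m_ne_zero
  have hmain : (c * m₂ : 𝓞 L) ^ 3 * (x₁ + (y₁ * e : ℤ) * r) =
      (A + (B * e : ℤ) * r) ^ 3 * (x₂ + (y₂ * e : ℤ) * r) := by
    push_cast
    have hγ : (A + B * e * r : 𝓞 L) ^ 3 = c ^ 3 * ((x₁ + y₁ * e * r) * (x₂ - y₂ * e * r)) := by
      linear_combination e1' + e * r * e2' + (3 * A * B ^ 2 + B ^ 3 * e * r + c ^ 3 * y₁ * y₂) * hr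
    rw [hγ, mul_pow, ← hcube]
    linear_combination c ^ 3 * (x₁ + y₁ * e * r) * y₂ ^ 2 * hr
  refine ⟨c * m₂, A + (B * e : ℤ) * r, hcm, ?_, hmain⟩
  intro h0
  rw [h0, zero_pow three_ne_zero, zero_mul] at hmain
  exact mul_ne_zero (pow_ne_zero 3 hcm) hβ₁ hmain

end

/-- The reflection principle: classes modulo cubes in `ℚ(√(-3 * D))` that are cubes of ideals are
controlled by the cubic characters of the class group of `ℚ(√D)`. -/
theorem card_le_card_hom {K L : Type*} [Field K] [NumberField K] [Field L] [NumberField L]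
    {s : 𝓞 K} {r : 𝓞 L} {D D' e : ℤ} (HK : QuadData s D) (H : QuadData r D') (he : e ∣ 3)
    (hD' : e ^ 2 * D' = -3 * D) (Z : Finset (𝓞 L))
    (hZ : ∀ κ ∈ Z, κ ≠ 0 ∧ ∃ 𝔠 : Ideal (𝓞 L), Ideal.span {κ} = 𝔠 ^ 3)
    (hpair : ∀ κ ∈ Z, ∀ κ' ∈ Z, CubeRel κ κ' → κ = κ') :
    Z.card ≤ Nat.card (ClassGroup (𝓞 K) →* Multiplicative (ZMod 3)) * 5832 ^ 2 := by
  classical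
  have hD := HK.ne_zero
  have hM : 6 * D.natAbs ≠ 0 := by have := Int.natAbs_pos.mpr hD; omega
  have hM1 : 6 * D.natAbs ≠ 1 := by omega
  have hrep : ∀ κ : 𝓞 L, ∃ (κ' : 𝓞 L) (𝔠' : Ideal (𝓞 L)), κ ∈ Z → CubeRel κ κ' ∧ κ' ≠ 0 ∧
      Ideal.span {κ'} = 𝔠' ^ 3 ∧ Nat.Coprime (Ideal.absNorm 𝔠') (6 * D.natAbs) := by
    intro κ
    by_cases hκ : κ ∈ Z
    · obtain ⟨h0, 𝔠, h𝔠⟩ := hZ κ hκ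
      obtain ⟨κ', 𝔠', h⟩ := exists_coprime_rep hM hM1 H h0 h𝔠
      exact ⟨κ', 𝔠', fun _ => h⟩
    · exact ⟨0, ⊥, fun h => absurd h hκ⟩
  choose φ I hφ using hrep
  have hfin : Finite (𝓞 L ⧸ Ideal.span {((5832 : ℕ) : 𝓞 L)}) := by
    apply Ideal.finiteQuotientOfFreeOfNeBot
    simp
  have hfinH : Finite (ClassGroup (𝓞 K) →* Multiplicative (ZMod 3)) := DFunLike.finite _
  have hcard : Nat.card (𝓞 L ⧸ Ideal.span {((5832 : ℕ) : 𝓞 L)}) = 5832 ^ 2 := by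
    have := H.absNorm_natCast 5832
    rwa [Ideal.absNorm_apply, Submodule.cardQuot_apply] at this
  let q : 𝓞 L → 𝓞 L ⧸ Ideal.span {((5832 : ℕ) : 𝓞 L)} := fun κ => Ideal.Quotient.mk _ (φ κ)
  have himg : (Z.image q).card ≤ 5832 ^ 2 := by
    have := Fintype.ofFinite (𝓞 L ⧸ Ideal.span {((5832 : ℕ) : 𝓞 L)})
    rw [← hcard, Nat.card_eq_fintype_card]
    exact Finset.card_le_univ _
  refine (Finset.card_le_mul_card_image Z _ fun b hb => ?_).trans (Nat.mul_le_mul_left _ himg)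
  obtain ⟨κ₀, hκ₀, rfl⟩ := Finset.mem_image.mp hb
  obtain ⟨-, h01, h02, h03⟩ := hφ κ₀ hκ₀
  obtain ⟨n, hn, hn'⟩ := exists_dvd_pow_sub_one (κ := φ κ₀) (N := 5832) (by norm_num) (by
    rw [h02, map_pow]
    exact Nat.Coprime.pow_left 3 (Nat.Coprime.coprime_dvd_right
      ⟨D.natAbs ^ 6, by ring⟩ (h03.pow_right 6)) |>.coprime_dvd_right (by norm_num : 5832 ∣ 6 ^ 6))
  have key : ∀ κ : 𝓞 L, κ ∈ Z.filter (q · = q κ₀) → ∃ (f : ClassGroup (𝓞 K) →* Multiplicative (ZMod 3))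
      (x y m g : ℤ) (M : ℕ), SymbolData D x y m M ∧ g ≠ 0 ∧
      φ κ * φ κ₀ ^ (3 * n - 1) = g ^ 3 * (x + (y * e : ℤ) * r) ∧
      ∀ I : nonZeroDivisors (Ideal (𝓞 K)), Nat.Coprime (Ideal.absNorm I.1) M →
      f (ClassGroup.mk0 I) = Multiplicative.ofAdd (chi s x y M I) := by
    intro κ hκ
    obtain ⟨hκZ, hq⟩ := Finset.mem_filter.mp hκ
    obtain ⟨-, h1, h2, h3⟩ := hφ κ hκZ
    obtain ⟨x, y, m, g, M, h, hg, hx⟩ := exists_symbolData_mul H hD he hD' h2 h02 h3 h03 hn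
      (by exact_mod_cast hn') (by
        have := Ideal.Quotient.eq.mp hq
        rw [Ideal.mem_span_singleton] at this
        exact_mod_cast this)
    obtain ⟨f, hf⟩ := exists_hom HK h
    exact ⟨f, x, y, m, g, M, h, hg, hx, hf⟩
  let F : Z.filter (q · = q κ₀) → (ClassGroup (𝓞 K) →* Multiplicative (ZMod 3)) :=
    fun κ => (key κ.1 κ.2).choose
  have hF : Function.Injective F := by
    rintro ⟨κ₁, hκ₁⟩ ⟨κ₂, hκ₂⟩ hF
    obtain ⟨x₁, y₁, m₁, g₁, M₁, hs₁, hg₁, hx₁, hf₁⟩ := (key κ₁ hκ₁).choose_spec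
    obtain ⟨x₂, y₂, m₂, g₂, M₂, hs₂, hg₂, hx₂, hf₂⟩ := (key κ₂ hκ₂).choose_spec
    have hFe : (key κ₁ hκ₁).choose = (key κ₂ hκ₂).choose := hF
    rw [← hFe] at hf₂
    have hrel := cubeRel_of_cube H hD' hs₁ hs₂ (exists_cube_of_hom_eq HK hs₁ hs₂ hf₁ hf₂)
    have c₁ := CubeRel.cube_mul (x := (x₁ + (y₁ * e : ℤ) * r : 𝓞 L)) (z := (g₁ : 𝓞 L))
      (by exact_mod_cast hg₁)
    have c₂ := CubeRel.cube_mul (x := (x₂ + (y₂ * e : ℤ) * r : 𝓞 L)) (z := (g₂ : 𝓞 L))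
      (by exact_mod_cast hg₂)
    rw [← hx₁] at c₁
    rw [← hx₂] at c₂
    have hc := ((c₁.trans hrel).trans c₂.symm).of_mul_right (pow_ne_zero _ h01)
    have hκ₁Z := (Finset.mem_filter.mp hκ₁).1
    have hκ₂Z := (Finset.mem_filter.mp hκ₂).1
    exact Subtype.ext (hpair κ₁ hκ₁Z κ₂ hκ₂Z
      (((hφ κ₁ hκ₁Z).1.trans hc).trans (hφ κ₂ hκ₂Z).1.symm))
  have := Nat.card_le_card_of_injective F hF
  rwa [Nat.card_eq_fintype_card, Fintype.card_coe] at this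

end CubicSymbol

namespace QuadData

variable {K : Type*} [Field K] [NumberField K] {s : 𝓞 K} {D : ℤ} (H : QuadData s D)
include H

lemma trace_sqrt : Algebra.trace ℤ (𝓞 K) s = 0 := by
  obtain ⟨σ, hσ, hσσ⟩ := H.conj
  let e : 𝓞 K ≃ₐ[ℤ] 𝓞 K := AlgEquiv.ofRingEquiv (f := RingEquiv.ofRingHom σ σ
    (RingHom.ext hσσ) (RingHom.ext hσσ)) (fun n => by simp)
  have h := Algebra.trace_eq_of_algEquiv e s
  have h1 : e s = -s := hσ
  rw [h1, map_neg] at h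
  omega

lemma finrank_int : Module.finrank ℤ (𝓞 K) = 2 := by
  rw [RingOfIntegers.rank, H.finrank]

lemma trace_intCast (n : ℤ) : Algebra.trace ℤ (𝓞 K) (n : 𝓞 K) = 2 * n := by
  have : (n : 𝓞 K) = algebraMap ℤ (𝓞 K) n := rfl
  rw [this, Algebra.trace_algebraMap, H.finrank_int]
  simp

lemma abs_discr_le : |discr K| ≤ 4 * |D| := by
  let b : Module.Basis (Fin 2) ℤ (𝓞 K) := Module.finBasisOfFinrankEq ℤ (𝓞 K) H.finrank_int
  let v : Fin 2 → 𝓞 K := ![1, s]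
  have h := Algebra.discr_of_matrix_vecMul b (b.toMatrix v)
  rw [Module.Basis.toMatrix_map_vecMul, discr_eq_discr] at h
  have hv : Algebra.discr ℤ v = 4 * D := by
    have h1 := H.trace_intCast 1
    have h2 := H.trace_intCast D
    rw [Int.cast_one] at h1
    rw [Algebra.discr_def, Matrix.det_fin_two]
    simp only [Algebra.traceMatrix_apply, Algebra.traceForm_apply, v, Matrix.cons_val_zero,
      Matrix.cons_val_one, mul_one, one_mul, ← pow_two, H.sq, H.trace_sqrt, h2, h1, one_pow]
    ring
  rw [hv] at h
  have hdet : (b.toMatrix v).det ≠ 0 := by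
    intro h0
    rw [h0] at h
    have := H.ne_zero
    simp at h
    exact this h
  have h3 : 4 * |D| = (b.toMatrix v).det ^ 2 * |discr K| := by
    rw [← abs_sq, ← abs_mul, ← h, abs_mul]; rfl
  rw [h3]
  have : 0 < (b.toMatrix v).det ^ 2 := by positivity
  exact le_mul_of_one_le_left (abs_nonneg _) this

open Classical in
lemma exists_mem_ideal_lt {J : Ideal (𝓞 K)} (hJ : J ≠ ⊥) (f : InfinitePlace K → NNReal)
    (h : 8 * (Ideal.absNorm J : ℝ) * √|(D : ℝ)| < ∏ w, (f w : ℝ) ^ w.mult) :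
    ∃ a ∈ J, a ≠ 0 ∧ ∀ w : InfinitePlace K, w (a : K) < f w := by
  let I : (FractionalIdeal (nonZeroDivisors (𝓞 K)) K)ˣ :=
    FractionalIdeal.mk0 K ⟨J, mem_nonZeroDivisors_of_ne_zero hJ⟩
  have hdisc : (√‖discr K‖₊ : ℝ) ≤ 2 * √|(D : ℝ)| := by
    have h4 : (4 : ℝ) = 2 ^ 2 := by norm_num
    rw [← Real.sqrt_sq (zero_le_two : (0 : ℝ) ≤ 2), ← Real.sqrt_mul (by positivity)]
    apply Real.sqrt_le_sqrt
    rw [← h4]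
    have := H.abs_discr_le
    rw [coe_nnnorm, Int.norm_eq_abs]
    exact_mod_cast this
  have hlt : mixedEmbedding.minkowskiBound K I <
      MeasureTheory.volume (mixedEmbedding.convexBodyLT K f) := by
    rw [mixedEmbedding.minkowskiBound,
      mixedEmbedding.volume_fundamentalDomain_fractionalIdealLatticeBasis,
      mixedEmbedding.volume_fundamentalDomain_latticeBasis, mixedEmbedding.finrank, H.finrank,
      mixedEmbedding.convexBodyLT_volume]
    have hN : FractionalIdeal.absNorm I.1 = (Ideal.absNorm J : ℚ) := by
      rw [show I.1 = (J : FractionalIdeal (nonZeroDivisors (𝓞 K)) K) from rfl,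
        FractionalIdeal.coeIdeal_absNorm]
    rw [hN]
    have h1 : (1 : ENNReal) ≤ mixedEmbedding.convexBodyLTFactor K := by
      exact_mod_cast mixedEmbedding.one_le_convexBodyLTFactor K
    refine lt_of_lt_of_le ?_ (le_mul_of_one_le_left' h1)
    have h2 : (2 : ENNReal)⁻¹ ^ InfinitePlace.nrComplexPlaces K ≤ 1 :=
      pow_le_one' (by simp) _
    calc _ ≤ ENNReal.ofReal ((Ideal.absNorm J : ℚ) : ℝ) * (1 * (NNReal.sqrt ‖discr K‖₊ : ENNReal))
          * 2 ^ 2 := by gcongr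
      _ = ENNReal.ofReal (Ideal.absNorm J * √‖discr K‖₊ * 4) := by
        rw [ENNReal.ofReal_mul (by positivity), ENNReal.ofReal_mul (by positivity), one_mul,
          ← Real.coe_sqrt, ENNReal.ofReal_coe_nnreal]
        norm_num [mul_assoc]
      _ < ENNReal.ofReal (∏ w, (f w : ℝ) ^ w.mult) := by
        refine ENNReal.ofReal_lt_ofReal_iff_of_nonneg (by positivity) |>.mpr ?_
        refine lt_of_le_of_lt ?_ h
        have := mul_le_mul_of_nonneg_left hdisc (Nat.cast_nonneg (α := ℝ) (Ideal.absNorm J))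
        nlinarith
      _ = _ := by
        have : (∏ w, (f w : ℝ) ^ w.mult) = ((∏ w, (f w) ^ w.mult : NNReal) : ℝ) := by
          push_cast; rfl
        rw [this, ENNReal.ofReal_coe_nnreal]
  obtain ⟨a, ha, ha0, haf⟩ := mixedEmbedding.exists_ne_zero_mem_ideal_lt K I hlt
  obtain ⟨x, hx, rfl⟩ := (FractionalIdeal.mem_coeIdeal _).mp ha
  exact ⟨x, hx, fun h => ha0 (by rw [h]; simp), haf⟩

/-- An integer of `ℚ(√D)` all of whose conjugates are small is rational. -/
lemma exists_int_of_place_le {x : 𝓞 K} {B : ℝ} (hx : ∀ w : InfinitePlace K, w (x : K) ≤ B)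
    (hB : 2 * B < √|(D : ℝ)|) : ∃ a : ℤ, 2 * x = a := by
  obtain ⟨σ, hσ, hσσ⟩ := H.conj
  obtain ⟨a, b, hab⟩ := H.repr x
  obtain ⟨φ⟩ := (inferInstance : Nonempty (K →+* ℂ))
  have hinj : Function.Injective ((φ.comp (algebraMap (𝓞 K) K)).comp σ) := by
    intro u v huv
    have h1 : σ u = σ v := (FaithfulSMul.algebraMap_injective (𝓞 K) K) (φ.injective huv)
    rw [← hσσ u, h1, hσσ]
  let ψ : K →+* ℂ := IsFractionRing.lift hinj
  have hψ : ∀ u : 𝓞 K, ψ u = φ (σ u : 𝓞 K) := fun u => IsFractionRing.lift_algebraMap hinj u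
  have h1 : ‖φ (x : K)‖ ≤ B := hx (InfinitePlace.mk φ)
  have h2 : ‖ψ (x : K)‖ ≤ B := hx (InfinitePlace.mk ψ)
  have hab' : 2 * σ x = a - b * s := by
    have := congrArg σ hab
    rw [map_mul, map_add, map_mul, hσ, map_intCast, map_intCast, map_ofNat] at this
    rw [this]; ring
  have h3 : φ (x : K) - ψ (x : K) = b * φ (s : K) := by
    rw [hψ]
    have h4 : x - σ x = b * s := by
      have h5 : (2 : 𝓞 K) * (x - σ x) = 2 * (b * s) := by linear_combination hab - hab'
      exact mul_left_cancel₀ two_ne_zero h5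
    have := congrArg (fun u : 𝓞 K => φ (u : K)) h4
    simpa using this
  have hs : ‖φ (s : K)‖ = √|(D : ℝ)| := by
    have h5 : φ (s : K) ^ 2 = (D : ℂ) := by
      have := congrArg (fun u : 𝓞 K => φ (u : K)) H.sq
      simpa using this
    have h6 := congrArg norm h5
    rw [norm_pow, Complex.norm_intCast] at h6
    rw [← h6, Real.sqrt_sq (norm_nonneg _)]
  have h7 : |(b : ℝ)| * √|(D : ℝ)| ≤ 2 * B := by
    rw [← hs, ← Complex.norm_intCast, ← norm_mul, ← h3]
    exact (norm_sub_le _ _).trans (by linarith)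
  have hb : b = 0 := by
    by_contra hb
    have : (1 : ℝ) ≤ |(b : ℝ)| := by exact_mod_cast Int.one_le_abs hb
    have := le_mul_of_one_le_left (Real.sqrt_nonneg |(D : ℝ)|) this
    linarith
  exact ⟨a, by rw [hab, hb]; simp⟩

end QuadData

lemma Nat.exists_card_divisors_le {ε : ℝ} (hε : 0 < ε) :
    ∃ C : ℝ, 1 ≤ C ∧ ∀ n : ℕ, n ≠ 0 → (n.divisors.card : ℝ) ≤ C * (n : ℝ) ^ ε := by
  obtain ⟨B, hB⟩ : ∃ B : ℕ, ∀ p : ℕ, B ≤ p → (2 : ℝ) ≤ (p : ℝ) ^ ε :=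
    (Filter.eventually_atTop.mp (((tendsto_rpow_atTop hε).comp
      tendsto_natCast_atTop_atTop).eventually_ge_atTop 2))
  have hlog : 0 < ε * Real.log 2 := mul_pos hε (Real.log_pos one_lt_two)
  set A : ℝ := 1 + 1 / (ε * Real.log 2) with hA
  have hA1 : 1 ≤ A := le_add_of_nonneg_right (by positivity)
  have key : ∀ (p : ℕ), p.Prime → ∀ e : ℕ, ((e : ℝ) + 1) ≤
      (if p < B then A else 1) * ((p : ℝ) ^ ε) ^ e := by
    intro p hp e
    split_ifs with h
    · have h1 : (1 : ℝ) + e * (ε * Real.log 2) ≤ ((p : ℝ) ^ ε) ^ e := by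
        have hp0 : (0 : ℝ) < p := by exact_mod_cast hp.pos
        have hl : Real.log 2 ≤ Real.log p :=
          Real.log_le_log two_pos (by exact_mod_cast hp.two_le)
        calc (1 : ℝ) + e * (ε * Real.log 2) ≤ e * (ε * Real.log p) + 1 := by
              have : (e : ℝ) * (ε * Real.log 2) ≤ e * (ε * Real.log p) := by gcongr
              linarith
          _ ≤ Real.exp (e * (ε * Real.log p)) := Real.add_one_le_exp _
          _ = ((p : ℝ) ^ ε) ^ e := by
            rw [Real.rpow_def_of_pos hp0, ← Real.exp_nat_mul, mul_comm ε]
      calc (e : ℝ) + 1 ≤ A * (1 + e * (ε * Real.log 2)) := by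
            have h2 : A * (1 + e * (ε * Real.log 2)) =
              1 + e + 1 / (ε * Real.log 2) + e * (ε * Real.log 2) := by
              rw [hA]; field_simp; ring
            rw [h2]
            have : 0 ≤ 1 / (ε * Real.log 2) + e * (ε * Real.log 2) := by positivity
            linarith
        _ ≤ _ := by gcongr
    · rw [one_mul]
      calc (e : ℝ) + 1 ≤ 2 ^ e := by exact_mod_cast Nat.lt_two_pow_self
        _ ≤ _ := pow_le_pow_left₀ zero_le_two (hB p (not_lt.mp h)) e
  refine ⟨A ^ B, one_le_pow₀ hA1, fun n hn => ?_⟩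
  rw [Nat.card_divisors hn]
  have h1 : ((n : ℝ) ^ ε) = ∏ p ∈ n.primeFactors, ((p : ℝ) ^ ε) ^ n.factorization p := by
    conv_lhs => rw [← Nat.prod_factorization_pow_eq_self hn, Finsupp.prod]
    rw [Nat.support_factorization]
    push_cast
    rw [← Real.finsetProd_rpow _ _ (fun _ _ => by positivity)]
    refine Finset.prod_congr rfl fun p _ => ?_
    rw [← Real.rpow_natCast, ← Real.rpow_mul (by positivity), mul_comm,
      Real.rpow_mul (by positivity), Real.rpow_natCast]
  have h2 : ∏ p ∈ n.primeFactors, (if p < B then A else 1) ≤ A ^ B := by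
    rw [Finset.prod_ite, Finset.prod_const, Finset.prod_const_one, mul_one]
    refine pow_le_pow_right₀ hA1 ?_
    calc _ ≤ (Finset.range B).card := Finset.card_le_card fun p hp => by
          simp only [Finset.mem_filter] at hp
          simpa using hp.2
      _ = B := Finset.card_range B
  push_cast
  calc _ ≤ ∏ p ∈ n.primeFactors, (if p < B then A else 1) * ((p : ℝ) ^ ε) ^ n.factorization p :=
        Finset.prod_le_prod (fun _ _ => by positivity) fun p hp =>
          key p (Nat.prime_of_mem_primeFactors hp) _
    _ ≤ _ := by
      rw [Finset.prod_mul_distrib, ← h1]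
      gcongr

namespace QuadData

variable {K : Type*} [Field K] [NumberField K] {s : 𝓞 K} {D : ℤ} (H : QuadData s D)
include H

lemma eq_or_eq_comap {σ : 𝓞 K →+* 𝓞 K} (hσ : σ s = -s) {P Q : Ideal (𝓞 K)} (hP : P.IsPrime)
    (hQ : Q.IsPrime) {p : ℕ} (hp : p.Prime) (hpP : (p : 𝓞 K) ∈ P) (hpQ : (p : 𝓞 K) ∈ Q) :
    Q = P ∨ Q = P.comap σ := by
  have hQ0 : Q ≠ ⊥ := by
    rintro rfl
    have : (p : 𝓞 K) = 0 := by simpa using hpQ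
    exact hp.ne_zero (by exact_mod_cast this)
  have hQmax := hQ.isMaximal hQ0
  have hsub : (Q : Set (𝓞 K)) ⊆ P ∪ (P.comap σ : Ideal (𝓞 K)) := by
    intro x hx
    obtain ⟨a, b, hab⟩ := H.repr x
    have hN := H.four_mul_absNorm hab
    have hab' : 2 * σ x = a - b * s := by
      have := congrArg σ hab
      rw [map_mul, map_add, map_mul, hσ, map_intCast, map_intCast, map_ofNat] at this
      rw [this]; ring
    obtain ⟨c, hc⟩ : ∃ c : ℤ, x * σ x = c := by
      have h4 : 4 * (x * σ x) = ((a ^ 2 - D * b ^ 2 : ℤ) : 𝓞 K) := by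
        push_cast
        linear_combination 2 * σ x * hab + (a + b * s) * hab' - (b ^ 2 : 𝓞 K) * H.sq
      rcases abs_choice (a ^ 2 - D * b ^ 2) with h | h
      · refine ⟨Ideal.absNorm (Ideal.span {x}), mul_left_cancel₀ ((by norm_num : (4 : 𝓞 K) ≠ 0)) ?_⟩
        rw [h4, ← h, ← hN]
        push_cast; rfl
      · refine ⟨-Ideal.absNorm (Ideal.span {x}), mul_left_cancel₀ ((by norm_num : (4 : 𝓞 K) ≠ 0)) ?_⟩
        rw [h4, ← neg_neg (a ^ 2 - D * b ^ 2), ← h, ← hN]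
        push_cast; ring
    have hcQ : (c : 𝓞 K) ∈ Q := hc ▸ Q.mul_mem_right _ hx
    have hcP : x * σ x ∈ P := by
      rw [hc]
      exact (Ideal.intCast_mem_iff_dvd hP.ne_top hp hpP c).mpr
        ((Ideal.intCast_mem_iff_dvd hQ.ne_top hp hpQ c).mp hcQ)
    exact hP.mem_or_mem hcP
  rcases Ideal.subset_union.mp hsub with h | h
  · exact Or.inl (hQmax.eq_of_le hP.ne_top h)
  · exact Or.inr (hQmax.eq_of_le (Ideal.comap_ne_top σ hP.ne_top) h)

lemma exists_prime_above {p : ℕ} (hp : p.Prime) :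
    ∃ P : Ideal (𝓞 K), P.IsPrime ∧ (p : 𝓞 K) ∈ P := by
  have h : Ideal.span {(p : 𝓞 K)} ≠ ⊤ := by
    intro h
    have := H.absNorm_natCast p
    rw [h, Ideal.absNorm_top] at this
    have := hp.two_le
    nlinarith
  obtain ⟨P, hP, hle⟩ := Ideal.exists_le_maximal _ h
  exact ⟨P, hP.isPrime, hle (Ideal.mem_span_singleton_self _)⟩

open UniqueFactorizationMonoid Classical in
lemma card_le_of_absNorm_eq {n : ℕ} (hn : n ≠ 0) (S : Finset (Ideal (𝓞 K)))
    (hS : ∀ I ∈ S, Ideal.absNorm I = n) : S.card ≤ n.divisors.card ^ 2 := by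
  obtain ⟨σ, hσ, hσσ⟩ := H.conj
  have hex : ∀ p : n.primeFactors, ∃ P : Ideal (𝓞 K), P.IsPrime ∧ ((p : ℕ) : 𝓞 K) ∈ P :=
    fun p => H.exists_prime_above (Nat.prime_of_mem_primeFactors p.2)
  choose P hP hpP using hex
  have hne : ∀ I ∈ S, I ≠ ⊥ := by
    intro I hI h
    have := hS I hI
    rw [h, Ideal.absNorm_bot] at this
    exact hn this.symm
  have hbound : ∀ I ∈ S, ∀ p : n.primeFactors, ∀ Q : Ideal (𝓞 K), Q.IsPrime →
      ((p : ℕ) : 𝓞 K) ∈ Q → (normalizedFactors I).count Q < n.factorization p + 1 := by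
    intro I hI p Q hQ hpQ
    have hp := Nat.prime_of_mem_primeFactors p.2
    have hQ0 : Q ≠ ⊥ := by
      rintro rfl
      have : ((p : ℕ) : 𝓞 K) = 0 := by simpa using hpQ
      exact hp.ne_zero (by exact_mod_cast this)
    obtain ⟨q, hq, hqQ, hqN⟩ := Ideal.exists_prime_mem hQ hQ0
    rw [← Ideal.prime_unique hQ.ne_top hp hq hpQ hqQ] at hqN
    rw [Nat.lt_succ_iff]
    apply (hp.pow_dvd_iff_le_factorization hn).mp
    have h1 : Q ^ (normalizedFactors I).count Q ∣ I := by
      have hQp : Prime Q := Ideal.prime_of_isPrime hQ0 hQ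
      have := (le_emultiplicity_iff_replicate_le_normalizedFactors (n := (normalizedFactors I).count Q)
        hQp.irreducible (hne I hI)).mpr (by
          rw [normalize_eq]; exact Multiset.le_count_iff_replicate_le.mp le_rfl)
      exact pow_dvd_of_le_emultiplicity this
    have h2 := Ideal.absNorm_dvd_absNorm_of_le (Ideal.le_of_dvd h1)
    rw [hS I hI, map_pow] at h2
    exact (pow_dvd_pow_of_dvd hqN _).trans h2
  have hPc : ∀ p, (P p).comap σ |>.IsPrime := fun p => Ideal.comap_isPrime σ (P p)
  have hpPc : ∀ p : n.primeFactors, ((p : ℕ) : 𝓞 K) ∈ (P p).comap σ := by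
    intro p
    rw [Ideal.mem_comap, map_natCast]; exact hpP p
  let F : S → (∀ p : n.primeFactors,
      Fin (n.factorization p + 1) × Fin (n.factorization p + 1)) := fun I p =>
    (⟨_, hbound I.1 I.2 p (P p) (hP p) (hpP p)⟩,
      ⟨_, hbound I.1 I.2 p ((P p).comap σ) (hPc p) (hpPc p)⟩)
  have hmem : ∀ I ∈ S, ∀ Q ∈ normalizedFactors I, ∃ p, Q = P p ∨ Q = (P p).comap σ := by
    intro I hI Q hQ
    have hQp : Q.IsPrime := Ideal.isPrime_of_prime (prime_of_normalized_factor Q hQ)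
    have hQ0 : Q ≠ ⊥ := (prime_of_normalized_factor Q hQ).ne_zero
    have hIQ : I ≤ Q := Ideal.le_of_dvd (dvd_of_mem_normalizedFactors hQ)
    obtain ⟨q, hq, hqQ, -⟩ := Ideal.exists_prime_mem hQp hQ0
    have hnQ : ((n : ℤ) : 𝓞 K) ∈ Q := by
      have := hIQ (Ideal.absNorm_mem I)
      rw [hS I hI] at this
      exact_mod_cast this
    have hqn := (Ideal.intCast_mem_iff_dvd hQp.ne_top hq hqQ n).mp hnQ
    let p : n.primeFactors := ⟨q, Nat.mem_primeFactors.mpr ⟨hq, by exact_mod_cast hqn, hn⟩⟩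
    exact ⟨p, H.eq_or_eq_comap hσ (hP p) hQp hq (hpP p) hqQ⟩
  have hF : Function.Injective F := by
    rintro ⟨I, hI⟩ ⟨J, hJ⟩ hIJ
    have hcount : ∀ p, ∀ Q : Ideal (𝓞 K), Q = P p ∨ Q = (P p).comap σ →
        (normalizedFactors I).count Q = (normalizedFactors J).count Q := by
      rintro p Q (rfl | rfl)
      · exact congrArg (fun f => ((f p).1 : ℕ)) hIJ
      · exact congrArg (fun f => ((f p).2 : ℕ)) hIJ
    have heq : normalizedFactors I = normalizedFactors J := by
      ext Q
      by_cases h1 : Q ∈ normalizedFactors I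
      · obtain ⟨p, hp⟩ := hmem I hI Q h1
        exact hcount p Q hp
      by_cases h2 : Q ∈ normalizedFactors J
      · obtain ⟨p, hp⟩ := hmem J hJ Q h2
        exact hcount p Q hp
      rw [Multiset.count_eq_zero.mpr h1, Multiset.count_eq_zero.mpr h2]
    apply Subtype.ext
    have h1 := prod_normalizedFactors_eq (hne I hI)
    have h2 := prod_normalizedFactors_eq (hne J hJ)
    rw [normalize_eq] at h1 h2
    exact h1.symm.trans ((congrArg Multiset.prod heq).trans h2)
  have hcard := Fintype.card_le_of_injective F hF
  rw [Fintype.card_coe] at hcard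
  refine hcard.trans (le_of_eq ?_)
  rw [Fintype.card_pi, Nat.card_divisors hn, ← Finset.prod_pow,
    ← Finset.prod_coe_sort n.primeFactors]
  refine Finset.prod_congr rfl fun p _ => ?_
  rw [Fintype.card_prod, Fintype.card_fin, pow_two]

end QuadData

lemma exists_card_ideal_le {ε : ℝ} (hε : 0 < ε) : ∃ C : ℝ, 1 ≤ C ∧
    ∀ {K : Type} [Field K] [NumberField K] {s : 𝓞 K} {D : ℤ}, QuadData s D →
    ∀ Y : ℝ, 1 ≤ Y → ∀ S : Finset (Ideal (𝓞 K)),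
    (∀ I ∈ S, I ≠ ⊥ ∧ (Ideal.absNorm I : ℝ) ≤ Y) → (S.card : ℝ) ≤ C * Y ^ (1 + ε) := by
  classical
  obtain ⟨C, hC, hCn⟩ := Nat.exists_card_divisors_le (half_pos hε)
  refine ⟨C ^ 2, one_le_pow₀ hC, ?_⟩
  intro K _ _ s D H Y hY S hS
  have hY0 : 0 ≤ Y := by linarith
  have hmaps : ∀ I ∈ S, Ideal.absNorm I ∈ Finset.Icc 1 ⌊Y⌋₊ := by
    intro I hI
    obtain ⟨h1, h2⟩ := hS I hI
    rw [Finset.mem_Icc]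
    exact ⟨Nat.one_le_iff_ne_zero.mpr (by rwa [Ne, Ideal.absNorm_eq_zero_iff]), Nat.le_floor h2⟩
  rw [Finset.card_eq_sum_card_fiberwise hmaps]
  push_cast
  calc _ ≤ ∑ n ∈ Finset.Icc 1 ⌊Y⌋₊, C ^ 2 * Y ^ ε := by
        refine Finset.sum_le_sum fun n hn => ?_
        obtain ⟨h1, h2⟩ := Finset.mem_Icc.mp hn
        have h3 := H.card_le_of_absNorm_eq (n := n) (by omega) (S.filter (Ideal.absNorm · = n))
          (fun I hI => (Finset.mem_filter.mp hI).2)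
        have h4 : (n : ℝ) ≤ Y := (Nat.le_floor_iff hY0).mp h2
        calc _ ≤ ((n.divisors.card : ℝ)) ^ 2 := by exact_mod_cast h3
          _ ≤ (C * (n : ℝ) ^ (ε / 2)) ^ 2 := by gcongr; exact hCn n (by omega)
          _ ≤ (C * Y ^ (ε / 2)) ^ 2 := by gcongr
          _ = C ^ 2 * Y ^ ε := by
            rw [mul_pow, ← Real.rpow_natCast (Y ^ (ε / 2)), ← Real.rpow_mul hY0]
            norm_num
    _ = ⌊Y⌋₊ * (C ^ 2 * Y ^ ε) := by rw [Finset.sum_const, Nat.card_Icc, nsmul_eq_mul]; simp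
    _ ≤ Y * (C ^ 2 * Y ^ ε) := by gcongr; exact Nat.floor_le hY0
    _ = C ^ 2 * Y ^ (1 + ε) := by rw [Real.rpow_add (by linarith), Real.rpow_one]; ring

section

variable {K : Type*} [Field K] [NumberField K]

open Classical in
lemma NumberField.prod_place_eq (x : 𝓞 K) :
    ∏ w : InfinitePlace K, w (x : K) ^ w.mult = Ideal.absNorm (Ideal.span {x}) := by
  rw [InfinitePlace.prod_eq_abs_norm, Ideal.absNorm_span_singleton]
  have : Algebra.norm ℚ (x : K) = ((Algebra.norm ℤ x : ℤ) : ℚ) := (Algebra.coe_norm_int x).symm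
  rw [this]
  push_cast [Nat.cast_natAbs]
  rfl

omit [NumberField K] in
lemma NumberField.place_pos {x : 𝓞 K} (hx : x ≠ 0) (w : InfinitePlace K) : 0 < w (x : K) :=
  InfinitePlace.pos_iff.mpr (by simpa using hx)

lemma one_le_mul_of_prod_pow {ι : Type*} [Fintype ι] {m : ι → ℕ} (hm : ∀ i, 1 ≤ m i)
    (hsum : ∑ i, m i = 2) {y : ι → ℝ} {T : ℝ} (hy : ∀ i, 0 < y i) (hT : ∀ i, y i ≤ T)
    (h : 1 ≤ ∏ i, y i ^ m i) (i : ι) : 1 ≤ y i * T := by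
  classical
  have hT0 : 0 ≤ T := (hy i).le.trans (hT i)
  have h1 : ∑ j ∈ Finset.univ.erase i, m j + m i = 2 := by
    rw [Finset.sum_erase_add _ _ (Finset.mem_univ i), hsum]
  calc 1 ≤ ∏ j, y j ^ m j := h
    _ = y i ^ m i * ∏ j ∈ Finset.univ.erase i, y j ^ m j :=
      (Finset.mul_prod_erase _ _ (Finset.mem_univ i)).symm
    _ ≤ (y i * T ^ (m i - 1)) * ∏ j ∈ Finset.univ.erase i, T ^ m j := by
      gcongr with j _
      · exact Finset.prod_nonneg fun j _ => pow_nonneg (hy j).le _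
      · exact mul_nonneg (hy i).le (pow_nonneg hT0 _)
      · obtain ⟨k, hk⟩ : ∃ k, m i = k + 1 := ⟨m i - 1, by have := hm i; omega⟩
        rw [hk, pow_succ', Nat.add_sub_cancel]
        exact mul_le_mul_of_nonneg_left (pow_le_pow_left₀ (hy i).le (hT i) _) (hy i).le
      · exact fun j _ => pow_nonneg (hy j).le _
      · exact (hy _).le
      · exact hT _
    _ = y i * T := by
      rw [Finset.prod_pow_eq_pow_sum, mul_assoc, ← pow_add]
      have := hm i
      rw [show m i - 1 + ∑ j ∈ Finset.univ.erase i, m j = 1 by omega, pow_one]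

end

namespace QuadData

variable {K : Type*} [Field K] [NumberField K] {s : 𝓞 K} {D : ℤ} (H : QuadData s D)
include H

lemma sum_mult : ∑ w : InfinitePlace K, w.mult = 2 := by
  rw [InfinitePlace.sum_mult_eq, H.finrank]

lemma one_le_sqrt : 1 ≤ √|(D : ℝ)| := by
  rw [Real.one_le_sqrt]
  exact_mod_cast Int.one_le_abs H.ne_zero

lemma exists_short_element {κ : 𝓞 K} (hκ : κ ≠ 0) {𝔠 P : Ideal (𝓞 K)}
    (h : Ideal.span {κ} = 𝔠 ^ 3) (hP : P ≠ ⊥) {t : ℝ} (ht : 0 < t)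
    (htP : t ^ 2 = 9 * Ideal.absNorm P * √|(D : ℝ)|) :
    ∃ (α : 𝓞 K) (𝔟 : Ideal (𝓞 K)), α ≠ 0 ∧ Ideal.span {α} = 𝔠 * P * 𝔟 ∧ 𝔟 ≠ ⊥ ∧
      (Ideal.absNorm 𝔟 : ℝ) ≤ 9 * √|(D : ℝ)| ∧ ∀ w : InfinitePlace K,
        w (α : K) ^ 3 / w (κ : K) ≤ t ^ 3 ∧ 1 ≤ w (α : K) ^ 3 / w (κ : K) * t ^ 3 := by
  classical
  have hs := H.one_le_sqrt
  have h𝔠 : 𝔠 ≠ ⊥ := by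
    rintro rfl
    rw [← Ideal.zero_eq_bot, zero_pow three_ne_zero, Ideal.zero_eq_bot,
      Ideal.span_singleton_eq_bot] at h
    exact hκ h
  have hNκ : (Ideal.absNorm (Ideal.span {κ}) : ℝ) = (Ideal.absNorm 𝔠 : ℝ) ^ 3 := by
    rw [h, map_pow]; push_cast; rfl
  have hNP : (0 : ℝ) < Ideal.absNorm P := by
    exact_mod_cast Nat.pos_of_ne_zero (by rwa [Ne, Ideal.absNorm_eq_zero_iff])
  have hN𝔠 : (0 : ℝ) < Ideal.absNorm 𝔠 := by
    exact_mod_cast Nat.pos_of_ne_zero (by rwa [Ne, Ideal.absNorm_eq_zero_iff])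
  let f : InfinitePlace K → NNReal := fun w =>
    ⟨w (κ : K) ^ (1 / 3 : ℝ) * t, by have := place_pos hκ w; positivity⟩
  have hf : ∀ w, (f w : ℝ) = w (κ : K) ^ (1 / 3 : ℝ) * t := fun w => rfl
  have hf3 : ∀ w, (f w : ℝ) ^ 3 = w (κ : K) * t ^ 3 := fun w => by
    rw [hf, mul_pow, ← Real.rpow_natCast, ← Real.rpow_mul (place_pos hκ w).le]
    norm_num
  have hfpos : ∀ w, 0 < (f w : ℝ) := fun w => by
    rw [hf]; have := place_pos hκ w; positivity
  have hprod : ∏ w, (f w : ℝ) ^ w.mult = Ideal.absNorm 𝔠 * t ^ 2 := by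
    apply (pow_left_inj₀ (Finset.prod_nonneg fun w _ => pow_nonneg (hfpos w).le _)
      (by positivity) three_ne_zero).mp
    rw [← Finset.prod_pow]
    calc _ = ∏ w : InfinitePlace K, w (κ : K) ^ w.mult * (t ^ 3) ^ w.mult := by
          refine Finset.prod_congr rfl fun w _ => ?_
          rw [← pow_mul, mul_comm, pow_mul, hf3, mul_pow]
      _ = _ := by
          rw [Finset.prod_mul_distrib, NumberField.prod_place_eq, hNκ, Finset.prod_pow_eq_pow_sum,
            H.sum_mult]
          ring
  obtain ⟨α, hα, hα0, hαf⟩ := H.exists_mem_ideal_lt (J := 𝔠 * P) (mul_ne_zero h𝔠 hP) f (by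
    rw [hprod, htP, map_mul]
    push_cast
    have : 0 < (Ideal.absNorm 𝔠 : ℝ) * Ideal.absNorm P * √|(D : ℝ)| := by positivity
    linarith)
  obtain ⟨𝔟, h𝔟⟩ := Ideal.dvd_iff_le.mpr ((Ideal.span_singleton_le_iff_mem _).mpr hα)
  have h𝔟0 : 𝔟 ≠ ⊥ := by
    rintro rfl
    rw [Ideal.mul_bot, Ideal.span_singleton_eq_bot] at h𝔟
    exact hα0 h𝔟
  have hN𝔟 : (1 : ℝ) ≤ Ideal.absNorm 𝔟 := by
    exact_mod_cast Nat.pos_of_ne_zero (by rwa [Ne, Ideal.absNorm_eq_zero_iff])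
  have hNα : (Ideal.absNorm (Ideal.span {α}) : ℝ) =
      Ideal.absNorm 𝔠 * Ideal.absNorm P * Ideal.absNorm 𝔟 := by
    rw [h𝔟, map_mul, map_mul]; push_cast; rfl
  refine ⟨α, 𝔟, hα0, h𝔟, h𝔟0, ?_, fun w => ?_⟩
  · have h1 : (Ideal.absNorm (Ideal.span {α}) : ℝ) ≤ Ideal.absNorm 𝔠 * t ^ 2 := by
      rw [← hprod, ← NumberField.prod_place_eq]
      exact Finset.prod_le_prod (fun w _ => by positivity) fun w _ =>
        pow_le_pow_left₀ (by positivity) (hαf w).le _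
    rw [hNα, htP] at h1
    have h2 : 0 < (Ideal.absNorm 𝔠 : ℝ) * Ideal.absNorm P := by positivity
    apply le_of_mul_le_mul_left _ h2
    linarith
  · have hle : ∀ w : InfinitePlace K, w (α : K) ^ 3 / w (κ : K) ≤ t ^ 3 := fun w => by
      rw [div_le_iff₀ (place_pos hκ w), mul_comm, ← hf3]
      exact pow_le_pow_left₀ (by positivity) (hαf w).le _
    refine ⟨hle w, one_le_mul_of_prod_pow (m := InfinitePlace.mult)
      (fun w => InfinitePlace.mult_pos) H.sum_mult
      (y := fun w : InfinitePlace K => w (α : K) ^ 3 / w (κ : K)) (fun w => ?_) hle ?_ w⟩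
    · have := place_pos hκ w
      have := place_pos hα0 w
      positivity
    · have : ∏ w : InfinitePlace K, (w (α : K) ^ 3 / w (κ : K)) ^ w.mult =
          (Ideal.absNorm P * Ideal.absNorm 𝔟 : ℝ) ^ 3 := by
        calc _ = (∏ w : InfinitePlace K, w (α : K) ^ w.mult) ^ 3 /
              ∏ w : InfinitePlace K, w (κ : K) ^ w.mult := by
              rw [← Finset.prod_pow, ← Finset.prod_div_distrib]
              refine Finset.prod_congr rfl fun w _ => ?_
              rw [div_pow, ← pow_mul, ← pow_mul, mul_comm]
          _ = _ := by
              rw [NumberField.prod_place_eq, NumberField.prod_place_eq, hNκ, hNα]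
              field_simp
      rw [this]
      apply one_le_pow₀
      have : (1 : ℝ) ≤ Ideal.absNorm P := by exact_mod_cast hNP
      nlinarith

lemma exists_int_of_close {κ κ' α α' : 𝓞 K} {𝔠 𝔠' P P' 𝔟 : Ideal (𝓞 K)} (hκ : κ ≠ 0)
    (hα' : α' ≠ 0) (h : Ideal.span {κ} = 𝔠 ^ 3)
    (h' : Ideal.span {κ'} = 𝔠' ^ 3) (hα : Ideal.span {α} = 𝔠 * P * 𝔟)
    (hαs' : Ideal.span {α'} = 𝔠' * P' * 𝔟) {X : ℝ} (hX : 16 * X ^ 3 < √|(D : ℝ)|)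
    (hP' : (Ideal.absNorm P' : ℝ) ≤ X) (hw : ∀ w : InfinitePlace K,
      w (α : K) ^ 3 * w (κ' : K) ≤ 8 * (w (α' : K) ^ 3 * w (κ : K))) :
    ∃ a : ℤ, a * (α' ^ 3 * κ) = ((2 * Ideal.absNorm P' ^ 3 : ℤ) : 𝓞 K) * (α ^ 3 * κ') := by
  set N : ℕ := Ideal.absNorm P'
  have hdvd : α' ^ 3 * κ ∣ α ^ 3 * κ' * (N : 𝓞 K) ^ 3 := by
    rw [← Ideal.span_singleton_le_span_singleton, ← Ideal.dvd_iff_le,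
      ← Ideal.span_singleton_mul_span_singleton, ← Ideal.span_singleton_mul_span_singleton,
      ← Ideal.span_singleton_mul_span_singleton, ← Ideal.span_singleton_pow,
      ← Ideal.span_singleton_pow, ← Ideal.span_singleton_pow, h, h', hα, hαs']
    have hPN : P' ∣ Ideal.span {(N : 𝓞 K)} := by
      rw [Ideal.dvd_iff_le, Ideal.span_singleton_le_iff_mem]
      exact Ideal.absNorm_mem P'
    obtain ⟨R, hR⟩ := hPN
    exact ⟨P ^ 3 * R ^ 3, by rw [hR]; ring⟩
  obtain ⟨δ, hδ⟩ := hdvd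
  have hδw : ∀ w : InfinitePlace K, w (δ : K) ≤ 8 * X ^ 3 := by
    intro w
    have h1 : 0 < w (α' : K) ^ 3 * w (κ : K) := by
      have := place_pos hκ w
      have := place_pos hα' w
      positivity
    have h2 := congrArg (fun x : 𝓞 K => w (x : K)) hδ
    simp only [map_mul, map_pow, map_natCast] at h2
    have hwN : w (N : K) = N := by
      have := w.norm_embedding_eq (N : K)
      rw [← this, map_natCast, Complex.norm_natCast]
    rw [hwN] at h2
    apply le_of_mul_le_mul_left _ h1
    rw [← h2]
    calc _ ≤ 8 * (w (α' : K) ^ 3 * w (κ : K)) * X ^ 3 := by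
          exact mul_le_mul (hw w) (pow_le_pow_left₀ (Nat.cast_nonneg _) hP' 3) (by positivity)
            (by positivity)
      _ = _ := by ring
  obtain ⟨a, ha⟩ := H.exists_int_of_place_le hδw (by linarith)
  refine ⟨a, ?_⟩
  push_cast
  linear_combination (-α' ^ 3 * κ) * ha - 2 * hδ

end QuadData

lemma exists_logb_le {δ : ℝ} (hδ : 0 < δ) : ∃ C : ℝ, 0 < C ∧ ∀ x : ℝ, 1 ≤ x →
    2 * Real.logb 2 (3 * x) + 2 ≤ C * x ^ δ := by
  have hlog : 0 < Real.log 2 := Real.log_pos one_lt_two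
  refine ⟨2 * (3 ^ δ / δ / Real.log 2) + 2, by positivity, fun x hx => ?_⟩
  have h1 : Real.logb 2 (3 * x) ≤ 3 ^ δ / δ / Real.log 2 * x ^ δ := by
    rw [Real.logb]
    calc _ ≤ (3 * x) ^ δ / δ / Real.log 2 := by
          gcongr
          exact Real.log_le_rpow_div (by positivity) hδ
      _ = _ := by rw [Real.mul_rpow (by norm_num) (by linarith)]; ring
  have h2 : 1 ≤ x ^ δ := Real.one_le_rpow hx hδ.le
  nlinarith

lemma le_mul_of_floor_logb_eq {b u v : ℝ} (hb : 1 < b) (hu : 0 < u) (hv : 0 < v)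
    (h : ⌊Real.logb b u⌋ = ⌊Real.logb b v⌋) : u ≤ b * v := by
  have h1 := Int.lt_floor_add_one (Real.logb b u)
  rw [h] at h1
  have h2 : Real.logb b u ≤ Real.logb b (b * v) := by
    rw [Real.logb_mul (by positivity) hv.ne', Real.logb_self_eq_one hb]
    linarith [Int.floor_le (Real.logb b v)]
  exact (Real.logb_le_logb hb hu (by positivity)).mp h2

lemma floor_logb_mem_Icc {b u T : ℝ} (hb : 1 < b) (hu : 0 < u) (hT : u ≤ T) (h1 : 1 ≤ u * T) :
    ⌊Real.logb b u⌋ ∈ Finset.Icc ⌊-Real.logb b T⌋ ⌊Real.logb b T⌋ := by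
  rw [Finset.mem_Icc]
  refine ⟨Int.floor_le_floor ?_, Int.floor_le_floor ((Real.logb_le_logb hb hu (hu.trans_le hT)).mpr hT)⟩
  have hT0 := hu.trans_le hT
  rw [neg_le_iff_add_nonneg', add_comm, ← Real.logb_mul hu.ne' hT0.ne']
  exact Real.logb_nonneg hb h1

lemma card_Icc_floor_le {ℓ : ℝ} (hℓ : 0 ≤ ℓ) : ((Finset.Icc ⌊-ℓ⌋ ⌊ℓ⌋).card : ℝ) ≤ 2 * ℓ + 2 := by
  rw [Int.card_Icc]
  have h1 := Int.floor_le ℓ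
  have h2 := Int.lt_floor_add_one (-ℓ)
  have h3 : (0 : ℤ) ≤ ⌊ℓ⌋ + 1 - ⌊-ℓ⌋ := by
    have : ⌊-ℓ⌋ ≤ ⌊ℓ⌋ := Int.floor_le_floor (by linarith)
    omega
  have h4 : (((⌊ℓ⌋ + 1 - ⌊-ℓ⌋).toNat : ℤ) : ℝ) = ((⌊ℓ⌋ + 1 - ⌊-ℓ⌋ : ℤ) : ℝ) := by
    rw [Int.toNat_of_nonneg h3]
  rw [Int.cast_natCast] at h4
  rw [h4]
  push_cast
  linarith

/-- The counting lemma of Ellenberg and Venkatesh for a quadratic field: many ideals of small norm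
force few classes modulo cubes. -/
theorem exists_card_mul_card_le {ε : ℝ} (hε : 0 < ε) : ∃ C : ℝ, 0 < C ∧
    ∀ {K : Type} [Field K] [NumberField K] {s : 𝓞 K} {D : ℤ}, QuadData s D →
    ∀ (Z : Finset (𝓞 K)) (S : Finset (Ideal (𝓞 K))) (X : ℝ),
    (∀ κ ∈ Z, κ ≠ 0 ∧ ∃ 𝔠 : Ideal (𝓞 K), Ideal.span {κ} = 𝔠 ^ 3) →
    (∀ κ ∈ Z, ∀ κ' ∈ Z, CubeRel κ κ' → κ = κ') →
    16 * X ^ 3 < √|(D : ℝ)| →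
    (∀ P ∈ S, P ≠ ⊥ ∧ (Ideal.absNorm P : ℝ) ≤ X) →
    (∀ P ∈ S, ∀ P' ∈ S, ∀ m m' : ℤ, m ≠ 0 → m' ≠ 0 →
      Ideal.span {(m : 𝓞 K)} * P' ^ 3 = Ideal.span {(m' : 𝓞 K)} * P ^ 3 → P = P') →
    (Z.card * S.card : ℝ) ≤ C * |(D : ℝ)| ^ (1 / 2 + ε) := by
  classical
  obtain ⟨C₁, hC₁, hideal⟩ := exists_card_ideal_le hε
  obtain ⟨C₂, hC₂, hlogb⟩ := exists_logb_le (δ := ε / 4) (by positivity)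
  refine ⟨C₁ * 9 ^ (1 + ε) * (1 + C₂) ^ 2, by positivity, ?_⟩
  intro K _ _ s D H Z S X hZ hpair hX hS hSpair
  have hs := H.one_le_sqrt
  have hD1 : (1 : ℝ) ≤ |(D : ℝ)| := by exact_mod_cast Int.one_le_abs H.ne_zero
  set T : ℝ := (3 * |(D : ℝ)|) ^ 3 with hT
  have hex : ∀ q : 𝓞 K × Ideal (𝓞 K), ∃ (𝔠 𝔟 : Ideal (𝓞 K)) (α : 𝓞 K), q ∈ Z ×ˢ S →
      Ideal.span {q.1} = 𝔠 ^ 3 ∧ α ≠ 0 ∧ Ideal.span {α} = 𝔠 * q.2 * 𝔟 ∧ 𝔟 ≠ ⊥ ∧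
      (Ideal.absNorm 𝔟 : ℝ) ≤ 9 * √|(D : ℝ)| ∧ ∀ w : InfinitePlace K,
        w (α : K) ^ 3 / w (q.1 : K) ≤ T ∧ 1 ≤ w (α : K) ^ 3 / w (q.1 : K) * T := by
    rintro ⟨κ, P⟩
    by_cases hq : (κ, P) ∈ Z ×ˢ S
    swap
    · exact ⟨⊥, ⊥, 0, fun h => absurd h hq⟩
    obtain ⟨hκ, hP⟩ := Finset.mem_product.mp hq
    obtain ⟨hκ0, 𝔠, h𝔠⟩ := hZ κ hκ
    obtain ⟨hP0, hPX⟩ := hS P hP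
    have hNP : (1 : ℝ) ≤ Ideal.absNorm P := by
      exact_mod_cast Nat.pos_of_ne_zero (by rwa [Ne, Ideal.absNorm_eq_zero_iff])
    have hX1 : 1 ≤ X := hNP.trans hPX
    have hXs : X ≤ √|(D : ℝ)| := by nlinarith [pow_pos (by linarith : 0 < X) 2, sq_nonneg (X - 1)]
    have hpos : 0 < 9 * (Ideal.absNorm P : ℝ) * √|(D : ℝ)| := by positivity
    obtain ⟨α, 𝔟, h1, h2, h3, h4, h5⟩ := H.exists_short_element hκ0 h𝔠 hP0
      (t := √(9 * (Ideal.absNorm P : ℝ) * √|(D : ℝ)|)) (Real.sqrt_pos.mpr hpos)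
      (Real.sq_sqrt hpos.le)
    have htT : √(9 * (Ideal.absNorm P : ℝ) * √|(D : ℝ)|) ^ 3 ≤ T := by
      rw [hT]
      refine pow_le_pow_left₀ (Real.sqrt_nonneg _) ?_ 3
      rw [Real.sqrt_le_left (by positivity)]
      calc 9 * (Ideal.absNorm P : ℝ) * √|(D : ℝ)| ≤ 9 * √|(D : ℝ)| * √|(D : ℝ)| := by
            gcongr; exact hPX.trans hXs
        _ = 9 * |(D : ℝ)| := by rw [mul_assoc, Real.mul_self_sqrt (abs_nonneg _)]
        _ ≤ _ := by nlinarith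
    refine ⟨𝔠, 𝔟, α, fun _ => ⟨h𝔠, h1, h2, h3, h4, fun w => ?_⟩⟩
    obtain ⟨h6, h7⟩ := h5 w
    have := place_pos hκ0 w
    exact ⟨h6.trans htT, h7.trans (mul_le_mul_of_nonneg_left htT (by positivity))⟩
  choose 𝔠 𝔟 α hall using hex
  let u : 𝓞 K × Ideal (𝓞 K) → InfinitePlace K → ℝ := fun q w => w (α q : K) ^ 3 / w (q.1 : K)
  have hu : ∀ q ∈ Z ×ˢ S, ∀ w, 0 < u q w := fun q hq w => by
    have := place_pos (hZ q.1 (Finset.mem_product.mp hq).1).1 w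
    have := place_pos (hall q hq).2.1 w
    simp only [u]
    positivity
  let B := Finset.Icc ⌊-Real.logb 8 T⌋ ⌊Real.logb 8 T⌋
  let F : 𝓞 K × Ideal (𝓞 K) → Ideal (𝓞 K) × (InfinitePlace K → ℤ) :=
    fun q => (𝔟 q, fun w => ⌊Real.logb 8 (u q w)⌋)
  have hcard : (Z ×ˢ S).card ≤
      (((Z ×ˢ S).image 𝔟) ×ˢ Fintype.piFinset (fun _ : InfinitePlace K => B)).card := by
    apply Finset.card_le_card_of_injOn F
    · intro q hq
      rw [Finset.mem_coe] at hq
      simp only [F, Finset.coe_product, Set.mem_prod, Finset.mem_coe, Fintype.mem_piFinset]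
      exact ⟨Finset.mem_image_of_mem _ hq, fun w => floor_logb_mem_Icc (by norm_num) (hu q hq w)
        ((hall q hq).2.2.2.2.2 w).1 ((hall q hq).2.2.2.2.2 w).2⟩
    · rintro ⟨κ, P⟩ hq ⟨κ', P'⟩ hq' hF
      rw [Finset.mem_coe] at hq hq'
      obtain ⟨hκ, hP⟩ := Finset.mem_product.mp hq
      obtain ⟨hκ', hP'⟩ := Finset.mem_product.mp hq'
      obtain ⟨a1, a2, a3, -, -, -⟩ := hall _ hq
      obtain ⟨b1, b2, b3, b4, -, -⟩ := hall _ hq'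
      have hF1 : 𝔟 (κ, P) = 𝔟 (κ', P') := congrArg Prod.fst hF
      have hF2 : ∀ w, ⌊Real.logb 8 (u (κ, P) w)⌋ = ⌊Real.logb 8 (u (κ', P') w)⌋ :=
        fun w => congrFun (congrArg Prod.snd hF) w
      rw [hF1] at a3
      have hκ0 := (hZ κ hκ).1
      have hκ0' := (hZ κ' hκ').1
      obtain ⟨a, ha⟩ := H.exists_int_of_close hκ0 b2 a1 b1 a3 b3 hX (hS P' hP').2 (fun w => by
        have h1 := le_mul_of_floor_logb_eq (by norm_num) (hu _ hq w) (hu _ hq' w) (hF2 w)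
        simp only [u] at h1
        have hw := place_pos hκ0 w
        have hw' := place_pos hκ0' w
        rw [← mul_div_assoc, div_le_div_iff₀ hw hw'] at h1
        linarith)
      set N := Ideal.absNorm P' with hN
      have hN0 : (N : ℤ) ≠ 0 := by
        rw [hN]
        exact_mod_cast (by rw [Ne, Ideal.absNorm_eq_zero_iff]; exact (hS P' hP').1 : N ≠ 0)
      have hm' : (2 * (N : ℤ) ^ 3) ≠ 0 := mul_ne_zero two_ne_zero (pow_ne_zero 3 hN0)
      have ha0 : a ≠ 0 := by
        rintro rfl
        rw [Int.cast_zero, zero_mul] at ha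
        refine mul_ne_zero ?_ (mul_ne_zero (pow_ne_zero 3 a2) hκ0') ha.symm
        exact_mod_cast hm'
      have hsp : Ideal.span {(a : 𝓞 K)} * P' ^ 3 =
          Ideal.span {((2 * (N : ℤ) ^ 3 : ℤ) : 𝓞 K)} * P ^ 3 := by
        have h1 := congrArg (fun x : 𝓞 K => Ideal.span {x}) ha
        simp only [← Ideal.span_singleton_mul_span_singleton, ← Ideal.span_singleton_pow] at h1
        rw [a1, b1, a3, b3] at h1
        have h0 : (𝔠 (κ, P) * 𝔠 (κ', P') * 𝔟 (κ', P')) ^ 3 ≠ 0 := by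
          apply pow_ne_zero
          refine mul_ne_zero (mul_ne_zero ?_ ?_) b4
          · intro h; rw [h, zero_mul, zero_mul, Ideal.zero_eq_bot,
              Ideal.span_singleton_eq_bot] at a3; exact a2 a3
          · intro h; rw [h, zero_mul, zero_mul, Ideal.zero_eq_bot,
              Ideal.span_singleton_eq_bot] at b3; exact b2 b3
        apply mul_left_cancel₀ h0
        calc _ = _ := by ring
          _ = _ := h1
          _ = _ := by ring
      have hPP : P = P' := hSpair P hP P' hP' a _ ha0 hm' hsp
      subst hPP
      have hP3 : P ^ 3 ≠ 0 := pow_ne_zero 3 (hS P hP).1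
      have h2 := congrArg Ideal.absNorm (mul_right_cancel₀ hP3 hsp)
      rw [H.absNorm_intCast, H.absNorm_intCast] at h2
      have h3 := Int.natAbs_eq_natAbs_iff.mp ((Nat.pow_left_injective two_ne_zero) h2)
      have hm0 : ((2 * (N : ℤ) ^ 3 : ℤ) : 𝓞 K) ≠ 0 := by exact_mod_cast hm'
      have hrel : CubeRel κ κ' := by
        rcases h3 with h3 | h3
        · rw [h3] at ha
          exact ⟨_, _, b2, a2, mul_left_cancel₀ hm0 ha⟩
        · refine ⟨-α (κ', P), α (κ, P), neg_ne_zero.mpr b2, a2, mul_left_cancel₀ hm0 ?_⟩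
          rw [← ha, h3]
          push_cast; ring
      rw [hpair κ hκ κ' hκ' hrel]
  have hT1 : 1 ≤ T := one_le_pow₀ (by linarith)
  have hlogT : Real.logb 8 T = Real.logb 2 (3 * |(D : ℝ)|) := by
    rw [hT, Real.logb, Real.logb, Real.log_pow, show (8 : ℝ) = 2 ^ 3 by norm_num, Real.log_pow]
    push_cast
    rw [mul_div_mul_left _ _ three_ne_zero]
  have hB : (B.card : ℝ) ≤ (1 + C₂) * |(D : ℝ)| ^ (ε / 4) := by
    refine (card_Icc_floor_le (Real.logb_nonneg (by norm_num) hT1)).trans ?_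
    rw [hlogT]
    refine (hlogb _ hD1).trans ?_
    gcongr
    linarith
  have hplaces : Fintype.card (InfinitePlace K) ≤ 2 := by
    rw [← H.sum_mult, Fintype.card, Finset.card_eq_sum_ones]
    exact Finset.sum_le_sum fun w _ => InfinitePlace.mult_pos
  have hpi : ((Fintype.piFinset (fun _ : InfinitePlace K => B)).card : ℝ) ≤
      (1 + C₂) ^ 2 * |(D : ℝ)| ^ (ε / 2) := by
    rw [Fintype.card_piFinset, Finset.prod_const, Finset.card_univ]
    have h1 : 1 ≤ (1 + C₂) * |(D : ℝ)| ^ (ε / 4) := by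
      have := Real.one_le_rpow hD1 (by positivity : 0 ≤ ε / 4)
      nlinarith
    push_cast
    calc _ ≤ ((1 + C₂) * |(D : ℝ)| ^ (ε / 4)) ^ Fintype.card (InfinitePlace K) := by gcongr
      _ ≤ ((1 + C₂) * |(D : ℝ)| ^ (ε / 4)) ^ 2 := pow_le_pow_right₀ h1 hplaces
      _ = _ := by
        rw [mul_pow, ← Real.rpow_natCast (_ ^ (ε / 4)), ← Real.rpow_mul (abs_nonneg _)]
        congr 2
        push_cast
        ring
  have himg : (((Z ×ˢ S).image 𝔟).card : ℝ) ≤ C₁ * 9 ^ (1 + ε) * |(D : ℝ)| ^ (1 / 2 + ε / 2) := by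
    have h1 := hideal H (9 * √|(D : ℝ)|) (by linarith) ((Z ×ˢ S).image 𝔟) (by
      intro I hI
      obtain ⟨q, hq, rfl⟩ := Finset.mem_image.mp hI
      exact ⟨(hall q hq).2.2.2.1, (hall q hq).2.2.2.2.1⟩)
    refine h1.trans (le_of_eq ?_)
    rw [Real.mul_rpow (by norm_num) (Real.sqrt_nonneg _), Real.sqrt_eq_rpow,
      ← Real.rpow_mul (abs_nonneg _)]
    ring_nf
  rw [Finset.card_product, Finset.card_product] at hcard
  calc (Z.card * S.card : ℝ) ≤ ((Z ×ˢ S).image 𝔟).card *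
        (Fintype.piFinset (fun _ : InfinitePlace K => B)).card := by exact_mod_cast hcard
    _ ≤ (C₁ * 9 ^ (1 + ε) * |(D : ℝ)| ^ (1 / 2 + ε / 2)) *
        ((1 + C₂) ^ 2 * |(D : ℝ)| ^ (ε / 2)) := by gcongr
    _ = C₁ * 9 ^ (1 + ε) * (1 + C₂) ^ 2 *
        (|(D : ℝ)| ^ (1 / 2 + ε / 2) * |(D : ℝ)| ^ (ε / 2)) := by ring
    _ = _ := by
      rw [← Real.rpow_add (by linarith)]
      ring_nf

lemma CommGroup.card_hom_le_card_torsion (G : Type*) [CommGroup G] [Finite G] :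
    Nat.card (G →* Multiplicative (ZMod 3)) ≤ Nat.card {g : G // g ^ 3 = 1} := by
  obtain ⟨e⟩ := CommGroup.monoidHom_mulEquiv_of_hasEnoughRootsOfUnity G ℂ
  let ι : Multiplicative (ZMod 3) →* ℂˣ :=
    Circle.toUnits.comp (AddChar.toMonoidHom (ZMod.toCircle (N := 3)))
  have hι : Function.Injective ι := by
    intro x y h
    have h1 : (ZMod.toCircle x.toAdd : ℂ) = ZMod.toCircle y.toAdd := congrArg Units.val h
    exact ZMod.injective_toCircle (Subtype.ext h1)
  have hcube : ∀ x : Multiplicative (ZMod 3), x ^ 3 = 1 := by decide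
  refine Nat.card_le_card_of_injective
    (fun f => ⟨e (ι.comp f), ?_⟩) fun f g hfg => ?_
  · rw [← map_pow, ← map_one e]
    congr 1
    ext x
    rw [MonoidHom.pow_apply, MonoidHom.comp_apply, ← map_pow, hcube, map_one, MonoidHom.one_apply]
  · have h1 := e.injective (congrArg Subtype.val hfg)
    ext x
    exact hι (DFunLike.congr_fun h1 x)

lemma Ideal.eq_of_pow_three_eq {R : Type*} [CommRing R] [IsDedekindDomain R]
    {I J : Ideal R} (h : I ^ 3 = J ^ 3) : I = J :=
  pow_left_injective three_ne_zero h

namespace CubicSymbol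

/-- Representatives in `𝓞 K` of the `3`-torsion of the class group, as classes modulo cubes. -/
lemma exists_finset_card_hom_le (K : Type*) [Field K] [NumberField K] : ∃ Z : Finset (𝓞 K),
    (∀ κ ∈ Z, κ ≠ 0 ∧ ∃ 𝔠 : Ideal (𝓞 K), Ideal.span {κ} = 𝔠 ^ 3) ∧
    (∀ κ ∈ Z, ∀ κ' ∈ Z, CubeRel κ κ' → κ = κ') ∧
    Nat.card (ClassGroup (𝓞 K) →* Multiplicative (ZMod 3)) ≤ Z.card := by
  classical
  have hex : ∀ c : {g : ClassGroup (𝓞 K) // g ^ 3 = 1}, ∃ (I : nonZeroDivisors (Ideal (𝓞 K)))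
      (κ : 𝓞 K), ClassGroup.mk0 I = c.1 ∧ Ideal.span {κ} = (I : Ideal (𝓞 K)) ^ 3 := by
    rintro ⟨c, hc⟩
    obtain ⟨I, rfl⟩ := ClassGroup.mk0_surjective c
    rw [← map_pow, ClassGroup.mk0_eq_one_iff (I ^ 3).2] at hc
    obtain ⟨κ, hκ⟩ := hc.principal
    exact ⟨I, κ, rfl, hκ.symm⟩
  choose I κ hI hκ using hex
  have hκ0 : ∀ c, κ c ≠ 0 := fun c h => by
    have := hκ c
    rw [h, Ideal.span_singleton_eq_bot.mpr rfl] at this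
    exact pow_ne_zero 3 (nonZeroDivisors.coe_ne_zero (I c)) this.symm
  have hinj : ∀ c c', CubeRel (κ c) (κ c') → c = c' := by
    rintro c c' ⟨a, b, ha, hb, hab⟩
    have h1 := congrArg (fun x : 𝓞 K => Ideal.span {x}) hab
    simp only [← Ideal.span_singleton_mul_span_singleton, ← Ideal.span_singleton_pow, hκ,
      ← mul_pow] at h1
    apply Subtype.ext
    rw [← hI c, ← hI c', ClassGroup.mk0_eq_mk0_iff]
    exact ⟨a, b, ha, hb, Ideal.eq_of_pow_three_eq h1⟩
  have : Fintype {g : ClassGroup (𝓞 K) // g ^ 3 = 1} := Fintype.ofFinite _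
  refine ⟨Finset.univ.image κ, ?_, ?_, ?_⟩
  · intro x hx
    obtain ⟨c, -, rfl⟩ := Finset.mem_image.mp hx
    exact ⟨hκ0 c, _, hκ c⟩
  · intro x hx y hy h
    obtain ⟨c, -, rfl⟩ := Finset.mem_image.mp hx
    obtain ⟨c', -, rfl⟩ := Finset.mem_image.mp hy
    rw [hinj c c' h]
  · rw [Finset.card_image_of_injective]
    · exact (CommGroup.card_hom_le_card_torsion _).trans (by
        rw [Nat.card_eq_fintype_card, Finset.card_univ])
    · intro c c' h
      refine hinj c c' ?_
      rw [h]
      exact ⟨1, 1, one_ne_zero, one_ne_zero, rfl⟩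

end CubicSymbol

namespace CubicSymbol

lemma exists_card_le_of_cubeRel (K : Type*) [Field K] [NumberField K] : ∃ C : ℕ,
    ∀ Z : Finset (𝓞 K), (∀ κ ∈ Z, κ ≠ 0 ∧ ∃ 𝔠 : Ideal (𝓞 K), Ideal.span {κ} = 𝔠 ^ 3) →
    (∀ κ ∈ Z, ∀ κ' ∈ Z, CubeRel κ κ' → κ = κ') → Z.card ≤ C := by
  classical
  let U := (𝓞 K)ˣ ⧸ (powMonoidHom (α := (𝓞 K)ˣ) 3).range
  have hfin : (powMonoidHom (α := (𝓞 K)ˣ) 3).range.FiniteIndex :=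
    have : Group.FG (𝓞 K)ˣ := Group.fg_iff_monoid_fg.mpr inferInstance
    Subgroup.finiteIndex_range_powMonoidHom_of_fg _ three_ne_zero
  have : Finite U := Subgroup.finite_quotient_of_finiteIndex
  have : Fintype U := Fintype.ofFinite _
  refine ⟨Fintype.card (ClassGroup (𝓞 K) × U), fun Z hZ hpair => ?_⟩
  have hex : ∀ κ : 𝓞 K, ∃ I : nonZeroDivisors (Ideal (𝓞 K)), κ ∈ Z →
      Ideal.span {κ} = (I : Ideal (𝓞 K)) ^ 3 := by
    intro κ
    by_cases hκ : κ ∈ Z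
    · obtain ⟨h0, 𝔠, h𝔠⟩ := hZ κ hκ
      have : 𝔠 ≠ 0 := by
        rintro rfl
        rw [zero_pow three_ne_zero, Ideal.zero_eq_bot, Ideal.span_singleton_eq_bot] at h𝔠
        exact h0 h𝔠
      exact ⟨⟨𝔠, mem_nonZeroDivisors_of_ne_zero this⟩, fun _ => h𝔠⟩
    · exact ⟨1, fun h => absurd h hκ⟩
  choose I hI using hex
  have href : ∀ c : ClassGroup (𝓞 K), ∃ κ₀ : 𝓞 K, ∀ κ ∈ Z, ClassGroup.mk0 (I κ) = c →
      κ₀ ∈ Z ∧ ClassGroup.mk0 (I κ₀) = c := by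
    intro c
    by_cases h : ∃ κ ∈ Z, ClassGroup.mk0 (I κ) = c
    · obtain ⟨κ, h1, h2⟩ := h
      exact ⟨κ, fun _ _ _ => ⟨h1, h2⟩⟩
    · exact ⟨0, fun κ h1 h2 => absurd ⟨κ, h1, h2⟩ h⟩
  choose ref href using href
  have hunit : ∀ κ : 𝓞 K, ∃ u : (𝓞 K)ˣ, κ ∈ Z → ∃ x y : 𝓞 K, x ≠ 0 ∧ y ≠ 0 ∧
      x ^ 3 * κ * u = y ^ 3 * ref (ClassGroup.mk0 (I κ)) := by
    intro κ
    by_cases hκ : κ ∈ Z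
    · obtain ⟨h1, h2⟩ := href _ κ hκ rfl
      obtain ⟨x, y, hx, hy, hxy⟩ := ClassGroup.mk0_eq_mk0_iff.mp h2.symm
      have h3 : Ideal.span {x ^ 3 * κ} =
          Ideal.span {y ^ 3 * ref (ClassGroup.mk0 (I κ))} := by
        rw [← Ideal.span_singleton_mul_span_singleton, ← Ideal.span_singleton_mul_span_singleton,
          ← Ideal.span_singleton_pow, ← Ideal.span_singleton_pow, hI κ hκ, hI _ h1, ← mul_pow,
          ← mul_pow, hxy]
      obtain ⟨u, hu⟩ := Ideal.span_singleton_eq_span_singleton.mp h3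
      exact ⟨u, fun _ => ⟨x, y, hx, hy, hu⟩⟩
    · exact ⟨1, fun h => absurd h hκ⟩
  choose u hu using hunit
  refine Finset.card_le_card_of_injOn
    (fun κ => (ClassGroup.mk0 (I κ), ((u κ : (𝓞 K)ˣ) : U))) (fun _ _ => Finset.mem_univ _) ?_
  intro κ hκ κ' hκ' h
  rw [Finset.mem_coe] at hκ hκ'
  obtain ⟨h1, h2⟩ := Prod.ext_iff.mp h
  obtain ⟨⟨v, hv⟩⟩ : Nonempty {v : (𝓞 K)ˣ // v ^ 3 = (u κ)⁻¹ * u κ'} := by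
    obtain ⟨v, hv⟩ := QuotientGroup.eq.mp h2
    exact ⟨⟨v, hv⟩⟩
  have hv' : (u κ' : 𝓞 K) = u κ * v ^ 3 := by
    rw [← Units.val_pow_eq_pow_val, hv]
    simp
  obtain ⟨x, y, hx, hy, hxy⟩ := hu κ hκ
  obtain ⟨x', y', hx', hy', hxy'⟩ := hu κ' hκ'
  simp only at h1
  rw [← h1, hv'] at hxy'
  refine hpair κ hκ κ' hκ' ⟨x * y', x' * v * y, mul_ne_zero hx hy',
    mul_ne_zero (mul_ne_zero hx' v.ne_zero) hy, ?_⟩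
  apply mul_right_cancel₀ (u κ).ne_zero
  linear_combination y' ^ 3 * hxy - y ^ 3 * hxy'

end CubicSymbol

end

section

open ArithmeticFunction Finset

/-- The nontrivial Dirichlet character modulo `3`. -/
def chiThree (n : ℕ) : ℝ := if n % 3 = 1 then 1 else if n % 3 = 2 then -1 else 0

namespace ChiThree

lemma mul (m n : ℕ) : chiThree (m * n) = chiThree m * chiThree n := by
  have h1 : m % 3 < 3 := Nat.mod_lt _ (by norm_num)
  have h2 : n % 3 < 3 := Nat.mod_lt _ (by norm_num)
  simp only [chiThree, Nat.mul_mod m n 3]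
  interval_cases m % 3 <;> interval_cases n % 3 <;> norm_num

lemma abs_le_one (n : ℕ) : |chiThree n| ≤ 1 := by
  unfold chiThree
  split_ifs <;> norm_num

/-- The partial sums `∑ k < n, χ k`. -/
private def part (n : ℕ) : ℝ := if n % 3 = 2 then 1 else 0

private lemma part_succ (n : ℕ) : part (n + 1) = part n + chiThree n := by
  have h : n % 3 < 3 := Nat.mod_lt _ (by norm_num)
  simp only [part, chiThree, Nat.add_mod n 1 3]
  interval_cases n % 3 <;> norm_num

private lemma part_nonneg (n : ℕ) : 0 ≤ part n := by unfold part; split_ifs <;> norm_num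

private lemma part_le_one (n : ℕ) : part n ≤ 1 := by unfold part; split_ifs <;> norm_num

lemma abs_sum_le {f : ℕ → ℝ} {a : ℕ} (hf : ∀ n, a ≤ n → f (n + 1) ≤ f n)
    (h0 : ∀ n, a ≤ n → 0 ≤ f n) {b : ℕ} (hab : a ≤ b) :
    |∑ n ∈ Ico a b, chiThree n * f n| ≤ f a := by
  have key : part b * f b - part a * f a ≤ ∑ n ∈ Ico a b, chiThree n * f n ∧
      ∑ n ∈ Ico a b, chiThree n * f n ≤ (part b - 1) * f b + (1 - part a) * f a := by
    induction b, hab using Nat.le_induction with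
    | base => exact ⟨by simp, le_of_eq (by rw [Ico_self, sum_empty]; ring)⟩
    | succ b hab ih =>
      rw [sum_Ico_succ_top hab]
      have h1 := hf b hab
      have h2 := part_succ b
      have h3 := mul_le_mul_of_nonneg_left h1 (part_nonneg (b + 1))
      have h4 := mul_le_mul_of_nonneg_left h1 (sub_nonneg.mpr (part_le_one (b + 1)))
      have h5 : chiThree b * f b = part (b + 1) * f b - part b * f b := by rw [h2]; ring
      constructor <;> nlinarith
  have h1 := mul_nonneg (part_nonneg b) (h0 b hab)
  have h2 := mul_nonneg (sub_nonneg.mpr (part_le_one b)) (h0 b hab)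
  have h3 := mul_nonneg (part_nonneg a) (h0 a le_rfl)
  have h4 := mul_nonneg (sub_nonneg.mpr (part_le_one a)) (h0 a le_rfl)
  rw [abs_le]
  constructor <;> nlinarith [key.1, key.2]

private lemma inv_anti {n : ℕ} (hn : 1 ≤ n) : ((n + 1 : ℕ) : ℝ)⁻¹ ≤ (n : ℝ)⁻¹ := by
  have : (0 : ℝ) < n := by exact_mod_cast hn
  gcongr
  omega

lemma abs_sum_Ioc_le {M N : ℕ} (h : M ≤ N) :
    |∑ n ∈ Ioc M N, chiThree n * (n : ℝ)⁻¹| ≤ ((M : ℝ) + 1)⁻¹ := by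
  rw [← Ico_succ_succ_eq_Ioc]
  have := abs_sum_le (f := fun n : ℕ => (n : ℝ)⁻¹) (a := M + 1) (b := N + 1)
    (fun n hn => inv_anti (by omega)) (fun n _ => by positivity) (by omega)
  simpa using this

lemma half_le_sum {N : ℕ} (hN : 1 ≤ N) : 1 / 2 ≤ ∑ n ∈ Ioc 0 N, chiThree n * (n : ℝ)⁻¹ := by
  rw [← sum_Ioc_consecutive _ zero_le_one hN]
  have h1 := abs_sum_Ioc_le hN
  have h2 : ∑ n ∈ Ioc 0 1, chiThree n * (n : ℝ)⁻¹ = 1 := by simp [chiThree]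
  rw [h2]
  rw [abs_le] at h1
  norm_num at h1 ⊢
  linarith [h1.1]

lemma abs_sum_log_le (N : ℕ) : |∑ n ∈ Ioc 0 N, chiThree n * (Real.log n / n)| ≤ 2 := by
  have hlog2 : Real.log 2 ≤ 1 := by linarith [Real.log_two_lt_d9]
  have hlog3 : Real.log 3 ≤ 3 - 1 := Real.log_le_sub_one_of_pos (by norm_num)
  have hlog2' : 0 ≤ Real.log 2 := Real.log_nonneg (by norm_num)
  rcases Nat.lt_or_ge N 2 with hN | hN
  · interval_cases N <;> simp [chiThree]
  · rw [← sum_Ioc_consecutive _ (zero_le_two) hN, ← Ico_succ_succ_eq_Ioc 2]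
    have h1 := abs_sum_le (f := fun n : ℕ => Real.log n / n) (a := 3) (b := N + 1)
      (fun n hn => by
        have h3 : Real.exp 1 ≤ 3 := by linarith [Real.exp_one_lt_d9]
        have hn' : (3 : ℝ) ≤ n := by exact_mod_cast hn
        exact Real.log_div_self_antitoneOn (Set.mem_Ici.mpr (h3.trans hn'))
          (Set.mem_Ici.mpr (by push_cast; linarith)) (by push_cast; linarith))
      (fun n hn => div_nonneg (Real.log_natCast_nonneg n) (Nat.cast_nonneg n)) (by omega)
    have h2 : ∑ n ∈ Ioc 0 2, chiThree n * (Real.log n / n) = - (Real.log 2 / 2) := by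
      rw [show Ioc 0 2 = {1, 2} by decide]
      simp [chiThree]
    rw [h2]
    push_cast at h1
    refine (abs_add_le _ _).trans ?_
    refine (add_le_add_right h1 _).trans ?_
    rw [abs_neg, abs_of_nonneg (by positivity)]
    linarith

/-- The Mertens bound for the character `χ` modulo `3`. -/
lemma exists_abs_sum_vonMangoldt_le : ∃ C : ℝ, ∀ N : ℕ,
    |∑ n ∈ Ioc 0 N, chiThree n * (Λ n / n)| ≤ C := by
  refine ⟨2 * (2 + (Real.log 4 + 4)), fun N => ?_⟩
  rcases Nat.eq_zero_or_pos N with rfl | hN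
  · simp only [Ioc_self, sum_empty, abs_zero]
    have := Real.log_nonneg (by norm_num : (1 : ℝ) ≤ 4)
    positivity
  have hN' : (0 : ℝ) < N := by exact_mod_cast hN
  let F : ArithmeticFunction ℝ := ⟨fun n => chiThree n * (Λ n / n), by simp⟩
  let G : ArithmeticFunction ℝ := ⟨fun n => chiThree n * (n : ℝ)⁻¹, by simp⟩
  have hFG : ∀ n, (F * G) n = chiThree n * (Real.log n / n) := by
    intro n
    rw [mul_apply, ← vonMangoldt_sum, sum_div, mul_sum,
      ← Nat.sum_divisorsAntidiagonal (fun d _ : ℕ => chiThree n * (Λ d / (n : ℝ)))]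
    refine sum_congr rfl fun x hx => ?_
    obtain ⟨hx, -⟩ := Nat.mem_divisorsAntidiagonal.mp hx
    rw [← hx, mul]
    simp only [F, G, coe_mk]
    push_cast
    rw [div_mul_eq_div_mul_one_div, div_eq_mul_inv, one_div]
    ring
  have h1 := sum_Ioc_mul_eq_sum_sum F G N
  simp only [hFG] at h1
  simp only [F, G, coe_mk] at h1
  set H : ℕ → ℝ := fun M => ∑ n ∈ Ioc 0 M, chiThree n * (n : ℝ)⁻¹ with hH
  set S := ∑ n ∈ Ioc 0 N, chiThree n * (Λ n / n) with hS
  have herr : |H N * S - ∑ n ∈ Ioc 0 N, chiThree n * (Λ n / n) * H (N / n)| ≤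
      Real.log 4 + 4 := by
    rw [hS, mul_sum, ← sum_sub_distrib]
    refine (abs_sum_le_sum_abs _ _).trans ?_
    calc _ ≤ ∑ n ∈ Ioc 0 N, Λ n / N := by
          refine sum_le_sum fun n hn => ?_
          obtain ⟨hn0, hnN⟩ := mem_Ioc.mp hn
          have hn0' : (0 : ℝ) < n := by exact_mod_cast hn0
          have h2 : |H N - H (N / n)| ≤ ((N / n : ℕ) + 1 : ℝ)⁻¹ := by
            have h3 := abs_sum_Ioc_le (Nat.div_le_self N n)
            have h4 : H (N / n) + _ = H N := sum_Ioc_consecutive _ (Nat.zero_le _)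
              (Nat.div_le_self N n)
            rwa [← h4, add_sub_cancel_left]
          have h4 : ((N / n : ℕ) + 1 : ℝ)⁻¹ ≤ n / N := by
            rw [inv_le_comm₀ (by positivity) (by positivity), inv_div]
            exact (Nat.lt_floor_add_one ((N : ℝ) / n)).le.trans
              (by rw [Nat.floor_div_eq_div])
          calc |H N * (chiThree n * (Λ n / n)) - chiThree n * (Λ n / n) * H (N / n)|
              = |chiThree n| * (Λ n / n) * |H N - H (N / n)| := by
                rw [← abs_of_nonneg (div_nonneg vonMangoldt_nonneg hn0'.le : 0 ≤ Λ n / n),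
                  ← abs_mul, ← abs_mul,
                  abs_of_nonneg (div_nonneg vonMangoldt_nonneg hn0'.le : 0 ≤ Λ n / n)]
                congr 1
                ring
            _ ≤ 1 * (Λ n / n) * (n / N) := by
                have := div_nonneg (vonMangoldt_nonneg (n := n)) hn0'.le
                gcongr
                · exact abs_le_one n
                · exact h2.trans h4
            _ = Λ n / N := by field_simp
      _ = Chebyshev.psi N / N := by rw [← sum_div, Chebyshev.psi, Nat.floor_natCast]
      _ ≤ _ := by
          rw [div_le_iff₀ hN']
          exact Chebyshev.psi_le_const_mul_self hN'.le
  rw [← h1] at herr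
  have h5 := abs_sum_log_le N
  have h6 : |H N * S| ≤ 2 + (Real.log 4 + 4) := by
    have := abs_sub_abs_le_abs_sub (H N * S) (∑ n ∈ Ioc 0 N, chiThree n * (Real.log n / n))
    linarith
  have h7 := half_le_sum hN
  rw [abs_mul, abs_of_nonneg (by linarith : 0 ≤ H N)] at h6
  nlinarith [abs_nonneg S]

end ChiThree

lemma exists_abs_sum_vonMangoldt_div_sub_log_le : ∃ C : ℝ, ∀ N : ℕ, 1 ≤ N →
    |∑ n ∈ Ioc 0 N, Λ n / n - Real.log N| ≤ C := by
  refine ⟨Real.log 4 + 4, fun N hN => ?_⟩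
  have hN' : (0 : ℝ) < N := by exact_mod_cast hN
  have hfac : ∑ n ∈ Ioc 0 N, Λ n * (N / n : ℕ) = Real.log (N.factorial) := by
    rw [← sum_Ioc_mul_zeta_eq_sum, vonMangoldt_mul_zeta]
    simp only [log_apply]
    clear hN hN'
    induction N with
    | zero => simp
    | succ N ih =>
      rw [sum_Ioc_succ_top (Nat.zero_le _), ih, Nat.factorial_succ, Nat.cast_mul,
        Real.log_mul (by positivity) (by positivity), add_comm]
  have hlow : N * Real.log N - N ≤ Real.log (N.factorial) := by
    have h1 := Stirling.le_log_factorial_stirling (Nat.one_le_iff_ne_zero.mp hN)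
    have h2 := Real.log_natCast_nonneg N
    have h3 : 0 ≤ Real.log (2 * Real.pi) := Real.log_nonneg (by linarith [Real.pi_gt_three])
    linarith
  have hup : Real.log (N.factorial) ≤ N * Real.log N := by
    rw [← Real.log_pow]
    exact Real.log_le_log (by exact_mod_cast N.factorial_pos)
      (by exact_mod_cast Nat.factorial_le_pow N)
  have hpsi : ∑ n ∈ Ioc 0 N, Λ n ≤ (Real.log 4 + 4) * N := by
    have := Chebyshev.psi_le_const_mul_self hN'.le
    rwa [Chebyshev.psi, Nat.floor_natCast] at this
  have hmul : N * ∑ n ∈ Ioc 0 N, Λ n / n = ∑ n ∈ Ioc 0 N, Λ n * ((N : ℝ) / n) := by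
    rw [mul_sum]
    exact sum_congr rfl fun n _ => by ring
  have h1 : Real.log (N.factorial) ≤ N * ∑ n ∈ Ioc 0 N, Λ n / n := by
    rw [hmul, ← hfac]
    refine sum_le_sum fun n _ => mul_le_mul_of_nonneg_left ?_ vonMangoldt_nonneg
    exact Nat.cast_div_le
  have h2 : N * ∑ n ∈ Ioc 0 N, Λ n / n ≤ Real.log (N.factorial) + ∑ n ∈ Ioc 0 N, Λ n := by
    rw [hmul, ← hfac, ← sum_add_distrib]
    refine sum_le_sum fun n _ => ?_
    rw [← mul_add_one]
    refine mul_le_mul_of_nonneg_left ?_ vonMangoldt_nonneg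
    rw [← Nat.floor_div_eq_div (K := ℝ)]
    exact (Nat.lt_floor_add_one _).le
  have h4 := Real.log_nonneg (by norm_num : (1 : ℝ) ≤ 4)
  rw [abs_le]
  constructor <;> nlinarith

/-- A positive proportion of the primes up to `N` is congruent to `2` modulo `3`. -/
theorem exists_card_primes_two_mod_three : ∃ c : ℝ, 0 < c ∧ ∀ᶠ N : ℕ in Filter.atTop,
    c * N ≤ Real.log N * ((Ioc 0 N).filter (fun p => p.Prime ∧ p % 3 = 2)).card := by
  obtain ⟨C₁, hC₁⟩ := exists_abs_sum_vonMangoldt_div_sub_log_le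
  obtain ⟨C₂, hC₂⟩ := ChiThree.exists_abs_sum_vonMangoldt_le
  obtain ⟨K, hK⟩ := exists_nat_ge (Real.exp (2 * (C₁ + C₂ + 2)))
  have hK0 : 0 < K := by
    have := (Real.exp_pos _).trans_le hK
    exact_mod_cast this
  have hKR : (0 : ℝ) < K := by exact_mod_cast hK0
  have hlogK : 2 * (C₁ + C₂ + 2) ≤ Real.log K := (Real.le_log_iff_exp_le hKR).mpr hK
  refine ⟨1 / (2 * K), by positivity, ?_⟩
  have hsmall : ∀ᶠ N : ℕ in Filter.atTop, 4 * K * Real.log N ≤ √N := by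
    have h1 := (isLittleO_log_rpow_atTop (r := 1 / 2) (by norm_num)).def
      (show (0 : ℝ) < 1 / (4 * K) by positivity)
    filter_upwards [tendsto_natCast_atTop_atTop.eventually h1] with N hN
    rw [Real.norm_of_nonneg (Real.log_natCast_nonneg N), Real.norm_of_nonneg (by positivity),
      ← Real.sqrt_eq_rpow] at hN
    rw [one_div_mul_eq_div, le_div_iff₀ (by positivity)] at hN
    linarith
  filter_upwards [hsmall, Filter.eventually_ge_atTop (8 * K)] with N hN hNK
  set y := N / K with hy
  have hy8 : 8 ≤ y := (Nat.le_div_iff_mul_le hK0).mpr hNK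
  have hyN : y ≤ N := Nat.div_le_self N K
  have hyR : (0 : ℝ) < y := by exact_mod_cast (by omega : 0 < y)
  have hNR : (0 : ℝ) < N := by exact_mod_cast (by omega : 0 < N)
  have hyle : (K : ℝ) * y ≤ N := by exact_mod_cast Nat.mul_div_le N K
  have hyge : (N : ℝ) ≤ 2 * K * y := by
    have h1 : N < K * (y + 1) := by
      exact Nat.lt_mul_div_succ N hK0
    have h2 : (N : ℝ) < K * (y + 1) := by exact_mod_cast h1
    have h3 : (1 : ℝ) ≤ y := by exact_mod_cast (by omega : 1 ≤ y)
    nlinarith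
  have hlogN : 0 ≤ Real.log N := Real.log_natCast_nonneg N
  have hsplitA : ∑ n ∈ Ioc y N, Λ n / n ≥ Real.log K - 2 * C₁ := by
    have h1 := sum_Ioc_consecutive (fun n : ℕ => Λ n / n) (Nat.zero_le y) hyN
    have h2 := abs_le.mp (hC₁ N (by omega))
    have h3 := abs_le.mp (hC₁ y (by omega))
    have h4 : Real.log K + Real.log y ≤ Real.log N := by
      rw [← Real.log_mul hKR.ne' hyR.ne']
      exact Real.log_le_log (by positivity) hyle
    linarith [h2.1, h3.2]
  have hsplitM : ∑ n ∈ Ioc y N, chiThree n * (Λ n / n) ≤ 2 * C₂ := by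
    have h1 := sum_Ioc_consecutive (fun n : ℕ => chiThree n * (Λ n / n)) (Nat.zero_le y) hyN
    have h2 := abs_le.mp (hC₂ N)
    have h3 := abs_le.mp (hC₂ y)
    linarith [h2.2, h3.1]
  have hnp : ∑ n ∈ (Ioc y N).filter (fun n => ¬ n.Prime), Λ n / n ≤ 1 := by
    have h1 : ∑ n ∈ (Ioc y N).filter (fun n => ¬ n.Prime), Λ n / n ≤
        (∑ n ∈ (Ioc 0 N).filter (fun n => ¬ n.Prime), Λ n) / y := by
      rw [sum_div]
      refine (sum_le_sum fun n hn => ?_).trans (sum_le_sum_of_subset_of_nonneg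
        (filter_subset_filter _ (Ioc_subset_Ioc_left (Nat.zero_le y)))
        fun n _ _ => div_nonneg vonMangoldt_nonneg hyR.le)
      have := (mem_Ioc.mp (mem_filter.mp hn).1).1
      exact div_le_div_of_nonneg_left vonMangoldt_nonneg hyR (by exact_mod_cast this.le)
    refine h1.trans ((div_le_one hyR).mpr ?_)
    have h2 := Chebyshev.psi_sub_theta_eq_sum_not_prime N
    rw [Nat.floor_natCast] at h2
    rw [← h2]
    refine (Chebyshev.psi_sub_theta_le (by exact_mod_cast (by omega : 1 ≤ N))).trans ?_
    have h3 : √(N : ℝ) * √(N : ℝ) = N := Real.mul_self_sqrt hNR.le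
    have h4 : 0 < √(N : ℝ) := Real.sqrt_pos.mpr hNR
    have h5 : 2 * K * (2 * √(N : ℝ) * Real.log N) ≤ 2 * K * y := by nlinarith
    exact le_of_mul_le_mul_left h5 (by positivity)
  have hpt : ∀ n ∈ Ioc y N, (Λ n / n - chiThree n * (Λ n / n)) / 2 ≤
      (if n.Prime ∧ n % 3 = 2 then Λ n / n else 0) + (if ¬ n.Prime then Λ n / n else 0) := by
    intro n hn
    have hn8 : 8 < n := by have := (mem_Ioc.mp hn).1; omega
    have h0 : 0 ≤ Λ n / (n : ℝ) := div_nonneg vonMangoldt_nonneg (Nat.cast_nonneg n)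
    by_cases hp : n.Prime
    · have h3 : n % 3 ≠ 0 := fun h => by
        have := (Nat.prime_dvd_prime_iff_eq Nat.prime_three hp).mp (Nat.dvd_of_mod_eq_zero h)
        omega
      by_cases h2 : n % 3 = 2
      · simp only [hp, h2, chiThree]
        norm_num
      · have h1 : n % 3 = 1 := by omega
        simp only [hp, h1, chiThree]
        norm_num
    · have h2 := (abs_le.mp (ChiThree.abs_le_one n)).1
      simp only [hp, false_and, if_false, not_false_eq_true, if_true]
      nlinarith
  have hsum := sum_le_sum hpt
  rw [← sum_div, sum_sub_distrib, sum_add_distrib, ← sum_filter, ← sum_filter] at hsum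
  have hlow : 1 ≤ ∑ n ∈ (Ioc y N).filter (fun n => n.Prime ∧ n % 3 = 2), Λ n / n := by linarith
  have hup : ∑ n ∈ (Ioc y N).filter (fun n => n.Prime ∧ n % 3 = 2), Λ n / n ≤
      ((Ioc 0 N).filter (fun n => n.Prime ∧ n % 3 = 2)).card * (Real.log N / y) := by
    rw [← nsmul_eq_mul]
    refine (sum_le_card_nsmul _ _ (Real.log N / y) fun n hn => ?_).trans ?_
    · obtain ⟨h1, h2⟩ := mem_Ioc.mp (mem_filter.mp hn).1
      have h3 : (0 : ℝ) < n := by exact_mod_cast (by omega : 0 < n)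
      exact div_le_div₀ hlogN (vonMangoldt_le_log.trans
        (Real.log_le_log h3 (by exact_mod_cast h2))) hyR (by exact_mod_cast h1.le)
    · exact nsmul_le_nsmul_left (by positivity)
        (card_le_card (filter_subset_filter _ (Ioc_subset_Ioc_left (Nat.zero_le y))))
  have h1 := hlow.trans hup
  rw [← mul_div_assoc, le_div_iff₀ hyR, one_mul] at h1
  rw [one_div_mul_eq_div, div_le_iff₀ (by positivity)]
  nlinarith

end

section

open NumberField

lemma ZMod.not_isSquare_neg_three {p : ℕ} [Fact p.Prime] (hp2 : p ≠ 2) (hp : p % 3 = 2) :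
    ¬ IsSquare (-3 : ZMod p) := by
  rintro ⟨a, ha⟩
  have h2 : (2 : ZMod p) ≠ 0 := by
    have : ((2 : ℕ) : ZMod p) ≠ 0 := fun h => hp2 <|
      (Nat.prime_dvd_prime_iff_eq Fact.out Nat.prime_two).mp ((ZMod.natCast_eq_zero_iff _ _).mp h)
    exact_mod_cast this
  have h3 : (3 : ZMod p) ≠ 0 := by
    have : ((3 : ℕ) : ZMod p) ≠ 0 := fun h => by
      have := (Nat.prime_dvd_prime_iff_eq Fact.out Nat.prime_three).mp
        ((ZMod.natCast_eq_zero_iff _ _).mp h)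
      omega
    exact_mod_cast this
  set w : ZMod p := (a - 1) / 2 with hw
  have hw2 : 2 * w = a - 1 := by rw [hw]; field_simp
  have hw3 : w * w + w + 1 = 0 := by
    have : 4 * (w * w + w + 1) = 0 := by linear_combination (2 * w + a + 1) * hw2 - ha
    refine (mul_eq_zero.mp this).resolve_left ?_
    rw [show (4 : ZMod p) = 2 * 2 by norm_num]
    exact mul_ne_zero h2 h2
  have hord : orderOf w = 3 := by
    have : Fact (Nat.Prime 3) := ⟨Nat.prime_three⟩
    refine orderOf_eq_prime (by linear_combination (w - 1) * hw3) fun h => h3 ?_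
    rw [h] at hw3
    linear_combination hw3
  have hw0 : w ≠ 0 := fun h => by rw [h] at hw3; simp at hw3
  have h4 := ZMod.orderOf_dvd_card_sub_one hw0
  rw [hord] at h4
  have := (Fact.out : p.Prime).two_le
  omega

lemma ZMod.isSquare_or_isSquare {p : ℕ} [Fact p.Prime] (hp2 : p ≠ 2) (hp : p % 3 = 2)
    {D D' e : ℤ} (h : e ^ 2 * D' = -3 * D) (hpD : ¬ (p : ℤ) ∣ D) :
    IsSquare (D : ZMod p) ∨ IsSquare (D' : ZMod p) := by
  by_contra! hns
  obtain ⟨h1, h2⟩ := hns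
  rw [← quadraticChar_neg_one_iff_not_isSquare] at h1 h2
  have hD0 : (D : ZMod p) ≠ 0 := by rwa [Ne, ZMod.intCast_zmod_eq_zero_iff_dvd]
  have h3 : quadraticChar (ZMod p) (D * D') = 1 := by rw [map_mul, h1, h2]; norm_num
  have h4 : (D * D' : ZMod p) ≠ 0 := fun h => by rw [h] at h3; simp at h3
  obtain ⟨c, hc⟩ := (quadraticChar_one_iff_isSquare h4).mp h3
  have h5 : (e : ZMod p) ^ 2 * D' = -3 * D := by exact_mod_cast congrArg (Int.cast : ℤ → ZMod p) h
  apply ZMod.not_isSquare_neg_three hp2 hp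
  refine ⟨e * c / D, ?_⟩
  field_simp
  linear_combination -(D : ZMod p) * h5 + (e : ZMod p) ^ 2 * hc

lemma Nat.eq_of_sq_mul_cube_eq {m m' p q : ℕ} (hm : m ≠ 0) (hm' : m' ≠ 0) (hp : p.Prime)
    (hq : q.Prime) (h : m ^ 2 * q ^ 3 = m' ^ 2 * p ^ 3) : p = q := by
  by_contra hne
  have h1 := congrArg (fun n => n.factorization p) h
  rw [Nat.factorization_mul (by positivity) (pow_ne_zero 3 hq.ne_zero),
    Nat.factorization_mul (by positivity) (pow_ne_zero 3 hp.ne_zero)] at h1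
  simp only [Nat.factorization_pow, Finsupp.add_apply, Finsupp.smul_apply, smul_eq_mul,
    hp.factorization_self, hq.factorization, Finsupp.single_apply, if_neg (Ne.symm hne)] at h1
  omega

namespace CubicSymbol

lemma exists_finset_prime_ideals {K : Type*} [Field K] [NumberField K] {s : 𝓞 K} {D : ℤ}
    (H : QuadData s D) (W : Finset ℕ)
    (hW : ∀ p ∈ W, p.Prime ∧ p ≠ 2 ∧ ∃ δ : ℤ, (p : ℤ) ∣ δ ^ 2 - D) :
    ∃ S : Finset (Ideal (𝓞 K)), S.card = W.card ∧
      (∀ P ∈ S, P ≠ ⊥ ∧ Ideal.absNorm P ∈ W) ∧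
      (∀ P ∈ S, ∀ P' ∈ S, ∀ m m' : ℤ, m ≠ 0 → m' ≠ 0 →
        Ideal.span {(m : 𝓞 K)} * P' ^ 3 = Ideal.span {(m' : 𝓞 K)} * P ^ 3 → P = P') := by
  classical
  have hex : ∀ p : ℕ, ∃ P : Ideal (𝓞 K), p ∈ W → P ≠ ⊥ ∧ Ideal.absNorm P = p := by
    intro p
    by_cases hp : p ∈ W
    · obtain ⟨h1, h2, δ, hδ⟩ := hW p hp
      obtain ⟨P, hP, hP0, hpP, hsP⟩ := QuadData.exists_prime_of_dvd H h1 h2 hδ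
      exact ⟨P, fun _ => ⟨hP0, H.absNorm_eq hP.ne_top h1 h2 hpP hsP⟩⟩
    · exact ⟨⊥, fun h => absurd h hp⟩
  choose P hP using hex
  refine ⟨W.image P, ?_, ?_, ?_⟩
  · refine Finset.card_image_of_injOn fun p hp q hq h => ?_
    rw [← (hP p hp).2, ← (hP q hq).2, h]
  · intro I hI
    obtain ⟨p, hp, rfl⟩ := Finset.mem_image.mp hI
    obtain ⟨h1, h2⟩ := hP p hp
    exact ⟨h1, h2.symm ▸ hp⟩
  · intro I hI J hJ m m' hm hm' h
    obtain ⟨p, hp, rfl⟩ := Finset.mem_image.mp hI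
    obtain ⟨q, hq, rfl⟩ := Finset.mem_image.mp hJ
    have h1 := congrArg Ideal.absNorm h
    rw [map_mul, map_mul, map_pow, map_pow, H.absNorm_intCast, H.absNorm_intCast, (hP p hp).2,
      (hP q hq).2] at h1
    rw [Nat.eq_of_sq_mul_cube_eq (Int.natAbs_ne_zero.mpr hm) (Int.natAbs_ne_zero.mpr hm')
      (hW p hp).1 (hW q hq).1 h1]

/-- Many primes up to `|D|^(1/6) / 4` are congruent to `2` modulo `3` and do not divide `6 * D`. -/
lemma exists_finset_primes {ε : ℝ} (hε : 0 < ε) : ∃ D₀ : ℝ, ∀ D : ℤ, D₀ ≤ |(D : ℝ)| →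
    ∃ W : Finset ℕ, (∀ p ∈ W, p.Prime ∧ p ≠ 2 ∧ p % 3 = 2 ∧ ¬ (p : ℤ) ∣ D ∧
      (p : ℝ) ≤ |(D : ℝ)| ^ (1 / 6 : ℝ) / 4) ∧ |(D : ℝ)| ^ (1 / 6 - ε) ≤ W.card := by
  obtain ⟨c, hc, hcount⟩ := exists_card_primes_two_mod_three
  obtain ⟨C, hC, hdiv⟩ := Nat.exists_card_divisors_le (ε := 1 / 12) (by norm_num)
  have hcount' := tendsto_nat_floor_atTop (α := ℝ).eventually hcount
  have htend : Filter.Tendsto (fun y : ℝ => y ^ (1 / 6 : ℝ) / 4) Filter.atTop Filter.atTop :=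
    (tendsto_rpow_atTop (by norm_num)).atTop_div_const (by norm_num)
  have hA := (isLittleO_log_rpow_atTop hε).def (show (0 : ℝ) < c / 16 by positivity)
  have hB := (isLittleO_log_rpow_atTop (r := 1 / 12) (by norm_num)).def
    (show (0 : ℝ) < c / (16 * (C * 2 ^ (1 / 12 : ℝ))) by positivity)
  have hev := (htend.eventually hcount').and (((htend.eventually_ge_atTop 1).and
    (Filter.eventually_ge_atTop 1)).and (hA.and hB))
  obtain ⟨D₀, hD₀⟩ := Filter.eventually_atTop.mp hev
  refine ⟨D₀, fun D hD => ?_⟩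
  obtain ⟨h1, ⟨h2, hy1⟩, h3, h4⟩ := hD₀ _ hD
  set y := |(D : ℝ)| with hy
  set N := ⌊y ^ (1 / 6 : ℝ) / 4⌋₊ with hN
  have hy0 : 0 < y := by linarith
  have hDnat : (D.natAbs : ℝ) = y := by rw [hy, Nat.cast_natAbs, Int.cast_abs]
  have hD0 : D.natAbs ≠ 0 := fun h => by rw [h] at hDnat; simp at hDnat; linarith
  set T := (Finset.Ioc 0 N).filter (fun p => p.Prime ∧ p % 3 = 2) with hT
  refine ⟨T \ (2 * D.natAbs).divisors, ?_, ?_⟩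
  · intro p hp
    obtain ⟨hp1, hp2⟩ := Finset.mem_sdiff.mp hp
    obtain ⟨hp3, hp4, hp5⟩ := Finset.mem_filter.mp hp1
    have hnd : ¬ p ∣ 2 * D.natAbs := fun h => hp2 (Nat.mem_divisors.mpr ⟨h, by positivity⟩)
    refine ⟨hp4, ?_, hp5, ?_, ?_⟩
    · rintro rfl; exact hnd ⟨_, rfl⟩
    · exact fun h => hnd (Dvd.dvd.mul_left (Int.natCast_dvd.mp h) 2)
    · exact (Nat.le_floor_iff (by linarith)).mp (Finset.mem_Ioc.mp hp3).2
  · have hcard : (T.card : ℝ) ≤ (T \ (2 * D.natAbs).divisors).card +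
        (2 * D.natAbs).divisors.card := by
      exact_mod_cast Finset.card_le_card_sdiff_add_card
    have h5 := hdiv (2 * D.natAbs) (by positivity)
    push_cast at h5
    rw [hDnat, Real.mul_rpow (by norm_num) hy0.le] at h5
    have hlogy : 0 ≤ Real.log y := Real.log_nonneg hy1
    rw [Real.norm_of_nonneg hlogy, Real.norm_of_nonneg (by positivity)] at h3 h4
    have hNge : y ^ (1 / 6 : ℝ) / 8 ≤ N := by
      have := Nat.lt_floor_add_one (y ^ (1 / 6 : ℝ) / 4)
      have h6 : (1 : ℝ) ≤ N := by exact_mod_cast Nat.le_floor (by simpa using h2)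
      rw [← hN] at this
      linarith
    have hN0 : (0 : ℝ) < N := by
      have : 0 < y ^ (1 / 6 : ℝ) := by positivity
      linarith
    have hlogN : Real.log N ≤ Real.log y := by
      refine Real.log_le_log hN0 ?_
      calc (N : ℝ) ≤ y ^ (1 / 6 : ℝ) / 4 := Nat.floor_le (by linarith)
        _ ≤ y ^ (1 / 6 : ℝ) := by linarith
        _ ≤ y ^ (1 : ℝ) := Real.rpow_le_rpow_of_exponent_le hy1 (by norm_num)
        _ = y := Real.rpow_one y
    have h7 : c * (y ^ (1 / 6 : ℝ) / 8) ≤ Real.log y * T.card :=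
      (mul_le_mul_of_nonneg_left hNge hc.le).trans (h1.trans (by gcongr))
    have hlogpos : 0 < Real.log y := by
      by_contra h
      have : Real.log y = 0 := le_antisymm (not_lt.mp h) hlogy
      rw [this, zero_mul] at h7
      have : 0 < c * (y ^ (1 / 6 : ℝ) / 8) := by positivity
      linarith
    have h8 : Real.log y * y ^ (1 / 6 - ε) ≤ c / 16 * y ^ (1 / 6 : ℝ) := by
      calc _ ≤ c / 16 * y ^ ε * y ^ (1 / 6 - ε) := by gcongr
        _ = _ := by rw [mul_assoc, ← Real.rpow_add hy0]; ring_nf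
    have h9 : Real.log y * (C * (2 ^ (1 / 12 : ℝ) * y ^ (1 / 12 : ℝ))) ≤
        c / 16 * y ^ (1 / 6 : ℝ) := by
      calc _ ≤ c / (16 * (C * 2 ^ (1 / 12 : ℝ))) * y ^ (1 / 12 : ℝ) *
            (C * (2 ^ (1 / 12 : ℝ) * y ^ (1 / 12 : ℝ))) := by gcongr
        _ = c / 16 * (y ^ (1 / 12 : ℝ) * y ^ (1 / 12 : ℝ)) := by field_simp
        _ = _ := by rw [← Real.rpow_add hy0]; norm_num
    have h10 : Real.log y * y ^ (1 / 6 - ε) ≤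
        Real.log y * (T \ (2 * D.natAbs).divisors).card := by
      have h11 : Real.log y * T.card ≤ Real.log y * ((T \ (2 * D.natAbs).divisors).card +
        (C * (2 ^ (1 / 12 : ℝ) * y ^ (1 / 12 : ℝ)))) := by gcongr; linarith
      nlinarith
    exact le_of_mul_le_mul_left h10 hlogpos

end CubicSymbol

namespace CubicSymbol

/-- Given a large enough set of split primes, the number of classes modulo cubes is small. -/
lemma exists_card_le_of_split {ε : ℝ} (hε : 0 < ε) : ∃ C : ℝ, 0 < C ∧
    ∀ {K : Type} [Field K] [NumberField K] {s : 𝓞 K} {D : ℤ}, QuadData s D →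
    ∀ (Z : Finset (𝓞 K)) (W : Finset ℕ) (y : ℝ), 1 ≤ y → y / 3 ≤ |(D : ℝ)| → |(D : ℝ)| ≤ 3 * y →
    (∀ κ ∈ Z, κ ≠ 0 ∧ ∃ 𝔠 : Ideal (𝓞 K), Ideal.span {κ} = 𝔠 ^ 3) →
    (∀ κ ∈ Z, ∀ κ' ∈ Z, CubeRel κ κ' → κ = κ') →
    (∀ p ∈ W, p.Prime ∧ p ≠ 2 ∧ IsSquare (D : ZMod p) ∧ (p : ℝ) ≤ y ^ (1 / 6 : ℝ) / 4) →
    y ^ (1 / 6 - ε) ≤ 2 * W.card →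
    (Z.card : ℝ) ≤ C * y ^ (1 / 3 + 2 * ε) := by
  obtain ⟨C, hC, hcard⟩ := exists_card_mul_card_le hε
  refine ⟨2 * C * 3 ^ (1 / 2 + ε), by positivity, ?_⟩
  intro K _ _ s D H Z W y hy hy1 hy2 hZ hpair hW hWcard
  have hy0 : 0 < y := by linarith
  obtain ⟨S, hS, hSW, hSpair⟩ := exists_finset_prime_ideals H W (fun p hp => by
    obtain ⟨h1, h2, ⟨a, ha⟩, -⟩ := hW p hp
    have : NeZero p := ⟨h1.ne_zero⟩
    refine ⟨h1, h2, a.val, ?_⟩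
    rw [← ZMod.intCast_zmod_eq_zero_iff_dvd]
    push_cast
    rw [ZMod.natCast_zmod_val, ha]
    ring)
  have hX : 16 * (y ^ (1 / 6 : ℝ) / 4) ^ 3 < √|(D : ℝ)| := by
    have h1 : (y ^ (1 / 6 : ℝ)) ^ 3 = √y := by
      rw [Real.sqrt_eq_rpow, ← Real.rpow_natCast, ← Real.rpow_mul hy0.le]
      norm_num
    have h2 : √y / 2 ≤ √|(D : ℝ)| := by
      apply Real.le_sqrt_of_sq_le
      rw [div_pow, Real.sq_sqrt hy0.le]
      linarith
    have h3 : 0 < √y := Real.sqrt_pos.mpr hy0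
    rw [div_pow, h1]
    linarith
  have h1 := hcard H Z S _ hZ hpair hX (fun P hP =>
    ⟨(hSW P hP).1, (hW _ (hSW P hP).2).2.2.2⟩) hSpair
  rw [hS] at h1
  have h2 : |(D : ℝ)| ^ (1 / 2 + ε) ≤ 3 ^ (1 / 2 + ε) * y ^ (1 / 2 + ε) := by
    rw [← Real.mul_rpow (by norm_num) hy0.le]
    gcongr
  have h3 : Z.card * y ^ (1 / 6 - ε) ≤ 2 * C * 3 ^ (1 / 2 + ε) * y ^ (1 / 2 + ε) := by
    calc Z.card * y ^ (1 / 6 - ε) ≤ Z.card * (2 * W.card) := by gcongr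
      _ = 2 * (Z.card * W.card) := by ring
      _ ≤ 2 * (C * |(D : ℝ)| ^ (1 / 2 + ε)) := by gcongr
      _ ≤ 2 * (C * (3 ^ (1 / 2 + ε) * y ^ (1 / 2 + ε))) := by gcongr
      _ = _ := by ring
  have h4 : y ^ (1 / 2 + ε) = y ^ (1 / 3 + 2 * ε) * y ^ (1 / 6 - ε) := by
    rw [← Real.rpow_add hy0]; ring_nf
  rw [h4, ← mul_assoc] at h3
  exact le_of_mul_le_mul_right h3 (by positivity)

/-- The Ellenberg--Venkatesh bound for `3`-Selmer elements of a quadratic field. -/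
theorem exists_card_le_rpow {ε : ℝ} (hε : 0 < ε) : ∃ C D₀ : ℝ, 0 < C ∧
    ∀ {K L : Type} [Field K] [NumberField K] [Field L] [NumberField L] {s : 𝓞 K} {r : 𝓞 L}
    {D D' e : ℤ}, QuadData s D → QuadData r D' → e ∣ 3 → e ^ 2 * D' = -3 * D →
    D₀ ≤ |(D : ℝ)| → ∀ Z : Finset (𝓞 L),
    (∀ κ ∈ Z, κ ≠ 0 ∧ ∃ 𝔠 : Ideal (𝓞 L), Ideal.span {κ} = 𝔠 ^ 3) →
    (∀ κ ∈ Z, ∀ κ' ∈ Z, CubeRel κ κ' → κ = κ') →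
    (Z.card : ℝ) ≤ C * |(D : ℝ)| ^ (1 / 3 + ε) := by
  obtain ⟨C, hC, hsplit⟩ := exists_card_le_of_split (half_pos hε)
  obtain ⟨D₀, hprimes⟩ := exists_finset_primes (half_pos hε)
  refine ⟨C * 5832 ^ 2, D₀, by positivity, ?_⟩
  intro K L _ _ _ _ s r D D' e HK HL he hD' hD₀ Z hZ hpair
  obtain ⟨W, hW, hWcard⟩ := hprimes D hD₀
  set y := |(D : ℝ)| with hy
  have hy1 : 1 ≤ y := by rw [hy]; exact_mod_cast Int.one_le_abs HK.ne_zero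
  have he3 : e ^ 2 = 1 ∨ e ^ 2 = 9 := by
    have h1 : e.natAbs ∣ 3 := Int.natCast_dvd_natCast.mp (by simpa using he)
    rcases (Nat.dvd_prime Nat.prime_three).mp h1 with h | h <;>
      rw [← Int.natAbs_sq, h] <;> norm_num
  have hyD' : y / 3 ≤ |(D' : ℝ)| ∧ |(D' : ℝ)| ≤ 3 * y := by
    have h1 : (e : ℝ) ^ 2 * |(D' : ℝ)| = 3 * y := by
      have h2 : ((e : ℝ) ^ 2 * D') = -3 * D := by exact_mod_cast hD'
      have h3 := congrArg abs h2
      rw [abs_mul, abs_mul, abs_of_nonneg (sq_nonneg _)] at h3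
      rw [h3, hy]; norm_num
    rcases he3 with h | h
    · have : (e : ℝ) ^ 2 = 1 := by exact_mod_cast h
      rw [this] at h1
      constructor <;> linarith
    · have : (e : ℝ) ^ 2 = 9 := by exact_mod_cast h
      rw [this] at h1
      constructor <;> linarith
  classical
  set W₁ := W.filter (fun p => IsSquare (D : ZMod p))
  set W₂ := W.filter (fun p => IsSquare (D' : ZMod p))
  have hWle : W.card ≤ W₁.card + W₂.card := by
    rw [← Finset.filter_true_of_mem (s := W) (p := fun p =>
      IsSquare (D : ZMod p) ∨ IsSquare (D' : ZMod p)), Finset.filter_or]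
    · exact Finset.card_union_le _ _
    · intro p hp
      obtain ⟨h1, h2, h3, h4, -⟩ := hW p hp
      have : Fact p.Prime := ⟨h1⟩
      exact ZMod.isSquare_or_isSquare h2 h3 hD' h4
  have hε2 : 1 / 3 + 2 * (ε / 2) = 1 / 3 + ε := by ring
  rcases le_total W₁.card W₂.card with hle | hle
  · have h1 := hsplit HL Z W₂ y hy1 hyD'.1 hyD'.2 hZ hpair (fun p hp => by
      obtain ⟨h1, h2⟩ := Finset.mem_filter.mp hp
      obtain ⟨h3, h4, -, -, h5⟩ := hW p h1
      exact ⟨h3, h4, h2, h5⟩) (hWcard.trans (by exact_mod_cast (by omega : W.card ≤ 2 * W₂.card)))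
    rw [hε2] at h1
    refine h1.trans ?_
    gcongr
    linarith
  · obtain ⟨Z', hZ', hpair', hcard'⟩ := exists_finset_card_hom_le K
    have h1 := hsplit HK Z' W₁ y hy1 (by linarith) (by linarith) hZ' hpair' (fun p hp => by
      obtain ⟨h1, h2⟩ := Finset.mem_filter.mp hp
      obtain ⟨h3, h4, -, -, h5⟩ := hW p h1
      exact ⟨h3, h4, h2, h5⟩) (hWcard.trans (by exact_mod_cast (by omega : W.card ≤ 2 * W₁.card)))
    rw [hε2] at h1
    have h2 : Z.card ≤ Z'.card * 5832 ^ 2 :=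
      (card_le_card_hom HK HL he hD' Z hZ hpair).trans (by gcongr)
    have h3 : (Z.card : ℝ) ≤ Z'.card * 5832 ^ 2 := by exact_mod_cast h2
    nlinarith

end CubicSymbol

end

section

open NumberField Polynomial

namespace NumberField

/-- A prime not dividing the discriminant generates a radical ideal of the ring of integers. -/
lemma intCast_dvd_of_dvd_pow {K : Type*} [Field K] [NumberField K] {q : ℤ} (hq : Prime q)
    (hqd : ¬ q ∣ discr K) {x : 𝓞 K} {n : ℕ} (h : (q : 𝓞 K) ∣ x ^ n) : (q : 𝓞 K) ∣ x := by
  have hq0 : (q : 𝓞 K) ≠ 0 := by exact_mod_cast hq.ne_zero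
  have hsf : Squarefree (Ideal.span {(q : 𝓞 K)}) := by
    refine (squarefree_iff_no_irreducibles (by simpa using hq0)).mpr fun P hP hPq => ?_
    have hmax : (Ideal.span {q}).IsMaximal :=
      PrincipalIdealRing.isMaximal_of_irreducible hq.irreducible
    have h1 := pow_sub_one_dvd_differentIdeal ℤ (p := Ideal.span {q}) P 2
      (by simpa using hq.ne_zero) (by simpa [Ideal.map_span, pow_two] using hPq)
    have h2 : (discr K : 𝓞 K) ∈ P := by
      have := Ideal.dvd_iff_le.mp h1 (discr_mem_differentIdeal K (𝓞 K))
      simpa using this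
    have h3 : (q : 𝓞 K) ∈ P :=
      Ideal.dvd_iff_le.mp ((dvd_mul_right P P).trans hPq) (Ideal.mem_span_singleton_self _)
    obtain ⟨a, b, hab⟩ := (hq.coprime_iff_not_dvd).mpr hqd
    apply hP.not_isUnit
    rw [Ideal.isUnit_iff, Ideal.eq_top_iff_one]
    have : (1 : 𝓞 K) = a * q + b * discr K := by exact_mod_cast hab.symm
    rw [this]
    exact P.add_mem (P.mul_mem_left _ h3) (P.mul_mem_left _ h2)
  have h4 : Ideal.span {(q : 𝓞 K)} ∣ Ideal.span {x} ^ n := by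
    rw [Ideal.span_singleton_pow, Ideal.dvd_iff_le]
    exact Ideal.span_singleton_le_span_singleton.mpr h
  have h5 := hsf.isRadical n _ h4
  rw [Ideal.dvd_iff_le] at h5
  exact Ideal.span_singleton_le_span_singleton.mp h5

end NumberField

namespace CubicRelation

variable {K : Type*} [Field K] [NumberField K] {θ : K} {a b : ℚ}

lemma natDegree_minpoly (hK : Module.finrank ℚ K = 3) (hθ : θ ∉ (algebraMap ℚ K).range) :
    (minpoly ℚ θ).natDegree = 3 := by
  have h1 : (minpoly ℚ θ).natDegree ∣ 3 := hK ▸ minpoly.degree_dvd (Algebra.IsIntegral.isIntegral θ)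
  rcases (Nat.dvd_prime Nat.prime_three).mp h1 with h | h
  · exact absurd (minpoly.natDegree_eq_one_iff.mp h) hθ
  · exact h

lemma minpoly_eq (hK : Module.finrank ℚ K = 3) (hθ : θ ∉ (algebraMap ℚ K).range)
    (h : θ ^ 3 = a * θ + b) : minpoly ℚ θ = X ^ 3 - C a * X - C b := by
  have hd := natDegree_minpoly hK hθ
  have h2 : (X ^ 3 - C a * X - C b : ℚ[X]).natDegree = 3 := by compute_degree!
  have hm : (X ^ 3 - C a * X - C b : ℚ[X]).Monic := by monicity!
  symm
  refine eq_of_monic_of_dvd_of_natDegree_le (minpoly.monic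
    (Algebra.IsIntegral.isIntegral θ)) hm (minpoly.dvd ℚ θ ?_) (by rw [hd, h2])
  simp [h]

/-- The discriminant of the order generated by a root of a cubic is a square multiple of the
discriminant of the field. -/
lemma exists_discr_eq (hK : Module.finrank ℚ K = 3) (hθ : θ ∉ (algebraMap ℚ K).range)
    (h : θ ^ 3 = a * θ + b) : ∃ i : ℚ, 4 * a ^ 3 - 27 * b ^ 2 = discr K * i ^ 2 := by
  have hd := natDegree_minpoly hK hθ
  have hli : LinearIndependent ℚ ![1, θ, θ ^ 2] := by
    have := linearIndependent_pow (K := ℚ) θ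
    rw [hd] at this
    have h1 : ![1, θ, θ ^ 2] = fun i : Fin 3 => θ ^ (i : ℕ) := by
      ext i; fin_cases i <;> simp
    rw [h1]
    exact this
  let B : Module.Basis (Fin 3) ℚ K := basisOfLinearIndependentOfCardEqFinrank hli (by simp [hK])
  have hB : ⇑B = ![1, θ, θ ^ 2] := coe_basisOfLinearIndependentOfCardEqFinrank hli _
  have hB0 : B 0 = 1 := by simp [hB]
  have hB1 : B 1 = θ := by simp [hB]
  have hB2 : B 2 = θ ^ 2 := by simp [hB]
  have hr (x : K) (u v w : ℚ) (hx : x = u * B 0 + v * B 1 + w * B 2) :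
      B.repr x = Finsupp.single 0 u + Finsupp.single 1 v + Finsupp.single 2 w := by
    have : x = u • B 0 + v • B 1 + w • B 2 := by simp only [Rat.smul_def, hx]
    rw [this]; simp
  have ht (x : K) : Algebra.trace ℚ K x = B.repr (x * B 0) 0 + B.repr (x * B 1) 1 +
      B.repr (x * B 2) 2 := by
    rw [Algebra.trace_eq_matrix_trace B, Matrix.trace_fin_three]
    simp [Algebra.leftMulMatrix_eq_repr_mul]
  have ht1 : Algebra.trace ℚ K θ = 0 := by
    rw [ht, hr _ 0 1 0 (by simp [hB0, hB1]), hr _ 0 0 1 (by simp [hB1, hB2]; ring),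
      hr _ b a 0 (by rw [hB0, hB1, hB2]; push_cast; linear_combination h)]
    simp
  have ht2 : Algebra.trace ℚ K (θ ^ 2) = 2 * a := by
    rw [ht, hr _ 0 0 1 (by simp [hB0, hB2]),
      hr _ b a 0 (by rw [hB0, hB1, hB2]; push_cast; linear_combination h),
      hr _ 0 b a (by rw [hB0, hB1, hB2]; push_cast; linear_combination θ * h)]
    simp; ring
  have ht0 : Algebra.trace ℚ K 1 = 3 := by
    simpa [hK] using Algebra.trace_algebraMap (S := K) (1 : ℚ)
  have hlin (u v w : ℚ) : Algebra.trace ℚ K (u + v * θ + w * θ ^ 2) = 3 * u + 2 * a * w := by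
    have : (u + v * θ + w * θ ^ 2 : K) = u • 1 + v • θ + w • θ ^ 2 := by simp [Rat.smul_def]
    rw [this]; simp only [map_add, map_smul, ht0, ht1, ht2, smul_eq_mul]; ring
  have ht3 : Algebra.trace ℚ K (θ ^ 3) = 3 * b := by
    have := hlin b a 0
    rw [h]; push_cast at this; rw [show a * θ + b = b + a * θ + 0 * θ ^ 2 by ring, this]; ring
  have ht4 : Algebra.trace ℚ K (θ ^ 4) = 2 * a ^ 2 := by
    have := hlin 0 b a
    push_cast at this
    rw [show θ ^ 4 = 0 + b * θ + a * θ ^ 2 by linear_combination θ * h, this]; ring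
  have hdisc : Algebra.discr ℚ ![1, θ, θ ^ 2] = 4 * a ^ 3 - 27 * b ^ 2 := by
    rw [Algebra.discr_def, Matrix.det_fin_three]
    simp only [Algebra.traceMatrix_apply, Algebra.traceForm_apply, Matrix.cons_val]
    ring_nf
    simp only [ht0, ht1, ht2, ht3, ht4]
    ring
  have hcard : Fintype.card (Module.Free.ChooseBasisIndex ℤ (𝓞 K)) = Fintype.card (Fin 3) := by
    rw [← Module.finrank_eq_card_chooseBasisIndex, RingOfIntegers.rank, hK, Fintype.card_fin]
  let e := Fintype.equivOfCardEq hcard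
  let B' := (integralBasis K).reindex e
  have h1 : Algebra.discr ℚ B' = discr K := by
    rw [coe_discr, Module.Basis.coe_reindex, Algebra.discr_reindex]
  refine ⟨(B'.toMatrix ![1, θ, θ ^ 2]).det, ?_⟩
  rw [← hdisc, ← h1, mul_comm, ← Algebra.discr_of_matrix_vecMul, Module.Basis.toMatrix_map_vecMul]

end CubicRelation

namespace CubicRelation

variable {K : Type*} [Field K] [NumberField K] {θ : K}

lemma quadratic_ne_zero (hK : Module.finrank ℚ K = 3) (hθ : θ ∉ (algebraMap ℚ K).range) (x y : ℚ) :
    θ ^ 2 + x * θ + y ≠ 0 := by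
  intro h
  have hd := natDegree_minpoly hK hθ
  have h2 : (X ^ 2 + C x * X + C y : ℚ[X]).natDegree = 2 := by compute_degree!
  have hm : (X ^ 2 + C x * X + C y : ℚ[X]).Monic := by monicity!
  have := natDegree_le_natDegree (minpoly.min ℚ θ hm (by simpa using h))
  omega

lemma exists_not_mem_range (hK : Module.finrank ℚ K = 3) : ∃ θ : K, θ ∉ (algebraMap ℚ K).range := by
  by_contra! h
  have h1 : (⊥ : Subalgebra ℚ K) = ⊤ := by
    rw [eq_top_iff]
    intro x _
    obtain ⟨y, hy⟩ := h x
    exact Algebra.mem_bot.mpr ⟨y, hy⟩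
  rw [Subalgebra.bot_eq_top_iff_finrank_eq_one, hK] at h1
  omega

/-- Every cubic field is generated by a root of a depressed cubic with nonzero linear coefficient. -/
lemma exists_depressed (hK : Module.finrank ℚ K = 3) : ∃ (θ : K) (p q : ℚ), p ≠ 0 ∧
    θ ∉ (algebraMap ℚ K).range ∧ θ ^ 3 = 3 * p * θ + 2 * q := by
  obtain ⟨θ₀, hθ₀⟩ := exists_not_mem_range hK
  have hd := natDegree_minpoly hK hθ₀
  have hm := minpoly.monic (Algebra.IsIntegral.isIntegral (R := ℚ) θ₀)
  have h0 := minpoly.aeval ℚ θ₀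
  have h3 : (minpoly ℚ θ₀).coeff 3 = 1 := by rw [← hd]; exact hm
  rw [aeval_eq_sum_range, hd] at h0
  simp only [Finset.sum_range_succ, Finset.sum_range_zero, h3, Rat.smul_def] at h0
  set c₀ := (minpoly ℚ θ₀).coeff 0
  set c₁ := (minpoly ℚ θ₀).coeff 1
  set c₂ := (minpoly ℚ θ₀).coeff 2
  have hrel : ∃ (θ : K) (p q : ℚ), θ ∉ (algebraMap ℚ K).range ∧ θ ^ 3 = 3 * p * θ + 2 * q := by
    refine ⟨θ₀ + (c₂ / 3 : ℚ), (c₂ ^ 2 / 3 - c₁) / 3,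
      - (2 * c₂ ^ 3 / 27 - c₁ * c₂ / 3 + c₀) / 2, ?_, ?_⟩
    · rintro ⟨y, hy⟩
      refine hθ₀ ⟨y - c₂ / 3, ?_⟩
      rw [map_sub, hy]; simp
    · push_cast at h0 ⊢
      linear_combination h0
  obtain ⟨θ, p, q, hθ, h⟩ := hrel
  by_cases hp : p = 0
  · subst hp
    have hq : q ≠ 0 := by
      rintro rfl
      apply hθ
      have : θ = 0 := by simpa using h
      exact ⟨0, by simp [this]⟩
    refine ⟨θ + θ ^ 2, 2 * q, q * (1 + 2 * q), by simpa using hq, ?_, ?_⟩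
    · rintro ⟨y, hy⟩
      refine quadratic_ne_zero hK hθ 1 (-y) ?_
      push_cast
      rw [show (y : K) = algebraMap ℚ K y from rfl, hy]
      ring
    · push_cast at h ⊢
      linear_combination (1 + 3 * θ + 3 * θ ^ 2 + (θ ^ 3 + 2 * q)) * h
  · exact ⟨θ, p, q, hp, hθ, h⟩

/-- The integral point on `q ^ 2 - D' * w ^ 2 = p ^ 3` attached to a cubic field. -/
lemma exists_point (hK : Module.finrank ℚ K = 3) {D' g : ℤ}
    (hg : -3 * discr K = D' * g ^ 2) : ∃ (θ : K) (p q w : ℤ), p ≠ 0 ∧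
      θ ∉ (algebraMap ℚ K).range ∧ θ ^ 3 = 3 * p * θ + 2 * q ∧ q ^ 2 - D' * w ^ 2 = p ^ 3 := by
  obtain ⟨θ, p, q, hp, hθ, h⟩ := exists_depressed hK
  obtain ⟨i, hi⟩ := exists_discr_eq hK hθ (a := 3 * p) (b := 2 * q) (by push_cast; exact h)
  obtain ⟨w, hw⟩ : ∃ w : ℚ, w = g * i / 18 := ⟨_, rfl⟩
  have hg' : (-3 * discr K : ℚ) = D' * g ^ 2 := by exact_mod_cast hg
  have hpt : q ^ 2 - D' * w ^ 2 = p ^ 3 := by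
    rw [hw]; linear_combination (-1 / 108) * hi + i ^ 2 / 324 * hg'
  have hN (x : ℚ) : x * x.den = x.num := Rat.mul_den_eq_num x
  set N : ℤ := p.den * q.den * w.den with hNdef
  have hN0 : N ≠ 0 := by
    have := p.den_nz; have := q.den_nz; have := w.den_nz
    positivity
  have hNQ : (N : ℚ) = p.den * q.den * w.den := by rw [hNdef]; push_cast; rfl
  have e1 : ((p.num * p.den * (q.den * w.den) ^ 2 : ℤ) : ℚ) = p * N ^ 2 := by
    push_cast; rw [hNQ, ← hN p]; ring
  have e2 : ((q.num * q.den ^ 2 * (p.den * w.den) ^ 3 : ℤ) : ℚ) = q * N ^ 3 := by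
    push_cast; rw [hNQ, ← hN q]; ring
  have e3 : ((w.num * w.den ^ 2 * (q.den * p.den) ^ 3 : ℤ) : ℚ) = w * N ^ 3 := by
    push_cast; rw [hNQ, ← hN w]; ring
  refine ⟨N * θ, p.num * p.den * (q.den * w.den) ^ 2, q.num * q.den ^ 2 * (p.den * w.den) ^ 3,
    w.num * w.den ^ 2 * (q.den * p.den) ^ 3, ?_, ?_, ?_, ?_⟩
  · rw [← Int.cast_ne_zero (α := ℚ), e1]
    have : (N : ℚ) ≠ 0 := by exact_mod_cast hN0
    positivity
  · rintro ⟨y, hy⟩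
    refine hθ ⟨y / N, ?_⟩
    have : (N : K) ≠ 0 := by exact_mod_cast hN0
    rw [map_div₀, hy]; simp; field_simp
  · rw [← Rat.cast_intCast (p.num * _ * _), ← Rat.cast_intCast (q.num * _ * _), e1, e2]
    push_cast
    linear_combination (N : K) ^ 3 * h
  · rw [← Int.cast_inj (α := ℚ)]
    simp only [Int.cast_sub, Int.cast_mul D', Int.cast_pow _ 2, Int.cast_pow _ 3, e1, e2, e3]
    linear_combination (N : ℚ) ^ 6 * hpt

/-- A cubic field is determined by the minimal polynomial of a generator. -/
lemma nonempty_ringEquiv_adjoinRoot (hK : Module.finrank ℚ K = 3) {f : ℚ[X]} (hf : Irreducible f)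
    (hdeg : f.natDegree = 3) {x : K} (hx : aeval x f = 0) : Nonempty (AdjoinRoot f ≃+* K) := by
  have : Fact (Irreducible f) := ⟨hf⟩
  let φ : AdjoinRoot f →ₐ[ℚ] K := AdjoinRoot.liftAlgHom f (Algebra.ofId ℚ K) x hx
  have hfd : Module.finrank ℚ (AdjoinRoot f) = 3 := by
    rw [(AdjoinRoot.powerBasis hf.ne_zero).finrank, AdjoinRoot.powerBasis_dim, hdeg]
  have hfin : FiniteDimensional ℚ (AdjoinRoot f) := .of_finrank_pos (by omega)
  have hinj : Function.Injective φ := φ.toRingHom.injective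
  have hsurj : Function.Surjective φ :=
    (LinearMap.injective_iff_surjective_of_finrank_eq_finrank (f := φ.toLinearMap)
      (by rw [hfd, hK])).mp hinj
  exact ⟨RingEquiv.ofBijective φ ⟨hinj, hsurj⟩⟩

/-- Two points of `q ^ 2 - D' * w ^ 2 = p ^ 3` differing by a cube define the same cubic field. -/
lemma nonempty_ringEquiv {K' : Type*} [Field K'] [NumberField K'] {θ' : K'}
    (hK : Module.finrank ℚ K = 3) (hK' : Module.finrank ℚ K' = 3)
    (hθ : θ ∉ (algebraMap ℚ K).range) (hθ' : θ' ∉ (algebraMap ℚ K').range)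
    {p q w p' q' D' u v : ℚ} (h : θ ^ 3 = 3 * p * θ + 2 * q) (h' : θ' ^ 3 = 3 * p' * θ' + 2 * q')
    (hpt : q ^ 2 - D' * w ^ 2 = p ^ 3) (hp' : p' = (u ^ 2 - D' * v ^ 2) * p)
    (hq' : q' = u ^ 3 * q + 3 * u ^ 2 * v * w * D' + 3 * u * v ^ 2 * D' * q + v ^ 3 * w * D' ^ 2) :
    Nonempty (K ≃+* K') := by
  have hne : θ ^ 2 - p ≠ 0 := by
    have := quadratic_ne_zero hK hθ 0 (-p)
    intro h
    apply this
    push_cast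
    linear_combination h
  obtain ⟨x, hx⟩ : ∃ x : K, x * (θ ^ 2 - p) = 2 * w * D' := ⟨2 * w * D' / (θ ^ 2 - p), by field_simp⟩
  have hpt' : (q : K) ^ 2 - D' * w ^ 2 = p ^ 3 := by exact_mod_cast congrArg (Rat.cast (K := K)) hpt
  have hx2 : x ^ 2 = D' * (θ ^ 2 - 4 * p) := by
    refine mul_right_cancel₀ (pow_ne_zero 2 hne) ?_
    linear_combination (x * (θ ^ 2 - p) + 2 * w * D') * hx - 4 * D' * hpt' -
      D' * (θ ^ 3 - 3 * p * θ + 2 * q) * h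
  have hη : (u * θ + v * x) ^ 3 = 3 * p' * (u * θ + v * x) + 2 * q' := by
    rw [hp', hq']
    push_cast
    have h1 : θ ^ 2 * x = 2 * w * D' + p * x := by linear_combination hx
    have h2 : θ * x ^ 2 = D' * (2 * q - p * θ) := by linear_combination θ * hx2 + D' * h
    have h3 : x ^ 3 = D' * (2 * w * D' - 3 * p * x) := by linear_combination x * hx2 + D' * h1
    linear_combination (u : K) ^ 3 * h + 3 * u ^ 2 * v * h1 + 3 * u * v ^ 2 * h2 + v ^ 3 * h3
  have hmin := minpoly_eq hK' hθ' (a := 3 * p') (b := 2 * q') (by push_cast; exact h')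
  have hirr := minpoly.irreducible (Algebra.IsIntegral.isIntegral (R := ℚ) θ')
  have hdeg := natDegree_minpoly hK' hθ'
  obtain ⟨e⟩ := nonempty_ringEquiv_adjoinRoot hK hirr hdeg (x := u * θ + v * x) (by
    rw [hmin]; simp [hη])
  obtain ⟨e'⟩ := nonempty_ringEquiv_adjoinRoot hK' hirr hdeg (minpoly.aeval ℚ θ')
  exact ⟨e.symm.trans e'⟩

/-- A local condition at primes not dividing the discriminant. -/
lemma not_pow_dvd (hK : Module.finrank ℚ K = 3) (hθ : θ ∉ (algebraMap ℚ K).range) {a b : ℤ}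
    (h : θ ^ 3 = a * θ + b) {ℓ : ℤ} (hℓ : Prime ℓ) (hℓd : ¬ ℓ ∣ discr K) {n : ℕ} (hn : ¬ 3 ∣ n)
    (hb : ℓ ^ n ∣ b) (hb' : ¬ ℓ ^ (n + 1) ∣ b) : ¬ ℓ ^ (2 * (n / 3) + 1) ∣ a := by
  rintro ⟨a₁, rfl⟩
  obtain ⟨b₁, rfl⟩ : ℓ ^ (3 * (n / 3) + 1) ∣ b := (pow_dvd_pow _ (by omega)).trans hb
  have hb₁ : ¬ ℓ ^ 2 ∣ b₁ := by
    rintro ⟨c, rfl⟩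
    exact hb' ((pow_dvd_pow _ (by omega : n + 1 ≤ 3 * (n / 3) + 1 + 2)).trans ⟨c, by ring⟩)
  set s := n / 3
  have hℓ0 : (ℓ : K) ≠ 0 := by exact_mod_cast hℓ.ne_zero
  set θ₁ : K := θ / ℓ ^ s with hθ₁
  have hθθ₁ : θ = ℓ ^ s * θ₁ := by rw [hθ₁]; field_simp
  have h1 : θ₁ ^ 3 = ℓ * (a₁ * θ₁ + b₁) := by
    refine mul_left_cancel₀ (pow_ne_zero (3 * s) hℓ0) ?_
    rw [hθθ₁] at h
    push_cast at h
    linear_combination h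
  have hint : IsIntegral ℤ θ₁ := by
    refine ⟨X ^ 3 - C (ℓ * a₁) * X - C (ℓ * b₁), by monicity!, ?_⟩
    rw [eval₂_sub, eval₂_sub, eval₂_mul, eval₂_C, eval₂_C, eval₂_X, eval₂_X_pow, h1]
    simp only [eq_intCast, Int.cast_mul]
    ring
  obtain ⟨y, hy⟩ : ∃ y : 𝓞 K, (y : K) = θ₁ := ⟨⟨θ₁, hint⟩, rfl⟩
  have h2 : (ℓ : 𝓞 K) ∣ y ^ 3 := by
    refine ⟨a₁ * y + b₁, ?_⟩
    apply RingOfIntegers.ext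
    push_cast
    simp [hy, h1]
  obtain ⟨z, rfl⟩ := intCast_dvd_of_dvd_pow hℓ hℓd h2
  have hz : ℓ * (z : K) = θ₁ := by rw [← hy]; simp
  have hzr : (z : K) ∉ (algebraMap ℚ K).range := by
    rintro ⟨c, hc⟩
    refine hθ ⟨ℓ ^ (s + 1) * c, ?_⟩
    rw [hθθ₁, ← hz, map_mul, hc]; simp; ring
  have hzrel : (z : K) ^ 3 = ((a₁ / ℓ : ℚ) : K) * z + ((b₁ / ℓ ^ 2 : ℚ) : K) := by
    push_cast
    rw [← hz] at h1
    field_simp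
    refine mul_left_cancel₀ hℓ0 ?_
    linear_combination h1
  have hmin := minpoly_eq hK hzr hzrel
  rw [minpoly.isIntegrallyClosed_eq_field_fractions' ℚ (RingOfIntegers.isIntegral_coe z)] at hmin
  have hc := congrArg (fun f => f.coeff 0) hmin
  simp only [coeff_map, coeff_sub, coeff_C_zero, coeff_X_pow, coeff_mul_X_zero] at hc
  norm_num at hc
  apply hb₁
  refine ⟨-(minpoly ℤ (z : K)).coeff 0, ?_⟩
  have hℓ0' : (ℓ : ℚ) ≠ 0 := by exact_mod_cast hℓ.ne_zero
  field_simp at hc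
  rw [← Int.cast_inj (α := ℚ)]
  push_cast
  linarith

end CubicRelation

end

section

open NumberField

/-- A nonzero ideal all of whose multiplicities are divisible by `k` is a `k`-th power. -/
lemma Ideal.exists_eq_pow_of_dvd_multiplicity {R : Type*} [CommRing R] [IsDedekindDomain R]
    {I : Ideal R} (hI : I ≠ ⊥) {k : ℕ}
    (h : ∀ P : Ideal R, Prime P → k ∣ multiplicity P I) : ∃ J : Ideal R, I = J ^ k := by
  classical
  obtain ⟨u, hu⟩ := Multiset.exists_smul_of_dvd_count
    (UniqueFactorizationMonoid.normalizedFactors I) (k := k) fun P hP => by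
      have hP' := UniqueFactorizationMonoid.prime_of_normalized_factor P hP
      have h1 := UniqueFactorizationMonoid.emultiplicity_eq_count_normalizedFactors
        hP'.irreducible hI
      rw [normalize_eq] at h1
      rw [← multiplicity_eq_of_emultiplicity_eq_some h1]
      exact h P hP'
  refine ⟨u.prod, ?_⟩
  rw [← Ideal.prod_normalizedFactors_eq_self hI, hu, Multiset.prod_nsmul]

namespace CubicSymbol

variable {L : Type*} [Field L] [NumberField L]

/-- Cube classes of elements of norm a cube control cubic points up to twisting. -/
def DetectsCubes (r : 𝓞 L) (D' : ℤ) : Prop :=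
  ∀ q w p q' w' p' : ℤ, p ≠ 0 → p' ≠ 0 → q ^ 2 - D' * w ^ 2 = p ^ 3 →
    q' ^ 2 - D' * w' ^ 2 = p' ^ 3 → CubeRel (q + w * r : 𝓞 L) (q' + w' * r) →
    ∃ u v : ℚ, (p' : ℚ) = (u ^ 2 - D' * v ^ 2) * p ∧
      (q' : ℚ) = u ^ 3 * q + 3 * u ^ 2 * v * w * D' + 3 * u * v ^ 2 * D' * q + v ^ 3 * w * D' ^ 2

section Multiplicity

variable {P : Ideal (𝓞 L)}

lemma finiteMultiplicity_span (hP : Prime P) {x : 𝓞 L} (hx : x ≠ 0) :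
    FiniteMultiplicity P (Ideal.span {x}) :=
  .of_prime_left hP (by simpa using hx)

lemma multiplicity_span_mul (hP : Prime P) {x y : 𝓞 L} (hx : x ≠ 0) (hy : y ≠ 0) :
    multiplicity P (Ideal.span {x * y}) =
      multiplicity P (Ideal.span {x}) + multiplicity P (Ideal.span {y}) := by
  have := finiteMultiplicity_span hP (mul_ne_zero hx hy)
  rw [← Ideal.span_singleton_mul_span_singleton] at this ⊢
  exact multiplicity_mul hP this

lemma multiplicity_span_pow (hP : Prime P) {x : 𝓞 L} (hx : x ≠ 0) (n : ℕ) :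
    multiplicity P (Ideal.span {x ^ n}) = n * multiplicity P (Ideal.span {x}) := by
  rw [← Ideal.span_singleton_pow]
  exact (finiteMultiplicity_span hP hx).multiplicity_pow hP

lemma mem_pow_iff_le_multiplicity (hP : Prime P) {x : 𝓞 L} (hx : x ≠ 0) {k : ℕ} :
    x ∈ P ^ k ↔ k ≤ multiplicity P (Ideal.span {x}) := by
  rw [← (finiteMultiplicity_span hP hx).pow_dvd_iff_le_multiplicity, Ideal.dvd_span_singleton]

lemma multiplicity_span_intCast (hP : Prime P) {ℓ : ℕ} (hℓ : ℓ.Prime) (hℓP : (ℓ : 𝓞 L) ∈ P)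
    {n : ℤ} (hn : n ≠ 0) : multiplicity P (Ideal.span {(n : 𝓞 L)}) =
      multiplicity (ℓ : ℤ) n * multiplicity P (Ideal.span {(ℓ : 𝓞 L)}) := by
  have hfin : FiniteMultiplicity (ℓ : ℤ) n :=
    .of_prime_left (Nat.prime_iff_prime_int.mp hℓ) hn
  obtain ⟨m, hm, hm'⟩ := hfin.exists_eq_pow_mul_and_not_dvd
  have hm0 : (m : 𝓞 L) ≠ 0 := by
    rintro h
    exact hm' (by rw [Int.cast_eq_zero.mp h]; exact dvd_zero _)
  have hℓ0 : (ℓ : 𝓞 L) ≠ 0 := by exact_mod_cast hℓ.ne_zero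
  have h0 : multiplicity P (Ideal.span {(m : 𝓞 L)}) = 0 := by
    by_contra h
    have h1 := (mem_pow_iff_le_multiplicity hP hm0 (k := 1)).mpr (by omega)
    rw [pow_one, Ideal.intCast_mem_iff_dvd (Ideal.isPrime_of_prime hP).ne_top hℓ hℓP] at h1
    exact hm' h1
  conv_lhs => rw [hm]
  push_cast
  rw [multiplicity_span_mul hP (pow_ne_zero _ hℓ0) hm0, multiplicity_span_pow hP hℓ0, h0, add_zero]

variable {K : Type*} [Field K] [NumberField K] {θ : K} {r : 𝓞 L} {D' p q w : ℤ}

lemma le_of_not_three_dvd_multiplicity (hK : Module.finrank ℚ K = 3)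
    (hθ : θ ∉ (algebraMap ℚ K).range) (h : θ ^ 3 = 3 * p * θ + 2 * q) (hr : r ^ 2 = D')
    (hp : p ≠ 0) (hpt : q ^ 2 - D' * w ^ 2 = p ^ 3) (hP : Prime P)
    (hPd : (6 * discr K : 𝓞 L) ∉ P)
    (h3 : ¬ 3 ∣ multiplicity P (Ideal.span {(q + w * r : 𝓞 L)})) :
    multiplicity P (Ideal.span {(q - w * r : 𝓞 L)}) ≤
      multiplicity P (Ideal.span {(q + w * r : 𝓞 L)}) := by
  by_contra! hlt
  have hpL : (p : 𝓞 L) ≠ 0 := by exact_mod_cast hp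
  have hmul : (q + w * r : 𝓞 L) * (q - w * r) = (p : 𝓞 L) ^ 3 := by
    have : (q : 𝓞 L) ^ 2 - D' * w ^ 2 = p ^ 3 := by exact_mod_cast congrArg (Int.cast (R := 𝓞 L)) hpt
    linear_combination this - w ^ 2 * hr
  have hne : (q + w * r : 𝓞 L) * (q - w * r) ≠ 0 := hmul ▸ pow_ne_zero 3 hpL
  have hβ := left_ne_zero_of_mul hne
  have hβ' := right_ne_zero_of_mul hne
  have hsum := multiplicity_span_mul hP hβ hβ'
  rw [hmul, multiplicity_span_pow hP hpL] at hsum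
  have hPrime := Ideal.isPrime_of_prime hP
  obtain ⟨ℓ, hℓ, hℓP, -⟩ := Ideal.exists_prime_mem hPrime hP.ne_zero
  have hℓ' := Nat.prime_iff_prime_int.mp hℓ
  have hℓ6 : ¬ (ℓ : ℤ) ∣ 6 * discr K := by
    rw [← Ideal.intCast_mem_iff_dvd hPrime.ne_top hℓ hℓP]
    push_cast
    exact hPd
  have hℓ3 : ¬ (ℓ : ℤ) ∣ 3 := fun h => hℓ6 (h.trans ⟨2 * discr K, by ring⟩)
  set a := multiplicity P (Ideal.span {(q + w * r : 𝓞 L)}) with ha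
  have hmem : ((2 * q : ℤ) : 𝓞 L) ∈ P ^ a ∧ ((2 * q : ℤ) : 𝓞 L) ∉ P ^ (a + 1) := by
    have e1 : ((2 * q : ℤ) : 𝓞 L) = (q + w * r) + (q - w * r) := by push_cast; ring
    have m1 := (mem_pow_iff_le_multiplicity hP hβ (k := a)).mpr le_rfl
    have m1' := mt (mem_pow_iff_le_multiplicity hP hβ (k := a + 1)).mp (by omega)
    have m2 := (mem_pow_iff_le_multiplicity hP hβ' (k := a + 1)).mpr (by omega)
    rw [e1]
    exact ⟨add_mem m1 (Ideal.pow_le_pow_right (by omega) m2),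
      fun h => m1' (by simpa using sub_mem h m2)⟩
  have hq0 : 2 * q ≠ 0 := by
    intro h
    rw [h] at hmem
    simp at hmem
  have hqL : ((2 * q : ℤ) : 𝓞 L) ≠ 0 := by exact_mod_cast hq0
  have ha' : multiplicity P (Ideal.span {((2 * q : ℤ) : 𝓞 L)}) = a := by
    rw [mem_pow_iff_le_multiplicity hP hqL, mem_pow_iff_le_multiplicity hP hqL] at hmem
    omega
  rw [multiplicity_span_intCast hP hℓ hℓP hq0] at ha'
  rw [multiplicity_span_intCast hP hℓ hℓP hp] at hsum
  set n := multiplicity (ℓ : ℤ) (2 * q) with hn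
  set m := multiplicity (ℓ : ℤ) p with hm
  have hfin : FiniteMultiplicity (ℓ : ℤ) (2 * q) := .of_prime_left hℓ' hq0
  have hn3 : ¬ 3 ∣ n := fun h => h3 (ha' ▸ h.mul_right _)
  have key := CubicRelation.not_pow_dvd hK hθ (a := 3 * p) (b := 2 * q) (by push_cast; exact h) hℓ'
    (fun h => hℓ6 (h.mul_left _)) hn3 (pow_multiplicity_dvd _ _)
    (hfin.not_pow_dvd_of_multiplicity_lt (Nat.lt_succ_self _))
  have hmn : m ≤ 2 * (n / 3) := by
    by_contra! hlt
    exact key (((pow_dvd_pow _ hlt).trans (pow_multiplicity_dvd _ _)).mul_left _)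
  have : 3 * m ≤ 2 * n := by omega
  have := Nat.mul_le_mul_right (multiplicity P (Ideal.span {(ℓ : 𝓞 L)})) this
  have : 3 * (m * multiplicity P (Ideal.span {(ℓ : 𝓞 L)})) ≤ 2 * a := by
    rw [← ha']; linarith
  omega

/-- Away from the discriminant, the point attached to a cubic field is a cube. -/
lemma three_dvd_multiplicity (hK : Module.finrank ℚ K = 3)
    (hθ : θ ∉ (algebraMap ℚ K).range) (h : θ ^ 3 = 3 * p * θ + 2 * q) (hr : r ^ 2 = D')
    (hp : p ≠ 0) (hpt : q ^ 2 - D' * w ^ 2 = p ^ 3) (hP : Prime P)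
    (hPd : (6 * discr K : 𝓞 L) ∉ P) :
    3 ∣ multiplicity P (Ideal.span {(q + w * r : 𝓞 L)}) := by
  by_contra h3
  have hpL : (p : 𝓞 L) ≠ 0 := by exact_mod_cast hp
  have hmul : (q + w * r : 𝓞 L) * (q - w * r) = (p : 𝓞 L) ^ 3 := by
    have : (q : 𝓞 L) ^ 2 - D' * w ^ 2 = p ^ 3 := by exact_mod_cast congrArg (Int.cast (R := 𝓞 L)) hpt
    linear_combination this - w ^ 2 * hr
  have hne : (q + w * r : 𝓞 L) * (q - w * r) ≠ 0 := hmul ▸ pow_ne_zero 3 hpL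
  have hsum := multiplicity_span_mul hP (left_ne_zero_of_mul hne) (right_ne_zero_of_mul hne)
  rw [hmul, multiplicity_span_pow hP hpL] at hsum
  have h1 := le_of_not_three_dvd_multiplicity hK hθ h hr hp hpt hP hPd h3
  have h2 := le_of_not_three_dvd_multiplicity (w := -w) hK hθ h hr hp (by linarith) hP hPd
  push_cast at h2
  simp only [neg_mul, sub_neg_eq_add, ← sub_eq_add_neg] at h2
  have h4 := h2 (by omega)
  omega

end Multiplicity

/-- Pigeonholing on the multiplicities at the bad primes. -/
theorem card_cubicFields_le {r : 𝓞 L} {D' g d : ℤ} (hr : r ^ 2 = D') (hg : -3 * d = D' * g ^ 2)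
    (hdet : DetectsCubes r D') (S : Finset (Ideal (𝓞 L)))
    (hS : ∀ P : Ideal (𝓞 L), Prime P → (6 * d : 𝓞 L) ∈ P → P ∈ S) (M : ℕ)
    (hM : ∀ Z : Finset (𝓞 L), (∀ κ ∈ Z, κ ≠ 0 ∧ ∃ 𝔠 : Ideal (𝓞 L), Ideal.span {κ} = 𝔠 ^ 3) →
      (∀ κ ∈ Z, ∀ κ' ∈ Z, CubeRel κ κ' → κ = κ') → Z.card ≤ M)
    {ι : Type*} [Fintype ι] (F : ι → CubicField) (hF : ∀ i, discr (F i).carrier = d)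
    (hiso : ∀ i j, Nonempty ((F i).carrier ≃+* (F j).carrier) → i = j) :
    Fintype.card ι ≤ M * 3 ^ S.card := by
  classical
  choose θ p q w hp hθ h hpt using fun i =>
    CubicRelation.exists_point (F i).deg (D' := D') (g := g) (by rw [hF]; exact hg)
  set β : ι → 𝓞 L := fun i => q i + w i * r with hβ
  have hβ0 (i) : β i ≠ 0 := by
    have hpL : (p i : 𝓞 L) ≠ 0 := by exact_mod_cast hp i
    have hmul : β i * (q i - w i * r) = (p i : 𝓞 L) ^ 3 := by
      have : (q i : 𝓞 L) ^ 2 - D' * w i ^ 2 = p i ^ 3 := by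
        exact_mod_cast congrArg (Int.cast (R := 𝓞 L)) (hpt i)
      rw [hβ]
      linear_combination this - w i ^ 2 * hr
    exact left_ne_zero_of_mul (hmul ▸ pow_ne_zero 3 hpL)
  have hrel (i j) (hij : CubeRel (β i) (β j)) : i = j := by
    obtain ⟨u, v, h1, h2⟩ := hdet _ _ _ _ _ _ (hp i) (hp j) (hpt i) (hpt j) hij
    exact hiso i j (CubicRelation.nonempty_ringEquiv (p := p i) (q := q i) (w := w i)
      (p' := p j) (q' := q j) (D' := D') (F i).deg (F j).deg (hθ i) (hθ j)
      (by push_cast; exact h i) (by push_cast; exact h j) (by exact_mod_cast hpt i) h1 h2)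
  let c : ι → S → ZMod 3 := fun i P => (multiplicity P.1 (Ideal.span {β i}) : ZMod 3)
  have hfib : ∀ a ∈ Finset.univ.image c, (Finset.univ.filter fun i => c i = a).card ≤ M := by
    intro a ha
    obtain ⟨i₁, -, rfl⟩ := Finset.mem_image.mp ha
    have hinj : Function.Injective fun i => β i * β i₁ ^ 2 := by
      intro i j hij
      apply hrel
      refine .of_mul_right (pow_ne_zero 2 (hβ0 i₁)) ?_
      exact ⟨1, 1, one_ne_zero, one_ne_zero, by simpa using hij⟩
    rw [← Finset.card_image_of_injective _ hinj]
    apply hM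
    · intro κ hκ
      obtain ⟨i, hi, rfl⟩ := Finset.mem_image.mp hκ
      replace hi := (Finset.mem_filter.mp hi).2
      have hne : β i * β i₁ ^ 2 ≠ 0 := mul_ne_zero (hβ0 i) (pow_ne_zero 2 (hβ0 i₁))
      refine ⟨hne, Ideal.exists_eq_pow_of_dvd_multiplicity (by simpa using hne) fun P hP => ?_⟩
      rw [multiplicity_span_mul hP (hβ0 i) (pow_ne_zero 2 (hβ0 i₁)),
        multiplicity_span_pow hP (hβ0 i₁)]
      by_cases hPS : P ∈ S
      · have h1 : (multiplicity P (Ideal.span {β i}) : ZMod 3) =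
            multiplicity P (Ideal.span {β i₁}) := congrFun hi ⟨P, hPS⟩
        rw [ZMod.natCast_eq_natCast_iff'] at h1
        omega
      · have hb (j) : 3 ∣ multiplicity P (Ideal.span {β j}) :=
          three_dvd_multiplicity (F j).deg (hθ j) (h j) hr (hp j) (hpt j) hP
            (by rw [hF]; exact fun h => hPS (hS P hP h))
        exact dvd_add (hb i) ((hb i₁).mul_left _)
    · intro κ hκ κ' hκ' hκκ
      obtain ⟨i, -, rfl⟩ := Finset.mem_image.mp hκ
      obtain ⟨j, -, rfl⟩ := Finset.mem_image.mp hκ'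
      rw [hrel i j (hκκ.of_mul_right (pow_ne_zero 2 (hβ0 i₁)))]
  have h1 := Finset.card_le_mul_card_image (s := Finset.univ) (f := c) M hfib
  have h2 : (Finset.univ.image c).card ≤ 3 ^ S.card := by
    refine (Finset.card_le_univ _).trans ?_
    simp [ZMod.card]
  calc Fintype.card ι ≤ M * (Finset.univ.image c).card := h1
    _ ≤ _ := Nat.mul_le_mul_left _ h2

end CubicSymbol

namespace CubicSymbol

section BadPrimes

variable {L : Type*} [Field L] [NumberField L]

lemma card_primes_over_le {ℓ : ℕ} (hℓ : ℓ.Prime) (T : Finset (Ideal (𝓞 L)))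
    (hT : ∀ P ∈ T, Prime P ∧ (ℓ : 𝓞 L) ∈ P) : T.card ≤ Module.finrank ℚ L := by
  have h1 : ∏ P ∈ T, P ∣ Ideal.span {(ℓ : 𝓞 L)} :=
    Finset.prod_primes_dvd _ (fun P hP => (hT P hP).1)
      fun P hP => Ideal.dvd_span_singleton.mpr (hT P hP).2
  have h2 : ∀ P ∈ T, ℓ ∣ Ideal.absNorm P := by
    intro P hP
    obtain ⟨hP1, hP2⟩ := hT P hP
    have hPp := Ideal.isPrime_of_prime hP1
    obtain ⟨p, hp, hpP, hdvd⟩ := Ideal.exists_prime_mem hPp hP1.ne_zero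
    rwa [Ideal.prime_unique hPp.ne_top hℓ hp hP2 hpP]
  have h3 : ℓ ^ T.card ∣ ℓ ^ Module.finrank ℚ L := by
    have h4 : Ideal.absNorm (Ideal.span {(ℓ : 𝓞 L)}) = ℓ ^ Module.finrank ℚ L := by
      rw [Ideal.absNorm_span_singleton]
      have := Algebra.norm_algebraMap (S := 𝓞 L) (ℓ : ℤ)
      simp only [eq_intCast, Int.cast_natCast] at this
      rw [this, RingOfIntegers.rank]
      simp [Int.natAbs_pow]
    rw [← h4]
    refine dvd_trans ?_ (Ideal.absNorm_dvd_absNorm_of_le (Ideal.dvd_iff_le.mp h1))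
    rw [map_prod, ← Finset.prod_const]
    exact Finset.prod_dvd_prod_of_dvd _ _ h2
  exact (Nat.pow_dvd_pow_iff_le_right hℓ.one_lt).mp h3

lemma exists_bad_primes (m : ℤ) (hm : m ≠ 0) : ∃ S : Finset (Ideal (𝓞 L)),
    (∀ P : Ideal (𝓞 L), Prime P → (m : 𝓞 L) ∈ P → P ∈ S) ∧
      S.card ≤ Module.finrank ℚ L * m.natAbs.primeFactors.card := by
  classical
  have hm0 : Ideal.span {(m : 𝓞 L)} ≠ ⊥ := by simpa using hm
  let S := (UniqueFactorizationMonoid.normalizedFactors (Ideal.span {(m : 𝓞 L)})).toFinset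
  have hS (P : Ideal (𝓞 L)) : P ∈ S ↔ Prime P ∧ (m : 𝓞 L) ∈ P := by
    rw [Multiset.mem_toFinset, Ideal.mem_normalizedFactors_iff hm0, Ideal.span_singleton_le_iff_mem]
    refine ⟨fun ⟨h1, h2⟩ => ⟨Ideal.prime_of_isPrime ?_ h1, h2⟩,
      fun ⟨h1, h2⟩ => ⟨Ideal.isPrime_of_prime h1, h2⟩⟩
    rintro rfl
    exact hm0 (by simpa using h2)
  have hex (P : Ideal (𝓞 L)) : ∃ ℓ : ℕ, P ∈ S → ℓ.Prime ∧ (ℓ : 𝓞 L) ∈ P ∧ (ℓ : ℤ) ∣ m := by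
    by_cases hP : P ∈ S
    · obtain ⟨h1, h2⟩ := (hS P).mp hP
      have hPp := Ideal.isPrime_of_prime h1
      obtain ⟨p, hp, hpP, -⟩ := Ideal.exists_prime_mem hPp h1.ne_zero
      exact ⟨p, fun _ => ⟨hp, hpP, (Ideal.intCast_mem_iff_dvd hPp.ne_top hp hpP m).mp h2⟩⟩
    · exact ⟨0, fun h => absurd h hP⟩
  choose ℓ hℓ using hex
  refine ⟨S, fun P h1 h2 => (hS P).mpr ⟨h1, h2⟩, ?_⟩
  refine Finset.card_le_mul_card_image_of_maps_to (f := ℓ) (fun P hP => ?_) _ fun p hp => ?_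
  · obtain ⟨h1, -, h3⟩ := hℓ P hP
    exact Nat.mem_primeFactors.mpr ⟨h1, Int.natCast_dvd.mp h3, by simpa using hm⟩
  · refine card_primes_over_le (Nat.prime_of_mem_primeFactors hp) _ fun P hP => ?_
    obtain ⟨hPS, rfl⟩ := Finset.mem_filter.mp hP
    exact ⟨((hS P).mp hPS).1, (hℓ P hPS).2.1⟩

end BadPrimes

lemma _root_.Nat.two_pow_card_primeFactors_le {n : ℕ} (hn : n ≠ 0) :
    2 ^ n.primeFactors.card ≤ n.divisors.card := by
  rw [← Finset.card_powerset]
  refine Finset.card_le_card_of_injOn (fun T => ∏ p ∈ T, p) (fun T hT => ?_) ?_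
  · simp only [Finset.coe_powerset, Set.mem_preimage, Set.mem_powerset_iff, Finset.coe_subset] at hT
    exact Nat.mem_divisors.mpr ⟨(Finset.prod_dvd_prod_of_subset _ _ _ hT).trans
      (Nat.prod_primeFactors_dvd n), hn⟩
  · intro T hT T' hT' h
    simp only [Finset.coe_powerset, Set.mem_preimage, Set.mem_powerset_iff, Finset.coe_subset]
      at hT hT'
    have key (T : Finset ℕ) (hT : T ⊆ n.primeFactors) : (∏ p ∈ T, p).primeFactors = T :=
      Nat.primeFactors_prod fun p hp => Nat.prime_of_mem_primeFactors (hT hp)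
    rw [← key T hT, ← key T' hT']
    exact congrArg _ h

section DetectsCubes

variable {L : Type*} [Field L] [NumberField L] {r : 𝓞 L} {D' : ℤ}

lemma _root_.QuadData.exists_rat_repr (H : QuadData r D') (x : L) :
    ∃ u v : ℚ, x = u + v * r := by
  have halg : IsAlgebraic ℤ x :=
    (IsFractionRing.isAlgebraic_iff ℤ ℚ L).mpr (Algebra.IsAlgebraic.isAlgebraic x)
  obtain ⟨n, hn, hx⟩ := halg.exists_integral_multiple
  obtain ⟨y, hy⟩ : ∃ y : 𝓞 L, (y : L) = n • x := ⟨⟨_, hx⟩, rfl⟩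
  obtain ⟨a, b, hab⟩ := H.repr y
  have h1 := congrArg (algebraMap (𝓞 L) L) hab
  simp only [map_mul, map_add, map_ofNat, map_intCast, hy, zsmul_eq_mul] at h1
  have hn0 : (n : L) ≠ 0 := by exact_mod_cast hn
  refine ⟨a / (2 * n), b / (2 * n), ?_⟩
  push_cast
  field_simp
  linear_combination h1

lemma _root_.QuadData.eq_zero_of_rat (H : QuadData r D') {u v : ℚ}
    (h : (u + v * (r : L) : L) = 0) : u = 0 ∧ v = 0 := by
  have hr : (r : L) ^ 2 = D' := by
    have := congrArg (algebraMap (𝓞 L) L) H.sq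
    simpa using this
  by_cases hv : v = 0
  · subst hv
    exact ⟨by simpa using h, rfl⟩
  · exfalso
    apply H.nsq
    rw [← Rat.isSquare_intCast_iff]
    refine ⟨u / v, ?_⟩
    field_simp
    have h2 : (v : L) ^ 2 * D' = u ^ 2 := by
      rw [← hr]; linear_combination (v * (r : L) - u) * h
    have h3 : v ^ 2 * (D' : ℚ) = u ^ 2 := by exact_mod_cast h2
    linarith

lemma _root_.QuadData.detectsCubes (H : QuadData r D') : DetectsCubes r D' := by
  rintro q w p q' w' p' hp hp' hpt hpt' ⟨a, b, ha, hb, hab⟩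
  have hr : (r : L) ^ 2 = D' := by
    have := congrArg (algebraMap (𝓞 L) L) H.sq
    simpa using this
  obtain ⟨u, v, huv⟩ := H.exists_rat_repr ((a : L) / b)
  have hb' : (b : L) ≠ 0 := by simpa using hb
  have h1 : (q' + w' * r : L) = (u + v * r) ^ 3 * (q + w * r) := by
    have := congrArg (algebraMap (𝓞 L) L) hab
    simp only [map_mul, map_add, map_intCast, map_pow] at this
    rw [← huv]
    field_simp
    linear_combination -this
  have h2 := H.eq_zero_of_rat
    (u := q' - (u ^ 3 * q + 3 * u ^ 2 * v * w * D' + 3 * u * v ^ 2 * D' * q + v ^ 3 * w * D' ^ 2))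
    (v := w' - (u ^ 3 * w + 3 * u ^ 2 * v * q + 3 * u * v ^ 2 * D' * w + v ^ 3 * D' * q)) (by
      push_cast
      linear_combination h1 + (3 * u * v ^ 2 * (q + w * (r : L)) + 3 * u ^ 2 * v * w +
        v ^ 3 * q * (r : L) + v ^ 3 * w * ((r : L) ^ 2 + D')) * hr)
  have hq := sub_eq_zero.mp h2.1
  have hw := sub_eq_zero.mp h2.2
  refine ⟨u, v, ?_, hq⟩
  have hptQ : (q ^ 2 - D' * w ^ 2 : ℚ) = p ^ 3 := by exact_mod_cast hpt
  have hptQ' : (q' ^ 2 - D' * w' ^ 2 : ℚ) = p' ^ 3 := by exact_mod_cast hpt'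
  refine (Odd.strictMono_pow (R := ℚ) (by decide : Odd 3)).injective ?_
  show (p' : ℚ) ^ 3 = ((u ^ 2 - D' * v ^ 2) * p) ^ 3
  rw [← hptQ', mul_pow, ← hptQ, hq, hw]
  ring

lemma detectsCubes_one : DetectsCubes (1 : 𝓞 ℚ) 1 := by
  rintro q w p q' w' p' hp hp' hpt hpt' ⟨a, b, ha, hb, hab⟩
  have hb' : (b : ℚ) ≠ 0 := by simpa using hb
  have ha' : (a : ℚ) ≠ 0 := by simpa using ha
  have hpQ : (p : ℚ) ≠ 0 := by exact_mod_cast hp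
  have hptQ : ((q - w) * (q + w) : ℚ) = p ^ 3 := by
    have : (q ^ 2 - 1 * w ^ 2 : ℚ) = p ^ 3 := by exact_mod_cast hpt
    linear_combination this
  have hptQ' : ((q' - w') * (q' + w') : ℚ) = p' ^ 3 := by
    have : (q' ^ 2 - 1 * w' ^ 2 : ℚ) = p' ^ 3 := by exact_mod_cast hpt'
    linear_combination this
  obtain ⟨γ, hγ⟩ : ∃ γ : ℚ, γ = a / b := ⟨_, rfl⟩
  have hγ0 : γ ≠ 0 := hγ ▸ div_ne_zero ha' hb'
  have h1 : (q' + w' : ℚ) = γ ^ 3 * (q + w) := by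
    have := congrArg (algebraMap (𝓞 ℚ) ℚ) hab
    simp only [map_mul, map_add, map_intCast, map_pow, mul_one] at this
    rw [hγ]
    field_simp
    linear_combination -this
  obtain ⟨δ, hδ⟩ : ∃ δ : ℚ, δ * (p * γ) = p' := ⟨p' / (p * γ), by field_simp⟩
  have hqw : (q + w : ℚ) ≠ 0 := right_ne_zero_of_mul (hptQ ▸ pow_ne_zero 3 hpQ)
  have h2 : (q' - w' : ℚ) = δ ^ 3 * (q - w) := by
    refine mul_right_cancel₀ (mul_ne_zero (pow_ne_zero 3 hγ0) hqw) ?_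
    rw [← h1, hptQ', h1, ← hδ]
    linear_combination -δ ^ 3 * γ ^ 3 * hptQ
  refine ⟨(γ + δ) / 2, (γ - δ) / 2, ?_, ?_⟩
  · rw [← hδ]; push_cast; ring
  · push_cast
    linear_combination (h1 + h2) / 2

end DetectsCubes

end CubicSymbol

lemma Rat.exists_intCast_of_mul_sq {D : ℤ} (hD : Squarefree D) {v : ℚ} {m : ℤ}
    (h : D * v ^ 2 = m) : ∃ n : ℤ, v = n := by
  have h1 : D * v.num ^ 2 = m * (v.den : ℤ) ^ 2 := by
    have h2 : (v.den : ℚ) ≠ 0 := by exact_mod_cast v.den_nz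
    have h3 := Rat.mul_den_eq_num v
    have : (D * v.num ^ 2 : ℚ) = m * v.den ^ 2 := by
      rw [← h3, ← h]; ring
    exact_mod_cast this
  have hcop : IsCoprime ((v.den : ℤ) ^ 2) (v.num ^ 2) :=
    (Int.isCoprime_iff_nat_coprime.mpr (by simpa using v.reduced.symm)).pow
  have h2 : (v.den : ℤ) * v.den ∣ D := by
    rw [← pow_two]
    exact hcop.dvd_of_dvd_mul_right ⟨m, by linear_combination h1⟩
  have h3 := hD _ h2
  have h4 : v.den = 1 := by simpa using Int.isUnit_iff_natAbs_eq.mp h3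
  exact ⟨v.num, (Rat.coe_int_num_of_den_eq_one h4).symm⟩

lemma QuadData.exists_of_involution {K : Type*} [Field K] [NumberField K] {D : ℤ}
    (hD : Squarefree D) (hsq : ¬ IsSquare D) (hfin : Module.finrank ℚ K = 2) (τ : K →+* K)
    (δ : K) (hδ : δ ^ 2 = D) (hτ : τ δ = -δ) (hττ : ∀ x, τ (τ x) = x)
    (hrepr : ∀ x : K, ∃ u v : ℚ, x = u + v * δ) : ∃ s : 𝓞 K, QuadData s D := by
  have hint : IsIntegral ℤ δ := by
    refine IsIntegral.of_pow (n := 2) (by norm_num) ?_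
    rw [hδ]
    exact isIntegral_algebraMap (R := ℤ) (x := D)
  obtain ⟨s, hs⟩ : ∃ s : 𝓞 K, (s : K) = δ := ⟨⟨δ, hint⟩, rfl⟩
  have hrat (q : ℚ) (hq : IsIntegral ℤ (q : K)) : ∃ n : ℤ, q = n := by
    have h1 : IsIntegral ℤ (algebraMap ℚ K q) := by simpa using hq
    rw [isIntegral_algebraMap_iff (algebraMap ℚ K).injective] at h1
    obtain ⟨n, hn⟩ := IsIntegrallyClosed.isIntegral_iff.mp h1
    exact ⟨n, by simpa using hn.symm⟩
  have hinj : Function.Injective (algebraMap (𝓞 K) K) := RingOfIntegers.coe_injective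
  refine ⟨s, ⟨hinj (by simp [hs, hδ]), hD, hsq, hfin, fun x => ?_, ?_⟩⟩
  · obtain ⟨u, v, huv⟩ := hrepr x
    have hx : IsIntegral ℤ (x : K) := RingOfIntegers.isIntegral_coe x
    have hx' : IsIntegral ℤ (τ x) := hx.map τ.toIntAlgHom
    have hτx : τ x = u - v * δ := by rw [huv]; simp [hτ]; ring
    obtain ⟨a, ha⟩ := hrat (2 * u) (by
      have h : ((2 * u : ℚ) : K) = x + τ x := by rw [hτx, huv]; push_cast; ring
      rw [h]
      exact hx.add hx')
    obtain ⟨m, hm⟩ := hrat (D * (2 * v) ^ 2) (by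
      have h : ((D * (2 * v) ^ 2 : ℚ) : K) = (x - τ x) ^ 2 := by
        rw [hτx, huv]; push_cast; rw [← hδ]; ring
      rw [h]
      exact (hx.sub hx').pow 2)
    obtain ⟨b, hb⟩ := Rat.exists_intCast_of_mul_sq hD hm
    refine ⟨a, b, hinj ?_⟩
    have ha' : (2 * u : K) = a := by
      have h := congrArg (Rat.cast : ℚ → K) ha
      push_cast at h
      exact h
    have hb' : (2 * v : K) = b := by
      have h := congrArg (Rat.cast : ℚ → K) hb
      push_cast at h
      exact h
    have h2 : (algebraMap (𝓞 K) K) (2 * x) = 2 * (x : K) := by rw [map_mul, map_ofNat]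
    have h3 : (algebraMap (𝓞 K) K) (a + b * s) = a + b * δ := by simp [hs]
    rw [h2, h3, ← ha', ← hb', huv]
    ring
  · refine ⟨RingOfIntegers.mapRingHom τ, hinj ?_, fun x => hinj ?_⟩
    · change τ s = _
      simp [hs, hτ]
    · exact hττ x

lemma exists_quadData {D : ℤ} (hD : Squarefree D) (hsq : ¬ IsSquare D) :
    ∃ (K : Type) (_ : Field K) (_ : NumberField K) (s : 𝓞 K), QuadData s D := by
  have hfact : Fact (∀ r : ℚ, r ^ 2 ≠ D + 0 * r) := ⟨fun r hr => hsq <| by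
    rw [← Rat.isSquare_intCast_iff]
    exact ⟨r, by linear_combination -hr⟩⟩
  have hfin : Module.finrank ℚ (QuadraticAlgebra ℚ (D : ℚ) 0) = 2 :=
    QuadraticAlgebra.finrank_eq_two _ _
  have hcz : CharZero (QuadraticAlgebra ℚ (D : ℚ) 0) :=
    charZero_of_injective_algebraMap (algebraMap ℚ (QuadraticAlgebra ℚ (D : ℚ) 0)).injective
  have hnf : NumberField (QuadraticAlgebra ℚ (D : ℚ) 0) :=
    { to_charZero := hcz
      to_finiteDimensional := by
        convert (inferInstance : FiniteDimensional ℚ (QuadraticAlgebra ℚ (D : ℚ) 0)) using 1 }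
  refine ⟨QuadraticAlgebra ℚ (D : ℚ) 0, inferInstance, hnf,
    QuadData.exists_of_involution hD hsq ?_
      (starRingEnd (QuadraticAlgebra ℚ (D : ℚ) 0)) ⟨0, 1⟩ ?_ ?_ ?_ ?_⟩
  · convert hfin
  · ext <;> simp [pow_two]
  · ext <;> simp [starRingEnd_apply]
  · exact starRingEnd_self_apply
  · intro x
    refine ⟨x.re, x.im, ?_⟩
    ext <;> simp

namespace CubicSymbol

/-- `M` bounds the `3`-virtual units modulo cubes of a field in which `-3 * D` is a square and which
detects cubes. -/
def IsResolventBound (D : ℤ) (M : ℕ) : Prop :=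
  ∃ (L : Type) (_ : Field L) (_ : NumberField L) (r : 𝓞 L) (D' e : ℤ),
    r ^ 2 = D' ∧ e ^ 2 * D' = -3 * D ∧ DetectsCubes r D' ∧ Module.finrank ℚ L ≤ 2 ∧
    ∀ Z : Finset (𝓞 L), (∀ κ ∈ Z, κ ≠ 0 ∧ ∃ 𝔠 : Ideal (𝓞 L), Ideal.span {κ} = 𝔠 ^ 3) →
      (∀ κ ∈ Z, ∀ κ' ∈ Z, CubeRel κ κ' → κ = κ') → Z.card ≤ M

lemma exists_resolvent_discr {D : ℤ} (hD : Squarefree D) :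
    ∃ D' e : ℤ, Squarefree D' ∧ e ∣ 3 ∧ e ^ 2 * D' = -3 * D := by
  by_cases h3 : (3 : ℤ) ∣ D
  · obtain ⟨k, rfl⟩ := h3
    have hk : Squarefree (-k) := by
      rw [← Int.squarefree_natAbs, Int.natAbs_neg, Int.squarefree_natAbs]
      exact hD.squarefree_of_dvd (Dvd.intro_left 3 rfl)
    exact ⟨-k, 3, hk, dvd_rfl, by ring⟩
  · refine ⟨-(3 * D), 1, ?_, one_dvd _, by ring⟩
    rw [← Int.squarefree_natAbs, Int.natAbs_neg, Int.squarefree_natAbs]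
    have hcop : IsCoprime (3 : ℤ) D := (Int.prime_three.coprime_iff_not_dvd).mpr h3
    exact (squarefree_mul_iff.mpr ⟨hcop.isRelPrime, Int.prime_three.squarefree, hD⟩)

lemma not_isSquare_of_squarefree {D : ℤ} (hD : Squarefree D) (h1 : D ≠ 1) : ¬ IsSquare D := by
  rintro ⟨a, rfl⟩
  rcases Int.isUnit_iff.mp (hD a dvd_rfl) with rfl | rfl <;> simp at h1

lemma exists_isResolventBound {D : ℤ} (hD : Squarefree D) : ∃ M, IsResolventBound D M := by
  obtain ⟨D', e, hD', -, heq⟩ := exists_resolvent_discr hD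
  by_cases h1 : D' = 1
  · subst h1
    obtain ⟨C, hC⟩ := exists_card_le_of_cubeRel ℚ
    exact ⟨C, ℚ, inferInstance, inferInstance, 1, 1, e, by simp, heq, detectsCubes_one,
      by simp, hC⟩
  · obtain ⟨L, _, _, r, hr⟩ := exists_quadData hD' (not_isSquare_of_squarefree hD' h1)
    obtain ⟨C, hC⟩ := exists_card_le_of_cubeRel L
    exact ⟨C, L, inferInstance, inferInstance, r, D', e, hr.sq, heq, hr.detectsCubes,
      hr.finrank.le, hC⟩

lemma exists_isResolventBound_le_of_large {ε : ℝ} (hε : 0 < ε) : ∃ (C : ℝ) (N : ℕ), 0 < C ∧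
    ∀ D : ℤ, Squarefree D → N ≤ D.natAbs →
      ∃ M, IsResolventBound D M ∧ (M : ℝ) ≤ C * |(D : ℝ)| ^ (1 / 3 + ε) := by
  obtain ⟨C, D₀, hC, hbd⟩ := exists_card_le_rpow hε
  obtain ⟨N, hN⟩ := exists_nat_ge D₀
  refine ⟨C, N + 4, hC, fun D hD hDN => ?_⟩
  obtain ⟨D', e, hD', he, heq⟩ := exists_resolvent_discr hD
  have hD1 : D ≠ 1 := by rintro rfl; simp at hDN
  have hD1' : D' ≠ 1 := by
    rintro rfl
    have : e ≤ 3 := Int.le_of_dvd (by norm_num) he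
    have : -3 ≤ e := by
      have := Int.le_of_dvd (by norm_num) ((neg_dvd (a := e)).mpr he)
      linarith
    have h9 : e ^ 2 ≤ 9 := by nlinarith
    have h0 := sq_nonneg e
    omega
  obtain ⟨K, _, _, s, hs⟩ := exists_quadData hD (not_isSquare_of_squarefree hD hD1)
  obtain ⟨L, _, _, r, hr⟩ := exists_quadData hD' (not_isSquare_of_squarefree hD' hD1')
  have hlarge : D₀ ≤ |(D : ℝ)| := by
    rw [← Int.cast_abs, Int.abs_eq_natAbs, Int.cast_natCast]
    refine hN.trans ?_
    exact_mod_cast (by omega : N ≤ D.natAbs)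
  refine ⟨⌊C * |(D : ℝ)| ^ (1 / 3 + ε)⌋₊, ⟨L, inferInstance, inferInstance, r, D', e, hr.sq, heq,
    hr.detectsCubes, hr.finrank.le, fun Z hZ hpair => ?_⟩, Nat.floor_le (by positivity)⟩
  exact Nat.le_floor (hbd hs hr he heq hlarge Z hZ hpair)

lemma exists_isResolventBound_le {ε : ℝ} (hε : 0 < ε) : ∃ C : ℝ, 0 < C ∧
    ∀ D : ℤ, Squarefree D →
      ∃ M, IsResolventBound D M ∧ (M : ℝ) ≤ C * |(D : ℝ)| ^ (1 / 3 + ε) := by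
  obtain ⟨C, N, hC, hlarge⟩ := exists_isResolventBound_le_of_large hε
  choose! M hM using fun (D : ℤ) (hD : Squarefree D) => exists_isResolventBound hD
  refine ⟨C + ∑ D ∈ Finset.Icc (-(N : ℤ)) N, (M D : ℝ), by positivity, fun D hD => ?_⟩
  rcases le_total N D.natAbs with h | h
  · obtain ⟨M', h1, h2⟩ := hlarge D hD h
    refine ⟨M', h1, h2.trans ?_⟩
    gcongr
    exact le_add_of_nonneg_right (by positivity)
  · refine ⟨M D, hM D hD, ?_⟩
    have h1 : (1 : ℝ) ≤ |(D : ℝ)| := by exact_mod_cast Int.one_le_abs hD.ne_zero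
    have h2 : (M D : ℝ) ≤ ∑ D ∈ Finset.Icc (-(N : ℤ)) N, (M D : ℝ) :=
      Finset.single_le_sum (f := fun D => (M D : ℝ)) (fun _ _ => Nat.cast_nonneg _)
        (Finset.mem_Icc.mpr (by omega))
    calc (M D : ℝ) ≤ (C + ∑ D ∈ Finset.Icc (-(N : ℤ)) N, (M D : ℝ)) * 1 := by linarith
      _ ≤ _ := by
        gcongr
        exact Real.one_le_rpow h1 (by positivity)

lemma exists_squarefree_mul_sq {d : ℤ} (hd : d ≠ 0) :
    ∃ D f : ℤ, Squarefree D ∧ d = D * f ^ 2 ∧ |D| ≤ |d| := by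
  obtain ⟨a, b, h, ha⟩ := Nat.sq_mul_squarefree d.natAbs
  have hb : b ≠ 0 := by rintro rfl; simp at h; omega
  have hD : d = d.sign * a * b ^ 2 := by
    conv_lhs => rw [← Int.sign_mul_natAbs d, ← h]
    push_cast; ring
  refine ⟨d.sign * a, b, ?_, hD, ?_⟩
  · rw [← Int.squarefree_natAbs, Int.natAbs_mul, Int.natAbs_sign_of_ne_zero hd]
    simpa using ha
  · conv_rhs => rw [hD]
    rw [abs_mul _ ((b : ℤ) ^ 2)]
    refine le_mul_of_one_le_right (abs_nonneg _) (Int.one_le_abs (by positivity))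

lemma card_cubicFields_le_of_isResolventBound {D f d : ℤ} {M : ℕ} (hM : IsResolventBound D M)
    (hd : d ≠ 0) (hf : d = D * f ^ 2) {ι : Type*} [Fintype ι] (F : ι → CubicField)
    (hF : ∀ i, discr (F i).carrier = d)
    (hiso : ∀ i j, Nonempty ((F i).carrier ≃+* (F j).carrier) → i = j) :
    Fintype.card ι ≤ M * (6 * d).natAbs.divisors.card ^ 4 := by
  obtain ⟨L, _, _, r, D', e, hr, he, hdet, hfin, hZ⟩ := hM
  obtain ⟨S, hS, hScard⟩ := exists_bad_primes (L := L) (6 * d) (by simpa using hd)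
  refine (card_cubicFields_le hr (g := e * f) (by rw [hf]; linear_combination -f ^ 2 * he) hdet S
    (fun P hP hmem => hS P hP (by simpa using hmem)) M hZ F hF hiso).trans ?_
  refine Nat.mul_le_mul_left M ?_
  set w := (6 * d).natAbs.primeFactors.card with hw
  calc 3 ^ S.card ≤ 3 ^ (2 * w) := by
        gcongr
        · norm_num
        · exact hScard.trans (by gcongr)
    _ = 9 ^ w := by rw [pow_mul]; norm_num
    _ ≤ 16 ^ w := by gcongr; norm_num
    _ = (2 ^ w) ^ 4 := by rw [← pow_mul, mul_comm, pow_mul]; norm_num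
    _ ≤ _ := by
      gcongr
      exact Nat.two_pow_card_primeFactors_le (by simpa using hd)

lemma exists_card_cubicFields_le_rpow {ε : ℝ} (hε : 0 < ε) : ∃ C : ℝ, 0 < C ∧
    ∀ d : ℤ, d ≠ 0 → ∀ {ι : Type*} [Fintype ι] (F : ι → CubicField),
      (∀ i, discr (F i).carrier = d) →
      (∀ i j, Nonempty ((F i).carrier ≃+* (F j).carrier) → i = j) →
      (Fintype.card ι : ℝ) ≤ C * |(d : ℝ)| ^ (1 / 3 + ε) := by
  obtain ⟨C₁, hC₁, h₁⟩ := exists_isResolventBound_le (half_pos hε)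
  obtain ⟨C₂, hC₂, h₂⟩ := Nat.exists_card_divisors_le (ε := ε / 8) (by positivity)
  refine ⟨C₁ * (C₂ ^ 4 * 6 ^ (ε / 2)), by positivity, fun d hd ι _ F hF hiso => ?_⟩
  obtain ⟨D, f, hD, hf, hDd⟩ := exists_squarefree_mul_sq hd
  obtain ⟨M, hM, hMle⟩ := h₁ D hD
  have hcard := card_cubicFields_le_of_isResolventBound hM hd hf F hF hiso
  have hpos : 0 < |(d : ℝ)| := by simpa using hd
  have h6 : (((6 * d).natAbs : ℕ) : ℝ) = 6 * |(d : ℝ)| := by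
    rw [Nat.cast_natAbs]
    push_cast
    rw [abs_mul, abs_of_pos (by norm_num : (0 : ℝ) < 6)]
  have hdiv := h₂ (6 * d).natAbs (by simpa using hd)
  rw [h6] at hdiv
  have hDd' : |(D : ℝ)| ≤ |(d : ℝ)| := by exact_mod_cast hDd
  calc (Fintype.card ι : ℝ) ≤ M * ((6 * d).natAbs.divisors.card : ℝ) ^ 4 := by
        exact_mod_cast hcard
    _ ≤ (C₁ * |(d : ℝ)| ^ (1 / 3 + ε / 2)) * (C₂ * (6 * |(d : ℝ)|) ^ (ε / 8)) ^ 4 := by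
        gcongr
        refine hMle.trans ?_
        gcongr
    _ = C₁ * (C₂ ^ 4 * 6 ^ (ε / 2)) * |(d : ℝ)| ^ (1 / 3 + ε) := by
        rw [mul_pow, ← Real.rpow_natCast (_ ^ (ε / 8)) 4, ← Real.rpow_mul (by positivity),
          Real.mul_rpow (by norm_num) hpos.le, show 1 / 3 + ε = (1 / 3 + ε / 2) + ε / 2 by ring,
          Real.rpow_add hpos (1 / 3 + ε / 2),
          show ε / 8 * ((4 : ℕ) : ℝ) = ε / 2 by push_cast; ring]
        ring

lemma exists_countCubic_le {ε : ℝ} (hε : 0 < ε) : ∃ C : ℝ, ∀ n : ℕ, 0 < n →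
    (countCubic (fun d => |d| = (n : ℤ)) : ℝ) ≤ C * (n : ℝ) ^ ((1 : ℝ) / 3 + ε) := by
  classical
  obtain ⟨C, hC, hbd⟩ := exists_card_cubicFields_le_rpow hε
  refine ⟨2 * C, fun n hn => ?_⟩
  set T := {c : Quotient CubicField.setoid //
    ∃ K : CubicField, ⟦K⟧ = c ∧ |discr K.carrier| = (n : ℤ)} with hT
  change ((Nat.card T : ℕ) : ℝ) ≤ _
  rcases finite_or_infinite T with hfin | hinf
  swap
  · rw [Nat.card_eq_zero_of_infinite]
    simp only [Nat.cast_zero]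
    positivity
  have : Fintype T := Fintype.ofFinite T
  choose F hFq hFd using fun c : T => c.2
  have hF (c c' : T) (h : Nonempty ((F c).carrier ≃+* (F c').carrier)) : c = c' := by
    apply Subtype.ext
    rw [← hFq c, ← hFq c']
    exact Quotient.sound h
  have hpart (d : ℤ) (hd : |d| = n) :
      (Fintype.card {c : T // discr (F c).carrier = d} : ℝ) ≤ C * (n : ℝ) ^ (1 / 3 + ε) := by
    have hd0 : d ≠ 0 := by rintro rfl; simp at hd; omega
    have h := hbd d hd0 (fun c : {c : T // discr (F c).carrier = d} => F c) (fun c => c.2)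
      (fun c c' h => Subtype.ext (hF c c' h))
    rwa [← Int.cast_abs, hd, Int.cast_natCast] at h
  have hcard : Fintype.card T ≤ Fintype.card {c : T // discr (F c).carrier = n} +
      Fintype.card {c : T // discr (F c).carrier = -n} := by
    refine le_trans ?_ (Fintype.card_subtype_or _ _)
    refine Fintype.card_le_of_injective
      (fun c => ⟨c, eq_or_eq_neg_of_abs_eq (hFd c)⟩) fun c c' h => ?_
    simpa using h
  rw [Nat.card_eq_fintype_card]
  have h1 := hpart n (by simp)
  have h2 := hpart (-n) (by simp)
  have h3 : (Fintype.card T : ℝ) ≤ Fintype.card {c : T // discr (F c).carrier = n} +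
      Fintype.card {c : T // discr (F c).carrier = -n} := by exact_mod_cast hcard
  linarith

end CubicSymbol

end

/-- The Ellenberg-Venkatesh bound on the multiplicity of cubic field discriminants:
the number of cubic fields with `|Disc(K)| = n` is `O_ε(n^{1/3 + ε})`. -/
theorem cubic_multiplicity_bound :
    ∀ ε : ℝ, 0 < ε → ∃ Cε : ℝ, ∀ n : ℕ, 0 < n →
      (countCubic (fun d => |d| = (n : ℤ)) : ℝ) ≤ Cε * (n : ℝ) ^ ((1 : ℝ)/3 + ε) := by
  intro ε hε
  exact CubicSymbol.exists_countCubic_le hε
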